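/- There are exactly 24 GL_24(ℤ)-equivalence classes of positive definite integral quadratic forms in 24 variables with discriminant 1 (the Niemeier lattices). -/

import Mathlib

open scoped BigOperators

/-- The integral quadratic form `Q(x) = ∑_{i ≤ j} a_{ij} x_i x_j` attached to the
coefficient matrix `a` (only entries with `i ≤ j` are used). -/
def Qform {n : ℕ} (a : Matrix (Fin n) (Fin n) ℤ) (x : Fin n → ℤ) : ℤ :=
  ∑ i, ∑ j, if i ≤ j then a i j * x i * x j else 0

/-- The associated bilinear form `T(x,y) = Q(x+y) - Q(x) - Q(y)`. -/
def Tbil {n : ℕ} (a : Matrix (Fin n) (Fin n) ℤ) (x y : Fin n → ℤ) : ℤ :=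
  Qform a (x + y) - Qform a x - Qform a y

/-- The Gram matrix `[T] = (T(e_i, e_j))_{i,j}`. -/
def gram {n : ℕ} (a : Matrix (Fin n) (Fin n) ℤ) : Matrix (Fin n) (Fin n) ℤ :=
  Matrix.of fun i j => Tbil a (Pi.single i 1) (Pi.single j 1)

/-- `ε(n) = 0` if `n` is even, `1` if `n` is odd. -/
def eps (n : ℕ) : ℕ := if Even n then 0 else 1

/-- `Q` has (half-)discriminant `d`, i.e. `det [T] = 2^{ε(n)} d`. -/
def HasDisc {n : ℕ} (a : Matrix (Fin n) (Fin n) ℤ) (d : ℤ) : Prop :=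
  (gram a).det = 2 ^ (eps n) * d

/-- `Q` is positive definite: `Q(x) > 0` for all `x ≠ 0`. -/
def PosDef {n : ℕ} (a : Matrix (Fin n) (Fin n) ℤ) : Prop :=
  ∀ x : Fin n → ℤ, x ≠ 0 → 0 < Qform a x

/-- Two integral quadratic forms (as functions) are `GL_n(ℤ)`-equivalent:
`Q'(x) = Q(g⁻¹ x)` for some `g ∈ GL_n(ℤ)`. -/
def FormEquiv {n : ℕ} (Q Q' : (Fin n → ℤ) → ℤ) : Prop :=
  ∃ g : GL (Fin n) ℤ, ∀ x, Q' x = Q (Matrix.mulVec (↑(g⁻¹) : Matrix (Fin n) (Fin n) ℤ) x)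


section ModBase
open Complex MeasureTheory
open scoped BigOperators

namespace Nie

theorem summable_exp_norm : ∀ n : ℕ, Summable (fun m : Fin n → ℤ => Real.exp (- ∑ i, |(m i : ℝ)|)) := by
  intro n
  have h1 : Summable (fun m : ℤ => Real.exp (-|(m:ℝ)|)) := by
    have h2 : Summable (fun m : ℕ => Real.exp (-|(m:ℝ)|)) := by
      have : (fun m : ℕ => Real.exp (-|(m:ℝ)|)) = fun m : ℕ => Real.exp (-1)^m := by
        ext m
        rw [← Real.exp_nat_mul]; simp
      rw [this]
      apply summable_geometric_of_lt_one (Real.exp_pos _).le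
      simp
    apply Summable.of_nat_of_neg
    · simpa using h2
    · simpa using h2
  induction n with
  | zero => exact Summable.of_finite
  | succ n ih =>
    rw [← (Fin.consEquiv (fun _ => ℤ)).summable_iff]
    have := h1.mul_of_nonneg ih (fun _ => (Real.exp_pos _).le) (fun _ => (Real.exp_pos _).le)
    refine this.congr ?_
    rintro ⟨a, m⟩
    simp [Fin.consEquiv, Fin.sum_univ_succ, Real.exp_add]
    ring

variable {n : ℕ}

/-- Gaussian with linear term. -/
noncomputable def gaus (b : ℂ) (c : Fin n → ℂ) (u : Fin n → ℝ) : ℂ :=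
  cexp (-b * ∑ i, (u i : ℂ) ^ 2 + ∑ i, c i * u i)

theorem gaus_cont (b : ℂ) (c : Fin n → ℂ) : Continuous (gaus b c) := by
  unfold gaus; fun_prop

/-- cast an integer vector to a real vector -/
def rv (m : Fin n → ℤ) : Fin n → ℝ := fun i => (m i : ℝ)

theorem quad_lin (β γ t : ℝ) (hβ : 0 < β) : -β * t^2 + γ * t ≤ γ^2/(4*β) := by
  have : γ^2/(4*β) - (-β * t^2 + γ * t) = (β * 2 * t - γ)^2/(4*β) := by
    field_simp; ring
  have h2 : 0 ≤ (β * 2 * t - γ)^2/(4*β) := by positivity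
  linarith

/-- Uniform bound for the Gaussian. -/
theorem gaus_bound (A A' : Matrix (Fin n) (Fin n) ℝ) (hA : A' * A = 1) (β : ℝ) (hβ : 0 < β)
    (C R : ℝ) : ∃ K : ℝ, ∀ b : ℂ, β ≤ b.re → ∀ c : Fin n → ℂ, (∀ i, ‖c i‖ ≤ C) →
    ∀ x : Fin n → ℝ, (∀ i, |x i| ≤ R) → ∀ m : Fin n → ℤ,
    ‖gaus b c (A.mulVec (x + rv m))‖ ≤ K * Real.exp (-∑ i, |(m i:ℝ)|) := by
  -- D bounds the entries of A'
  obtain ⟨D, hD0, hD⟩ : ∃ D : ℝ, 0 ≤ D ∧ ∀ i j, |A' i j| ≤ D :=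
    ⟨∑ i, ∑ j, |A' i j|, by positivity, fun i j =>
      (Finset.single_le_sum (f := fun j => |A' i j|) (fun _ _ => abs_nonneg _) (Finset.mem_univ j)).trans
        (Finset.single_le_sum (f := fun i => ∑ j, |A' i j|) (fun _ _ => by positivity) (Finset.mem_univ i))⟩
  refine ⟨Real.exp (n * R + ∑ _i : Fin n, (C + n * D)^2/(4*β)), ?_⟩
  intro b hb c hc x hx m
  set u := A.mulVec (x + rv m) with hu
  have hum : x + rv m = A'.mulVec u := by
    rw [hu, Matrix.mulVec_mulVec, hA, Matrix.one_mulVec]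
  have h1 : ∑ i, |(m i:ℝ)| ≤ n * R + n * D * ∑ j, |u j| := by
    have : ∀ i, |(m i:ℝ)| ≤ R + D * ∑ j, |u j| := by
      intro i
      have e : (m i:ℝ) = (A'.mulVec u) i - x i := by
        rw [← hum]; simp [rv]
      rw [e]
      have h3 : |(A'.mulVec u) i| ≤ D * ∑ j, |u j| := by
        rw [Matrix.mulVec, dotProduct, Finset.mul_sum]
        refine (Finset.abs_sum_le_sum_abs _ _).trans (Finset.sum_le_sum fun j _ => ?_)
        rw [abs_mul]
        exact mul_le_mul_of_nonneg_right (hD i j) (abs_nonneg _)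
      have := abs_sub (A'.mulVec u i) (x i)
      have := hx i
      linarith
    calc _ ≤ ∑ i : Fin n, (R + D * ∑ j, |u j|) := Finset.sum_le_sum fun i _ => this i
      _ = _ := by simp; ring
  rw [gaus, Complex.norm_exp, ← Real.exp_add]
  apply Real.exp_le_exp.mpr
  have h4 : (-b * ∑ i, (u i : ℂ) ^ 2 + ∑ i, c i * u i).re ≤ ∑ i, (-β * |u i|^2 + C * |u i|) := by
    have : (-b * ∑ i, (u i : ℂ) ^ 2 + ∑ i, c i * u i).re = ∑ i, (- b.re * u i ^2 + (c i).re * u i) := by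
      rw [Finset.mul_sum, ← Finset.sum_add_distrib, Complex.re_sum]
      refine Finset.sum_congr rfl fun i _ => ?_
      rw [← Complex.ofReal_pow]
      simp only [Complex.add_re, Complex.mul_re, Complex.neg_re, Complex.neg_im, Complex.ofReal_re,
        Complex.ofReal_im]
      ring
    rw [this]
    refine Finset.sum_le_sum fun i _ => ?_
    rw [sq_abs]
    have h5 : (c i).re * u i ≤ C * |u i| := by
      calc _ ≤ |(c i).re * u i| := le_abs_self _
        _ = |(c i).re| * |u i| := abs_mul _ _
        _ ≤ _ := mul_le_mul_of_nonneg_right ((Complex.abs_re_le_norm _).trans (hc i)) (abs_nonneg _)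
    nlinarith [sq_nonneg (u i)]
  have h6 : ∑ i, (-β * |u i|^2 + C * |u i|) + n * D * ∑ j, |u j| ≤ ∑ _i : Fin n, (C + n * D)^2/(4*β) := by
    rw [Finset.mul_sum, ← Finset.sum_add_distrib]
    refine Finset.sum_le_sum fun i _ => ?_
    have := quad_lin β (C + n * D) |u i| hβ
    linarith
  linarith

end Nie

end ModBase

section ModPoisson
open Complex MeasureTheory
open scoped BigOperators

namespace Nie
variable {n : ℕ}

theorem gaus_summable (A A' : Matrix (Fin n) (Fin n) ℝ) (hA : A' * A = 1) (b : ℂ) (hb : 0 < b.re)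
    (c : Fin n → ℂ) : Summable (fun m : Fin n → ℤ => gaus b c (A.mulVec (rv m))) := by
  obtain ⟨K, hK⟩ := gaus_bound A A' hA b.re hb (∑ i, ‖c i‖) 0
  apply Summable.of_norm_bounded ((summable_exp_norm n).mul_left K)
  intro m
  have := hK b le_rfl c (fun i => Finset.single_le_sum (f := fun i => ‖c i‖) (fun _ _ => norm_nonneg _)
    (Finset.mem_univ i)) 0 (by simp) m
  simpa using this

theorem box_disj : Pairwise (Function.onFun Disjoint
    (fun m : Fin n → ℤ => {x : Fin n → ℝ | ∀ i, x i ∈ Set.Ioc (m i : ℝ) (m i + 1)})) := by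
  intro m m' h
  rw [Function.onFun, Set.disjoint_left]
  intro x hx hx'
  apply h
  ext i
  obtain ⟨h1, h2⟩ := hx i
  obtain ⟨h3, h4⟩ := hx' i
  have a1 : (m i : ℝ) < m' i + 1 := by linarith
  have a2 : (m' i : ℝ) < m i + 1 := by linarith
  have a1' : m i < m' i + 1 := by exact_mod_cast a1
  have a2' : m' i < m i + 1 := by exact_mod_cast a2
  omega

theorem box_union : (⋃ m : Fin n → ℤ, {x : Fin n → ℝ | ∀ i, x i ∈ Set.Ioc (m i : ℝ) (m i + 1)}) = Set.univ := by
  ext x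
  simp only [Set.mem_iUnion, Set.mem_ofPred_eq, Set.mem_univ, iff_true, Set.mem_Ioc]
  refine ⟨fun i => ⌈x i⌉ - 1, fun i => ?_⟩
  push_cast
  have := Int.ceil_lt_add_one (x i)
  have := Int.le_ceil (x i)
  constructor <;> linarith

theorem box_meas (a : Fin n → ℝ) : MeasurableSet {x : Fin n → ℝ | ∀ i, x i ∈ Set.Ioc (a i) (a i + 1)} := by
  have : {x : Fin n → ℝ | ∀ i, x i ∈ Set.Ioc (a i) (a i + 1)} = Set.pi Set.univ (fun i => Set.Ioc (a i) (a i + 1)) := by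
    ext x; simp
  rw [this]
  exact MeasurableSet.univ_pi fun i => measurableSet_Ioc

theorem unfold_integral (g : (Fin n → ℝ) → ℂ) (hg : Integrable g) :
    ∫ x, g x = ∑' m : Fin n → ℤ, ∫ x in {x : Fin n → ℝ | ∀ i, x i ∈ Set.Ioc ((0:Fin n → ℝ) i) ((0:Fin n → ℝ) i + 1)}, g (x + rv m) := by
  rw [← setIntegral_univ, ← box_union, integral_iUnion (s := fun m : Fin n → ℤ => {x : Fin n → ℝ | ∀ i, x i ∈ Set.Ioc (m i : ℝ) (m i + 1)})
    (fun m => box_meas (fun i => (m i : ℝ))) box_disj hg.integrableOn]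
  refine tsum_congr fun m => ?_
  have mp := measurePreserving_add_right (volume : Measure (Fin n → ℝ)) (rv m)
  rw [← mp.setIntegral_preimage_emb (measurableEmbedding_addRight _)]
  congr 2
  ext x
  simp only [Set.mem_preimage, Set.mem_ofPred_eq, Set.mem_Ioc, rv, Pi.add_apply, Pi.zero_apply]
  refine forall_congr' fun i => ?_
  constructor <;> rintro ⟨h1, h2⟩ <;> constructor <;> linarith

theorem box_integral (g : (Fin n → ℝ) → ℂ) (hg : Integrable g)
    (hb : ∀ R : ℝ, ∃ K : ℝ, ∀ x : Fin n → ℝ, (∀ i, |x i| ≤ R) → ∀ m : Fin n → ℤ,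
      ‖g (x + rv m)‖ ≤ K * Real.exp (-∑ i, |(m i:ℝ)|)) :
    ∫ x in {x : Fin n → ℝ | ∀ i, x i ∈ Set.Ioc ((0:Fin n → ℝ) i) ((0:Fin n → ℝ) i + 1)},
      ∑' m : Fin n → ℤ, g (x + rv m) = ∫ x, g x := by
  rw [unfold_integral g hg]
  obtain ⟨K, hK⟩ := hb 1
  set S := {x : Fin n → ℝ | ∀ i, x i ∈ Set.Ioc ((0:Fin n → ℝ) i) ((0:Fin n → ℝ) i + 1)} with hS
  have hSm : MeasurableSet S := box_meas 0
  have hvol : volume S = 1 := by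
    have : S = Set.pi Set.univ (fun i => Set.Ioc ((0:ℝ)) 1) := by
      ext x; simp [hS]
    rw [this, Real.volume_pi_Ioc]; simp
  have hSx : ∀ x ∈ S, ∀ i, |x i| ≤ 1 := by
    intro x hx i
    have := hx i
    simp at this
    rw [abs_le]; constructor <;> linarith
  refine (HasSum.tsum_eq (hasSum_integral_of_summable_integral_norm (fun m => ?_) ?_)).symm
  · exact (hg.comp_add_right (rv m)).integrableOn
  · apply Summable.of_nonneg_of_le (fun m => by positivity) (fun m => ?_) ((summable_exp_norm n).mul_left K)
    have h2 : ∫ x in S, ‖g (x + rv m)‖ ≤ ∫ x in S, K * Real.exp (-∑ i, |(m i:ℝ)|) := by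
      apply setIntegral_mono_on
      · exact (hg.comp_add_right (rv m)).norm.integrableOn
      · exact integrableOn_const (by rw [hvol]; simp)
      · exact hSm
      · intro x hx; exact hK x (hSx x hx) m
    refine h2.trans ?_
    simp [Measure.real, hvol]

theorem rv_add (m k : Fin n → ℤ) : rv (m + k) = rv m + rv k := by
  ext i; simp [rv]

theorem poisson_gen (g : (Fin n → ℝ) → ℂ) (hg : Integrable g) (hc : Continuous g)
    (hb : ∀ R : ℝ, ∃ K : ℝ, ∀ x : Fin n → ℝ, (∀ i, |x i| ≤ R) → ∀ m : Fin n → ℤ,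
      ‖g (x + rv m)‖ ≤ K * Real.exp (-∑ i, |(m i:ℝ)|))
    (hs : Summable fun k : Fin n → ℤ => ∫ x, g x * cexp (∑ i, (-(2 * Real.pi * I * k i)) * x i)) :
    ∑' m : Fin n → ℤ, g (rv m) = ∑' k : Fin n → ℤ, ∫ x, g x * cexp (∑ i, (-(2 * Real.pi * I * k i)) * x i) := by
  let F0 : (Fin n → ℝ) → ℂ := fun x => ∑' m : Fin n → ℤ, g (x + rv m)
  have hper : ∀ x (k : Fin n → ℤ), F0 (x + rv k) = F0 x := by
    intro x k
    simp only [F0]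
    rw [← (Equiv.addLeft k).tsum_eq (fun m => g (x + rv m))]
    refine tsum_congr fun m => ?_
    simp [rv_add, add_assoc]
  have hF0 : Continuous F0 := by
    rw [continuous_iff_continuousAt]
    intro x
    obtain ⟨K, hK⟩ := hb (‖x‖ + 1)
    have hball : ContinuousOn F0 (Metric.ball x 1) := by
      apply continuousOn_tsum (u := fun m => K * Real.exp (-∑ i, |(m i:ℝ)|))
      · intro m; exact (hc.comp (continuous_id.add continuous_const)).continuousOn
      · exact (summable_exp_norm n).mul_left K
      · intro m y hy
        apply hK
        intro i
        have h1 : ‖y‖ ≤ ‖x‖ + 1 := by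
          have := norm_sub_norm_le y x
          rw [Metric.mem_ball, dist_eq_norm] at hy
          linarith
        exact (norm_le_pi_norm y i).trans h1
    exact hball.continuousAt (Metric.ball_mem_nhds x one_pos)
  let π : (Fin n → ℝ) → UnitAddTorus (Fin n) := Pi.map (fun _ x => (x : UnitAddCircle))
  have hπ : IsOpenQuotientMap π := IsOpenQuotientMap.piMap fun i => QuotientAddGroup.isOpenQuotientMap_mk
  have hπeq : ∀ x y, π x = π y → F0 x = F0 y := by
    intro x y h
    have : ∀ i, ∃ k : ℤ, x i = y i + k := by
      intro i
      have hi : ((x i : ℝ) : UnitAddCircle) = (y i : ℝ) := congrFun h i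
      have hi2 : ((x i - y i : ℝ) : UnitAddCircle) = 0 := by
        rw [AddCircle.coe_sub, hi, sub_self]
      obtain ⟨k, hk⟩ := (AddCircle.coe_eq_zero_iff (1:ℝ)).mp hi2
      refine ⟨k, ?_⟩
      simp at hk
      linarith
    choose k hk using this
    have : x = y + rv k := by ext i; simp [rv, hk]
    rw [this, hper]
  let F : C(UnitAddTorus (Fin n), ℂ) := ⟨fun y => F0 (Function.surjInv hπ.surjective y), by
    rw [hπ.isQuotientMap.continuous_iff]
    convert hF0 using 1
    ext x
    exact hπeq _ _ (Function.surjInv_eq _ _)⟩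
  have hF : ∀ x, F (π x) = F0 x := fun x => hπeq _ _ (Function.surjInv_eq _ _)
  have hcoef : ∀ k, UnitAddTorus.mFourierCoeff F k =  ∫ x, g x * cexp (∑ i, (-(2 * Real.pi * I * k i)) * x i) := by
    intro k
    rw [UnitAddTorus.mFourierCoeff_eq_integral _ _ 0]
    let e : (Fin n → ℝ) → ℂ := fun x => cexp (∑ i, (-(2 * Real.pi * I * k i)) * x i)
    have he : Continuous e := by simp only [e]; fun_prop
    have henorm : ∀ x, ‖e x‖ = 1 := by
      intro x
      simp only [e]
      have : (∑ i, (-(2 * Real.pi * I * k i)) * x i : ℂ) = ((-∑ i, 2 * Real.pi * k i * x i : ℝ) : ℂ) * I := by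
        push_cast
        rw [neg_mul, Finset.sum_mul, ← Finset.sum_neg_distrib]
        refine Finset.sum_congr rfl fun i _ => by ring
      rw [this, Complex.norm_exp_ofReal_mul_I]
    have heper : ∀ x (m : Fin n → ℤ), e (x + rv m) = e x := by
      intro x m
      simp only [e]
      have : (∑ i, (-(2 * Real.pi * I * k i)) * ((x + rv m) i : ℝ) : ℂ) =
        (∑ i, (-(2 * Real.pi * I * k i)) * x i) + ((-∑ i, k i * m i : ℤ) : ℂ) * (2 * Real.pi * I) := by
        push_cast
        rw [neg_mul, Finset.sum_mul, ← Finset.sum_neg_distrib, ← Finset.sum_add_distrib]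
        refine Finset.sum_congr rfl fun i _ => ?_
        simp only [rv, Pi.add_apply]; push_cast; ring
      rw [this, Complex.exp_add, Complex.exp_int_mul_two_pi_mul_I, mul_one]
    have hmf : ∀ x : Fin n → ℝ, UnitAddTorus.mFourier (-k) (fun i => (x i : UnitAddCircle)) = e x := by
      intro x
      simp only [UnitAddTorus.mFourier, ContinuousMap.coe_mk, e, Complex.exp_sum]
      refine Finset.prod_congr rfl fun i _ => ?_
      rw [fourier_coe_apply]
      congr 1
      simp
    have hFx : ∀ x : Fin n → ℝ, F (fun i => (x i : UnitAddCircle)) = F0 x := hF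
    rw [← box_integral (fun x => g x * e x)]
    · congr 1
      ext x
      rw [hmf, hFx]
      simp only [F0, heper, smul_eq_mul]
      rw [tsum_mul_right, mul_comm]
    · apply hg.mul_of_top_left
      exact memLp_top_of_bound he.aestronglyMeasurable 1 (Filter.Eventually.of_forall fun x => (henorm x).le)
    · intro R
      obtain ⟨K, hK⟩ := hb R
      refine ⟨K, fun x hx m => ?_⟩
      rw [norm_mul, henorm, mul_one]
      exact hK x hx m
  have hsum := UnitAddTorus.hasSum_mFourier_series_apply_of_summable (f := F)
    (by convert hs using 1; ext k; exact hcoef k) 0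
  have h0 : F 0 = ∑' m : Fin n → ℤ, g (rv m) := by
    have := hF 0
    simp only [F0, zero_add] at this
    rw [← this]
    congr 1
  rw [← h0, ← hsum.tsum_eq]
  refine tsum_congr fun k => ?_
  rw [hcoef]
  simp [UnitAddTorus.mFourier]

theorem poisson (A A' : Matrix (Fin n) (Fin n) ℝ) (hA : A' * A = 1) (hdet : |A.det| = 1)
    (b : ℂ) (hb : 0 < b.re) (c : Fin n → ℂ) :
    ∑' m : Fin n → ℤ, gaus b c (A.mulVec (rv m)) =
      (Real.pi / b) ^ (n / 2 : ℂ) * cexp ((∑ i, c i ^ 2) / (4 * b)) *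
      ∑' k : Fin n → ℤ, gaus (Real.pi^2 / b) (fun i => -(Real.pi * I / b) * c i) (A'.transpose.mulVec (rv k)) := by
  have hb0 : b ≠ 0 := by rintro rfl; simp at hb
  have hA2 : A * A' = 1 := mul_eq_one_comm.mp hA
  have hAd : A.det ≠ 0 := by intro h; rw [h] at hdet; simp at hdet
  have hmap : MeasurePreserving (fun x : Fin n → ℝ => A.mulVec x) volume volume := by
    refine ⟨(by fun_prop : Continuous _).measurable, ?_⟩
    have := Real.map_matrix_volume_pi_eq_smul_volume_pi hAd
    rw [abs_inv, hdet] at this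
    simpa using! this
  have hemb : MeasurableEmbedding (fun x : Fin n → ℝ => A.mulVec x) := by
    let E : (Fin n → ℝ) ≃ₜ (Fin n → ℝ) :=
      { toFun := fun x => A.mulVec x
        invFun := fun x => A'.mulVec x
        left_inv := fun x => by simp [hA]
        right_inv := fun x => by simp [hA2]
        continuous_toFun := by fun_prop
        continuous_invFun := by fun_prop }
    exact E.measurableEmbedding
  have hint : ∀ c, Integrable (gaus (n := n) b c) := fun c =>
    GaussianFourier.integrable_cexp_neg_mul_sum_add hb c
  have hA'A : ∀ x : Fin n → ℝ, A'.mulVec (A.mulVec x) = x := fun x => by simp [hA]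
  have hco : ∀ k : Fin n → ℤ, ∫ x, gaus b c (A.mulVec x) * cexp (∑ i, (-(2 * Real.pi * I * k i)) * x i)
     = (Real.pi / b) ^ (n / 2 : ℂ) * cexp ((∑ i, c i ^ 2) / (4 * b)) *
      gaus (Real.pi^2 / b) (fun i => -(Real.pi * I / b) * c i) (A'.transpose.mulVec (rv k)) := by
    intro k
    have h1 : ∀ x : Fin n → ℝ, gaus b c (A.mulVec x) * cexp (∑ i, (-(2 * Real.pi * I * k i)) * x i)
       = (fun u => gaus b (fun i => c i - 2 * Real.pi * I * (A'.transpose.mulVec (rv k)) i) u) (A.mulVec x) := by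
      intro x
      simp only [gaus]
      rw [← Complex.exp_add]
      congr 1
      rw [add_assoc]
      congr 1
      simp only [sub_mul, Finset.sum_sub_distrib]
      rw [sub_eq_add_neg]
      congr 1
      have h2 : ∑ i, (A'.transpose.mulVec (rv k)) i * (A.mulVec x) i = ∑ i, (k i : ℝ) * x i := by
        change (A'.transpose.mulVec (rv k)) ⬝ᵥ (A.mulVec x) = rv k ⬝ᵥ x
        rw [Matrix.mulVec_transpose, ← Matrix.dotProduct_mulVec, hA'A]
      have h3 : (∑ i, 2 * Real.pi * I * ((A'.transpose.mulVec (rv k)) i : ℝ) * ((A.mulVec x) i : ℝ) : ℂ) = 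
         2 * Real.pi * I * ((∑ i, (A'.transpose.mulVec (rv k)) i * (A.mulVec x) i : ℝ) : ℂ) := by
        push_cast; rw [Finset.mul_sum]
        refine Finset.sum_congr rfl fun i _ => by ring
      rw [h3, h2]
      push_cast
      rw [Finset.mul_sum, ← Finset.sum_neg_distrib]
      refine Finset.sum_congr rfl fun i _ => by ring
    simp_rw [h1]
    rw [hmap.integral_comp hemb]
    simp only [gaus]
    rw [GaussianFourier.integral_cexp_neg_mul_sum_add hb]
    rw [Fintype.card_fin, mul_assoc _ (cexp _), ← Complex.exp_add]
    congr 2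
    rw [Finset.mul_sum, ← Finset.sum_add_distrib, Finset.sum_div, Finset.sum_div, ← Finset.sum_add_distrib]
    refine Finset.sum_congr rfl fun i _ => ?_
    field_simp
    ring_nf
    simp only [I_sq]
    ring
  have hre : 0 < ((Real.pi:ℂ)^2 / b).re := by
    rw [← Complex.ofReal_pow, div_eq_mul_inv, Complex.re_ofReal_mul, Complex.inv_re]
    have : 0 < Complex.normSq b := Complex.normSq_pos.mpr hb0
    positivity
  have hsumm := (gaus_summable A'.transpose A.transpose (by rw [← Matrix.transpose_mul, hA, Matrix.transpose_one]) _ hre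
      (fun i => -(Real.pi * I / b) * c i)).mul_left ((Real.pi / b) ^ (n / 2 : ℂ) * cexp ((∑ i, c i ^ 2) / (4 * b)))
  rw [← tsum_mul_left]
  simp_rw [← hco] at hsumm ⊢
  exact poisson_gen (fun x => gaus b c (A.mulVec x)) (hmap.integrable_comp_emb hemb |>.mpr (hint c))
    ((gaus_cont b c).comp (by fun_prop)) (fun R => by
      obtain ⟨K, hK⟩ := gaus_bound A A' hA b.re hb (∑ i, ‖c i‖) R
      exact ⟨K, hK b le_rfl c (fun i => Finset.single_le_sum (f := fun i => ‖c i‖) (fun _ _ => norm_nonneg _)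
        (Finset.mem_univ i))⟩) hsumm

end Nie

end ModPoisson

section ModModTheta
open Complex MeasureTheory
open scoped BigOperators

namespace Nie
section ModTheta
open UpperHalfPlane hiding I
open ModularForm MatrixGroups
open scoped MatrixGroups Manifold

/-- Generic theta series -/
noncomputable def thet {M : Type} (N : M → ℕ) (P : M → ℂ) (z : ℂ) : ℂ :=
  ∑' m, P m * cexp (2 * Real.pi * I * z * N m)

theorem thet_term_norm {M : Type} (N : M → ℕ) (P : M → ℂ) (z : ℂ) (m : M) :
    ‖P m * cexp (2 * Real.pi * I * z * N m)‖ = ‖P m‖ * Real.exp (-(2 * Real.pi * z.im * N m)) := by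
  rw [norm_mul, Complex.norm_exp]
  congr 2
  have : (2 * Real.pi * I * z * N m : ℂ) = ((2 * Real.pi * N m : ℝ) : ℂ) * (I * z) := by push_cast; ring
  rw [this, Complex.re_ofReal_mul]
  simp; ring

theorem thet_mf {M : Type} (N : M → ℕ) (P : M → ℂ) (k : ℤ)
    (hS : ∀ y : ℝ, 0 < y → Summable fun m => ‖P m‖ * Real.exp (-(2 * Real.pi * y * N m)))
    (hT : ∀ z : ℍ, thet N P (-1 / z) = (z:ℂ) ^ k * thet N P z) :
    ∃ f : ModularForm 𝒮ℒ k, ∀ n : ℕ, (qExpansion 1 f).coeff n = ∑' m : {m // N m = n}, P m := by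
  have hsm : ∀ z : ℍ, Summable fun m => P m * cexp (2 * Real.pi * I * z * N m) := by
    intro z
    apply Summable.of_norm
    simp_rw [thet_term_norm]
    exact hS z.im z.im_pos
  have hq : ∀ τ : ℍ, HasSum (fun n : ℕ => (∑' m : {m // N m = n}, P m) • (Function.Periodic.qParam 1 τ) ^ n)
      (thet N P τ) := by
    intro τ
    have h1 : HasSum (fun m => P m * cexp (2 * Real.pi * I * τ * N m)) (thet N P τ) := (hsm τ).hasSum
    rw [← (Equiv.sigmaFiberEquiv N).hasSum_iff] at h1
    have h2 := h1.sigma (fun n => (h1.summable.sigma_factor n).hasSum)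
    convert h2 using 1
    ext n
    rw [smul_eq_mul, ← tsum_mul_right]
    refine tsum_congr fun m => ?_
    simp only [Function.comp, Equiv.sigmaFiberEquiv, Equiv.coe_fn_mk, Function.Periodic.qParam]
    rw [m.2, ← Complex.exp_nat_mul]
    congr 2
    push_cast
    ring
  let F : ℍ → ℂ := fun τ => thet N P τ
  have hbd : IsBoundedAtImInfty F := isBoundedAtImInfty_of_hasSum_qExpansion one_pos hq
  have hhol : MDiff F := by
    rw [UpperHalfPlane.mdifferentiable_iff]
    have : DifferentiableOn ℂ (thet N P) {z | 0 < z.im} := by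
      intro z hz
      have hz' : 0 < z.im := hz
      have h1 : DifferentiableOn ℂ (thet N P) {w | z.im / 2 < w.im} := by
        apply differentiableOn_tsum_of_summable_norm (hS (z.im/2) (by positivity))
        · intro m; fun_prop
        · exact isOpen_lt continuous_const Complex.continuous_im
        · intro m w hw
          rw [thet_term_norm]
          have hw' : z.im / 2 < w.im := hw
          gcongr
      have h2 := h1.differentiableAt (x := z) ((isOpen_lt continuous_const Complex.continuous_im).mem_nhds (by change z.im/2 < z.im; linarith))
      exact h2.differentiableWithinAt
    refine this.congr fun z hz => ?_
    simp only [Function.comp, F]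
    rw [ofComplex_apply_of_im_pos hz]
  have hTinv : F ∣[k] ModularGroup.T = F := by
    ext z
    have hden : UpperHalfPlane.denom (ModularGroup.T : GL (Fin 2) ℝ) z = 1 := by
      rw [ModularGroup.denom_apply]; simp [ModularGroup.T]
    rw [SL_slash_apply, modular_T_smul, hden]
    simp [F, thet]
    refine tsum_congr fun m => ?_
    congr 1
    rw [Complex.exp_eq_exp_iff_exists_int]
    exact ⟨N m, by push_cast; ring⟩
  have hSinv : F ∣[k] ModularGroup.S = F := by
    ext z
    rw [SL_slash_apply, modular_S_smul, ModularGroup.denom_S]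
    have h3 := hT z
    simp only [F]
    have hz0 : (z:ℂ) ≠ 0 := z.ne_zero
    have h4 : (-(z:ℂ))⁻¹ = -1 / z := by
      simp [neg_div, inv_neg]
    rw [h4, h3, zpow_neg]
    field_simp
  have hinv := SlashInvariantForm.slash_action_generators_SL2Z hSinv hTinv
  let f : ModularForm 𝒮ℒ k :=
    { toFun := F
      slash_action_eq' := fun _ ⟨γ, hγ⟩ ↦ hγ ▸ hinv γ
      holo' := hhol
      bdd_at_cusps' := fun {c} hc => by
        rw [Subgroup.IsArithmetic.isCusp_iff_isCusp_SL2Z] at hc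
        rw [OnePoint.isBoundedAt_iff_forall_SL2Z hc]
        intro γ _
        rw [hinv γ]
        exact hbd }
  exact ⟨f, fun n => (ModularFormClass.qExpansion_coeff_unique one_pos one_mem_strictPeriods_SL (f := f) hq n).symm⟩
end ModTheta
end Nie

end ModModTheta

section ModThetaL
open Complex MeasureTheory
open scoped BigOperators

namespace Nie

theorem exp_norm_summable {M : Type} (w l : M → ℂ) (h : ∀ t : ℂ, Summable fun m => ‖w m * cexp (t * l m)‖)
    (T : ℝ) (hT : 0 ≤ T) : Summable fun m => ‖w m‖ * Real.exp (T * ‖l m‖) := by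
  have hs := ((h (T * (1 - I))).add (h (T * (1 + I)))).add ((h (T * (-1 - I))).add (h (T * (-1 + I))))
  refine Summable.of_nonneg_of_le (fun m => by positivity) (fun m => ?_) hs
  simp only [norm_mul, Complex.norm_exp]
  have e : ∀ t : ℂ, (T * t * l m).re = T * (t.re * (l m).re - t.im * (l m).im) := by
    intro t
    rw [mul_assoc, Complex.re_ofReal_mul, Complex.mul_re]
  rw [e, e, e, e, ← mul_add, ← mul_add, ← mul_add]
  apply mul_le_mul_of_nonneg_left _ (norm_nonneg _)
  simp only [Complex.sub_re, Complex.add_re, Complex.one_re, Complex.I_re, Complex.sub_im, Complex.add_im,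
    Complex.one_im, Complex.I_im, Complex.neg_re, Complex.neg_im]
  have hn := Complex.norm_le_abs_re_add_abs_im (l m)
  have h1 : Real.exp (T * ‖l m‖) ≤ Real.exp (T * (|(l m).re| + |(l m).im|)) := by gcongr
  refine h1.trans ?_
  set x := (l m).re
  set y := (l m).im
  have p := fun r : ℝ => (Real.exp_pos r).le
  rcases abs_cases x with ⟨hx, _⟩ | ⟨hx, _⟩ <;> rcases abs_cases y with ⟨hy, _⟩ | ⟨hy, _⟩ <;> rw [hx, hy] <;> ring_nf <;>
   nlinarith [p (T*x+T*y), p (T*x-T*y), p (-(T*x)+T*y), p (-(T*x)-T*y)]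

theorem exp_coeff {M : Type} (w l : M → ℂ) (h : ∀ t : ℂ, Summable fun m => ‖w m * cexp (t * l m)‖) (t : ℂ) :
    HasSum (fun k : ℕ => t ^ k * ((∑' m, w m * l m ^ k) / (k.factorial : ℂ))) (∑' m, w m * cexp (t * l m)) := by
  have hs := exp_norm_summable w l h ‖t‖ (norm_nonneg _)
  have hexp : ∀ z : ℂ, HasSum (fun k : ℕ => z ^ k / (k.factorial : ℂ)) (cexp z) := by
    intro z
    rw [Complex.exp_eq_exp_ℂ]
    exact NormedSpace.expSeries_div_hasSum_exp z
  have hexpR : ∀ z : ℝ, HasSum (fun k : ℕ => z ^ k / (k.factorial : ℝ)) (Real.exp z) := by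
    intro z
    rw [Real.exp_eq_exp_ℝ]
    exact NormedSpace.expSeries_div_hasSum_exp z
  let φ : M × ℕ → ℂ := fun p => w p.1 * ((t * l p.1) ^ p.2 / (p.2.factorial : ℂ))
  have hnorm : ∀ m k, ‖φ (m, k)‖ = ‖w m‖ * ((‖t‖ * ‖l m‖) ^ k / (k.factorial : ℝ)) := by
    intro m k
    simp [φ]
  have hφ : Summable φ := by
    apply Summable.of_norm
    rw [summable_prod_of_nonneg (fun _ => norm_nonneg _)]
    constructor
    · intro m
      simp_rw [hnorm]
      exact ((hexpR _).summable).mul_left _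
    · simp_rw [hnorm]
      simp_rw [tsum_mul_left, (hexpR _).tsum_eq]
      exact hs
  have h1 : ∑' p, φ p = ∑' m, w m * cexp (t * l m) := by
    rw [hφ.tsum_prod]
    refine tsum_congr fun m => ?_
    simp only [φ]
    rw [tsum_mul_left, (hexp _).tsum_eq]
  have h2 : HasSum (φ ∘ (Equiv.prodComm ℕ M)) (∑' m, w m * cexp (t * l m)) := by
    rw [Equiv.hasSum_iff, ← h1]; exact hφ.hasSum
  have h3 := h2.prod_fiberwise (fun k => (h2.summable.prod_factor k).hasSum)
  convert h3 using 1
  ext k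
  simp only [φ, Function.comp, Equiv.prodComm_apply, Prod.swap]
  rw [div_eq_mul_inv, mul_left_comm, ← tsum_mul_right]
  refine tsum_congr fun m => ?_
  rw [mul_pow]; ring

theorem coeff_unique (f : ℂ → ℂ) (a b : ℕ → ℂ) (ha : ∀ t, HasSum (fun k => t ^ k * a k) (f t))
    (hb : ∀ t, HasSum (fun k => t ^ k * b k) (f t)) : a = b := by
  have h1 : ∀ a : ℕ → ℂ, (∀ t, HasSum (fun k => t ^ k * a k) (f t)) → 
     HasFPowerSeriesAt f (FormalMultilinearSeries.ofScalars ℂ a) 0 := by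
    intro a ha
    rw [hasFPowerSeriesAt_iff]
    refine Filter.Eventually.of_forall fun z => ?_
    simpa using ha z
  have := (h1 a ha).eq_formalMultilinearSeries (h1 b hb)
  ext k
  simpa using congrArg (fun p => FormalMultilinearSeries.coeff p k) this

end Nie

end ModThetaL

section ModThetaG
open Complex MeasureTheory
open scoped BigOperators

namespace Nie

/-- bilinear form of a Gram matrix -/
def B (G : Matrix (Fin 24) (Fin 24) ℤ) (x y : Fin 24 → ℤ) : ℤ := x ⬝ᵥ G.mulVec y

/-- even unimodular positive definite Gram matrix of rank 24 -/
structure EUL (G : Matrix (Fin 24) (Fin 24) ℤ) : Prop where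
  symm : G.transpose = G
  even : ∀ x, 2 ∣ B G x x
  pos : ∀ x, x ≠ 0 → 0 < B G x x
  det : G.det = 1

theorem EUL.nonneg {G} (h : EUL G) (x) : 0 ≤ B G x x := by
  by_cases hx : x = 0
  · subst hx; simp [B]
  · exact (h.pos x hx).le

/-- half norm -/
def hn (G : Matrix (Fin 24) (Fin 24) ℤ) (x : Fin 24 → ℤ) : ℕ := (B G x x / 2).toNat

theorem EUL.hn_eq {G} (h : EUL G) (x) : B G x x = 2 * (hn G x : ℤ) := by
  have h1 := h.even x
  have h2 := h.nonneg x
  unfold hn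
  omega

abbrev GR (G : Matrix (Fin 24) (Fin 24) ℤ) : Matrix (Fin 24) (Fin 24) ℝ := G.map (Int.cast : ℤ → ℝ)

theorem GR_mulVec (G) (x : Fin 24 → ℤ) : (GR G).mulVec (rv x) = rv (G.mulVec x) := by
  ext i; simp [Matrix.mulVec, dotProduct, rv]

theorem rv_dot (x y : Fin 24 → ℤ) : rv x ⬝ᵥ rv y = ((x ⬝ᵥ y : ℤ) : ℝ) := by
  simp [dotProduct, rv]

theorem EUL.real_nonneg {G} (h : EUL G) (u : Fin 24 → ℝ) : 0 ≤ u ⬝ᵥ (GR G).mulVec u := by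
  have hc : IsClosed {u : Fin 24 → ℝ | 0 ≤ u ⬝ᵥ (GR G).mulVec u} := by
    apply isClosed_le continuous_const
    fun_prop
  have hd : DenseRange (fun q : Fin 24 → ℚ => fun i => (q i : ℝ)) := by
    exact DenseRange.piMap (fun _ => Rat.denseRange_cast)
  have : Set.range (fun q : Fin 24 → ℚ => fun i => (q i : ℝ)) ⊆ {u : Fin 24 → ℝ | 0 ≤ u ⬝ᵥ (GR G).mulVec u} := by
    rintro _ ⟨q, rfl⟩
    simp only [Set.mem_ofPred_eq]
    let D : ℕ := ∏ i, (q i).den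
    have hD : (0:ℝ) < D := by
      have : 0 < D := Finset.prod_pos fun i _ => (q i).pos
      exact_mod_cast this
    have : ∃ m : Fin 24 → ℤ, ∀ i, (D:ℝ) * (q i : ℝ) = m i := by
      refine ⟨fun i => (q i).num * ∏ j ∈ Finset.univ.erase i, ((q j).den : ℤ), fun i => ?_⟩
      have h1 : D = (q i).den * ∏ j ∈ Finset.univ.erase i, (q j).den :=
        (Finset.mul_prod_erase _ _ (Finset.mem_univ i)).symm
      rw [h1]
      have h2 : ((q i).den : ℝ) * (q i : ℝ) = (q i).num := by
        exact_mod_cast Rat.den_mul_eq_num (q i)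
      push_cast
      rw [← h2]; ring
    obtain ⟨m, hm⟩ := this
    have e : (fun i => (q i : ℝ)) = (D:ℝ)⁻¹ • rv m := by
      ext i
      simp only [Pi.smul_apply, rv, ← hm, smul_eq_mul]
      field_simp
    rw [e, Matrix.mulVec_smul, dotProduct_smul, smul_dotProduct, GR_mulVec, rv_dot]
    have h0 := h.nonneg m
    have : (0:ℝ) ≤ ((m ⬝ᵥ G.mulVec m : ℤ) : ℝ) := by exact_mod_cast h0
    simp only [smul_eq_mul]
    positivity
  have h3 := hc.closure_subset_iff.mpr this
  exact h3 (hd u)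

open scoped MatrixOrder Matrix.Norms.L2Operator in
theorem psd_sqrt (M : Matrix (Fin 24) (Fin 24) ℝ) (hp : M.PosSemidef) : ∃ A : Matrix (Fin 24) (Fin 24) ℝ, M = A.conjTranspose * A := by
  obtain ⟨A, hA⟩ := CStarAlgebra.nonneg_iff_eq_star_mul_self.mp hp.nonneg
  exact ⟨A, hA⟩

theorem EUL.exists_sqrt {G} (h : EUL G) : ∃ A A' : Matrix (Fin 24) (Fin 24) ℝ, A' * A = 1 ∧ |A.det| = 1 ∧
    A.transpose * A = GR G := by
  have hp : (GR G).PosSemidef := by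
    apply Matrix.PosSemidef.of_dotProduct_mulVec_nonneg
    · ext i j
      have := congrFun (congrFun h.symm i) j
      simp only [Matrix.transpose_apply] at this
      simp [this]
    · intro x; simpa using h.real_nonneg x
  obtain ⟨A, hA⟩ := psd_sqrt _ hp
  rw [Matrix.conjTranspose_eq_transpose_of_trivial] at hA
  have hd : A.det * A.det = 1 := by
    have := congrArg Matrix.det hA
    rw [Matrix.det_mul, Matrix.det_transpose] at this
    rw [← this]
    have h2 := RingHom.map_det (Int.castRingHom ℝ) G
    simp only [RingHom.mapMatrix_apply, h.det, map_one] at h2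
    exact h2.symm
  refine ⟨A, A⁻¹, ?_, ?_, hA.symm⟩
  · apply Matrix.nonsing_inv_mul
    exact IsUnit.of_mul_eq_one _ hd
  · rcases mul_self_eq_one_iff.mp hd with h | h <;> simp [h]

end Nie

end ModThetaG

section ModThetaH
open Complex MeasureTheory
open scoped BigOperators

namespace Nie
section ThetaH
open UpperHalfPlane hiding I
open ModularForm MatrixGroups
open scoped MatrixGroups Manifold

/-- complex linear functional on the lattice -/
noncomputable def lf (A : Matrix (Fin 24) (Fin 24) ℝ) (c : Fin 24 → ℂ) (m : Fin 24 → ℤ) : ℂ :=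
  ∑ i, c i * (A.mulVec (rv m) i : ℂ)

theorem sum_sq_eq {G} (h : EUL G) (A : Matrix (Fin 24) (Fin 24) ℝ) (hA : A.transpose * A = GR G) (m) :
    ∑ i, (A.mulVec (rv m) i : ℂ)^2 = 2 * (hn G m : ℂ) := by
  have h1 : (A.mulVec (rv m)) ⬝ᵥ (A.mulVec (rv m)) = ((B G m m : ℤ) : ℝ) := by
    rw [Matrix.dotProduct_mulVec, ← Matrix.mulVec_transpose, Matrix.mulVec_mulVec, hA, GR_mulVec, dotProduct_comm, rv_dot]
    rfl
  rw [h.hn_eq] at h1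
  have : ((A.mulVec (rv m)) ⬝ᵥ (A.mulVec (rv m)) : ℝ) = ∑ i, (A.mulVec (rv m) i)^2 := by
    simp [dotProduct, sq]
  rw [this] at h1
  have := congrArg (fun x : ℝ => (x:ℂ)) h1
  push_cast at this
  exact this

theorem gaus_eq {G} (h : EUL G) (A : Matrix (Fin 24) (Fin 24) ℝ) (hA : A.transpose * A = GR G) (m)
    (z t : ℂ) (c : Fin 24 → ℂ) : gaus (-Real.pi * I * z) (fun i => t * c i) (A.mulVec (rv m)) =
    cexp (2 * Real.pi * I * z * hn G m) * cexp (t * lf A c m) := by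
  rw [gaus, sum_sq_eq h A hA, ← Complex.exp_add, lf, Finset.mul_sum]
  congr 2
  · ring
  · exact Finset.sum_congr rfl fun i _ => by ring

theorem wl_summable {G} (h : EUL G) (A A' : Matrix (Fin 24) (Fin 24) ℝ) (h1 : A' * A = 1) (hA : A.transpose * A = GR G)
    (c : Fin 24 → ℂ) (z : ℂ) (hz : 0 < z.im) (t : ℂ) :
    Summable fun m => ‖cexp (2 * Real.pi * I * z * hn G m) * cexp (t * lf A c m)‖ := by
  have hb : 0 < (-Real.pi * I * z).re := by
    have : (-Real.pi * I * z) = ((-Real.pi : ℝ) : ℂ) * (I * z) := by push_cast; ring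
    rw [this, Complex.re_ofReal_mul]
    have := Real.pi_pos
    simp
    positivity
  have := (gaus_summable A A' h1 (-Real.pi * I * z) hb (fun i => t * c i)).norm
  simp_rw [gaus_eq h A hA] at this
  exact this

theorem EUL.inv_right {G} (h : EUL G) : G * G⁻¹ = 1 := by
  apply Matrix.mul_nonsing_inv; rw [h.det]; exact isUnit_one

theorem EUL.inv_left {G} (h : EUL G) : G⁻¹ * G = 1 := by
  apply Matrix.nonsing_inv_mul; rw [h.det]; exact isUnit_one

/-- the duality equivalence -/
noncomputable def EUL.eqv {G} (h : EUL G) : (Fin 24 → ℤ) ≃ (Fin 24 → ℤ) where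
  toFun x := G.mulVec x
  invFun x := (G⁻¹).mulVec x
  left_inv x := by simp [h.inv_left]
  right_inv x := by simp [h.inv_right]

theorem theta_fun {G} (h : EUL G) (A A' : Matrix (Fin 24) (Fin 24) ℝ) (h1 : A' * A = 1) (hd : |A.det| = 1)
    (hA : A.transpose * A = GR G) (c : Fin 24 → ℂ) (hc : ∑ i, c i ^ 2 = 0) (z : ℂ) (hz : 0 < z.im) (t : ℂ) :
    ∑' m, cexp (2 * Real.pi * I * z * hn G m) * cexp (t * lf A c m) =
    (z ^ 12)⁻¹ * ∑' m, cexp (2 * Real.pi * I * (-1 / z) * hn G m) * cexp ((t / z) * lf A c m) := by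
  have hz0 : z ≠ 0 := by rintro rfl; simp at hz
  have hpi : (Real.pi : ℂ) ≠ 0 := by exact_mod_cast Real.pi_ne_zero
  have hb : 0 < (-Real.pi * I * z).re := by
    have : (-Real.pi * I * z) = ((-Real.pi : ℝ) : ℂ) * (I * z) := by push_cast; ring
    rw [this, Complex.re_ofReal_mul]
    have := Real.pi_pos
    simp
    positivity
  have hp := poisson A A' h1 hd (-Real.pi * I * z) hb (fun i => t * c i)
  simp_rw [gaus_eq h A hA] at hp
  rw [hp]
  have e1 : ∑ i, (t * c i)^2 = 0 := by
    simp_rw [mul_pow, ← Finset.mul_sum, hc]; simp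
  rw [e1]
  simp only [zero_div, Complex.exp_zero, mul_one]
  have e2 : ((Real.pi : ℂ) / (-Real.pi * I * z)) ^ (((24:ℕ) : ℂ) / 2) = (z ^ 12)⁻¹ := by
    have : (((24:ℕ) : ℂ) / 2) = ((12 : ℕ) : ℂ) := by norm_num
    rw [this, Complex.cpow_natCast]
    have : ((Real.pi : ℂ) / (-Real.pi * I * z)) = I * z⁻¹ := by
      field_simp
      rw [I_sq]; 
    rw [this, mul_pow]
    have : I ^ 12 = 1 := by
      rw [show (12 = 4 * 3) from rfl, pow_mul, I_pow_four, one_pow]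
    rw [this, one_mul, inv_pow]
  rw [e2]
  congr 1
  rw [← Equiv.tsum_eq h.eqv]
  refine tsum_congr fun m => ?_
  have e3 : A'.transpose.mulVec (rv (h.eqv m)) = A.mulVec (rv m) := by
    have : rv (h.eqv m) = (GR G).mulVec (rv m) := (GR_mulVec G m).symm
    rw [this, ← hA, Matrix.mulVec_mulVec, ← Matrix.mul_assoc, ← Matrix.transpose_mul,
      mul_eq_one_comm.mp h1]
    simp
  rw [e3, ← gaus_eq h A hA]
  have e4 : (Real.pi : ℂ)^2 / (-Real.pi * I * z) = -Real.pi * I * (-1/z) := by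
    field_simp
    rw [I_sq]
  have e5 : ∀ i, -((Real.pi : ℂ) * I / (-Real.pi * I * z)) * (t * c i) = t / z * c i := by
    intro i
    field_simp
  rw [e4]
  simp_rw [e5]

theorem theta_inv {G} (h : EUL G) (A A' : Matrix (Fin 24) (Fin 24) ℝ) (h1 : A' * A = 1) (hd : |A.det| = 1)
    (hA : A.transpose * A = GR G) (c : Fin 24 → ℂ) (hc : ∑ i, c i ^ 2 = 0) (j : ℕ) (z : ℂ) (hz : 0 < z.im) :
    thet (hn G) (fun m => lf A c m ^ j) (-1 / z) = z ^ (12 + j) * thet (hn G) (fun m => lf A c m ^ j) z := by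
  have hz0 : z ≠ 0 := by rintro rfl; simp at hz
  have hz' : 0 < (-1 / z).im := by
    rw [neg_div, one_div, Complex.neg_im, Complex.inv_im]
    rw [neg_div, neg_neg]
    have := Complex.normSq_pos.mpr hz0
    positivity
  have H1 := exp_coeff _ _ (wl_summable h A A' h1 hA c z hz)
  have H2 := exp_coeff _ _ (wl_summable h A A' h1 hA c (-1/z) hz')
  have H3 := coeff_unique _ _ (fun k => (z^12)⁻¹ * (z^k)⁻¹ * ((∑' m, cexp (2 * Real.pi * I * (-1/z) * hn G m) * lf A c m ^ k) / (k.factorial : ℂ))) H1 (by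
    intro t
    rw [theta_fun h A A' h1 hd hA c hc z hz t]
    have H5 := (H2 (t/z)).mul_left ((z^12)⁻¹)
    refine Eq.mp (congrArg (fun F => HasSum F _) (funext fun k => ?_)) H5
    simp only [div_pow]
    ring)
  have H4 := congrFun H3 j
  have hf : (j.factorial : ℂ) ≠ 0 := by exact_mod_cast j.factorial_ne_zero
  simp only [thet]
  simp_rw [mul_comm (lf A c _ ^ j)]
  generalize (∑' m, cexp (2 * Real.pi * I * (-1/z) * hn G m) * lf A c m ^ j) = X at H4 ⊢
  field_simp at H4
  rw [← H4]; ring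

theorem theta_hS {G} (h : EUL G) (A A' : Matrix (Fin 24) (Fin 24) ℝ) (h1 : A' * A = 1) 
    (hA : A.transpose * A = GR G) (c : Fin 24 → ℂ) (j : ℕ) (y : ℝ) (hy : 0 < y) :
    Summable fun m => ‖lf A c m ^ j‖ * Real.exp (-(2 * Real.pi * y * hn G m)) := by
  have H := exp_norm_summable _ _ (wl_summable h A A' h1 hA c (y * I) (by simpa using hy)) 1 zero_le_one
  refine Summable.of_nonneg_of_le (fun m => by positivity) (fun m => ?_) (H.mul_left (j.factorial : ℝ))
  have e : ‖cexp (2 * Real.pi * I * (y * I) * hn G m)‖ = Real.exp (-(2 * Real.pi * y * hn G m)) := by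
    have := thet_term_norm (hn G) (fun _ => 1) (y * I) m
    simpa using this
  rw [e, one_mul, norm_pow]
  have hx : ‖lf A c m‖ ^ j ≤ j.factorial * Real.exp ‖lf A c m‖ := by
    have := Real.pow_div_factorial_le_exp _ (norm_nonneg (lf A c m)) j
    rw [div_le_iff₀ (by positivity)] at this
    linarith
  calc _ ≤ (j.factorial * Real.exp ‖lf A c m‖) * Real.exp (-(2 * Real.pi * y * hn G m)) := by gcongr
    _ = _ := by ring

theorem theta_mf {G} (h : EUL G) (A A' : Matrix (Fin 24) (Fin 24) ℝ) (h1 : A' * A = 1) (hd : |A.det| = 1)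
    (hA : A.transpose * A = GR G) (c : Fin 24 → ℂ) (hc : ∑ i, c i ^ 2 = 0) (j : ℕ) :
    ∃ f : ModularForm 𝒮ℒ ((12 + j : ℕ) : ℤ), ∀ n : ℕ, (qExpansion 1 f).coeff n = ∑' m : {m // hn G m = n}, lf A c m ^ j := by
  refine thet_mf (hn G) (fun m => lf A c m ^ j) _ (theta_hS h A A' h1 hA c j) ?_
  intro z
  rw [zpow_natCast]
  exact theta_inv h A A' h1 hd hA c hc j z z.im_pos

end ThetaH
end Nie

end ModThetaH

section ModThetaI
open Complex MeasureTheory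
open scoped BigOperators

namespace Nie
section ThetaI
open UpperHalfPlane hiding I
open ModularForm MatrixGroups
open scoped MatrixGroups Manifold

theorem EUL.finite {G} (h : EUL G) (n : ℕ) : {m | hn G m ≤ n}.Finite := by
  obtain ⟨A, A', h1, hd, hA⟩ := h.exists_sqrt
  have H := theta_hS h A A' h1 hA 0 0 1 one_pos
  simp only [pow_zero, norm_one, one_mul] at H
  have H2 := (H.tendsto_cofinite_zero).eventually_lt_const (Real.exp_pos (-(2 * Real.pi * 1 * n)))
  rw [Filter.eventually_cofinite] at H2
  refine H2.subset ?_
  intro m hm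
  simp only [Set.mem_ofPred_eq, not_lt] at hm ⊢
  apply Real.exp_le_exp.mpr
  have : (hn G m : ℝ) ≤ n := by exact_mod_cast hm
  have := Real.pi_pos
  nlinarith

open Classical in
/-- vectors of norm 2n -/
noncomputable def shell (G : Matrix (Fin 24) (Fin 24) ℤ) (n : ℕ) : Finset (Fin 24 → ℤ) :=
  if h : {m | hn G m = n}.Finite then h.toFinset else ∅

theorem EUL.mem_hn {G} (h : EUL G) (n : ℕ) (m) : m ∈ shell G n ↔ hn G m = n := by
  have : {m | hn G m = n}.Finite := (h.finite n).subset (fun m hm => le_of_eq hm)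
  simp [shell, this]

theorem EUL.mem_shell {G} (h : EUL G) (n : ℕ) (m) : m ∈ shell G n ↔ B G m m = 2 * n := by
  rw [h.mem_hn, h.hn_eq]
  constructor
  · rintro rfl; rfl
  · intro h2
    have : (hn G m : ℤ) = n := by linarith
    exact_mod_cast this

theorem EUL.shell_zero {G} (h : EUL G) : shell G 0 = {0} := by
  ext m
  rw [h.mem_shell, Finset.mem_singleton]
  constructor
  · intro h0
    by_contra hm
    have := h.pos m hm
    simp at h0; omega
  · rintro rfl; simp [B]

theorem EUL.tsum_shell {G} (h : EUL G) (n : ℕ) (F : (Fin 24 → ℤ) → ℂ) :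
    ∑' m : {m // hn G m = n}, F m = ∑ m ∈ shell G n, F m := by
  rw [← Finset.tsum_subtype]
  have : {m | hn G m = n} = {m | m ∈ shell G n} := by
    ext m; exact (h.mem_hn n m).symm
  exact tsum_congr_set_coe F this

theorem wt14 (f : ModularForm 𝒮ℒ ((12 + 2 : ℕ) : ℤ)) (h0 : (qExpansion 1 f).coeff 0 = 0) : qExpansion 1 f = 0 := by
  rw [qExpansion_eq_qExpansion_discriminant_mul f h0]
  have : (CuspForm.discriminantEquiv (toCuspForm f h0)) = 0 :=
    rank_zero_iff_forall_zero.mp levelOne_weight_two_rank_zero _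
  rw [this]
  have h2 : qExpansion 1 ((0 : ModularForm 𝒮ℒ (((12 + 2 : ℕ) : ℤ) - 12)) : ℍ → ℂ) = 0 :=
    (ModularForm.qExpansion_eq_zero_iff one_pos one_mem_strictPeriods_SL _).mpr rfl
  rw [h2, mul_zero]

theorem EUL.quad_sum {G} (h : EUL G) (A A' : Matrix (Fin 24) (Fin 24) ℝ) (h1 : A' * A = 1) (hd : |A.det| = 1)
    (hA : A.transpose * A = GR G) (i j : Fin 24) (hij : i ≠ j) :
    ∑ m ∈ shell G 1, (((A.mulVec (rv m) i : ℝ) : ℂ) + I * (A.mulVec (rv m) j : ℝ)) ^ 2 = 0 := by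
  let c : Fin 24 → ℂ := fun k => if k = i then 1 else if k = j then I else 0
  have hlf : ∀ m, lf A c m = ((A.mulVec (rv m) i : ℝ) : ℂ) + I * (A.mulVec (rv m) j : ℝ) := by
    intro m
    rw [lf, ← Finset.add_sum_erase _ _ (Finset.mem_univ i), ← Finset.add_sum_erase _ _ (Finset.mem_erase.mpr ⟨hij.symm, Finset.mem_univ j⟩),
      Finset.sum_eq_zero]
    · simp [c, hij.symm]
    · intro k hk
      simp only [Finset.mem_erase] at hk
      simp [c, hk.1, hk.2.1]
  have hc : ∑ k, c k ^ 2 = 0 := by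
    rw [← Finset.add_sum_erase _ _ (Finset.mem_univ i), ← Finset.add_sum_erase _ _ (Finset.mem_erase.mpr ⟨hij.symm, Finset.mem_univ j⟩),
      Finset.sum_eq_zero]
    · simp [c, hij.symm]
    · intro k hk
      simp only [Finset.mem_erase] at hk
      simp [c, hk.1, hk.2.1]
  obtain ⟨f, hf⟩ := theta_mf h A A' h1 hd hA c hc 2
  simp_rw [h.tsum_shell _ (fun m => lf A c m ^ 2)] at hf
  have h0 : (qExpansion 1 f).coeff 0 = 0 := by
    rw [hf, h.shell_zero]
    have : rv (0 : Fin 24 → ℤ) = 0 := by ext i; simp [rv]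
    simp [lf, this]
  have h2 := hf 1
  rw [wt14 f h0] at h2
  simp_rw [hlf] at h2
  simpa using h2.symm

theorem EUL.venkov {G} (h : EUL G) (a : Fin 24 → ℤ) :
    12 * ∑ r ∈ shell G 1, (B G r a) ^ 2 = (shell G 1).card * B G a a := by
  obtain ⟨A, A', h1, hd, hA⟩ := h.exists_sqrt
  let X : (Fin 24 → ℤ) → Fin 24 → ℝ := fun m => A.mulVec (rv m)
  have hB : ∀ x y, ((B G x y : ℤ) : ℝ) = ∑ i, X x i * X y i := by
    intro x y
    have : (A.mulVec (rv x)) ⬝ᵥ (A.mulVec (rv y)) = ((B G x y : ℤ) : ℝ) := by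
      rw [dotProduct_comm, Matrix.dotProduct_mulVec, ← Matrix.mulVec_transpose, Matrix.mulVec_mulVec, hA, GR_mulVec, dotProduct_comm, rv_dot]
      rfl
    rw [← this]; rfl
  have hq := fun i j hij => h.quad_sum A A' h1 hd hA i j hij
  have hre : ∀ i j, i ≠ j → ∑ m ∈ shell G 1, X m i * X m i = ∑ m ∈ shell G 1, X m j * X m j := by
    intro i j hij
    have := congrArg Complex.re (hq i j hij)
    rw [Complex.re_sum] at this
    have e : ∀ m, ((((A.mulVec (rv m) i : ℝ) : ℂ) + I * (A.mulVec (rv m) j : ℝ)) ^ 2).re = X m i * X m i - X m j * X m j := by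
      intro m
      simp [sq, X]
    simp_rw [e, Finset.sum_sub_distrib] at this
    simpa [sub_eq_zero] using this
  have him : ∀ i j, i ≠ j → ∑ m ∈ shell G 1, X m i * X m j = 0 := by
    intro i j hij
    have := congrArg Complex.im (hq i j hij)
    rw [Complex.im_sum] at this
    have e : ∀ m, ((((A.mulVec (rv m) i : ℝ) : ℂ) + I * (A.mulVec (rv m) j : ℝ)) ^ 2).im = 2 * (X m i * X m j) := by
      intro m
      simp [sq, X]; ring
    simp_rw [e, ← Finset.mul_sum] at this
    simpa using this
  set κ := ∑ m ∈ shell G 1, X m 0 * X m 0 with hκ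
  have hM : ∀ i j, ∑ m ∈ shell G 1, X m i * X m j = if i = j then κ else 0 := by
    intro i j
    split_ifs with hij
    · subst hij
      by_cases hi : i = 0
      · subst hi; rfl
      · exact hre i 0 hi
    · exact him i j hij
  have htr : 24 * κ = 2 * (shell G 1).card := by
    have : ∑ m ∈ shell G 1, ((B G m m : ℤ) : ℝ) = ∑ m ∈ shell G 1, (2:ℝ) := by
      refine Finset.sum_congr rfl fun m hm => ?_
      rw [(h.mem_shell 1 m).mp hm]; norm_num
    simp_rw [hB] at this
    rw [Finset.sum_comm] at this
    simp_rw [hM] at this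
    simp at this
    linarith
  have hmain : ∑ r ∈ shell G 1, ((B G r a : ℤ) : ℝ) ^ 2 = κ * ((B G a a : ℤ) : ℝ) := by
    simp_rw [hB, sq, Finset.sum_mul_sum]
    rw [Finset.sum_comm]
    simp_rw [Finset.sum_comm (s := shell G 1)]
    have e : ∀ i j, ∑ r ∈ shell G 1, X r i * X a i * (X r j * X a j) = (X a i * X a j) * (if i = j then κ else 0) := by
      intro i j
      rw [← hM, Finset.mul_sum]
      exact Finset.sum_congr rfl fun r _ => by ring
    simp_rw [e]
    simp [Finset.mul_sum]
    exact Finset.sum_congr rfl fun i _ => by ring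
  have : (12:ℝ) * ∑ r ∈ shell G 1, ((B G r a : ℤ) : ℝ) ^ 2 = (shell G 1).card * ((B G a a : ℤ) : ℝ) := by
    rw [hmain]
    have : κ = (shell G 1).card / 12 := by linarith
    rw [this]; ring
  exact_mod_cast this

end ThetaI
end Nie

end ModThetaI

section ModThetaJ
open Complex MeasureTheory
open scoped BigOperators

namespace Nie
section ThetaJ
open UpperHalfPlane hiding I
open ModularForm MatrixGroups
open scoped MatrixGroups Manifold
open EisensteinSeries

theorem E4c (n : ℕ) : (qExpansion 1 E₄).coeff n = if n = 0 then 1 else 240 * ((ArithmeticFunction.sigma 3 n : ℕ) : ℂ) := by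
  rw [E_qExpansion_coeff _ ⟨2, rfl⟩]
  rw [show bernoulli 4 = -1 / 30 by decide +kernel]
  norm_num

theorem E6c (n : ℕ) : (qExpansion 1 E₆).coeff n = if n = 0 then 1 else -504 * ((ArithmeticFunction.sigma 5 n : ℕ) : ℂ) := by
  rw [E_qExpansion_coeff _ ⟨3, rfl⟩]
  rw [show bernoulli 6 = 1 / 42 by decide +kernel]
  norm_num

theorem sg (k : ℕ) : ArithmeticFunction.sigma k 1 = 1 ∧ ArithmeticFunction.sigma k 2 = 1 + 2 ^ k ∧
   ArithmeticFunction.sigma k 3 = 1 + 3 ^ k ∧ ArithmeticFunction.sigma k 4 = 1 + 2 ^ k + 4 ^ k := by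
  simp only [ArithmeticFunction.sigma_apply]
  rw [show Nat.divisors 1 = {1} by decide, show Nat.divisors 2 = {1, 2} by decide, show Nat.divisors 3 = {1, 3} by decide, 
    show Nat.divisors 4 = {1, 2, 4} by decide]
  simp [add_assoc]

theorem EUL.leech_counts {G} (h : EUL G) (h0 : (shell G 1).card = 0) :
    (shell G 2).card = 196560 ∧ (shell G 3).card = 16773120 ∧ (shell G 4).card = 398034000 := by
  obtain ⟨A, A', h1, hd, hA⟩ := h.exists_sqrt
  obtain ⟨f, hf⟩ := theta_mf h A A' h1 hd hA 0 (by simp) 0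
  simp_rw [h.tsum_shell _ (fun m => lf A 0 m ^ 0)] at hf
  simp only [pow_zero, Finset.sum_const, nsmul_eq_mul, mul_one] at hf
  let e4 : ModularForm 𝒮ℒ ((12 + 0 : ℕ) : ℤ) := ModularForm.mcast (by decide) (E₄.pow 3)
  let e6 : ModularForm 𝒮ℒ ((12 + 0 : ℕ) : ℤ) := ModularForm.mcast (by decide) (E₆.pow 2)
  have he4 : qExpansion 1 e4 = qExpansion 1 E₄ * qExpansion 1 E₄ * qExpansion 1 E₄ := by
    simp only [e4, coe_mcast, ModularForm.qExpansion_pow one_pos one_mem_strictPeriods_SL]; ring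
  have he6 : qExpansion 1 e6 = qExpansion 1 E₆ * qExpansion 1 E₆ := by
    simp only [e6, coe_mcast, ModularForm.qExpansion_pow one_pos one_mem_strictPeriods_SL]; ring
  let g : ModularForm 𝒮ℒ ((12 + 0 : ℕ) : ℤ) := f - ((7/12 : ℂ) • e4 + (5/12 : ℂ) • e6)
  have hg : qExpansion 1 g = qExpansion 1 f - ((7/12 : ℂ) • qExpansion 1 e4 + (5/12 : ℂ) • qExpansion 1 e6) := by
    simp only [g, FunLike.coe_sub, FunLike.coe_add, FunLike.coe_smul]
    rw [← FunLike.coe_smul, ← FunLike.coe_smul, ← FunLike.coe_add, ModularForm.qExpansion_sub one_pos one_mem_strictPeriods_SL, FunLike.coe_add,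
     ModularForm.qExpansion_add one_pos one_mem_strictPeriods_SL, FunLike.coe_smul, FunLike.coe_smul,
    ModularForm.qExpansion_smul one_pos one_mem_strictPeriods_SL, ModularForm.qExpansion_smul one_pos one_mem_strictPeriods_SL]
  obtain ⟨s1, s2, s3, s4⟩ := sg 3
  obtain ⟨t1, t2, t3, t4⟩ := sg 5
  have hc : ∀ n, (qExpansion 1 g).coeff n = (shell G n).card - ((7/12 : ℂ) * (qExpansion 1 E₄ * qExpansion 1 E₄ * qExpansion 1 E₄).coeff n + 
      (5/12 : ℂ) * (qExpansion 1 E₆ * qExpansion 1 E₆).coeff n) := by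
    intro n
    rw [hg, he4, he6]; simp [hf]
  have c0 : (qExpansion 1 g).coeff 0 = 0 := by
    rw [hc, h.shell_zero]
    norm_num [PowerSeries.coeff_mul, Finset.Nat.antidiagonal_succ, E4c, E6c, -PowerSeries.coeff_zero_eq_constantCoeff]
  have c1 : (qExpansion 1 g).coeff 1 = 0 := by
    rw [hc, h0]
    norm_num [PowerSeries.coeff_mul, Finset.Nat.antidiagonal_succ, E4c, E6c, s1, t1, -PowerSeries.coeff_zero_eq_constantCoeff]
  have hz : g = 0 := by
    apply sturm_bound_levelOne_nat
    have : (2 : ℕ∞) ≤ (qExpansion 1 g).order := by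
      apply PowerSeries.le_order
      intro i hi
      have hi' : i < 2 := by exact_mod_cast hi
      interval_cases i
      · exact c0
      · exact c1
    refine lt_of_lt_of_le ?_ this
    norm_num
  have hz2 : qExpansion 1 g = 0 := (ModularForm.qExpansion_eq_zero_iff one_pos one_mem_strictPeriods_SL _).mpr hz
  rw [hz2] at hc
  refine ⟨?_, ?_, ?_⟩
  · have := hc 2
    norm_num [PowerSeries.coeff_mul, Finset.Nat.antidiagonal_succ, E4c, E6c, s1, t1, s2, t2, -PowerSeries.coeff_zero_eq_constantCoeff] at this
    have := (sub_eq_zero.mp this.symm)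
    exact_mod_cast this
  · have := hc 3
    norm_num [PowerSeries.coeff_mul, Finset.Nat.antidiagonal_succ, E4c, E6c, s1, t1, s2, t2, s3, t3, -PowerSeries.coeff_zero_eq_constantCoeff] at this
    have := (sub_eq_zero.mp this.symm)
    exact_mod_cast this
  · have := hc 4
    norm_num [PowerSeries.coeff_mul, Finset.Nat.antidiagonal_succ, E4c, E6c, s1, t1, s2, t2, s3, t3, s4, t4, -PowerSeries.coeff_zero_eq_constantCoeff] at this
    have := (sub_eq_zero.mp this.symm)
    exact_mod_cast this

end ThetaJ
end Nie

end ModThetaJ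

section ModDet
open scoped BigOperators

namespace Nie

/-! ### fraction-free elimination: positivity and determinant -/

/-- quadratic form of an array -/
def qf (n : ℕ) (M : ℕ → ℕ → ℤ) (x : ℕ → ℤ) : ℤ := ∑ i ∈ Finset.range n, ∑ j ∈ Finset.range n, x i * x j * M i j

theorem qf_step (n : ℕ) (M M' : ℕ → ℕ → ℤ) (d : ℤ) (hs : ∀ i ≤ n, ∀ j ≤ n, M i j = M j i)
    (hS : ∀ i < n, ∀ j < n, d * M' i j = M 0 0 * M (i + 1) (j + 1) - M (i + 1) 0 * M 0 (j + 1)) (x : ℕ → ℤ) :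
    M 0 0 * qf (n + 1) M x = (∑ j ∈ Finset.range (n + 1), M 0 j * x j) ^ 2 + d * qf n M' (fun i => x (i + 1)) := by
  have e1 : d * qf n M' (fun i => x (i + 1)) = ∑ i ∈ Finset.range n, ∑ j ∈ Finset.range n,
      x (i + 1) * x (j + 1) * (M 0 0 * M (i + 1) (j + 1) - M (i + 1) 0 * M 0 (j + 1)) := by
    unfold qf
    rw [Finset.mul_sum]
    refine Finset.sum_congr rfl fun i hi => ?_
    rw [Finset.mul_sum]
    refine Finset.sum_congr rfl fun j hj => ?_
    rw [← hS i (Finset.mem_range.mp hi) j (Finset.mem_range.mp hj)]; ring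
  have e2 : qf (n + 1) M x = ∑ i ∈ Finset.range n, ∑ j ∈ Finset.range n, x (i + 1) * x (j + 1) * M (i + 1) (j + 1)
      + 2 * x 0 * ∑ j ∈ Finset.range n, M 0 (j + 1) * x (j + 1) + x 0 * x 0 * M 0 0 := by
    unfold qf
    rw [Finset.sum_range_succ']
    simp only [Finset.sum_range_succ' _ n]
    rw [Finset.sum_add_distrib]
    have : ∑ i ∈ Finset.range n, x (i + 1) * x 0 * M (i + 1) 0 = x 0 * ∑ j ∈ Finset.range n, M 0 (j + 1) * x (j + 1) := by
      rw [Finset.mul_sum]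
      refine Finset.sum_congr rfl fun i hi => ?_
      rw [hs (i + 1) (by have := Finset.mem_range.mp hi; omega) 0 (by omega)]; ring
    rw [this]
    have : ∑ i ∈ Finset.range n, x 0 * x (i + 1) * M 0 (i + 1) = x 0 * ∑ j ∈ Finset.range n, M 0 (j + 1) * x (j + 1) := by
      rw [Finset.mul_sum]
      refine Finset.sum_congr rfl fun i hi => ?_
      ring
    rw [this]; ring
  have e3 : ∑ i ∈ Finset.range n, ∑ j ∈ Finset.range n,
      x (i + 1) * x (j + 1) * (M 0 0 * M (i + 1) (j + 1) - M (i + 1) 0 * M 0 (j + 1)) =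
      M 0 0 * ∑ i ∈ Finset.range n, ∑ j ∈ Finset.range n, x (i + 1) * x (j + 1) * M (i + 1) (j + 1)
      - (∑ j ∈ Finset.range n, M 0 (j + 1) * x (j + 1)) ^ 2 := by
    rw [sq, Finset.sum_mul_sum, Finset.mul_sum, ← Finset.sum_sub_distrib]
    refine Finset.sum_congr rfl fun i hi => ?_
    rw [Finset.mul_sum, ← Finset.sum_sub_distrib]
    refine Finset.sum_congr rfl fun j hj => ?_
    rw [hs (i + 1) (by have := Finset.mem_range.mp hi; omega) 0 (by omega)]; ring
  rw [e1, e2, e3, Finset.sum_range_succ']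
  ring

theorem det_step (n : ℕ) (M M' : ℕ → ℕ → ℤ) (d : ℤ)
    (hS : ∀ i < n, ∀ j < n, d * M' i j = M 0 0 * M (i + 1) (j + 1) - M (i + 1) 0 * M 0 (j + 1)) :
    M 0 0 ^ n * (Matrix.of fun i j : Fin (n + 1) => M i j).det =
      M 0 0 * (d ^ n * (Matrix.of fun i j : Fin n => M' i j).det) := by
  set a := M 0 0 with ha
  have h1 : a ^ n * (Matrix.of fun i j : Fin (n + 1) => M i j).det =
      (Matrix.of fun i j : Fin (n + 1) => (if i = 0 then 1 else a) * M i j).det := by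
    have := Matrix.det_mul_column (fun i : Fin (n + 1) => if i = 0 then (1 : ℤ) else a) (Matrix.of fun i j : Fin (n + 1) => M i j)
    simp only [Matrix.of_apply] at this
    rw [this, Fin.prod_univ_succ]
    simp [Fin.succ_ne_zero]
  have h2 : (Matrix.of fun i j : Fin (n + 1) => (if i = 0 then 0 else - M i 0) * M 0 j + (if i = 0 then 1 else a) * M i j).det =
      (Matrix.of fun i j : Fin (n + 1) => (if i = 0 then 1 else a) * M i j).det := by
    refine Matrix.det_eq_of_forall_row_eq_smul_add_const (fun i : Fin (n + 1) => if i = 0 then 0 else - M i 0) 0 (by simp) ?_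
    intro i j
    simp [add_comm]
  rw [h1, ← h2, Matrix.det_succ_column_zero, Fin.sum_univ_succ]
  rw [Finset.sum_eq_zero (fun i _ => ?_)]
  · have h3 : (Matrix.of fun i j : Fin n => d * M' i j).det = d ^ n * (Matrix.of fun i j : Fin n => M' i j).det := by
      have := Matrix.det_smul (Matrix.of fun i j : Fin n => M' i j) d
      rw [Fintype.card_fin] at this
      rw [← this]; rfl
    rw [← h3]
    simp only [Fin.val_zero, pow_zero, one_mul, Matrix.of_apply, if_true, zero_mul, zero_add, add_zero]
    congr 2
    ext i j
    simp only [Matrix.submatrix_apply, Matrix.of_apply, Fin.succAbove_zero, Fin.succ_ne_zero, if_false, Fin.val_succ]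
    rw [hS i i.2 j j.2]; ring
  · simp only [Matrix.of_apply, Fin.succ_ne_zero, if_false, Fin.val_succ, Fin.val_zero]
    rw [show -M (i + 1) 0 * M 0 0 + a * M (i + 1) 0 = 0 by rw [ha]; ring]
    simp

/-! list version -/

def hdZ (l : List ℤ) : ℤ := List.rec 0 (fun a _ _ => a) l
def tlZ (l : List ℤ) : List ℤ := List.rec [] (fun _ t _ => t) l
def ent (l : List (List ℤ)) (i j : ℕ) : ℤ := (l.getD i []).getD j 0

theorem hdZ_eq (l : List ℤ) : hdZ l = l.getD 0 0 := by cases l <;> rfl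
theorem tlZ_eq (l : List ℤ) (j) : (tlZ l).getD j 0 = l.getD (j + 1) 0 := by cases l <;> simp [tlZ]

def rowq (a r0 d : ℤ) (b : List ℤ) : List ℤ → List ℤ :=
  List.rec (fun _ => []) (fun x _ ih r => (a * hdZ r - r0 * x) / d :: ih (tlZ r)) b
def rowok (a r0 d : ℤ) (b : List ℤ) : List ℤ → List ℤ → Bool :=
  List.rec (fun _ _ => true) (fun x _ ih r q => decide (d * hdZ q = a * hdZ r - r0 * x) && ih (tlZ r) (tlZ q)) b

theorem rowok_spec {a r0 d : ℤ} {b r q : List ℤ} (h : rowok a r0 d b r q = true) :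
    ∀ j < b.length, d * q.getD j 0 = a * r.getD j 0 - r0 * b.getD j 0 := by
  induction b generalizing r q with
  | nil => intro j hj; simp at hj
  | cons x b ih =>
    change (decide (d * hdZ q = a * hdZ r - r0 * x) && rowok a r0 d b (tlZ r) (tlZ q)) = true at h
    rw [Bool.and_eq_true, decide_eq_true_eq] at h
    intro j hj
    cases j with
    | zero => rw [← hdZ_eq, ← hdZ_eq]; simpa using h.1
    | succ j =>
      have := ih h.2 j (by simpa using hj)
      rw [tlZ_eq, tlZ_eq] at this
      simpa using this

def nxt (a d : ℤ) (b : List ℤ) (rows : List (List ℤ)) : List (List ℤ) := rows.map fun r => rowq a (hdZ r) d b (tlZ r)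

/-- check one elimination step on all rows -/
def stepok (a d : ℤ) (b : List ℤ) (rows : List (List ℤ)) : List (List ℤ) → Bool :=
  List.rec (fun _ => true) (fun r _ ih qs => rowok a (hdZ r) d b (tlZ r) (qs.headD []) && ih qs.tail) rows

theorem stepok_spec {a d b rows qs} (h : stepok a d b rows qs = true) : ∀ i < rows.length, ∀ j < b.length,
    d * ent qs i j = a * ent rows i (j + 1) - ent rows i 0 * b.getD j 0 := by
  induction rows generalizing qs with
  | nil => intro i hi; simp at hi
  | cons r rows ih =>
    change (rowok a (hdZ r) d b (tlZ r) (qs.headD []) && stepok a d b rows qs.tail) = true at h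
    rw [Bool.and_eq_true] at h
    intro i hi j hj
    cases i with
    | zero =>
      have := rowok_spec h.1 j hj
      rw [tlZ_eq, hdZ_eq] at this
      have e : ent qs 0 j = (qs.headD []).getD j 0 := by cases qs <;> simp [ent]
      rw [e, this]; simp [ent]
    | succ i =>
      have := ih h.2 i (by simpa using hi) j hj
      have e : ent qs (i + 1) j = ent qs.tail i j := by cases qs <;> simp [ent]
      rw [e, this]; simp [ent]

def bar (n : ℕ) : ℤ → List (List ℤ) → Bool :=
  Nat.rec (fun _ M => decide (ent M 0 0 = 1))
    (fun n ih d M => (fun a b rows => decide (0 < a) && Nat.beq rows.length (n + 1) && Nat.beq b.length (n + 1) &&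
      (fun q => stepok a d b rows q && ih a q) (nxt a d b rows)) (ent M 0 0) (tlZ (M.headD [])) M.tail) n

theorem bar_spec (n : ℕ) : ∀ (d : ℤ) (M : List (List ℤ)), 0 < d → bar n d M = true →
    (∀ i ≤ n, ∀ j ≤ n, ent M i j = ent M j i) →
    (∀ x : ℕ → ℤ, (∃ i ≤ n, x i ≠ 0) → 0 < qf (n + 1) (ent M) x) ∧
    (Matrix.of fun i j : Fin (n + 1) => ent M i j).det = d ^ n := by
  induction n with
  | zero =>
    intro d M hd h hs
    have h : ent M 0 0 = 1 := of_decide_eq_true h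
    constructor
    · rintro x ⟨i, hi, hx⟩
      have : i = 0 := by omega
      subst this
      simp only [qf, zero_add, Finset.range_one, Finset.sum_singleton, h, mul_one]
      exact mul_self_pos.mpr hx
    · simp [h]
  | succ n ih =>
    intro d M hd h hs
    change (decide (0 < ent M 0 0) && Nat.beq M.tail.length (n + 1) && Nat.beq (tlZ (M.headD [])).length (n + 1) &&
      (stepok (ent M 0 0) d (tlZ (M.headD [])) M.tail (nxt (ent M 0 0) d (tlZ (M.headD [])) M.tail) &&
        bar n (ent M 0 0) (nxt (ent M 0 0) d (tlZ (M.headD [])) M.tail))) = true at h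
    simp only [Bool.and_eq_true, decide_eq_true_eq, Nat.beq_eq] at h
    obtain ⟨⟨⟨ha, hl1⟩, hl2⟩, hst, hb⟩ := h
    set Q := nxt (ent M 0 0) d (tlZ (M.headD [])) M.tail
    have hS : ∀ i < n + 1, ∀ j < n + 1, d * ent Q i j =
        ent M 0 0 * ent M (i + 1) (j + 1) - ent M (i + 1) 0 * ent M 0 (j + 1) := by
      intro i hi j hj
      have := stepok_spec hst i (by omega) j (by omega)
      rw [this, tlZ_eq]
      have e1 : ∀ k, ent M.tail i k = ent M (i + 1) k := by intro k; cases M <;> simp [ent]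
      have e2 : (M.headD []).getD (j + 1) 0 = ent M 0 (j + 1) := by cases M <;> simp [ent]
      rw [e1, e1, e2]
    have hQs : ∀ i ≤ n, ∀ j ≤ n, ent Q i j = ent Q j i := by
      intro i hi j hj
      have h1 := hS i (by omega) j (by omega)
      have h2 := hS j (by omega) i (by omega)
      rw [hs (j + 1) (by omega) (i + 1) (by omega), hs (j + 1) (by omega) 0 (by omega), hs 0 (by omega) (i + 1) (by omega)] at h2
      have : d * ent Q i j = d * ent Q j i := by rw [h1, h2]; ring
      exact mul_left_cancel₀ hd.ne' this
    obtain ⟨hp, hdt⟩ := ih (ent M 0 0) Q ha hb hQs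
    constructor
    · intro x hx
      have e := qf_step (n + 1) (ent M) (ent Q) d hs hS x
      have : 0 < ent M 0 0 * qf (n + 1 + 1) (ent M) x := by
        rw [e]
        by_cases hx1 : ∃ i ≤ n, x (i + 1) ≠ 0
        · have := hp (fun i => x (i + 1)) hx1
          positivity
        · push Not at hx1
          have hx0 : x 0 ≠ 0 := by
            obtain ⟨i, hi, hxi⟩ := hx
            cases i with
            | zero => exact hxi
            | succ i => exact absurd (hx1 i (by omega)) hxi
          have e0 : qf (n + 1) (ent Q) (fun i => x (i + 1)) = 0 := by
            unfold qf
            refine Finset.sum_eq_zero fun i hi => Finset.sum_eq_zero fun j hj => ?_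
            show x (i + 1) * x (j + 1) * _ = 0
            rw [hx1 i (by have := Finset.mem_range.mp hi; omega)]; simp
          rw [e0, Finset.sum_range_succ', Finset.sum_eq_zero (fun i hi => by
            rw [hx1 i (by have := Finset.mem_range.mp hi; omega), mul_zero])]
          have : ent M 0 0 * x 0 ≠ 0 := mul_ne_zero ha.ne' hx0
          simp only [zero_add, mul_zero, add_zero]
          positivity
      exact pos_of_mul_pos_right this ha.le
    · have := det_step (n + 1) (ent M) (ent Q) d hS
      rw [hdt] at this
      have h2 : ent M 0 0 ^ (n + 1) ≠ 0 := pow_ne_zero _ ha.ne'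
      apply mul_left_cancel₀ h2
      rw [this, pow_succ (ent M 0 0) n]; ring

end Nie

end ModDet

section ModRoots
open scoped BigOperators

namespace Nie

section Bil
variable (G : Matrix (Fin 24) (Fin 24) ℤ)

theorem B_add_left (x y z) : B G (x + y) z = B G x z + B G y z := by simp [B, add_dotProduct]
theorem B_add_right (x y z) : B G x (y + z) = B G x y + B G x z := by simp [B, Matrix.mulVec_add, dotProduct_add]
theorem B_smul_left (a : ℤ) (x y) : B G (a • x) y = a * B G x y := by
  simp only [B, smul_dotProduct, smul_eq_mul]
theorem B_smul_right (a : ℤ) (x y) : B G x (a • y) = a * B G x y := by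
  simp only [B, Matrix.mulVec_smul, dotProduct_smul, smul_eq_mul]
theorem B_neg_left (x y) : B G (-x) y = - B G x y := by simp [B]
theorem B_neg_right (x y) : B G x (-y) = - B G x y := by simp [B, Matrix.mulVec_neg]
theorem B_sub_left (x y z) : B G (x - y) z = B G x z - B G y z := by simp [B, sub_dotProduct]
theorem B_sub_right (x y z) : B G x (y - z) = B G x y - B G x z := by simp [B, Matrix.mulVec_sub, dotProduct_sub]
theorem B_zero_left (x) : B G 0 x = 0 := by simp [B]
theorem B_zero_right (x) : B G x 0 = 0 := by simp [B]
theorem B_sum_left {ι} (s : Finset ι) (f : ι → Fin 24 → ℤ) (y) : B G (∑ i ∈ s, f i) y = ∑ i ∈ s, B G (f i) y := by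
  classical
  induction s using Finset.induction_on with
  | empty => simp [B_zero_left]
  | insert a s ha ih => rw [Finset.sum_insert ha, Finset.sum_insert ha, B_add_left, ih]
theorem B_sum_right {ι} (s : Finset ι) (f : ι → Fin 24 → ℤ) (y) : B G y (∑ i ∈ s, f i) = ∑ i ∈ s, B G y (f i) := by
  classical
  induction s using Finset.induction_on with
  | empty => simp [B_zero_right]
  | insert a s ha ih => rw [Finset.sum_insert ha, Finset.sum_insert ha, B_add_right, ih]
end Bil

theorem EUL.comm {G} (h : EUL G) (x y) : B G x y = B G y x := by
  unfold B
  rw [Matrix.dotProduct_mulVec, ← Matrix.mulVec_transpose, h.symm, dotProduct_comm]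

theorem EUL.eq_zero {G} (h : EUL G) {x} (hx : B G x x ≤ 0) : x = 0 := by
  by_contra h0
  have := h.pos x h0
  omega

theorem EUL.norm_add {G} (h : EUL G) (x y) : B G (x + y) (x + y) = B G x x + 2 * B G x y + B G y y := by
  rw [B_add_left, B_add_right, B_add_right, h.comm y x]; ring

theorem EUL.norm_sub {G} (h : EUL G) (x y) : B G (x - y) (x - y) = B G x x - 2 * B G x y + B G y y := by
  rw [B_sub_left, B_sub_right, B_sub_right, h.comm y x]; ring

theorem EUL.root_ge {G} (h : EUL G) {x y} (hx : B G x x = 2) (hy : B G y y = 2) (hne : x + y ≠ 0) : -1 ≤ B G x y := by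
  have := h.pos _ hne
  rw [h.norm_add] at this; omega

theorem EUL.root_le {G} (h : EUL G) {x y} (hx : B G x x = 2) (hy : B G y y = 2) (hne : x ≠ y) : B G x y ≤ 1 := by
  have := h.pos _ (sub_ne_zero.mpr hne)
  rw [h.norm_sub] at this; omega

/-- root basis -/
structure RB (G : Matrix (Fin 24) (Fin 24) ℤ) {ι : Type} [Fintype ι] (v : ι → Fin 24 → ℤ) : Prop where
  diag : ∀ i, B G (v i) (v i) = 2
  off : ∀ i j, i ≠ j → B G (v i) (v j) ≤ 0
  li : ∀ x : ι → ℤ, ∑ i, x i • v i = 0 → x = 0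
  span : ∀ r, B G r r = 2 → ∃ x : ι → ℤ, r = ∑ i, x i • v i

section RBs
variable {G : Matrix (Fin 24) (Fin 24) ℤ} {ι : Type} [Fintype ι] [DecidableEq ι] {v : ι → Fin 24 → ℤ}

theorem RB.ext (hv : RB G v) {x y : ι → ℤ} (h : ∑ i, x i • v i = ∑ i, y i • v i) : x = y := by
  have := hv.li (x - y) (by simp only [Pi.sub_apply, sub_smul, Finset.sum_sub_distrib, h, sub_self])
  exact sub_eq_zero.mp this

theorem RB.sign (h : EUL G) (hv : RB G v) (x : ι → ℤ) (hx : B G (∑ i, x i • v i) (∑ i, x i • v i) = 2) :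
    (∀ i, 0 ≤ x i) ∨ (∀ i, x i ≤ 0) := by
  set p : Fin 24 → ℤ := ∑ i, (max (x i) 0) • v i with hp
  set q : Fin 24 → ℤ := ∑ i, (max (-x i) 0) • v i with hq
  have e : ∑ i, x i • v i = p - q := by
    rw [hp, hq, ← Finset.sum_sub_distrib]
    refine Finset.sum_congr rfl fun i _ => ?_
    rw [← sub_smul]; congr 1
    rcases le_total 0 (x i) with h0 | h0 <;> simp [h0]
  have hpq : B G p q ≤ 0 := by
    rw [hp, hq, B_sum_left]
    refine Finset.sum_nonpos fun i _ => ?_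
    rw [B_sum_right]
    refine Finset.sum_nonpos fun j _ => ?_
    rw [B_smul_left, B_smul_right]
    by_cases hij : i = j
    · subst hij
      rcases le_total 0 (x i) with h0 | h0 <;> simp [h0]
    · have := hv.off i j hij
      have h1 : 0 ≤ max (x i) 0 := le_max_right _ _
      have h2 : 0 ≤ max (-x j) 0 := le_max_right _ _
      have := mul_nonneg h1 h2
      nlinarith
  rw [e, h.norm_sub] at hx
  have hp0 : p = 0 ∨ q = 0 := by
    by_contra hcon
    push Not at hcon
    have h1 := h.pos p hcon.1
    have h2 := h.pos q hcon.2
    have h3 := h.even p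
    have h4 := h.even q
    omega
  rcases hp0 with h0 | h0
  · right
    have := hv.li _ h0
    intro i
    have := congrFun this i
    simpa using this
  · left
    have := hv.li _ h0
    intro i
    have := congrFun this i
    simpa using this

open Classical in
/-- positive roots -/
noncomputable def posR (G : Matrix (Fin 24) (Fin 24) ℤ) {ι : Type} [Fintype ι] (v : ι → Fin 24 → ℤ) : Finset (Fin 24 → ℤ) :=
  (shell G 1).filter (fun r => ∃ x : ι → ℤ, (∀ i, 0 ≤ x i) ∧ r = ∑ i, x i • v i)

theorem mem_posR (h : EUL G) (r) : r ∈ posR G v ↔ B G r r = 2 ∧ ∃ x : ι → ℤ, (∀ i, 0 ≤ x i) ∧ r = ∑ i, x i • v i := by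
  classical
  simp only [posR, Finset.mem_filter, h.mem_shell]; simp

theorem v_eq (v : ι → Fin 24 → ℤ) (i : ι) : v i = ∑ j, (Pi.single i (1:ℤ) : ι → ℤ) j • v j := by
  rw [Finset.sum_eq_single i] <;> simp +contextual [Pi.single_apply]

theorem refl_norm (h : EUL G) {a x} (ha : B G a a = 2) : B G (x - B G x a • a) (x - B G x a • a) = B G x x := by
  rw [h.norm_sub, B_smul_right, B_smul_right, B_smul_left, ha]; ring

theorem smul_single_sum (v : ι → Fin 24 → ℤ) (b : ℤ) (i : ι) :
    b • v i = ∑ k, (b • Pi.single i (1:ℤ) : ι → ℤ) k • v k := by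
  rw [Finset.sum_eq_single i]
  · simp only [Pi.smul_apply, Pi.single_eq_same, smul_eq_mul, mul_one]
  · intro k _ hk
    simp only [Pi.smul_apply, Pi.single_eq_of_ne hk, smul_zero, zero_smul]
  · intro hk; exact absurd (Finset.mem_univ _) hk

theorem sub_smul_single (v : ι → Fin 24 → ℤ) (x : ι → ℤ) (b : ℤ) (i : ι) :
    (∑ k, x k • v k) - b • v i = ∑ k, (x - b • Pi.single i (1:ℤ) : ι → ℤ) k • v k := by
  rw [smul_single_sum v b i, ← Finset.sum_sub_distrib]
  refine Finset.sum_congr rfl fun k _ => ?_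
  rw [Pi.sub_apply, sub_smul]

theorem refl_pos (h : EUL G) (hv : RB G v) (i : ι) (r) (hr : r ∈ posR G v) (hri : r ≠ v i) :
    r - B G r (v i) • v i ∈ posR G v ∧ r - B G r (v i) • v i ≠ v i := by
  rw [mem_posR h] at hr ⊢
  obtain ⟨hr, x, hx, hrr⟩ := hr
  have hj : ∃ j, j ≠ i ∧ 0 < x j := by
    by_contra hcon
    push Not at hcon
    have hx1 : x = x i • Pi.single i (1:ℤ) := by
      ext j
      by_cases hji : j = i
      · subst hji; simp
      · have := hcon j hji; have := hx j; simp [hji]; omega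
    have hr2 : r = x i • v i := by
      rw [hrr, smul_single_sum v (x i) i, ← hx1]
    rw [hr2, B_smul_left, B_smul_right, hv.diag] at hr
    have hxi := hx i
    have : x i * x i = 1 := by nlinarith
    have : x i = 1 := by nlinarith
    rw [this, one_smul] at hr2
    exact hri hr2
  obtain ⟨j, hji, hxj⟩ := hj
  have hn : B G (r - B G r (v i) • v i) (r - B G r (v i) • v i) = 2 := by rw [refl_norm h (hv.diag i), hr]
  generalize B G r (v i) = b at *
  have e : r - b • v i = ∑ k, (x - b • Pi.single i (1:ℤ) : ι → ℤ) k • v k := by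
    rw [hrr, sub_smul_single]
  have hxj' : (x - b • Pi.single i (1:ℤ) : ι → ℤ) j = x j := by simp [hji]
  generalize (x - b • Pi.single i (1:ℤ) : ι → ℤ) = y at *
  refine ⟨⟨hn, y, ?_, e⟩, ?_⟩
  · rcases hv.sign h y (by rw [← e, hn]) with h1 | h1
    · exact h1
    · have := h1 j; omega
  · intro heq
    rw [e, v_eq v i] at heq
    have := congrFun (hv.ext heq) j
    rw [hxj'] at this
    simp [hji] at this
    omega

theorem sum_pos_simple (h : EUL G) (hv : RB G v) (i : ι) : ∑ r ∈ posR G v, B G r (v i) = 2 := by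
  classical
  have hi : v i ∈ posR G v := by
    rw [mem_posR h]
    refine ⟨hv.diag i, Pi.single i 1, ?_, v_eq v i⟩
    intro j
    by_cases hj : j = i
    · subst hj; simp
    · simp [hj]
  rw [← Finset.add_sum_erase _ _ hi, hv.diag]
  have : ∑ r ∈ (posR G v).erase (v i), B G r (v i) = ∑ r ∈ (posR G v).erase (v i), -B G r (v i) := by
    refine Finset.sum_bij' (fun r _ => r - B G r (v i) • v i) (fun r _ => r - B G r (v i) • v i) ?_ ?_ ?_ ?_ ?_
    · intro r hr
      rw [Finset.mem_erase] at hr ⊢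
      exact (refl_pos h hv i r hr.2 hr.1).symm
    · intro r hr
      rw [Finset.mem_erase] at hr ⊢
      exact (refl_pos h hv i r hr.2 hr.1).symm
    · intro r _
      simp only [B_sub_left, B_smul_left, hv.diag, sub_smul]
      module
    · intro r _
      simp only [B_sub_left, B_smul_left, hv.diag, sub_smul]
      module
    · intro r _
      simp only [B_sub_left, B_smul_left, hv.diag]
      ring
  rw [Finset.sum_neg_distrib] at this
  omega

theorem RB.coxeter (h : EUL G) (hv : RB G v) (t : ι → ℤ) (ht : ∀ i, 0 ≤ t i)
    (hd : ∀ i, 0 ≤ B G (v i) (∑ j, t j • v j)) (h2 : B G (∑ j, t j • v j) (∑ j, t j • v j) = 2) :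
    ((shell G 1).card : ℤ) = 24 * (1 + ∑ i, t i) := by
  classical
  set θ := ∑ j, t j • v j with hθ
  have hV := h.venkov θ
  rw [h2] at hV
  have hθm : θ ∈ posR G v := (mem_posR h θ).mpr ⟨h2, t, ht, hθ⟩
  -- shell = pos ∪ neg
  have hdisj : Disjoint (posR G v) ((posR G v).image (fun r => -r)) := by
    rw [Finset.disjoint_left]
    intro r hr hr2
    rw [Finset.mem_image] at hr2
    obtain ⟨s, hs, rfl⟩ := hr2
    rw [mem_posR h] at hr hs
    obtain ⟨hs2, x, hx, rfl⟩ := hs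
    obtain ⟨_, y, hy, hxy⟩ := hr
    have : ∑ i, (-x) i • v i = ∑ i, y i • v i := by
      rw [← hxy]; simp only [Pi.neg_apply, neg_smul, Finset.sum_neg_distrib]
    have := hv.ext this
    have hx0 : x = 0 := by
      ext i
      have h1 := congrFun this i
      have h2 := hx i
      have h3 := hy i
      simp at h1 ⊢; omega
    simp [hx0, B_zero_left] at hs2
  have hun : shell G 1 = posR G v ∪ (posR G v).image (fun r => -r) := by
    ext r
    rw [Finset.mem_union, Finset.mem_image, h.mem_shell]
    constructor
    · intro hr
      have hr : B G r r = 2 := by simpa using hr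
      obtain ⟨x, rfl⟩ := hv.span r hr
      rcases hv.sign h x hr with h1 | h1
      · left; exact (mem_posR h _).mpr ⟨hr, x, h1, rfl⟩
      · right
        refine ⟨-∑ i, x i • v i, (mem_posR h _).mpr ⟨?_, -x, ?_, ?_⟩, by simp⟩
        · rw [B_neg_left, B_neg_right, hr]; rfl
        · intro i; have := h1 i; simp; omega
        · simp only [Pi.neg_apply, neg_smul, Finset.sum_neg_distrib]
    · rintro (h1 | ⟨s, hs, rfl⟩)
      · simpa using ((mem_posR h _).mp h1).1
      · rw [B_neg_left, B_neg_right]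
        simpa using ((mem_posR h _).mp hs).1
  have hsum : ∑ r ∈ shell G 1, (B G r θ)^2 = 2 * ∑ r ∈ posR G v, (B G r θ)^2 := by
    rw [hun, Finset.sum_union hdisj, Finset.sum_image (by intro a _ b _ hab; simpa using hab)]
    simp_rw [B_neg_left]
    simp; ring
  have hs2 : ∑ r ∈ posR G v, (B G r θ)^2 = ∑ r ∈ posR G v, B G r θ + 2 := by
    rw [← Finset.add_sum_erase _ _ hθm, ← Finset.add_sum_erase _ (fun r => B G r θ) hθm, h2]
    have : ∑ r ∈ (posR G v).erase θ, (B G r θ)^2 = ∑ r ∈ (posR G v).erase θ, B G r θ := by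
      refine Finset.sum_congr rfl fun r hr => ?_
      rw [Finset.mem_erase, mem_posR h] at hr
      obtain ⟨hne, hr2, x, hx, rfl⟩ := hr
      have hle := h.root_le hr2 h2 hne
      have hge : 0 ≤ B G (∑ i, x i • v i) θ := by
        rw [B_sum_left]
        refine Finset.sum_nonneg fun i _ => ?_
        rw [B_smul_left]
        exact mul_nonneg (hx i) (hd i)
      have : B G (∑ i, x i • v i) θ = 0 ∨ B G (∑ i, x i • v i) θ = 1 := by omega
      rcases this with h | h <;> rw [h] <;> norm_num
    rw [this]; ring
  have hs3 : ∑ r ∈ posR G v, B G r θ = 2 * ∑ i, t i := by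
    rw [hθ]
    simp_rw [B_sum_right, B_smul_right]
    rw [Finset.sum_comm]
    simp_rw [← Finset.mul_sum, sum_pos_simple h hv]
    rw [← Finset.sum_mul]; ring
  rw [hsum, hs2, hs3] at hV
  omega

end RBs
end Nie

end ModRoots

section ModSimple
open scoped BigOperators

namespace Nie

theorem exists_functional (R : Finset (Fin 24 → ℤ)) (h0 : (0 : Fin 24 → ℤ) ∉ R) :
    ∃ f : (Fin 24 → ℤ) →+ ℚ, ∀ r ∈ R, f r ≠ 0 := by
  obtain ⟨f, hf⟩ := Module.exists_dual_forall_apply_ne_zero (K := ℚ) (ι := {r // r ∈ R})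
    (fun r => (fun i => ((r.1 i : ℤ) : ℚ))) (by
      rintro ⟨r, hr⟩ h
      apply h0
      have : r = 0 := by
        ext i
        have := congrFun h i
        simpa using this
      rwa [this] at hr)
  refine ⟨⟨⟨fun r => f (fun i => (r i : ℚ)), ?_⟩, ?_⟩, fun r hr => hf ⟨r, hr⟩⟩
  · have : (fun i => (((0 : Fin 24 → ℤ) i : ℤ) : ℚ)) = 0 := by ext; simp
    rw [this, map_zero]
  · intro x y
    have : (fun i => (((x + y : Fin 24 → ℤ) i : ℤ) : ℚ)) = (fun i => ((x i : ℤ) : ℚ)) + fun i => ((y i : ℤ) : ℚ) := by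
      ext; simp
    change f _ = f _ + f _
    rw [← map_add, this]

section
variable {G : Matrix (Fin 24) (Fin 24) ℤ}

open Classical in
noncomputable def simpR (G : Matrix (Fin 24) (Fin 24) ℤ) (f : (Fin 24 → ℤ) →+ ℚ) : Finset (Fin 24 → ℤ) :=
  (shell G 1).filter (fun r => 0 < f r ∧ ¬ ∃ s t, B G s s = 2 ∧ B G t t = 2 ∧ 0 < f s ∧ 0 < f t ∧ r = s + t)

theorem mem_simpR (h : EUL G) (f) (r) : r ∈ simpR G f ↔ B G r r = 2 ∧ 0 < f r ∧
    ¬ ∃ s t, B G s s = 2 ∧ B G t t = 2 ∧ 0 < f s ∧ 0 < f t ∧ r = s + t := by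
  classical
  simp only [simpR, Finset.mem_filter, h.mem_shell]; simp

theorem simp_off (h : EUL G) {f} (hf : ∀ r, B G r r = 2 → f r ≠ 0) {r s} (hr : r ∈ simpR G f) (hs : s ∈ simpR G f)
    (hne : r ≠ s) : B G r s ≤ 0 := by
  rw [mem_simpR h] at hr hs
  obtain ⟨hr2, hr0, hr1⟩ := hr
  obtain ⟨hs2, hs0, hs1⟩ := hs
  by_contra hcon
  have h1 : B G r s = 1 := by
    have := h.root_le hr2 hs2 hne
    omega
  have hd : B G (r - s) (r - s) = 2 := by rw [h.norm_sub, hr2, hs2, h1]; norm_num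
  have hd' : B G (s - r) (s - r) = 2 := by rw [h.norm_sub, hr2, hs2, h.comm, h1]; norm_num
  rcases lt_or_gt_of_ne (hf _ hd) with hlt | hlt
  · apply hs1
    refine ⟨r, s - r, hr2, hd', hr0, ?_, by abel⟩
    rw [map_sub] at hlt ⊢; linarith
  · apply hr1
    exact ⟨s, r - s, hs2, hd, hs0, hlt, by abel⟩

theorem simp_span (h : EUL G) {f} (r) (hr : B G r r = 2) (hr0 : 0 < f r) :
    ∃ x : {r // r ∈ simpR G f} → ℤ, r = ∑ i, x i • i.1 := by
  classical
  by_contra hcon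
  let bad := (shell G 1).filter (fun r => 0 < f r ∧ ¬ ∃ x : {r // r ∈ simpR G f} → ℤ, r = ∑ i, x i • i.1)
  have hb : ∀ r, r ∈ bad ↔ B G r r = 2 ∧ 0 < f r ∧ ¬ ∃ x : {r // r ∈ simpR G f} → ℤ, r = ∑ i, x i • i.1 := by
    intro r
    simp only [bad, Finset.mem_filter, h.mem_shell]; simp
  obtain ⟨m, hm, hmin⟩ := Finset.exists_min_image bad f ⟨r, (hb r).mpr ⟨hr, hr0, hcon⟩⟩
  rw [hb] at hm
  obtain ⟨hm2, hm0, hm1⟩ := hm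
  by_cases hms : m ∈ simpR G f
  · exact hm1 ⟨Pi.single ⟨m, hms⟩ 1, v_eq (fun i : {r // r ∈ simpR G f} => i.1) ⟨m, hms⟩⟩
  · rw [mem_simpR h] at hms
    push Not at hms
    obtain ⟨s, t, hs2, ht2, hs0, ht0, hst⟩ := hms hm2 hm0
    have hs : s ∉ bad := fun hs => by
      have := hmin s hs
      rw [hst, map_add] at this; linarith
    have ht : t ∉ bad := fun hs => by
      have := hmin t hs
      rw [hst, map_add] at this; linarith
    rw [hb] at hs ht
    push Not at hs ht
    obtain ⟨x, hx⟩ := hs hs2 hs0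
    obtain ⟨y, hy⟩ := ht ht2 ht0
    apply hm1
    refine ⟨x + y, ?_⟩
    rw [hst, hx, hy, ← Finset.sum_add_distrib]
    exact Finset.sum_congr rfl fun i _ => by rw [Pi.add_apply, add_smul]

theorem simp_li (h : EUL G) {f} (hf : ∀ r, B G r r = 2 → f r ≠ 0) (x : {r // r ∈ simpR G f} → ℤ)
    (hx : ∑ i, x i • i.1 = 0) : x = 0 := by
  set p : Fin 24 → ℤ := ∑ i, (max (x i) 0) • i.1 with hp
  set q : Fin 24 → ℤ := ∑ i, (max (-x i) 0) • i.1 with hq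
  have e : ∑ i, x i • i.1 = p - q := by
    rw [hp, hq, ← Finset.sum_sub_distrib]
    refine Finset.sum_congr rfl fun i _ => ?_
    rw [← sub_smul]; congr 1
    rcases le_total 0 (x i) with h0 | h0 <;> simp [h0]
  have hpq : B G p q ≤ 0 := by
    rw [hp, hq, B_sum_left]
    refine Finset.sum_nonpos fun i _ => ?_
    rw [B_sum_right]
    refine Finset.sum_nonpos fun j _ => ?_
    rw [B_smul_left, B_smul_right]
    by_cases hij : i = j
    · subst hij
      rcases le_total 0 (x i) with h0 | h0 <;> simp [h0]
    · have := simp_off h hf i.2 j.2 (fun hh => hij (Subtype.ext hh))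
      have h1 : 0 ≤ max (x i) 0 := le_max_right _ _
      have h2 : 0 ≤ max (-x j) 0 := le_max_right _ _
      have := mul_nonneg h1 h2
      nlinarith
  rw [e] at hx
  have hpq' : p = q := sub_eq_zero.mp hx
  have hp0 : p = 0 := h.eq_zero (by rw [← hpq'] at hpq; exact hpq)
  have hq0 : q = 0 := by rw [← hpq', hp0]
  have key : ∀ y : {r // r ∈ simpR G f} → ℤ, (∀ i, 0 ≤ y i) → ∑ i, y i • i.1 = 0 → ∀ i, y i = 0 := by
    intro y hy hy0 i
    have := congrArg f hy0
    rw [map_sum, map_zero, Finset.sum_eq_zero_iff_of_nonneg] at this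
    · have := this i (Finset.mem_univ _)
      rw [map_zsmul, zsmul_eq_mul] at this
      have hi := ((mem_simpR h f _).mp i.2).2.1
      rcases mul_eq_zero.mp this with h1 | h1
      · exact_mod_cast h1
      · linarith
    · intro j _
      rw [map_zsmul, zsmul_eq_mul]
      have hi := ((mem_simpR h f _).mp j.2).2.1
      have := hy j
      positivity
  ext i
  have h1 := key _ (fun i => le_max_right _ _) hp0 i
  have h2 := key _ (fun i => le_max_right _ _) hq0 i
  simp at h1 h2 ⊢
  omega

theorem EUL.exists_RB (h : EUL G) (hN : (shell G 1).card ≠ 0) :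
    ∃ v : Fin 24 → Fin 24 → ℤ, RB G v := by
  classical
  obtain ⟨f, hf⟩ := exists_functional (shell G 1) (by rw [h.mem_shell, B_zero_left]; norm_num)
  have hf : ∀ r, B G r r = 2 → f r ≠ 0 := fun r hr => hf r (by rw [h.mem_shell, hr]; norm_num)
  have hsp : ∀ r, B G r r = 2 → ∃ x : {r // r ∈ simpR G f} → ℤ, r = ∑ i, x i • i.1 := by
    intro r hr
    rcases lt_or_gt_of_ne (hf r hr) with hlt | hlt
    · obtain ⟨x, hx⟩ := simp_span h (-r) (f := f) (by rw [B_neg_left, B_neg_right, hr]; rfl) (by rw [map_neg]; linarith)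
      refine ⟨-x, ?_⟩
      simp only [Pi.neg_apply, neg_smul, Finset.sum_neg_distrib, ← hx, neg_neg]
    · exact simp_span h r hr hlt
  have hc1 : Fintype.card {r // r ∈ simpR G f} ≤ 24 := by
    have := card_le_of_injective ℤ (α := {r // r ∈ simpR G f}) (β := Fin 24)
      { toFun := fun x => ∑ i, x i • i.1
        map_add' := by
          intro x y
          rw [← Finset.sum_add_distrib]
          exact Finset.sum_congr rfl fun i _ => by rw [Pi.add_apply, add_smul]
        map_smul' := by
          intro a x
          rw [Finset.smul_sum]
          exact Finset.sum_congr rfl fun i _ => by rw [Pi.smul_apply, smul_eq_mul, mul_smul, RingHom.id_apply] }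
      (by
        rw [injective_iff_map_eq_zero]
        intro x hx
        exact simp_li h hf x hx)
    simpa using this
  have hc2 : 24 ≤ Fintype.card {r // r ∈ simpR G f} := by
    have := card_le_of_injective ℤ (α := Fin 24) (β := {r // r ∈ simpR G f})
      { toFun := fun x i => B G i.1 x
        map_add' := by
          intro x y
          ext i
          rw [B_add_right]; rfl
        map_smul' := by
          intro a x
          ext i
          rw [B_smul_right]; rfl }
      (by
        rw [injective_iff_map_eq_zero]
        intro a ha
        have ha : ∀ i : {r // r ∈ simpR G f}, B G i.1 a = 0 := fun i => congrFun ha i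
        have hV := h.venkov a
        rw [Finset.sum_eq_zero] at hV
        · apply h.eq_zero
          have : ((shell G 1).card : ℤ) ≠ 0 := by exact_mod_cast hN
          rw [mul_zero] at hV
          rcases mul_eq_zero.mp hV.symm with h1 | h1
          · exact absurd h1 this
          · exact h1.le
        · intro r hr
          rw [h.mem_shell] at hr
          obtain ⟨x, hx⟩ := hsp r (by simpa using hr)
          rw [hx, B_sum_left, Finset.sum_eq_zero]
          · rfl
          · intro i _
            rw [B_smul_left, ha, mul_zero])
    simpa using this
  have e : Fin 24 ≃ {r // r ∈ simpR G f} := (Fintype.equivFinOfCardEq (le_antisymm hc1 hc2)).symm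
  refine ⟨fun i => (e i).1, ?_, ?_, ?_, ?_⟩
  · intro i; exact ((mem_simpR h f _).mp (e i).2).1
  · intro i j hij
    exact simp_off h hf (e i).2 (e j).2 (fun hh => hij (e.injective (Subtype.ext hh)))
  · intro x hx
    have := simp_li h hf (fun r => x (e.symm r)) (by
      rw [← hx, ← e.sum_comp]; simp only [Equiv.symm_apply_apply])
    ext i
    have := congrFun this (e i)
    simpa using this
  · intro r hr
    obtain ⟨x, hx⟩ := hsp r hr
    refine ⟨fun i => x (e i), ?_⟩
    rw [hx, ← e.sum_comp]

end
end Nie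

end ModSimple

section ModDynkin
open scoped BigOperators

namespace Nie

/-- adjacency in the diagram: path `1 - 2 - 3 - ...` together with node `0` attached to node `k` -/
def adjb (k i j : ℕ) : Bool :=
  (Nat.ble 1 i && Nat.beq j (i+1)) || (Nat.ble 1 j && Nat.beq i (j+1)) ||
  (Nat.beq i 0 && Nat.beq j k) || (Nat.beq j 0 && Nat.beq i k)

def cart (k i j : ℕ) : ℤ := bif Nat.beq i j then 2 else bif adjb k i j then -1 else 0

/-- valid diagrams: `k=1`: A_n, `k=2`: D_n, `k=3`: E_n -/
def validb (n k : ℕ) : Bool :=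
  (Nat.beq k 1 && Nat.ble 1 n) || (Nat.beq k 2 && Nat.ble 4 n) || (Nat.beq k 3 && Nat.ble 6 n && Nat.ble n 8)

/-- coefficients of the highest root -/
def mark (n k i : ℕ) : ℕ :=
  bif Nat.beq k 1 then 1
  else bif Nat.beq k 2 then (bif Nat.beq i 0 || Nat.beq i 1 || Nat.beq (i+1) n then 1 else 2)
  else bif Nat.beq n 6 then [2,1,2,3,2,1].getD i 1
  else bif Nat.beq n 7 then [2,2,3,4,3,2,1].getD i 1
  else [3,2,4,6,5,4,3,2].getD i 1

/-- Coxeter number -/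
def cox (n k : ℕ) : ℕ :=
  bif Nat.beq k 1 then n + 1
  else bif Nat.beq k 2 then 2*n - 2
  else bif Nat.beq n 6 then 12 else bif Nat.beq n 7 then 18 else 30

/-- sum over `i < n` by structural recursion -/
def sumb (n : ℕ) (f : ℕ → ℤ) : ℤ := Nat.rec 0 (fun i s => s + f i) n

theorem sumb_eq (n) (f : ℕ → ℤ) : sumb n f = ∑ i ∈ Finset.range n, f i := by
  induction n with
  | zero => rfl
  | succ n ih => rw [Finset.sum_range_succ, ← ih]; rfl

def allb (n : ℕ) (p : ℕ → Bool) : Bool := Nat.rec true (fun i s => s && p i) n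

theorem allb_iff {n} {p : ℕ → Bool} (h : allb n p = true) {i} (hi : i < n) : p i = true := by
  induction n with
  | zero => omega
  | succ n ih =>
    change (allb n p && p n) = true at h
    rw [Bool.and_eq_true] at h
    rcases Nat.lt_succ_iff_lt_or_eq.mp hi with h1 | h1
    · exact ih h.1 h1
    · subst h1; exact h.2

/-- the image of highest root under the Cartan matrix is ≥ 0, its norm is 2, marks are positive, and the sum is h-1 -/
def markCheck : Bool :=
  allb 25 fun n => allb 4 fun k => !validb n k ||
    ((allb n fun i => decide (0 ≤ sumb n fun j => cart k i j * mark n k j) && Nat.ble 1 (mark n k i)) &&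
     decide ((sumb n fun i => mark n k i * sumb n fun j => cart k i j * mark n k j) = 2) &&
     decide ((sumb n fun i => (mark n k i : ℤ)) + 1 = cox n k))

set_option maxRecDepth 100000 in
theorem markCheck_true : markCheck = true := by decide +kernel

def perm (n k s i : ℕ) : ℕ :=
  bif Nat.beq k 1 then
    (bif Nat.ble (2*s+1) n then (bif Nat.beq i 0 then n else i - 1) else n - i)
  else bif Nat.beq k 2 then
    (bif Nat.beq (s+1) n then i
     else bif Nat.beq n 4 then [1-s,3,2,s,4].getD i 0
     else bif Nat.beq i 0 then 1 - s else bif Nat.beq i 1 then n else bif Nat.beq i 2 then s else i - 1)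
  else (bif Nat.beq s 1 then [0,5,4,3,2,1,6].getD i 0 else i)

def newk (n k s : ℕ) : ℕ :=
  bif Nat.beq k 1 then (bif Nat.ble (2*s+1) n then s + 1 else n - s)
  else bif Nat.beq k 2 then (bif Nat.beq (s+1) n then 2 else bif Nat.beq n 4 then 2 else 3)
  else 3

/-- Gram matrix of the diagram extended by the node `n` attached to `s` -/
def ext (n k s i j : ℕ) : ℤ :=
  bif Nat.beq i n then (bif Nat.beq j n then 2 else bif Nat.beq j s then -1 else 0)
  else bif Nat.beq j n then (bif Nat.beq i s then -1 else 0)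
  else cart k i j

def nullv (k i : ℕ) : ℤ :=
  bif Nat.beq k 3 then [3,2,4,6,5,4,3,2,1].getD i 0
  else bif Nat.beq i 0 then 2 else
    [1,2,3,4,3,2,1].getD (i + 3 - k) 0 * (bif Nat.ble k (i+3) then 1 else 0)

/-- size of the sub-diagram to look at -/
def msz (n k : ℕ) : ℕ := bif validb n k then n else bif Nat.beq k 3 then 9 else k + 4

def nullCheck : Bool := allb 13 fun k => Nat.ble k 2 ||
  decide ((sumb (msz 40 k) fun i => nullv k i * sumb (msz 40 k) fun j => cart k i j * nullv k j) = 0) &&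
    decide (nullv k 0 ≠ 0)

theorem nullCheck_true : nullCheck = true := by decide +kernel

def growCheck2 : Bool :=
  allb 24 fun n => allb 4 fun k => !validb n k || (allb n fun s => !(Nat.beq (mark n k s) 1) ||
    (Nat.ble (msz (n+1) (newk n k s)) (n+1) && 
      (validb (n+1) (newk n k s) || (Nat.ble 3 (newk n k s) && Nat.ble (newk n k s) 12))))

theorem growCheck2_true : growCheck2 = true := by decide +kernel

def growCheck : Bool :=
  allb 24 fun n => allb 4 fun k => !validb n k || Nat.beq k 1 || (allb n fun s => !(Nat.beq (mark n k s) 1) ||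
    (allb (msz (n+1) (newk n k s)) fun i => Nat.ble (perm n k s i) n && allb (msz (n+1) (newk n k s)) fun j =>
        decide (ext n k s (perm n k s i) (perm n k s j) = cart (newk n k s) i j)))

set_option maxRecDepth 100000 in
theorem growCheck_true : growCheck = true := by decide +kernel

theorem beq_dec (a b : ℕ) : Nat.beq a b = decide (a = b) := by
  rw [Bool.eq_iff_iff, Nat.beq_eq, decide_eq_true_iff]
theorem ble_dec (a b : ℕ) : Nat.ble a b = decide (a ≤ b) := by
  rw [Bool.eq_iff_iff, Nat.ble_eq, decide_eq_true_iff]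

theorem cart_iff (k i j : ℕ) : cart k i j = if i = j then 2 else
    if ((1 ≤ i ∧ j = i+1) ∨ (1 ≤ j ∧ i = j+1) ∨ (i = 0 ∧ j = k) ∨ (j = 0 ∧ i = k)) then -1 else 0 := by
  simp only [cart, adjb, beq_dec, ble_dec, Bool.cond_eq_ite]
  simp only [decide_eq_true_eq, Bool.or_eq_true, Bool.and_eq_true, or_assoc]

theorem ext_iff (n k s i j : ℕ) : ext n k s i j = if i = n then (if j = n then 2 else if j = s then -1 else 0) else
    if j = n then (if i = s then -1 else 0) else cart k i j := by
  simp only [ext, beq_dec, Bool.cond_eq_ite, decide_eq_true_eq]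

theorem extA1 (n s i j) (hs : s < n) (hi : i ≤ n) (hj : j ≤ n) :
    ext n 1 s (if i = 0 then n else i - 1) (if j = 0 then n else j - 1) = cart (s+1) i j := by
  rw [ext_iff, cart_iff, cart_iff]
  repeat' split_ifs
  all_goals first | rfl | omega

theorem extA2 (n s i j) (hs : s < n) (hi : i ≤ n) (hj : j ≤ n) :
    ext n 1 s (n - i) (n - j) = cart (n-s) i j := by
  rw [ext_iff, cart_iff, cart_iff]
  repeat' split_ifs
  all_goals first | rfl | omega

theorem cart_comm (k i j : ℕ) : cart k i j = cart k j i := by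
  unfold cart adjb
  rw [show Nat.beq i j = Nat.beq j i by rw [Bool.eq_iff_iff, Nat.beq_eq, Nat.beq_eq, eq_comm]]
  congr 2
  cases (Nat.ble 1 i && Nat.beq j (i+1)) <;> cases (Nat.ble 1 j && Nat.beq i (j+1)) <;>
    cases (Nat.beq i 0 && Nat.beq j k) <;> cases (Nat.beq j 0 && Nat.beq i k) <;> rfl

section
variable {G : Matrix (Fin 24) (Fin 24) ℤ} {v : Fin 24 → Fin 24 → ℤ}

/-- a sub-diagram of the simple roots of shape `(n,k)` -/
structure IsComp (G : Matrix (Fin 24) (Fin 24) ℤ) (v : Fin 24 → Fin 24 → ℤ) (n k : ℕ) (w : ℕ → Fin 24) : Prop where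
  valid : validb n k = true
  inj : Set.InjOn w (Set.Iio n)
  gram : ∀ i < n, ∀ j < n, B G (v (w i)) (v (w j)) = cart k i j

def lcomb (v : Fin 24 → Fin 24 → ℤ) (w : ℕ → Fin 24) (n : ℕ) (z : ℕ → ℤ) : Fin 24 → ℤ :=
  ∑ i ∈ Finset.range n, z i • v (w i)

theorem lcomb_eq (v : Fin 24 → Fin 24 → ℤ) (w : ℕ → Fin 24) (n : ℕ) (z : ℕ → ℤ) :
    lcomb v w n z = ∑ j, (∑ i ∈ Finset.range n, if w i = j then z i else 0) • v j := by
  simp_rw [Finset.sum_smul]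
  rw [Finset.sum_comm]
  refine Finset.sum_congr rfl fun i _ => ?_
  rw [Finset.sum_eq_single (w i)]
  · rw [if_pos rfl]
  · intro j _ hj; rw [if_neg (Ne.symm hj), zero_smul]
  · intro h; exact absurd (Finset.mem_univ _) h

theorem lcomb_zero (hv : RB G v) {w : ℕ → Fin 24} {n : ℕ} (hw : Set.InjOn w (Set.Iio n)) {z : ℕ → ℤ}
    (h : lcomb v w n z = 0) {i} (hi : i < n) : z i = 0 := by
  rw [lcomb_eq] at h
  have := congrFun (hv.li _ h) (w i)
  simp only [Pi.zero_apply] at this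
  rw [Finset.sum_eq_single i] at this
  · rwa [if_pos rfl] at this
  · intro j hj hji
    rw [if_neg]
    intro hh
    exact hji (hw (Finset.mem_range.mp hj) hi hh)
  · intro hh; exact absurd (Finset.mem_range.mpr hi) hh

theorem lcomb_B (w : ℕ → Fin 24) (n : ℕ) (z : ℕ → ℤ) (x) :
    B G x (lcomb v w n z) = sumb n fun j => B G x (v (w j)) * z j := by
  rw [lcomb, sumb_eq, B_sum_right]
  refine Finset.sum_congr rfl fun i _ => ?_
  rw [B_smul_right, mul_comm]

theorem sumb_congr {n : ℕ} {f g : ℕ → ℤ} (h : ∀ i < n, f i = g i) : sumb n f = sumb n g := by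
  rw [sumb_eq, sumb_eq]
  exact Finset.sum_congr rfl fun i hi => h i (Finset.mem_range.mp hi)

theorem lcomb_norm {n k : ℕ} {w : ℕ → Fin 24}
    (hg : ∀ i < n, ∀ j < n, B G (v (w i)) (v (w j)) = cart k i j) (z : ℕ → ℤ) :
    B G (lcomb v w n z) (lcomb v w n z) = sumb n fun i => z i * sumb n fun j => cart k i j * z j := by
  rw [lcomb_B, sumb_eq]
  simp_rw [lcomb, B_sum_left, B_smul_left, Finset.sum_mul]
  rw [Finset.sum_comm, sumb_eq]
  refine Finset.sum_congr rfl fun i hi => ?_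
  rw [sumb_eq, Finset.mul_sum]
  refine Finset.sum_congr rfl fun j hj => ?_
  rw [hg i (Finset.mem_range.mp hi) j (Finset.mem_range.mp hj)]; ring

theorem markCheck_spec {n k : ℕ} (hn : n ≤ 24) (hv : validb n k = true) :
    (∀ i < n, 0 ≤ (sumb n fun j => cart k i j * mark n k j) ∧ 1 ≤ mark n k i) ∧
    ((sumb n fun i => mark n k i * sumb n fun j => cart k i j * mark n k j) = 2) ∧
    ((sumb n fun i => (mark n k i : ℤ)) + 1 = cox n k) := by
  have hk : k < 4 := by
    unfold validb at hv
    simp at hv; omega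
  have h := allb_iff (allb_iff markCheck_true (i := n) (by omega)) hk
  rw [hv] at h
  simp only [Bool.not_true, Bool.false_or, Bool.and_eq_true, decide_eq_true_eq] at h
  refine ⟨fun i hi => ?_, h.1.2, h.2⟩
  have := allb_iff h.1.1 hi
  simp only [Bool.and_eq_true, decide_eq_true_eq, Nat.ble_eq] at this
  exact this

theorem growCheck_spec {n k s : ℕ} (hn : n < 24) (hv : validb n k = true) (hs : s < n) (hm : mark n k s = 1) :
    ∃ m ≤ n + 1, (∀ i < m, perm n k s i ≤ n ∧ ∀ j < m, ext n k s (perm n k s i) (perm n k s j) = cart (newk n k s) i j) ∧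
      ((m = n + 1 ∧ validb (n+1) (newk n k s) = true) ∨ (0 < m ∧ nullv (newk n k s) 0 ≠ 0 ∧
        (sumb m fun i => nullv (newk n k s) i * sumb m fun j => cart (newk n k s) i j * nullv (newk n k s) j) = 0)) := by
  have hk : k < 4 := by
    unfold validb at hv
    simp at hv; omega
  have h2 := allb_iff (allb_iff growCheck2_true (i := n) (by omega)) hk
  rw [hv] at h2
  simp only [Bool.not_true, Bool.false_or] at h2
  have h2 := allb_iff h2 hs
  rw [hm] at h2
  simp only [Bool.and_eq_true, Bool.or_eq_true, Nat.ble_eq] at h2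
  have h2 := h2.resolve_left (by simp)
  refine ⟨msz (n+1) (newk n k s), h2.1, ?_, ?_⟩
  · by_cases hk1 : k = 1
    · subst hk1
      by_cases hs2 : 2 * s + 1 ≤ n
      · have hp : ∀ i, perm n 1 s i = if i = 0 then n else i - 1 := by
          intro i
          simp only [perm, beq_dec, ble_dec, Bool.cond_eq_ite, decide_eq_true_eq, if_true, if_pos hs2]
        have hnk : newk n 1 s = s + 1 := by
          simp only [newk, beq_dec, ble_dec, Bool.cond_eq_ite, decide_eq_true_eq, if_true, if_pos hs2]
        intro i hi
        rw [hp i]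
        refine ⟨by split_ifs <;> omega, fun j hj => ?_⟩
        rw [hp j, extA1 n s i j hs (by omega) (by omega), hnk]
      · have hp : ∀ i, perm n 1 s i = n - i := by
          intro i
          simp only [perm, beq_dec, ble_dec, Bool.cond_eq_ite, decide_eq_true_eq, if_true, if_neg hs2]
        have hnk : newk n 1 s = n - s := by
          simp only [newk, beq_dec, ble_dec, Bool.cond_eq_ite, decide_eq_true_eq, if_true, if_neg hs2]
        intro i hi
        rw [hp i]
        refine ⟨by omega, fun j hj => ?_⟩
        rw [hp j, extA2 n s i j hs (by omega) (by omega), hnk]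
    · have h := allb_iff (allb_iff growCheck_true (i := n) (by omega)) hk
      have hk1' : Nat.beq k 1 = false := by rw [beq_dec]; simpa using hk1
      rw [hv, hk1'] at h
      simp only [Bool.not_true, Bool.false_or] at h
      have h := allb_iff h hs
      rw [hm] at h
      have h : (allb (msz (n+1) (newk n k s)) fun i => Nat.ble (perm n k s i) n && allb (msz (n+1) (newk n k s)) fun j =>
        decide (ext n k s (perm n k s i) (perm n k s j) = cart (newk n k s) i j)) = true := by simpa using h
      intro i hi
      have := allb_iff h hi
      simp only [Bool.and_eq_true, Nat.ble_eq] at this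
      refine ⟨this.1, fun j hj => ?_⟩
      have := allb_iff this.2 hj
      simpa using this
  · cases hb : validb (n+1) (newk n k s) with
    | true => left; simp [msz, hb]
    | false =>
      right
      rw [hb] at h2
      have h3 := h2.2.resolve_left (by simp)
      have h4 := allb_iff nullCheck_true (show newk n k s < 13 by omega)
      have h5 : Nat.ble (newk n k s) 2 = false := by rw [ble_dec]; simp; omega
      rw [h5] at h4
      simp only [Bool.false_or, Bool.and_eq_true, decide_eq_true_eq] at h4
      have hms : msz 40 (newk n k s) = msz (n+1) (newk n k s) := by
        have : validb 40 (newk n k s) = false := by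
          simp only [validb, beq_dec, ble_dec]
          simp; omega
        simp [msz, this, hb]
      rw [hms] at h4
      refine ⟨?_, h4.2, h4.1⟩
      simp only [msz, hb, cond_false, beq_dec, Bool.cond_eq_ite]
      split_ifs <;> omega

theorem IsComp.le {n k w} (hc : IsComp G v n k w) : n ≤ 24 := by
  have := Finset.card_le_card_of_injOn (s := Finset.range n) (t := (Finset.univ : Finset (Fin 24))) w
    (fun _ _ => Finset.mem_coe.mpr (Finset.mem_univ _)) (by
      intro i hi j hj hij
      exact hc.inj (Finset.mem_range.mp (Finset.mem_coe.mp hi)) (Finset.mem_range.mp (Finset.mem_coe.mp hj)) hij)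
  simpa using this

theorem cart_eq_two {k i j} (h : cart k i j = 2) : i = j := by
  unfold cart at h
  by_contra hne
  have : Nat.beq i j = false := by
    rw [Bool.eq_false_iff]; intro hh; exact hne (Nat.eq_of_beq_eq_true hh)
  rw [this] at h
  cases hb : adjb k i j <;> rw [hb] at h <;> simp at h

theorem IsComp.grow (h : EUL G) (hv : RB G v) {n k w} (hc : IsComp G v n k w) (u : Fin 24)
    (hu : ∀ i < n, w i ≠ u) (s : ℕ) (hs : s < n) (hadj : B G (v u) (v (w s)) ≠ 0) :
    ∃ k' w', IsComp G v (n+1) k' w' ∧ ∀ i < n + 1, w' i = u ∨ ∃ j < n, w' i = w j := by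
  have hM := markCheck_spec hc.le hc.valid
  have hna : ∀ i < n, B G (v u) (v (w i)) ≤ 0 := fun i hi => hv.off _ _ (hu i hi).symm
  -- w' for extended list
  let w1 : ℕ → Fin 24 := fun i => if i = n then u else w i
  have hw1 : Set.InjOn w1 (Set.Iio (n+1)) := by
    intro i hi j hj hij
    have hi : i < n + 1 := hi
    have hj : j < n + 1 := hj
    simp only [w1] at hij
    by_cases h1 : i = n <;> by_cases h2 : j = n
    · omega
    · rw [if_pos h1, if_neg h2] at hij; exact absurd hij.symm (hu j (by omega))
    · rw [if_pos h2, if_neg h1] at hij; exact absurd hij (hu i (by omega))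
    · rw [if_neg h1, if_neg h2] at hij
      exact hc.inj (show i < n by omega) (show j < n by omega) hij
  have hn : n < 24 := by
    have := Finset.card_le_card_of_injOn (s := Finset.range (n+1)) (t := (Finset.univ : Finset (Fin 24))) w1
      (fun _ _ => Finset.mem_coe.mpr (Finset.mem_univ _)) (by
        intro i hi j hj hij
        exact hw1 (Finset.mem_range.mp (Finset.mem_coe.mp hi)) (Finset.mem_range.mp (Finset.mem_coe.mp hj)) hij)
    simp at this; omega
  -- highest root
  have hθ := lcomb_norm hc.gram (fun i => (mark n k i : ℤ))
  rw [hM.2.1] at hθ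
  have hne : v u + lcomb v w n (fun i => (mark n k i : ℤ)) ≠ 0 := by
    intro h0
    have e : lcomb v w1 (n+1) (fun i => if i = n then 1 else (mark n k i : ℤ)) = 0 := by
      rw [← h0, lcomb, Finset.sum_range_succ, add_comm, lcomb]
      congr 1
      · simp [w1]
      · refine Finset.sum_congr rfl fun i hi => ?_
        have := Finset.mem_range.mp hi
        simp only [w1]
        rw [if_neg (by omega), if_neg (by omega)]
    have := lcomb_zero hv hw1 e (i := n) (by omega)
    simp at this
  have hge := h.root_ge (hv.diag u) hθ hne
  rw [lcomb_B, sumb_eq] at hge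
  have hle : ∀ i ∈ Finset.range n, B G (v u) (v (w i)) * (mark n k i : ℤ) ≤ 0 := by
    intro i hi
    have := hna i (Finset.mem_range.mp hi)
    have h2 : (0:ℤ) ≤ mark n k i := by positivity
    nlinarith
  have hneg : ∑ i ∈ Finset.range n, -(B G (v u) (v (w i)) * (mark n k i : ℤ)) ≤ 1 := by
    rw [Finset.sum_neg_distrib]; omega
  have hall : ∀ i < n, B G (v u) (v (w i)) = if i = s then -1 else 0 := by
    intro i hi
    have hs' := hna s hs
    have hms := (hM.1 s hs).2
    have hmi := (hM.1 i hi).2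
    have h1 := Finset.sum_le_sum_of_subset_of_nonneg
      (f := fun i => -(B G (v u) (v (w i)) * (mark n k i : ℤ))) (s := {i, s}) (t := Finset.range n) (by
        intro a ha; simp at ha; rw [Finset.mem_range]; omega) (fun a ha _ => by have := hle a ha; omega)
    by_cases his : i = s
    · subst his
      rw [if_pos rfl]
      simp at h1
      zify at hmi
      have : B G (v u) (v (w i)) * 1 ≥ B G (v u) (v (w i)) * (mark n k i : ℤ) := by nlinarith
      omega
    · rw [if_neg his]
      rw [Finset.sum_pair his] at h1
      have hi' := hna i hi
      zify at hmi hms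
      have e1 : B G (v u) (v (w i)) * 1 ≥ B G (v u) (v (w i)) * (mark n k i : ℤ) := by nlinarith
      have e2 : B G (v u) (v (w s)) * 1 ≥ B G (v u) (v (w s)) * (mark n k s : ℤ) := by nlinarith
      omega
  have hmark : mark n k s = 1 := by
    have h1 := Finset.sum_le_sum_of_subset_of_nonneg
      (f := fun i => -(B G (v u) (v (w i)) * (mark n k i : ℤ))) (s := {s}) (t := Finset.range n) (by
        intro a ha; simp at ha; rw [Finset.mem_range]; omega) (fun a ha _ => by have := hle a ha; omega)
    rw [Finset.sum_singleton, hall s hs, if_pos rfl] at h1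
    have := (hM.1 s hs).2
    omega
  obtain ⟨m, hmn, hg1, hg2⟩ := growCheck_spec hn hc.valid hs hmark
  have hext : ∀ i ≤ n, ∀ j ≤ n, B G (v (w1 i)) (v (w1 j)) = ext n k s i j := by
    intro i hi j hj
    have hb : ∀ a b : ℕ, Nat.beq a b = decide (a = b) := by
      intro a b; rw [Bool.eq_iff_iff, Nat.beq_eq, decide_eq_true_iff]
    simp only [w1, ext, hb]
    by_cases h1 : i = n <;> by_cases h2 : j = n
    · simp [h1, h2, hv.diag]
    · rw [if_pos h1, if_neg h2, hall j (by omega)]; simp [h1, h2]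
    · rw [if_pos h2, if_neg h1, h.comm, hall i (by omega)]; simp [h1, h2]
    · rw [if_neg h1, if_neg h2, hc.gram i (by omega) j (by omega)]; simp [h1, h2]
  let w2 : ℕ → Fin 24 := fun i => w1 (perm n k s i)
  have hgr : ∀ i < m, ∀ j < m, B G (v (w2 i)) (v (w2 j)) = cart (newk n k s) i j := by
    intro i hi j hj
    rw [← (hg1 i hi).2 j hj]
    exact hext _ (hg1 i hi).1 _ (hg1 j hj).1
  have hinj : Set.InjOn w2 (Set.Iio m) := by
    intro i hi j hj hij
    have := hgr i hi j hj
    rw [hij, hv.diag] at this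
    exact cart_eq_two this.symm
  rcases hg2 with ⟨rfl, hg2⟩ | ⟨hm0, hz, hnorm⟩
  · refine ⟨newk n k s, w2, ⟨hg2, hinj, hgr⟩, ?_⟩
    intro i hi
    simp only [w2, w1]
    by_cases h1 : perm n k s i = n
    · left; rw [if_pos h1]
    · right; rw [if_neg h1]
      have := (hg1 i hi).1
      exact ⟨_, by omega, rfl⟩
  · exfalso
    have := lcomb_norm hgr (nullv (newk n k s))
    rw [hnorm] at this
    exact hz (lcomb_zero hv hinj (h.eq_zero this.le) (i := 0) hm0)

end
end Nie

end ModDynkin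

section ModComps
open scoped BigOperators

namespace Nie

section
variable {G : Matrix (Fin 24) (Fin 24) ℤ} {v : Fin 24 → Fin 24 → ℤ}

abbrev Cmp := ℕ × ℕ × (ℕ → Fin 24)

def cimg (c : Cmp) : Finset (Fin 24) := (Finset.range c.1).image c.2.2

theorem mem_cimg {c : Cmp} {u} : u ∈ cimg c ↔ ∃ i < c.1, c.2.2 i = u := by
  simp [cimg]

/-- a component, full in `A` -/
def Full (G : Matrix (Fin 24) (Fin 24) ℤ) (v : Fin 24 → Fin 24 → ℤ) (A : Finset (Fin 24)) (c : Cmp) : Prop :=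
  IsComp G v c.1 c.2.1 c.2.2 ∧ cimg c ⊆ A ∧ ∀ u ∈ A, u ∉ cimg c → ∀ i < c.1, B G (v u) (v (c.2.2 i)) = 0

theorem exists_full (h : EUL G) (hv : RB G v) (A : Finset (Fin 24)) (hA : A.Nonempty) : ∃ c : Cmp, Full G v A c := by
  classical
  obtain ⟨a, ha⟩ := hA
  let P : ℕ → Prop := fun n => ∃ k w, IsComp G v n k w ∧ cimg (n, k, w) ⊆ A
  have h1 : P 1 := by
    refine ⟨1, fun _ => a, ⟨rfl, ?_, ?_⟩, ?_⟩
    · intro i hi j hj _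
      have hi : i < 1 := hi
      have hj : j < 1 := hj
      omega
    · intro i hi j hj
      obtain rfl : i = 0 := by omega
      obtain rfl : j = 0 := by omega
      exact hv.diag a
    · intro u hu
      rw [mem_cimg] at hu
      obtain ⟨_, _, rfl⟩ := hu
      exact ha
  have hm : P (Nat.findGreatest P 24) := Nat.findGreatest_spec (by omega) h1
  obtain ⟨k, w, hc, hcA⟩ := hm
  refine ⟨(Nat.findGreatest P 24, k, w), hc, hcA, ?_⟩
  intro u hu hun i hi
  by_contra hne
  obtain ⟨k', w', hc', hw'⟩ := hc.grow h hv u (fun i hi hh => hun (mem_cimg.mpr ⟨i, hi, hh⟩)) i hi hne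
  have : P (Nat.findGreatest P 24 + 1) := by
    refine ⟨k', w', hc', ?_⟩
    intro x hx
    rw [mem_cimg] at hx
    obtain ⟨j, hj, rfl⟩ := hx
    rcases hw' j hj with h2 | ⟨l, hl, h2⟩
    · simp only [h2]; exact hu
    · simp only [h2]
      exact hcA (mem_cimg.mpr ⟨l, hl, rfl⟩)
  have := Nat.le_findGreatest (hc'.le) this
  omega

theorem exists_decomp (h : EUL G) (hv : RB G v) : ∀ (m : ℕ) (A : Finset (Fin 24)), A.card = m → ∃ l : List Cmp,
    (∀ c ∈ l, Full G v A c) ∧ l.Pairwise (fun c d => Disjoint (cimg c) (cimg d)) ∧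
    (∀ u ∈ A, ∃ c ∈ l, u ∈ cimg c) ∧ (l.map (fun c => c.1)).sum = A.card := by
  intro m
  induction m using Nat.strong_induction_on with
  | _ m ih =>
    intro A hA
    rcases A.eq_empty_or_nonempty with rfl | hne
    · exact ⟨[], by simp, by simp, by simp, by simp⟩
    · obtain ⟨c, hc⟩ := exists_full h hv A hne
      have hcard : (cimg c).card = c.1 := by
        rw [cimg, Finset.card_image_of_injOn, Finset.card_range]
        intro i hi j hj hij
        exact hc.1.inj (Finset.mem_range.mp (Finset.mem_coe.mp hi)) (Finset.mem_range.mp (Finset.mem_coe.mp hj)) hij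
      have hpos : 0 < c.1 := by
        have := hc.1.valid
        simp only [validb, beq_dec, ble_dec] at this
        simp at this; omega
      have hsd : (A \ cimg c).card = A.card - c.1 := by
        rw [Finset.card_sdiff_of_subset hc.2.1, hcard]
      have hle := Finset.card_le_card hc.2.1
      obtain ⟨l, hl1, hl2, hl3, hl4⟩ := ih (A \ cimg c).card (by omega) (A \ cimg c) rfl
      refine ⟨c :: l, ?_, ?_, ?_, ?_⟩
      · intro d hd
        rcases List.mem_cons.mp hd with rfl | hd
        · exact hc
        · obtain ⟨hd1, hd2, hd3⟩ := hl1 d hd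
          refine ⟨hd1, hd2.trans Finset.sdiff_subset, ?_⟩
          intro u hu hud i hi
          by_cases huc : u ∈ cimg c
          · obtain ⟨j, hj, rfl⟩ := mem_cimg.mp huc
            have hx := hd2 (mem_cimg.mpr ⟨i, hi, rfl⟩)
            rw [Finset.mem_sdiff] at hx
            rw [h.comm]
            exact hc.2.2 _ hx.1 hx.2 j hj
          · exact hd3 u (Finset.mem_sdiff.mpr ⟨hu, huc⟩) hud i hi
      · rw [List.pairwise_cons]
        refine ⟨fun d hd => ?_, hl2⟩
        exact Finset.disjoint_of_subset_right (hl1 d hd).2.1 Finset.disjoint_sdiff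
      · intro u hu
        by_cases huc : u ∈ cimg c
        · exact ⟨c, List.mem_cons_self, huc⟩
        · obtain ⟨d, hd, hud⟩ := hl3 u (Finset.mem_sdiff.mpr ⟨hu, huc⟩)
          exact ⟨d, List.mem_cons_of_mem _ hd, hud⟩
      · rw [List.map_cons, List.sum_cons, hl4, hsd, hcard] at *
        omega

theorem Full.cox (h : EUL G) (hv : RB G v) {c : Cmp} (hc : Full G v Finset.univ c) :
    (shell G 1).card = 24 * cox c.1 c.2.1 := by
  obtain ⟨n, k, w⟩ := c
  obtain ⟨hc1, _, hc3⟩ := hc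
  simp only at hc1 hc3 ⊢
  have hM := markCheck_spec hc1.le hc1.valid
  have e := lcomb_eq v w n (fun i => (mark n k i : ℤ))
  have hn := lcomb_norm hc1.gram (fun i => (mark n k i : ℤ))
  rw [hM.2.1] at hn
  rw [e] at hn
  have := hv.coxeter h _ ?_ ?_ hn
  · rw [Finset.sum_comm] at this
    have e2 : ∑ y ∈ Finset.range n, ∑ x, (if w y = x then (mark n k y : ℤ) else 0) = sumb n fun i => (mark n k i : ℤ) := by
      rw [sumb_eq]
      refine Finset.sum_congr rfl fun i _ => ?_
      simp
    rw [e2] at this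
    have h3 := hM.2.2
    zify
    rw [this, ← h3]; ring
  · intro i
    refine Finset.sum_nonneg fun j _ => ?_
    split_ifs <;> simp
  · intro u
    rw [← e, lcomb_B]
    by_cases hu : u ∈ cimg (n, k, w)
    · obtain ⟨i, hi, rfl⟩ := mem_cimg.mp hu
      rw [sumb_congr (g := fun j => cart k i j * (mark n k j : ℤ))]
      · exact (hM.1 i hi).1
      · intro j hj
        rw [← hc1.gram i hi j hj]
    · rw [sumb_eq, Finset.sum_eq_zero]
      intro j hj
      rw [hc3 u (Finset.mem_univ _) hu j (Finset.mem_range.mp hj), zero_mul]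

end

/-- the 23 types -/
def types : List (List (ℕ × ℕ)) :=
  [List.replicate 24 (1,1), List.replicate 12 (2,1), List.replicate 8 (3,1), List.replicate 6 (4,1),
   [(5,1),(5,1),(5,1),(5,1),(4,2)], List.replicate 4 (6,1), [(7,1),(7,1),(5,2),(5,2)], List.replicate 3 (8,1),
   [(9,1),(9,1),(6,2)], [(11,1),(7,2),(6,3)], [(12,1),(12,1)], [(15,1),(9,2)], [(17,1),(7,3)], [(24,1)],
   List.replicate 6 (4,2), List.replicate 4 (6,2), List.replicate 3 (8,2), [(12,2),(12,2)], [(16,2),(8,3)], [(24,2)],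
   List.replicate 4 (6,3), [(10,2),(7,3),(7,3)], List.replicate 3 (8,3)]

def nE (h : ℕ) : ℕ := bif Nat.beq h 12 then 6 else bif Nat.beq h 18 then 7 else bif Nat.beq h 30 then 8 else 9

def tripl (h a d e : ℕ) : List (ℕ × ℕ) :=
  List.replicate a (h-1,1) ++ (List.replicate d (h/2+1,2) ++ List.replicate e (nE h,3))

def typeCheck : Bool := allb 47 fun h => allb 25 fun a => allb 7 fun d => allb 5 fun e =>
  Nat.ble h 1 || !(Nat.beq (a*(h-1)+d*(h/2+1)+e*nE h) 24) || (!(Nat.beq d 0) && !(Nat.beq (h % 2) 0 && Nat.ble 6 h)) ||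
    (!(Nat.beq e 0) && Nat.ble 9 (nE h)) || types.contains (tripl h a d e)

set_option maxRecDepth 100000 in
theorem typeCheck_true : typeCheck = true := by decide +kernel

end Nie

end ModComps

section ModFrame
open scoped BigOperators

namespace Nie

theorem type_tripl (h : ℕ) : ∀ T : List (ℕ × ℕ), (∀ t ∈ T, validb t.1 t.2 = true ∧ cox t.1 t.2 = h) →
    ∃ a d e, T.Perm (tripl h a d e) ∧ (d ≠ 0 → h % 2 = 0 ∧ 6 ≤ h) ∧ (e ≠ 0 → nE h ≤ 8) ∧
      (T.map Prod.fst).sum = a * (h-1) + d * (h/2+1) + e * nE h ∧ (T ≠ [] → 2 ≤ h) := by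
  intro T
  induction T with
  | nil => intro _; exact ⟨0, 0, 0, by simp [tripl], by simp, by simp, by simp, by simp⟩
  | cons t T ih =>
    intro hT
    obtain ⟨a, d, e, hp, hd, he, hs, _⟩ := ih (fun t ht => hT t (List.mem_cons_of_mem _ ht))
    obtain ⟨hv, hc⟩ := hT t List.mem_cons_self
    obtain ⟨n, k⟩ := t
    simp only at hv hc
    have hk : (k = 1 ∧ 1 ≤ n) ∨ (k = 2 ∧ 4 ≤ n) ∨ (k = 3 ∧ (n = 6 ∨ n = 7 ∨ n = 8)) := by
      simp only [validb, beq_dec, ble_dec] at hv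
      simp at hv; omega
    rcases hk with ⟨rfl, hn⟩ | ⟨rfl, hn⟩ | ⟨rfl, hn⟩
    · have hh : h = n + 1 := by rw [← hc]; rfl
      subst hh
      refine ⟨a + 1, d, e, ?_, hd, he, ?_, fun _ => by omega⟩
      · simp only [tripl, List.replicate_succ, List.cons_append] at hp ⊢
        exact List.Perm.cons _ hp
      · rw [List.map_cons, List.sum_cons, hs]; simp; ring
    · have hh : h = 2 * n - 2 := by rw [← hc]; rfl
      have h2 : n = h / 2 + 1 := by omega
      refine ⟨a, d + 1, e, ?_, fun _ => by omega, he, ?_, fun _ => by omega⟩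
      · simp only [tripl, List.replicate_succ, List.cons_append] at hp ⊢
        rw [← h2] at hp ⊢
        exact (List.Perm.cons _ hp).trans List.perm_middle.symm
      · rw [List.map_cons, List.sum_cons, hs, ← h2]; ring
    · have h2 : nE h = n ∧ 2 ≤ h := by
        rcases hn with rfl | rfl | rfl <;> rw [← hc] <;> decide
      refine ⟨a, d, e + 1, ?_, hd, fun _ => by omega, ?_, fun _ => h2.2⟩
      · simp only [tripl, List.replicate_succ] at hp ⊢
        rw [h2.1] at hp ⊢
        refine (List.Perm.cons _ hp).trans ?_
        rw [← List.append_assoc, ← List.append_assoc]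
        exact List.perm_middle.symm
      · rw [List.map_cons, List.sum_cons, hs, h2.1]; ring

theorem type_perm (h : ℕ) (hh : h ≤ 46) (T : List (ℕ × ℕ)) (hT : ∀ t ∈ T, validb t.1 t.2 = true ∧ cox t.1 t.2 = h)
    (hs : (T.map Prod.fst).sum = 24) : ∃ T' ∈ types, T.Perm T' := by
  obtain ⟨a, d, e, hp, hd, he, hs2, hne⟩ := type_tripl h T hT
  have h2 : 2 ≤ h := hne (by rintro rfl; simp at hs)
  rw [hs] at hs2
  have ha : a < 25 := by
    have : a * 1 ≤ a * (h-1) := Nat.mul_le_mul_left _ (by omega)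
    omega
  have hd' : d < 7 := by
    by_contra hcon
    have := hd (by omega)
    have : d * 4 ≤ d * (h/2+1) := Nat.mul_le_mul_left _ (by omega)
    omega
  have he' : e < 5 := by
    have h6 : 6 ≤ nE h := by
      simp only [nE, Bool.cond_eq_ite]; split_ifs <;> omega
    have : e * 6 ≤ e * nE h := Nat.mul_le_mul_left _ h6
    omega
  have := allb_iff (allb_iff (allb_iff (allb_iff typeCheck_true (i := h) (by omega)) ha) hd') he'
  refine ⟨_, ?_, hp⟩
  simp only [ble_dec, beq_dec] at this
  rw [← hs2] at this
  simp at this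
  rcases this with (((h3 | h3) | h3)) | h3
  · omega
  · have := hd h3.1; have := h3.2; omega
  · have := he h3.1; omega
  · exact h3

def ty (T : List (ℕ × ℕ)) (c : ℕ) : ℕ × ℕ := T.getD c (0,0)

structure Frame0 (G : Matrix (Fin 24) (Fin 24) ℤ) (T : List (ℕ × ℕ)) (v : ℕ → ℕ → Fin 24 → ℤ) : Prop where
  gram : ∀ c i c' j, i < (ty T c).1 → j < (ty T c').1 → B G (v c i) (v c' j) = if c = c' then cart (ty T c).2 i j else 0
  sep : ∀ x, (∀ c i, i < (ty T c).1 → B G x (v c i) = 0) → x = 0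

structure Frame (G : Matrix (Fin 24) (Fin 24) ℤ) (T : List (ℕ × ℕ)) (v : ℕ → ℕ → Fin 24 → ℤ) : Prop extends Frame0 G T v where
  span : ∀ r, B G r r = 2 → ∃ z : ℕ → ℕ → ℤ, r = ∑ c ∈ Finset.range T.length, ∑ i ∈ Finset.range (ty T c).1, z c i • v c i

theorem exists_frame {G} (h : EUL G) (hN : (shell G 1).card ≠ 0) : ∃ T ∈ types, ∃ v, Frame G T v := by
  classical
  obtain ⟨v, hv⟩ := h.exists_RB hN
  obtain ⟨l, hl1, hl2, hl3, hl4⟩ := exists_decomp h hv 24 Finset.univ (by simp)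
  let f : Cmp → ℕ × ℕ := fun c => (c.1, c.2.1)
  have hT : ∀ t ∈ l.map f, validb t.1 t.2 = true ∧ cox t.1 t.2 = (shell G 1).card / 24 := by
    intro t ht
    obtain ⟨c, hc, rfl⟩ := List.mem_map.mp ht
    refine ⟨(hl1 c hc).1.valid, ?_⟩
    rw [(hl1 c hc).cox h hv]
    simp [f]
  have hh : (shell G 1).card / 24 ≤ 46 := by
    obtain ⟨c, hc, _⟩ := hl3 0 (Finset.mem_univ _)
    have h1 := hT (f c) (List.mem_map_of_mem hc)
    have h2 := (hl1 c hc).1.le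
    rw [← h1.2]
    simp only [f, cox, Bool.cond_eq_ite]
    split_ifs <;> omega
  have hsum : ((l.map f).map Prod.fst).sum = 24 := by
    rw [List.map_map]
    exact hl4
  obtain ⟨T, hTt, hperm⟩ := type_perm _ hh (l.map f) hT hsum
  -- permute l
  obtain ⟨l', hl'p, hl'm⟩ : ∃ l' : List Cmp, l'.Perm l ∧ l'.map f = T := by
    have : Relation.Comp List.Perm (List.Forall₂ (fun (t : ℕ × ℕ) c => t = f c)) T l := by
      refine ⟨l.map f, hperm.symm, ?_⟩
      rw [List.forall₂_map_left_iff]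
      exact List.forall₂_same.mpr (fun _ _ => rfl)
    rw [← List.forall₂_comp_perm_eq_perm_comp_forall₂] at this
    obtain ⟨l', h1, h2⟩ := this
    refine ⟨l', h2, ?_⟩
    clear h2 hTt hperm
    induction h1 with
    | nil => rfl
    | cons h1 _ ih => rw [List.map_cons, ih, h1]
  have hty : ∀ c, ∀ hc : c < l'.length, ty T c = f l'[c] := by
    intro c hc
    rw [ty, ← hl'm, List.getD_eq_getElem?_getD, List.getElem?_map, List.getElem?_eq_getElem hc]; rfl
  have hty0 : ∀ c i, i < (ty T c).1 → c < l'.length := by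
    intro c i hi
    by_contra hcon
    rw [ty, ← hl'm, List.getD_eq_default _ _ (by simpa using hcon)] at hi
    simp at hi
  have hfull : ∀ c, ∀ hc : c < l'.length, Full G v Finset.univ l'[c] :=
    fun c hc => hl1 _ (hl'p.mem_iff.mp (List.getElem_mem hc))
  have hpw : l'.Pairwise (fun c d => Disjoint (cimg c) (cimg d)) :=
    (hl'p.symm.pairwise_iff (fun h => h.symm)).mp hl2
  let V : ℕ → ℕ → Fin 24 → ℤ := fun c i => v ((l'.getD c (0,0,fun _ => 0)).2.2 i)
  have hV : ∀ c, ∀ hc : c < l'.length, ∀ i, V c i = v (l'[c].2.2 i) := by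
    intro c hc i
    simp only [V]
    rw [List.getD_eq_getElem _ _ hc]
  have hsurj : ∀ u, ∃ c i, i < (ty T c).1 ∧ V c i = v u := by
    intro u
    obtain ⟨c, hc, hu⟩ := hl3 u (Finset.mem_univ _)
    obtain ⟨m, hm, rfl⟩ := List.getElem_of_mem (hl'p.mem_iff.mpr hc)
    obtain ⟨i, hi, rfl⟩ := mem_cimg.mp hu
    exact ⟨m, i, by rw [hty m hm]; exact hi, hV m hm i⟩
  refine ⟨T, hTt, V, ⟨?_, ?_⟩, ?_⟩
  · intro c i c' j hi hj
    have hc := hty0 c i hi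
    have hc' := hty0 c' j hj
    rw [hV c hc, hV c' hc']
    rw [hty c hc] at hi ⊢
    rw [hty c' hc'] at hj
    by_cases he : c = c'
    · subst he
      rw [if_pos rfl]
      exact (hfull c hc).1.gram i hi j hj
    · rw [if_neg he, h.comm]
      refine (hfull c hc).2.2 _ (Finset.mem_univ _) ?_ i hi
      have hd : Disjoint (cimg l'[c]) (cimg l'[c']) := by
        rcases lt_or_gt_of_ne he with h1 | h1
        · exact List.pairwise_iff_getElem.mp hpw c c' hc hc' h1
        · exact (List.pairwise_iff_getElem.mp hpw c' c hc' hc h1).symm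
      intro hmem
      exact (Finset.disjoint_left.mp hd hmem) (mem_cimg.mpr ⟨j, hj, rfl⟩)
  · intro x hx
    have hx : ∀ u, B G x (v u) = 0 := by
      intro u
      obtain ⟨c, i, hi, hu⟩ := hsurj u
      rw [← hu]; exact hx c i hi
    have hVk := h.venkov x
    rw [Finset.sum_eq_zero] at hVk
    · rw [mul_zero] at hVk
      apply h.eq_zero
      rcases mul_eq_zero.mp hVk.symm with h1 | h1
      · exact absurd h1 (by exact_mod_cast hN)
      · exact h1.le
    · intro r hr
      rw [h.mem_shell] at hr
      obtain ⟨z, hz⟩ := hv.span r (by simpa using hr)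
      rw [hz, B_sum_left, Finset.sum_eq_zero]
      · rfl
      · intro i _
        rw [B_smul_left, h.comm, hx, mul_zero]
  · intro r hr
    obtain ⟨z, hz⟩ := hv.span r hr
    have hlen : T.length = l'.length := by rw [← hl'm, List.length_map]
    let key : Fin 24 → ℕ × ℕ := fun u => ((hsurj u).choose, (hsurj u).choose_spec.choose)
    have hk1 : ∀ u, (key u).2 < (ty T (key u).1).1 := fun u => (hsurj u).choose_spec.choose_spec.1
    have hk2 : ∀ u, V (key u).1 (key u).2 = v u := fun u => (hsurj u).choose_spec.choose_spec.2
    refine ⟨fun c i => ∑ u, if key u = (c, i) then z u else 0, ?_⟩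
    rw [hz]
    simp_rw [Finset.sum_smul]
    have : ∀ c, ∑ i ∈ Finset.range (ty T c).1, ∑ u, (if key u = (c, i) then z u else 0) • V c i =
        ∑ u, ∑ i ∈ Finset.range (ty T c).1, (if key u = (c, i) then z u else 0) • V c i := fun c => Finset.sum_comm
    simp_rw [this]
    rw [Finset.sum_comm]
    refine Finset.sum_congr rfl fun u _ => ?_
    rw [Finset.sum_eq_single (key u).1]
    · rw [Finset.sum_eq_single (key u).2]
      · rw [if_pos rfl, hk2]
      · intro i _ hi
        rw [if_neg (fun hh => hi (by rw [hh])), zero_smul]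
      · intro hh; exact absurd (Finset.mem_range.mpr (hk1 u)) hh
    · intro c _ hc
      refine Finset.sum_eq_zero fun i _ => ?_
      rw [if_neg (fun hh => hc (by rw [hh])), zero_smul]
    · intro hh
      exact absurd (Finset.mem_range.mpr (by rw [hlen]; exact hty0 _ _ (hk1 u))) hh

end Nie

end ModFrame

section ModCode
open scoped BigOperators

namespace Nie

/-- number of glue classes -/
def ncl (t : ℕ × ℕ) : ℕ :=
  bif Nat.beq t.2 1 then t.1 + 1 else bif Nat.beq t.2 2 then 4
  else bif Nat.beq t.1 6 then 3 else bif Nat.beq t.1 7 then 2 else 1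

/-- denominators of the inverse Cartan matrix -/
def den (t : ℕ × ℕ) : ℕ := ncl t

def cadd (t : ℕ × ℕ) (a b : ℕ) : ℕ :=
  bif Nat.beq t.2 1 then (a + b) % (t.1 + 1)
  else bif Nat.beq t.2 2 then
    (bif Nat.beq (t.1 % 2) 0 then Nat.xor a b
     else [0,1,3,2,0,1,3].getD ([0,1,3,2].getD a 0 + [0,1,3,2].getD b 0) 0)
  else (a + b) % ncl t

/-- node of a nonzero class -/
def node (t : ℕ × ℕ) (a : ℕ) : ℕ :=
  bif Nat.beq t.2 1 then a - 1
  else bif Nat.beq t.2 2 then (bif Nat.beq a 3 then t.1 - 1 else a - 1)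
  else bif Nat.beq t.1 6 then [0,1,5].getD a 0 else 6

/-- class of a fundamental weight -/
def cls (t : ℕ × ℕ) (i : ℕ) : ℕ :=
  bif Nat.beq t.2 1 then i + 1
  else bif Nat.beq t.2 2 then
    (bif Nat.beq i 0 then 1 else bif Nat.beq i 1 then 2 else 3 * ((t.1 - i) % 2))
  else bif Nat.beq t.1 6 then [0,1,2,0,1,2].getD i 0
  else bif Nat.beq t.1 7 then [1,0,0,0,1,0,1].getD i 0 else 0

/-- inverse Cartan matrix times `den` -/
def adj (t : ℕ × ℕ) (i j : ℕ) : ℕ :=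
  bif Nat.beq t.2 1 then (min i j + 1) * (t.1 - max i j)
  else bif Nat.beq t.2 2 then
    (bif Nat.ble i 1 then
      (bif Nat.ble j 1 then (bif Nat.beq i j then t.1 else t.1 - 2) else 2 * (t.1 - j))
     else bif Nat.ble j 1 then 2 * (t.1 - i) else 4 * (t.1 - max i j))
  else bif Nat.beq t.1 6 then
    ([[6,3,6,9,6,3],[3,4,5,6,4,2],[6,5,10,12,8,4],[9,6,12,18,12,6],[6,4,8,12,10,5],[3,2,4,6,5,4]].getD i []).getD j 0
  else bif Nat.beq t.1 7 then
    ([[7,4,8,12,9,6,3],[4,4,6,8,6,4,2],[8,6,12,16,12,8,4],[12,8,16,24,18,12,6],[9,6,12,18,15,10,5],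
      [6,4,8,12,10,8,4],[3,2,4,6,5,4,3]].getD i []).getD j 0
  else
    ([[8,5,10,15,12,9,6,3],[5,4,7,10,8,6,4,2],[10,7,14,20,16,12,8,4],[15,10,20,30,24,18,12,6],
      [12,8,16,24,20,15,10,5],[9,6,12,18,15,12,8,4],[6,4,8,12,10,8,6,3],[3,2,4,6,5,4,3,2]].getD i []).getD j 0

/-- action of the `e`-th diagram automorphism on classes -/
def phi (t : ℕ × ℕ) (e a : ℕ) : ℕ :=
  bif Nat.beq t.2 1 then (bif Nat.beq e 0 then a else (t.1 + 1 - a) % (t.1 + 1))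
  else bif Nat.beq t.2 2 then
    (bif Nat.beq t.1 4 then
      ([[0,1,2,3],[0,1,3,2],[0,2,1,3],[0,2,3,1],[0,3,1,2],[0,3,2,1]].getD e [0,1,2,3]).getD a 0
     else bif Nat.beq e 0 then a else [0,2,1,3].getD a 0)
  else bif Nat.beq e 0 then a else bif Nat.beq t.1 6 then [0,2,1].getD a 0 else a

/-- the inverse automorphism -/
def einv (t : ℕ × ℕ) (e : ℕ) : ℕ :=
  bif Nat.beq t.2 2 && Nat.beq t.1 4 then [0,1,2,4,3,5].getD e 0 else e

/-- action of the `e`-th diagram automorphism on nodes -/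
def alp (t : ℕ × ℕ) (e i : ℕ) : ℕ :=
  bif Nat.beq t.2 1 then (bif Nat.beq e 0 then i else t.1 - 1 - i)
  else bif Nat.beq t.2 2 then
    (bif Nat.beq t.1 4 then
      ([[0,1,2,3],[0,3,2,1],[1,0,2,3],[3,0,2,1],[1,3,2,0],[3,1,2,0]].getD e [0,1,2,3]).getD i 0
     else bif Nat.beq e 0 then i else bif Nat.ble i 1 then 1 - i else i)
  else bif Nat.beq e 0 then i else bif Nat.beq t.1 6 then [0,5,4,3,2,1].getD i 0 else i

/-- entries of the weight vector of a class -/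
def ev (t : ℕ × ℕ) (a i : ℕ) : ℕ := bif Nat.beq a 0 then 0 else bif Nat.beq i (node t a) then 1 else 0

def col (t : ℕ × ℕ) (a j : ℕ) : ℕ := bif Nat.beq a 0 then 0 else adj t j (node t a)

/-- number of automorphisms -/
def nau (t : ℕ × ℕ) : ℕ := bif Nat.beq t.2 2 && Nat.beq t.1 4 then 6 else 2

def tyList : List (ℕ × ℕ) :=
  [(1,1),(2,1),(3,1),(4,1),(5,1),(6,1),(7,1),(8,1),(9,1),(11,1),(12,1),(15,1),(17,1),(24,1),
   (4,2),(5,2),(6,2),(7,2),(8,2),(9,2),(10,2),(12,2),(16,2),(24,2),(6,3),(7,3),(8,3)]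

/-- all finite facts about one type -/
def tabCheck (t : ℕ × ℕ) : Bool :=
  validb t.1 t.2 && Nat.ble 1 (ncl t) &&
  (allb t.1 fun i => allb t.1 fun l =>
    decide ((sumb t.1 fun j => bif Nat.beq i j || adjb t.2 i j then cart t.2 i j * (adj t j l : ℤ) else 0)
      = (bif Nat.beq i l then (den t : ℤ) else 0)) && Nat.beq (adj t i l) (adj t l i)) &&
  (allb (ncl t) fun a => allb (ncl t) fun b => Nat.ble (cadd t a b + 1) (ncl t) &&
    allb t.1 fun j => Nat.beq ((col t a j + col t b j) % den t) (col t (cadd t a b) j % den t)) &&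
  (allb t.1 fun i => Nat.ble (cls t i % ncl t + 1) (ncl t) &&
    allb t.1 fun j => Nat.beq (adj t j i % den t) (col t (cls t i % ncl t) j % den t)) &&
  (allb (ncl t) fun a => Nat.beq a 0 || (Nat.ble (node t a + 1) t.1 &&
    !(allb t.1 fun j => Nat.beq (adj t j (node t a) % den t) 0))) &&
  (allb (nau t) fun e => (allb t.1 fun i => Nat.ble (alp t e i + 1) t.1 &&
      (allb t.1 fun j => decide (cart t.2 (alp t e i) (alp t e j) = cart t.2 i j)) &&
      allb (ncl t) fun a => Nat.beq (ev t a (alp t e i)) (ev t (phi t e a) i)) &&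
    allb (ncl t) fun a => Nat.ble (phi t e a + 1) (ncl t) && Nat.beq (phi t (einv t e) (phi t e a)) a &&
      (Nat.beq a 0 == Nat.beq (phi t e a) 0) &&
      allb (ncl t) fun b => Nat.beq a 0 || (Nat.beq b 0 ||
        Nat.beq (adj t (node t (phi t e a)) (node t (phi t e b))) (adj t (node t a) (node t b)))) &&
  (allb t.1 fun i => !(Nat.beq (mark t.1 t.2 i) 1) || (Nat.ble 1 (cls t i) && Nat.ble (cls t i + 1) (ncl t) && Nat.beq (node t (cls t i)) i))

set_option maxRecDepth 100000 in
theorem tabCheck_true : tyList.all tabCheck = true := by decide +kernel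

end Nie

end ModCode

section ModCode2
open scoped BigOperators

namespace Nie

theorem sumb_congr' {n} {f g : ℕ → ℤ} (h : ∀ i < n, f i = g i) : sumb n f = sumb n g := by
  rw [sumb_eq, sumb_eq]; exact Finset.sum_congr rfl fun i hi => h i (Finset.mem_range.mp hi)

theorem allb_of {n} {p : ℕ → Bool} (h : ∀ i < n, p i = true) : allb n p = true := by
  induction n with
  | zero => rfl
  | succ n ih =>
    change (allb n p && p n) = true
    rw [ih (fun j hj => h j (by omega)), h n (by omega)]; rfl

structure TOK (t : ℕ × ℕ) : Prop where
  valid : validb t.1 t.2 = true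
  ncl1 : 1 ≤ ncl t
  inv : ∀ i < t.1, ∀ l < t.1, (∑ j ∈ Finset.range t.1, cart t.2 i j * (adj t j l : ℤ)) = if i = l then (den t : ℤ) else 0
  symm : ∀ i < t.1, ∀ l < t.1, adj t i l = adj t l i
  add_lt : ∀ a < ncl t, ∀ b < ncl t, cadd t a b < ncl t
  add : ∀ a < ncl t, ∀ b < ncl t, ∀ j < t.1, (col t a j + col t b j) % den t = col t (cadd t a b) j % den t
  cls : ∀ i < t.1, ∃ a < ncl t, ∀ j < t.1, adj t j i % den t = col t a j % den t
  node_lt : ∀ a < ncl t, a ≠ 0 → node t a < t.1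
  node_ne : ∀ a < ncl t, a ≠ 0 → ∃ j < t.1, adj t j (node t a) % den t ≠ 0
  alp_lt : ∀ e < nau t, ∀ i < t.1, alp t e i < t.1
  alp_cart : ∀ e < nau t, ∀ i < t.1, ∀ j < t.1, cart t.2 (alp t e i) (alp t e j) = cart t.2 i j
  alp_ev : ∀ e < nau t, ∀ i < t.1, ∀ a < ncl t, ev t a (alp t e i) = ev t (phi t e a) i
  phi_lt : ∀ e < nau t, ∀ a < ncl t, phi t e a < ncl t
  phi_inv : ∀ e < nau t, ∀ a < ncl t, phi t (einv t e) (phi t e a) = a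
  phi_zero : ∀ e < nau t, ∀ a < ncl t, (a = 0 ↔ phi t e a = 0)
  phi_adj : ∀ e < nau t, ∀ a < ncl t, ∀ b < ncl t, a ≠ 0 → b ≠ 0 →
    adj t (node t (phi t e a)) (node t (phi t e b)) = adj t (node t a) (node t b)
  mark : ∀ i < t.1, mark t.1 t.2 i = 1 → ∃ a < ncl t, a ≠ 0 ∧ node t a = i

theorem tok {t} (ht : t ∈ tyList) : TOK t := by
  have h := List.all_eq_true.mp tabCheck_true t ht
  unfold tabCheck at h
  simp only [Bool.and_eq_true] at h
  obtain ⟨⟨⟨⟨⟨⟨⟨h0, h00⟩, h1⟩, h2⟩, h3⟩, h4⟩, h5⟩, h6⟩ := h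
  have e1 := fun i (hi : i < t.1) l (hl : l < t.1) => allb_iff (allb_iff h1 hi) hl
  have e2 := fun a (ha : a < ncl t) b (hb : b < ncl t) => allb_iff (allb_iff h2 ha) hb
  have e3 := fun i (hi : i < t.1) => allb_iff h3 hi
  have e4 := fun i (hi : i < ncl t) => allb_iff h4 hi
  have e5 := fun e (he : e < nau t) => allb_iff h5 he
  have e6 := fun i (hi : i < t.1) => allb_iff h6 hi
  simp only [Bool.and_eq_true, Bool.or_eq_true, beq_dec, ble_dec, decide_eq_true_eq, Bool.not_eq_true'] at e1 e2 e3 e4 e5 e6 h00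
  refine ⟨h0, h00, ?_, fun i hi l hl => (e1 i hi l hl).2, fun a ha b hb => (e2 a ha b hb).1, ?_, ?_, ?_, ?_, ?_, ?_, ?_, ?_, ?_, ?_, ?_, ?_⟩
  · intro i hi l hl
    have := (e1 i hi l hl).1
    rw [Bool.cond_eq_ite] at this
    simp only [decide_eq_true_eq] at this
    rw [← this, sumb_eq]
    refine Finset.sum_congr rfl fun j _ => ?_
    unfold cart
    simp only [beq_dec, Bool.cond_eq_ite, Bool.or_eq_true, decide_eq_true_eq]
    split_ifs <;> simp_all
  · intro a ha b hb j hj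
    have := allb_iff (e2 a ha b hb).2 hj
    simpa [beq_dec] using this
  · intro i hi
    refine ⟨_, (e3 i hi).1, fun j hj => ?_⟩
    have := allb_iff (e3 i hi).2 hj
    simpa [beq_dec] using this
  · intro a ha h0
    rcases e4 a ha with h | h
    · exact absurd h h0
    · exact h.1
  · intro a ha h0
    rcases e4 a ha with h | h
    · exact absurd h h0
    · by_contra hc
      push Not at hc
      have h7 := h.2
      have : allb t.1 (fun j => decide (adj t j (node t a) % den t = 0)) = true := by
        exact allb_of fun j hj => by simp [hc j hj]
      rw [this] at h7; simp at h7
  · exact fun e he i hi => ((allb_iff (e5 e he).1 hi |> fun h => by simpa [beq_dec, ble_dec] using h :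
        (alp t e i < t.1 ∧ allb t.1 _ = true) ∧ allb (ncl t) _ = true)).1.1
  · intro e he i hi j hj
    have h7 := allb_iff (e5 e he).1 hi
    simp only [Bool.and_eq_true] at h7
    simpa using allb_iff h7.1.2 hj
  · intro e he i hi a ha
    have h7 := allb_iff (e5 e he).1 hi
    simp only [Bool.and_eq_true] at h7
    simpa [beq_dec] using allb_iff h7.2 ha
  · intro e he a ha
    have h7 := allb_iff (e5 e he).2 ha
    simp only [Bool.and_eq_true, ble_dec, decide_eq_true_eq] at h7
    exact h7.1.1.1
  · intro e he a ha
    have h7 := allb_iff (e5 e he).2 ha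
    simp only [Bool.and_eq_true, ble_dec, beq_dec, decide_eq_true_eq] at h7
    exact h7.1.1.2
  · intro e he a ha
    have h7 := allb_iff (e5 e he).2 ha
    simp only [Bool.and_eq_true, ble_dec, beq_dec, decide_eq_true_eq, beq_iff_eq, decide_eq_decide] at h7
    exact h7.1.2
  · intro e he a ha b hb h0 h0'
    have h7 := allb_iff (e5 e he).2 ha
    simp only [Bool.and_eq_true, ble_dec, beq_dec, decide_eq_true_eq] at h7
    have := allb_iff h7.2 hb
    simpa [h0, h0'] using this
  · intro i hi hm
    rcases e6 i hi with h | h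
    · simp [hm] at h
    · exact ⟨_, h.1.2, by omega, h.2⟩

def typesSub : Bool := types.all fun T => T.all fun t => tyList.any fun s => Nat.beq s.1 t.1 && Nat.beq s.2 t.2

theorem tyOK {T} (hT : T ∈ types) {c} (hc : c < T.length) : TOK (ty T c) := by
  apply tok
  have : typesSub = true := by decide +kernel
  have := List.all_eq_true.mp this T hT
  have h2 : ty T c = T[c] := by rw [ty, List.getD_eq_getElem _ _ hc]
  have := List.all_eq_true.mp this T[c] (List.getElem_mem hc)
  rw [h2]
  obtain ⟨s, hs, h3⟩ := List.any_eq_true.mp this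
  simp only [Bool.and_eq_true, beq_dec, decide_eq_true_eq] at h3
  have : s = T[c] := Prod.ext h3.1 h3.2
  rwa [← this]

theorem ty_lt {T : List (ℕ × ℕ)} {c i} (h : i < (ty T c).1) : c < T.length := by
  by_contra hc
  rw [ty, List.getD_eq_default _ _ (by omega)] at h
  simp at h

end Nie

end ModCode2

section ModSep
open scoped BigOperators

namespace Nie

theorem char_sep {J : Type} [Fintype J] (M : AddSubgroup (J → ℤ)) (p : J → ℤ) (hp : p ∉ M) :
    ∃ z : J → ℚ, (∀ y ∈ M, ∃ n : ℤ, ∑ j, z j * (y j : ℚ) = n) ∧ ¬ ∃ n : ℤ, ∑ j, z j * (p j : ℚ) = n := by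
  classical
  have h0 : (QuotientAddGroup.mk p : (J → ℤ) ⧸ M) ≠ 0 := by
    rwa [Ne, QuotientAddGroup.eq_zero_iff]
  obtain ⟨χ, hχ⟩ := CharacterModule.exists_character_apply_ne_zero_of_ne_zero h0
  have hz : ∀ j, ∃ z : ℚ, ((z : ℚ) : AddCircle (1:ℚ)) = χ (QuotientAddGroup.mk (Pi.single j (1:ℤ))) :=
    fun j => QuotientAddGroup.mk_surjective _
  choose z hz using hz
  have key : ∀ y : J → ℤ, ((∑ j, z j * (y j : ℚ) : ℚ) : AddCircle (1:ℚ)) = χ (QuotientAddGroup.mk y) := by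
    intro y
    have hy : y = ∑ j, y j • (Pi.single j (1:ℤ) : J → ℤ) := by
      funext k
      simp only [Finset.sum_apply, Pi.smul_apply, Pi.single_apply, smul_eq_mul, mul_ite, mul_one, mul_zero]
      simp
    conv_rhs => rw [hy]
    have h2 : (QuotientAddGroup.mk (∑ j, y j • (Pi.single j (1:ℤ) : J → ℤ)) : (J → ℤ) ⧸ M) =
        ∑ j, QuotientAddGroup.mk (y j • (Pi.single j (1:ℤ) : J → ℤ)) :=
      map_sum (QuotientAddGroup.mk' M) _ _
    rw [h2, map_sum]
    have : ((∑ j, z j * (y j : ℚ) : ℚ) : AddCircle (1:ℚ)) = ∑ j, ((z j * (y j : ℚ) : ℚ) : AddCircle (1:ℚ)) := by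
      exact map_sum (QuotientAddGroup.mk' (AddSubgroup.zmultiples (1:ℚ))) _ _
    rw [this]
    refine Finset.sum_congr rfl fun j _ => ?_
    rw [QuotientAddGroup.mk_zsmul, map_zsmul, ← hz j, ← QuotientAddGroup.mk_zsmul]
    congr 1
    rw [zsmul_eq_mul, mul_comm]
  refine ⟨z, fun y hy => ?_, ?_⟩
  · have := key y
    rw [(QuotientAddGroup.eq_zero_iff y).mpr hy, map_zero] at this
    obtain ⟨n, hn⟩ := (AddCircle.coe_eq_zero_iff (1:ℚ)).mp this
    exact ⟨n, by rw [← hn]; simp⟩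
  · rintro ⟨n, hn⟩
    apply hχ
    rw [← key p, hn]
    exact (AddCircle.coe_eq_zero_iff (1:ℚ)).mpr ⟨n, by simp⟩

theorem EUL.sep {G : Matrix (Fin 24) (Fin 24) ℤ} (h : EUL G) {J : Type} [Fintype J] (f : J → Fin 24 → ℤ) (p : J → ℤ)
    (hp : ¬ ∃ x, ∀ j, B G x (f j) = p j) :
    ∃ z : J → ℚ, ∃ u, (∀ x, (B G x u : ℚ) = ∑ j, z j * (B G x (f j) : ℚ)) ∧ ¬ ∃ n : ℤ, ∑ j, z j * (p j : ℚ) = n := by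
  classical
  let Φ : (Fin 24 → ℤ) →+ (J → ℤ) :=
    { toFun := fun x j => B G x (f j)
      map_zero' := by funext j; exact B_zero_left ..
      map_add' := fun x y => by funext j; exact B_add_left .. }
  obtain ⟨z, hz1, hz2⟩ := char_sep Φ.range p (by rintro ⟨x, hx⟩; exact hp ⟨x, fun j => congrFun hx j⟩)
  have hk : ∀ k : Fin 24, ∃ n : ℤ, ∑ j, z j * (B G (Pi.single k 1) (f j) : ℚ) = n :=
    fun k => hz1 _ ⟨Pi.single k 1, rfl⟩
  choose n hn using hk
  refine ⟨z, G⁻¹.mulVec n, fun x => ?_, hz2⟩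
  have h1 : B G x (G⁻¹.mulVec n) = ∑ k, x k * n k := by
    unfold B
    rw [Matrix.mulVec_mulVec, h.inv_right, Matrix.one_mulVec]; rfl
  rw [h1]
  push_cast
  simp_rw [← hn, Finset.mul_sum]
  rw [Finset.sum_comm]
  refine Finset.sum_congr rfl fun j _ => ?_
  have hx : x = ∑ k, x k • (Pi.single k (1:ℤ) : Fin 24 → ℤ) := by
    funext k
    simp only [Finset.sum_apply, Pi.smul_apply, Pi.single_apply, smul_eq_mul, mul_ite, mul_one, mul_zero]
    simp
  conv_rhs => rw [hx, B_sum_left]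
  push_cast
  rw [Finset.mul_sum]
  refine Finset.sum_congr rfl fun k _ => ?_
  rw [B_smul_left]; push_cast; ring

end Nie

end ModSep

section ModFam
open scoped BigOperators

namespace Nie

def sumN (n : ℕ) (f : ℕ → ℕ) : ℕ := Nat.rec 0 (fun i s => s + f i) n

theorem sumN_eq (n) (f : ℕ → ℕ) : sumN n f = ∑ i ∈ Finset.range n, f i := by
  induction n with
  | zero => rfl
  | succ n ih => rw [Finset.sum_range_succ, ← ih]; rfl

/-- inner product of classes, times `D` -/
def ip (t : ℕ × ℕ) (D a b : ℕ) : ℕ :=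
  bif Nat.beq a 0 || Nat.beq b 0 then 0 else D / den t * adj t (node t a) (node t b)

def wt (w : List ℕ) (c : ℕ) : ℕ := w.getD c 0

def pairN (T : List (ℕ × ℕ)) (D : ℕ) (w w' : List ℕ) : ℕ :=
  sumN T.length fun c => ip (ty T c) D (wt w c) (wt w' c)

def tab (m : ℕ) (f : ℕ → ℕ) : List ℕ := (List.range m).map f

theorem tab_length (m f) : (tab m f).length = m := by simp [tab]
theorem wt_tab {m f c} (hc : c < m) : wt (tab m f) c = f c := by
  simp [wt, tab, List.getD_eq_getElem?_getD, hc]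

def wadd (T : List (ℕ × ℕ)) (w w' : List ℕ) : List ℕ :=
  tab T.length fun c => cadd (ty T c) (wt w c) (wt w' c)

/-- action of a symmetry on words -/
def sapp (T : List (ℕ × ℕ)) (π e : ℕ → ℕ) (w : List ℕ) : List ℕ :=
  tab T.length fun c => phi (ty T c) (e c) (wt w (π c))

structure SymOK (T : List (ℕ × ℕ)) (π ρ e : ℕ → ℕ) : Prop where
  lt : ∀ c < T.length, π c < T.length
  lt' : ∀ c < T.length, ρ c < T.length
  inv : ∀ c < T.length, π (ρ c) = c
  inv' : ∀ c < T.length, ρ (π c) = c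
  ty : ∀ c < T.length, ty T (π c) = ty T c
  aut : ∀ c < T.length, e c < nau (Nie.ty T c)

structure Fam (T : List (ℕ × ℕ)) (D : ℕ) (F : Set (Set (List ℕ))) : Prop where
  len : ∀ C ∈ F, ∀ w ∈ C, w.length = T.length
  lt : ∀ C ∈ F, ∀ w ∈ C, ∀ c < T.length, wt w c < ncl (ty T c)
  zero : ∀ C ∈ F, tab T.length (fun _ => 0) ∈ C
  add : ∀ C ∈ F, ∀ w ∈ C, ∀ w' ∈ C, wadd T w w' ∈ C
  nrm : ∀ C ∈ F, ∀ w ∈ C, 2 * D ∣ pairN T D w w ∧ pairN T D w w ≠ 2 * D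
  pair : ∀ C ∈ F, ∀ w ∈ C, ∀ w' ∈ C, D ∣ pairN T D w w'
  surj : ∀ C ∈ F, ∀ (s : ℕ → Bool) (p : List ℕ), (∀ c < T.length, wt p c < ncl (ty T c)) →
    (∀ c < T.length, s c = false → wt p c = 0) →
    (∀ w ∈ C, (∀ c < T.length, s c = false → wt w c = 0) → D ∣ pairN T D w p) →
    ∃ w ∈ C, ∀ c < T.length, s c = true → wt w c = wt p c
  sym : ∀ C ∈ F, ∀ π ρ e, SymOK T π ρ e → ∃ C' ∈ F, ∀ w ∈ C, sapp T π e w ∈ C'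

/-! ### reduction of weights to classes -/

theorem TOK.sum_ev {t} (h : TOK t) {a} (ha : a < ncl t) {j} (hj : j < t.1) :
    ∑ i ∈ Finset.range t.1, (adj t j i : ℤ) * ev t a i = col t a j := by
  unfold ev col
  simp only [beq_dec, Bool.cond_eq_ite, decide_eq_true_eq]
  by_cases h0 : a = 0
  · simp [h0]
  · rw [if_neg h0]
    rw [Finset.sum_eq_single (node t a)]
    · simp [h0]
    · intro i _ hi; simp [h0, hi]
    · intro hn; exact absurd (Finset.mem_range.mpr (h.node_lt a ha h0)) hn

theorem TOK.den_pos {t} (h : TOK t) : 0 < den t := h.ncl1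

theorem TOK.inv' {t} (h : TOK t) {i l} (hi : i < t.1) (hl : l < t.1) :
    (∑ j ∈ Finset.range t.1, (adj t l j : ℤ) * cart t.2 j i) = if i = l then (den t : ℤ) else 0 := by
  rw [← h.inv i hi l hl]
  refine Finset.sum_congr rfl fun j hj => ?_
  rw [h.symm l hl j (Finset.mem_range.mp hj), cart_comm, mul_comm]

theorem TOK.redu {t} (h : TOK t) {y : ℕ → ℤ} {a} (ha : a < ncl t)
    (hd : ∀ j < t.1, (den t : ℤ) ∣ ∑ i ∈ Finset.range t.1, (adj t j i : ℤ) * y i - col t a j) :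
    ∃ z : ℕ → ℤ, ∀ i < t.1, y i = ev t a i + ∑ j ∈ Finset.range t.1, z j * cart t.2 j i := by
  have : ∀ j, ∃ z : ℤ, j < t.1 → ∑ i ∈ Finset.range t.1, (adj t j i : ℤ) * y i - col t a j = den t * z := by
    intro j
    by_cases hj : j < t.1
    · obtain ⟨z, hz⟩ := hd j hj; exact ⟨z, fun _ => hz⟩
    · exact ⟨0, fun h => absurd h hj⟩
  choose z hz using this
  refine ⟨z, fun i hi => ?_⟩
  have hden : (den t : ℤ) ≠ 0 := by exact_mod_cast h.den_pos.ne'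
  apply mul_left_cancel₀ hden
  rw [mul_add, Finset.mul_sum]
  have : ∀ j ∈ Finset.range t.1, (den t : ℤ) * (z j * cart t.2 j i) =
      ∑ k ∈ Finset.range t.1, (y k - ev t a k) * ((adj t k j : ℤ) * cart t.2 j i) := by
    intro j hj
    rw [← mul_assoc, ← hz j (Finset.mem_range.mp hj), ← h.sum_ev ha (Finset.mem_range.mp hj), ← Finset.sum_sub_distrib,
      Finset.sum_mul]
    refine Finset.sum_congr rfl fun k hk => ?_
    rw [h.symm j (Finset.mem_range.mp hj) k (Finset.mem_range.mp hk)]; ring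
  rw [Finset.sum_congr rfl this, Finset.sum_comm]
  simp_rw [← Finset.mul_sum]
  have h3 : ∀ k ∈ Finset.range t.1, (y k - ev t a k) * ∑ j ∈ Finset.range t.1, (adj t k j : ℤ) * cart t.2 j i =
      if i = k then (y k - ev t a k) * den t else 0 := by
    intro k hk
    rw [h.inv' hi (Finset.mem_range.mp hk)]; split_ifs <;> simp
  rw [Finset.sum_congr rfl h3, Finset.sum_ite_eq, if_pos (Finset.mem_range.mpr hi)]
  ring

theorem TOK.conv {t} (h : TOK t) {y z : ℕ → ℤ} {a} (ha : a < ncl t)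
    (hy : ∀ i < t.1, y i = ev t a i + ∑ j ∈ Finset.range t.1, z j * cart t.2 j i) {l} (hl : l < t.1) :
    ∑ i ∈ Finset.range t.1, (adj t l i : ℤ) * y i = col t a l + den t * z l := by
  have : ∀ i ∈ Finset.range t.1, (adj t l i : ℤ) * y i =
      (adj t l i : ℤ) * ev t a i + ∑ j ∈ Finset.range t.1, z j * ((adj t l i : ℤ) * cart t.2 i j) := by
    intro i hi
    rw [hy i (Finset.mem_range.mp hi), mul_add, Finset.mul_sum]
    congr 1
    refine Finset.sum_congr rfl fun j _ => ?_
    rw [cart_comm]; ring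
  rw [Finset.sum_congr rfl this, Finset.sum_add_distrib, h.sum_ev ha hl, Finset.sum_comm]
  simp_rw [← Finset.mul_sum]
  have h3 : ∀ k ∈ Finset.range t.1, z k * ∑ j ∈ Finset.range t.1, (adj t l j : ℤ) * cart t.2 j k =
      if k = l then z k * den t else 0 := by
    intro k hk
    rw [h.inv' (Finset.mem_range.mp hk) hl]; split_ifs <;> simp
  rw [Finset.sum_congr rfl h3, Finset.sum_ite_eq', if_pos (Finset.mem_range.mpr hl)]
  ring

theorem TOK.addc {t} (h : TOK t) {a b} (ha : a < ncl t) (hb : b < ncl t) {j} (hj : j < t.1) :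
    (den t : ℤ) ∣ (col t a j : ℤ) + col t b j - col t (cadd t a b) j := by
  have := h.add a ha b hb j hj
  have h2 : ((col t a j + col t b j : ℕ) : ℤ) % den t = (col t (cadd t a b) j : ℕ) % (den t : ℤ) := by exact_mod_cast this
  have := Int.ModEq.dvd (Eq.symm h2)
  push_cast at this
  exact this

theorem TOK.mulc {t} (h : TOK t) {a b} (ha : a < ncl t) (hb : b < ncl t) (r : ℕ) :
    ∃ a' < ncl t, ∀ j < t.1, (den t : ℤ) ∣ (col t a j : ℤ) + r * col t b j - col t a' j := by
  induction r with
  | zero => exact ⟨a, ha, fun j _ => by simp⟩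
  | succ r ih =>
    obtain ⟨a', ha', h1⟩ := ih
    refine ⟨_, h.add_lt a' ha' b hb, fun j hj => ?_⟩
    obtain ⟨p, hp⟩ := h1 j hj
    obtain ⟨q, hq⟩ := h.addc ha' hb hj
    exact ⟨p + q, by push_cast; linear_combination hp + hq⟩

theorem TOK.class {t} (h : TOK t) (y : ℕ → ℤ) :
    ∃ a < ncl t, ∀ j < t.1, (den t : ℤ) ∣ ∑ i ∈ Finset.range t.1, (adj t j i : ℤ) * y i - col t a j := by
  have key : ∀ k ≤ t.1, ∃ a < ncl t, ∀ j < t.1, (den t : ℤ) ∣ ∑ i ∈ Finset.range k, (adj t j i : ℤ) * y i - col t a j := by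
    intro k
    induction k with
    | zero => intro _; exact ⟨0, h.ncl1, fun j _ => by simp [col, beq_dec]⟩
    | succ k ih =>
      intro hk
      obtain ⟨a, ha, h1⟩ := ih (by omega)
      obtain ⟨b, hb, h2⟩ := h.cls k (by omega)
      have hden : (0:ℤ) < den t := by exact_mod_cast h.den_pos
      obtain ⟨a', ha', h3⟩ := h.mulc ha hb (y k % den t).toNat
      refine ⟨a', ha', fun j hj => ?_⟩
      have hr : (((y k % den t).toNat : ℕ) : ℤ) = y k - den t * (y k / den t) := by
        rw [Int.toNat_of_nonneg (Int.emod_nonneg _ hden.ne')]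
        have := Int.emod_add_mul_ediv (y k) (den t); linarith
      have h2' : (den t : ℤ) ∣ (adj t j k : ℤ) - col t b j := by
        have h4 : ((adj t j k : ℕ) : ℤ) % den t = (col t b j : ℕ) % (den t : ℤ) := by exact_mod_cast h2 j hj
        exact Int.ModEq.dvd (Eq.symm h4)
      have h3' := h3 j hj
      rw [hr] at h3'
      rw [Finset.sum_range_succ]
      obtain ⟨p, hp⟩ := h1 j hj
      obtain ⟨q, hq⟩ := h2'
      obtain ⟨s, hs⟩ := h3'
      refine ⟨p + q * y k + s + (y k / den t) * col t b j, ?_⟩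
      linear_combination hp + y k * hq + hs
  exact key t.1 le_rfl

end Nie

end ModFam

section ModFrameFam
open scoped BigOperators

namespace Nie

theorem EUL.sepF {G} (h : EUL G) {ι : Type} [DecidableEq ι] (s : Finset ι) (f : ι → Fin 24 → ℤ) (p : ι → ℤ)
    (hp : ¬ ∃ x, ∀ j ∈ s, B G x (f j) = p j) :
    ∃ z : ι → ℚ, ∃ u, (∀ x, (B G x u : ℚ) = ∑ j ∈ s, z j * (B G x (f j) : ℚ)) ∧
      ¬ ∃ n : ℤ, ∑ j ∈ s, z j * (p j : ℚ) = n := by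
  obtain ⟨z, u, h1, h2⟩ := h.sep (J := s) (fun j => f j) (fun j => p j) (by
    rintro ⟨x, hx⟩; exact hp ⟨x, fun j hj => hx ⟨j, hj⟩⟩)
  have key : ∀ g : ι → ℚ, ∑ j ∈ s, (if h : j ∈ s then z ⟨j, h⟩ else 0) * g j = ∑ j : s, z j * g j := by
    intro g
    rw [← Finset.sum_coe_sort s]
    refine Finset.sum_congr rfl fun j _ => ?_
    simp
  refine ⟨fun j => if h : j ∈ s then z ⟨j, h⟩ else 0, u, ?_, ?_⟩
  · intro x; rw [key fun j => (B G x (f j) : ℚ)]; exact h1 x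
  · rw [key fun j => (p j : ℚ)]; exact h2

def combo (T : List (ℕ × ℕ)) (v : ℕ → ℕ → Fin 24 → ℤ) (z : ℕ → ℕ → ℤ) : Fin 24 → ℤ :=
  ∑ c ∈ Finset.range T.length, ∑ i ∈ Finset.range (ty T c).1, z c i • v c i

/-- the glue code of a frame -/
def cod (G : Matrix (Fin 24) (Fin 24) ℤ) (T : List (ℕ × ℕ)) (v : ℕ → ℕ → Fin 24 → ℤ) : Set (List ℕ) :=
  {w | w.length = T.length ∧ (∀ c < T.length, wt w c < ncl (ty T c)) ∧
    ∃ x, ∀ c i, i < (ty T c).1 → B G x (v c i) = ev (ty T c) (wt w c) i}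

variable {G : Matrix (Fin 24) (Fin 24) ℤ} {T : List (ℕ × ℕ)} {v : ℕ → ℕ → Fin 24 → ℤ} {D : ℕ}

theorem Frame0.B_combo (hF : Frame0 G T v) (z) {c l} (hl : l < (ty T c).1) :
    B G (combo T v z) (v c l) = ∑ i ∈ Finset.range (ty T c).1, z c i * cart (ty T c).2 i l := by
  have hc := ty_lt hl
  unfold combo
  rw [B_sum_left, Finset.sum_eq_single c]
  · rw [B_sum_left]
    refine Finset.sum_congr rfl fun i hi => ?_
    rw [B_smul_left, hF.gram c i c l (Finset.mem_range.mp hi) hl, if_pos rfl]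
  · intro c' _ hne
    rw [B_sum_left]
    refine Finset.sum_eq_zero fun i hi => ?_
    rw [B_smul_left, hF.gram c' i c l (Finset.mem_range.mp hi) hl, if_neg hne, mul_zero]
  · intro hn; exact absurd (Finset.mem_range.mpr hc) hn

structure FOK (T : List (ℕ × ℕ)) (D : ℕ) : Prop where
  tok : ∀ c < T.length, TOK (ty T c)
  pos : 0 < D
  dvd : ∀ c < T.length, den (ty T c) ∣ D

theorem FOK.div (h : FOK T D) {c} (hc : c < T.length) : (D / den (ty T c) : ℕ) * (den (ty T c) : ℤ) = D := by
  exact_mod_cast Nat.div_mul_cancel (h.dvd c hc)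

theorem Frame0.expand (hF : Frame0 G T v) (hT : FOK T D) (x) :
    (D : ℤ) • x = combo T v fun c i => (D / den (ty T c) : ℕ) * ∑ j ∈ Finset.range (ty T c).1, (adj (ty T c) i j : ℤ) * B G x (v c j) := by
  rw [← sub_eq_zero]
  apply hF.sep
  intro c l hl
  have hc := ty_lt hl
  have ht := hT.tok c hc
  rw [B_sub_left, B_smul_left, hF.B_combo _ hl]
  have : ∀ i ∈ Finset.range (ty T c).1, ((D / den (ty T c) : ℕ) * ∑ j ∈ Finset.range (ty T c).1, (adj (ty T c) i j : ℤ) * B G x (v c j)) * cart (ty T c).2 i l =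
      ∑ j ∈ Finset.range (ty T c).1, (D / den (ty T c) : ℕ) * B G x (v c j) * ((adj (ty T c) j i : ℤ) * cart (ty T c).2 i l) := by
    intro i hi
    rw [Finset.mul_sum, Finset.sum_mul]
    refine Finset.sum_congr rfl fun j hj => ?_
    rw [ht.symm i (Finset.mem_range.mp hi) j (Finset.mem_range.mp hj)]; ring
  rw [Finset.sum_congr rfl this, Finset.sum_comm]
  simp_rw [← Finset.mul_sum]
  have h3 : ∀ k ∈ Finset.range (ty T c).1, (D / den (ty T c) : ℕ) * B G x (v c k) * ∑ j ∈ Finset.range (ty T c).1, (adj (ty T c) k j : ℤ) * cart (ty T c).2 j l =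
      if l = k then D * B G x (v c k) else 0 := by
    intro k hk
    rw [ht.inv' hl (Finset.mem_range.mp hk)]
    split_ifs
    · linear_combination B G x (v c k) * hT.div hc
    · simp
  rw [Finset.sum_congr rfl h3, Finset.sum_ite_eq, if_pos (Finset.mem_range.mpr hl)]
  ring

theorem Frame0.pairing (h : EUL G) (hF : Frame0 G T v) (hT : FOK T D) (x y) :
    (D : ℤ) * B G x y = ∑ c ∈ Finset.range T.length, (D / den (ty T c) : ℕ) *
      ∑ i ∈ Finset.range (ty T c).1, (∑ j ∈ Finset.range (ty T c).1, (adj (ty T c) i j : ℤ) * B G x (v c j)) * B G y (v c i) := by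
  rw [← B_smul_left, hF.expand hT x]
  unfold combo
  rw [B_sum_left]
  refine Finset.sum_congr rfl fun c _ => ?_
  rw [B_sum_left, Finset.mul_sum]
  refine Finset.sum_congr rfl fun i _ => ?_
  rw [B_smul_left, h.comm]; ring

theorem TOK.ip_eq {t} (h : TOK t) {a b} (ha : a < ncl t) (hb : b < ncl t) :
    (D / den t : ℕ) * ∑ i ∈ Finset.range t.1, (col t a i : ℤ) * ev t b i = ip t D a b := by
  unfold ip col ev
  simp only [beq_dec, Bool.cond_eq_ite, decide_eq_true_eq, Bool.or_eq_true]
  by_cases h0 : a = 0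
  · simp [h0]
  by_cases h1 : b = 0
  · simp [h1]
  rw [if_neg (by tauto)]
  rw [Finset.sum_eq_single (node t b)]
  · simp only [h0, h1, if_false, if_true]
    rw [h.symm _ (h.node_lt a ha h0) _ (h.node_lt b hb h1)]; simp
  · intro i _ hi; simp [h1, hi]
  · intro hn; exact absurd (Finset.mem_range.mpr (h.node_lt b hb h1)) hn

theorem Frame0.pairing_word (h : EUL G) (hF : Frame0 G T v) (hT : FOK T D) {x y} {w w' : List ℕ}
    (hw : ∀ c < T.length, wt w c < ncl (ty T c)) (hw' : ∀ c < T.length, wt w' c < ncl (ty T c))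
    (hx : ∀ c i, i < (ty T c).1 → B G x (v c i) = ev (ty T c) (wt w c) i)
    (hy : ∀ c i, i < (ty T c).1 → B G y (v c i) = ev (ty T c) (wt w' c) i) :
    (D : ℤ) * B G x y = pairN T D w w' := by
  rw [hF.pairing h hT, pairN, sumN_eq]
  push_cast
  refine Finset.sum_congr rfl fun c hc => ?_
  have hc := Finset.mem_range.mp hc
  have ht := hT.tok c hc
  rw [← ht.ip_eq (hw c hc) (hw' c hc)]
  congr 1
  refine Finset.sum_congr rfl fun i hi => ?_
  have hi := Finset.mem_range.mp hi
  rw [hy c i hi, ← ht.sum_ev (hw c hc) hi]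
  congr 1
  refine Finset.sum_congr rfl fun j hj => ?_
  rw [hx c j (Finset.mem_range.mp hj)]

theorem Frame0.shift (hF : Frame0 G T v) (hT : FOK T D) (x) (w : List ℕ) (hl : w.length = T.length)
    (hw : ∀ c < T.length, wt w c < ncl (ty T c))
    (hd : ∀ c < T.length, ∀ j < (ty T c).1, (den (ty T c) : ℤ) ∣
      ∑ i ∈ Finset.range (ty T c).1, (adj (ty T c) j i : ℤ) * B G x (v c i) - col (ty T c) (wt w c) j) :
    w ∈ cod G T v ∧ ∃ z : ℕ → ℕ → ℤ, ∀ c i, i < (ty T c).1 → B G x (v c i) = ev (ty T c) (wt w c) i +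
      ∑ j ∈ Finset.range (ty T c).1, z c j * cart (ty T c).2 j i := by
  have : ∀ c, ∃ z : ℕ → ℤ, ∀ i < (ty T c).1, B G x (v c i) = ev (ty T c) (wt w c) i +
      ∑ j ∈ Finset.range (ty T c).1, z j * cart (ty T c).2 j i := by
    intro c
    by_cases hc : c < T.length
    · exact (hT.tok c hc).redu (y := fun i => B G x (v c i)) (hw c hc) (hd c hc)
    · exact ⟨0, fun i hi => absurd (ty_lt hi) hc⟩
  choose z hz using this
  refine ⟨⟨hl, hw, x - combo T v z, fun c i hi => ?_⟩, z, hz⟩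
  rw [B_sub_left, hF.B_combo z hi, hz c i hi]; ring

theorem alp_inj {t} (h : TOK t) {e} (he : e < nau t) {i j} (hi : i < t.1) (hj : j < t.1) (hij : alp t e i = alp t e j) : i = j := by
  have := h.alp_cart e he i hi j hj
  rw [hij] at this
  rw [(h.alp_cart e he j hj j hj)] at this
  apply cart_eq_two (k := t.2)
  rw [← this]
  simp [cart]

theorem alp_surj {t} (h : TOK t) {e} (he : e < nau t) {i} (hi : i < t.1) : ∃ j < t.1, alp t e j = i := by
  have inj : Function.Injective (fun j : Fin t.1 => (⟨alp t e j, h.alp_lt e he j j.2⟩ : Fin t.1)) := by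
    intro a b hab
    simp only [Fin.mk.injEq] at hab
    exact Fin.ext (alp_inj h he a.2 b.2 hab)
  obtain ⟨j, hj⟩ := Finite.injective_iff_surjective.mp inj ⟨i, hi⟩
  exact ⟨j, j.2, by simpa using hj⟩

theorem Frame.sym (hF : Frame G T v) (hT : FOK T D) {π ρ e} (hs : SymOK T π ρ e) :
    Frame G T (fun c i => v (π c) (alp (ty T c) (e c) i)) := by
  have lt1 : ∀ c i, i < (ty T c).1 → alp (ty T c) (e c) i < (ty T (π c)).1 := by
    intro c i hi
    have hc := ty_lt hi
    rw [hs.ty c hc]; exact (hT.tok c hc).alp_lt _ (hs.aut c hc) i hi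
  refine ⟨⟨?_, ?_⟩, ?_⟩
  · intro c i c' j hi hj
    rw [hF.gram _ _ _ _ (lt1 c i hi) (lt1 c' j hj)]
    have hc := ty_lt hi
    have hc' := ty_lt hj
    by_cases hcc : c = c'
    · subst hcc
      rw [if_pos rfl, if_pos rfl, hs.ty c hc]
      exact (hT.tok c hc).alp_cart _ (hs.aut c hc) i hi j hj
    · rw [if_neg hcc, if_neg]
      intro h; apply hcc
      rw [← hs.inv' c hc, h, hs.inv' c' hc']
  · intro x hx
    apply hF.sep
    intro c i hi
    have hc := ty_lt hi
    have h1 := hs.lt' c hc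
    have h2 : ty T c = ty T (ρ c) := by rw [← hs.ty _ h1, hs.inv c hc]
    obtain ⟨j, hj, hji⟩ := alp_surj (hT.tok _ h1) (hs.aut _ h1) (i := i) (by rwa [← h2])
    have := hx (ρ c) j hj
    rwa [hji, hs.inv c hc] at this
  · intro r hr
    obtain ⟨z, hz⟩ := hF.span r hr
    refine ⟨fun c i => z (π c) (alp (ty T c) (e c) i), hz.trans ?_⟩
    symm
    have : ∀ c ∈ Finset.range T.length, ∑ i ∈ Finset.range (ty T c).1, z (π c) (alp (ty T c) (e c) i) • v (π c) (alp (ty T c) (e c) i) =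
        ∑ i ∈ Finset.range (ty T (π c)).1, z (π c) i • v (π c) i := by
      intro c hc
      have hc := Finset.mem_range.mp hc
      refine Finset.sum_nbij (alp (ty T c) (e c)) ?_ ?_ ?_ (fun _ _ => rfl)
      · intro i hi; exact Finset.mem_range.mpr (lt1 c i (Finset.mem_range.mp hi))
      · intro i hi j hj hij
        exact alp_inj (hT.tok c hc) (hs.aut c hc) (by simpa using hi) (by simpa using hj) hij
      · intro i hi
        have hi : i < (ty T (π c)).1 := by simpa using hi
        rw [hs.ty c hc] at hi
        obtain ⟨j, hj, hji⟩ := alp_surj (hT.tok c hc) (hs.aut c hc) hi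
        exact ⟨j, by simpa using hj, hji⟩
    rw [Finset.sum_congr rfl this]
    refine Finset.sum_nbij' π ρ ?_ ?_ ?_ ?_ (fun _ _ => rfl)
    · intro c hc; simpa using hs.lt c (by simpa using hc)
    · intro c hc; simpa using hs.lt' c (by simpa using hc)
    · intro c hc; simpa using hs.inv' c (by simpa using hc)
    · intro c hc; simpa using hs.inv c (by simpa using hc)

theorem sum_sigma_q {n : ℕ → ℕ} (m : ℕ) (s : ℕ → Bool) (f : ℕ → ℕ → ℚ) :
    ∑ j ∈ ((Finset.range m).filter (fun c => s c = true)).sigma (fun c => Finset.range (n c)), f j.1 j.2 =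
    ∑ c ∈ Finset.range m, if s c = true then ∑ i ∈ Finset.range (n c), f c i else 0 := by
  rw [Finset.sum_sigma, Finset.sum_filter]

theorem fam_of_EUL (h : EUL G) (hT : FOK T D) : Fam T D {C | ∃ v, Frame G T v ∧ C = cod G T v} := by
  refine ⟨?_, ?_, ?_, ?_, ?_, ?_, ?_, ?_⟩
  · rintro _ ⟨v, hF, rfl⟩ w hw; exact hw.1
  · rintro _ ⟨v, hF, rfl⟩ w hw; exact hw.2.1
  · rintro _ ⟨v, hF, rfl⟩
    refine ⟨tab_length _ _, fun c hc => ?_, 0, fun c i hi => ?_⟩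
    · rw [wt_tab hc]; exact (hT.tok c hc).ncl1
    · rw [wt_tab (ty_lt hi), B_zero_left]; simp [ev]
  · rintro _ ⟨v, hF, rfl⟩ w ⟨hl, hw, x, hx⟩ w' ⟨hl', hw', x', hx'⟩
    refine (hF.shift hT (x + x') _ (tab_length _ _) ?_ ?_).1
    · intro c hc
      rw [wt_tab hc]; exact (hT.tok c hc).add_lt _ (hw c hc) _ (hw' c hc)
    · intro c hc j hj
      have ht := hT.tok c hc
      rw [wt_tab hc]
      convert ht.addc (hw c hc) (hw' c hc) hj using 2
      rw [← ht.sum_ev (hw c hc) hj, ← ht.sum_ev (hw' c hc) hj, ← Finset.sum_add_distrib]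
      refine Finset.sum_congr rfl fun i hi => ?_
      rw [B_add_left, hx c i (Finset.mem_range.mp hi), hx' c i (Finset.mem_range.mp hi)]; ring
  · rintro _ ⟨v, hF, rfl⟩ w ⟨hl, hw, x, hx⟩
    have hp := hF.pairing_word h hT hw hw hx hx
    constructor
    · obtain ⟨k, hk⟩ := h.even x
      have : ((2 * D : ℕ) : ℤ) ∣ (pairN T D w w : ℕ) := ⟨k, by rw [← hp, hk]; push_cast; ring⟩
      exact_mod_cast this
    · intro h2
      rw [h2] at hp
      have hD : (D : ℤ) ≠ 0 := by exact_mod_cast hT.pos.ne'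
      have hx2 : B G x x = 2 := by
        apply mul_left_cancel₀ hD; rw [hp]; push_cast; ring
      obtain ⟨z, hz⟩ := hF.span x hx2
      change x = combo T v z at hz
      have hex : ∃ c < T.length, wt w c ≠ 0 := by
        by_contra hcon
        push Not at hcon
        have : pairN T D w w = 0 := by
          rw [pairN, sumN_eq]
          refine Finset.sum_eq_zero fun c hc => ?_
          rw [hcon c (Finset.mem_range.mp hc)]; simp [ip]
        have := hT.pos
        omega
      obtain ⟨c, hc, h0⟩ := hex
      have ht := hT.tok c hc
      obtain ⟨j, hj, hne⟩ := ht.node_ne _ (hw c hc) h0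
      have h3 := ht.conv (y := fun i => (ev (ty T c) (wt w c) i : ℤ)) (z := z c) (a := 0) ht.ncl1 (by
        intro i hi
        rw [← hF.B_combo z hi, ← hz, hx c i hi]; simp [ev]) hj
      rw [ht.sum_ev (hw c hc) hj] at h3
      apply hne
      simp only [col, beq_dec, h0] at h3
      simp at h3
      apply Nat.mod_eq_zero_of_dvd
      have : (den (ty T c) : ℤ) ∣ (adj (ty T c) j (node (ty T c) (wt w c)) : ℕ) := ⟨_, h3⟩
      exact_mod_cast this
  · rintro _ ⟨v, hF, rfl⟩ w ⟨hl, hw, x, hx⟩ w' ⟨hl', hw', x', hx'⟩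
    have := hF.pairing_word h hT hw hw' hx hx'
    have : (D : ℤ) ∣ (pairN T D w w' : ℕ) := ⟨_, this.symm⟩
    exact_mod_cast this
  · rintro _ ⟨v, hF, rfl⟩ s p hp hps hperp
    by_contra hno
    obtain ⟨z, u, hz, hnot⟩ := h.sepF (((Finset.range T.length).filter (fun c => s c = true)).sigma (fun c => Finset.range (ty T c).1))
      (fun j => v j.1 j.2) (fun j => ev (ty T j.1) (wt p j.1) j.2) (by
        rintro ⟨x, hx⟩
        apply hno
        have : ∀ c, ∃ a, c < T.length → a < ncl (ty T c) ∧ (s c = true → a = wt p c) ∧ ∀ j < (ty T c).1, (den (ty T c) : ℤ) ∣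
            ∑ i ∈ Finset.range (ty T c).1, (adj (ty T c) j i : ℤ) * B G x (v c i) - col (ty T c) a j := by
          intro c
          by_cases hc : c < T.length
          swap
          · exact ⟨0, fun h => absurd h hc⟩
          by_cases hsc : s c = true
          · refine ⟨wt p c, fun _ => ⟨hp c hc, fun _ => rfl, fun j hj => ?_⟩⟩
            rw [← (hT.tok c hc).sum_ev (hp c hc) hj, ← Finset.sum_sub_distrib]
            rw [Finset.sum_eq_zero]
            · exact dvd_zero _
            intro i hi
            have := hx ⟨c, i⟩ (by simpa [hc, hsc] using hi)
            simp only at this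
            rw [this]; ring
          · obtain ⟨a, ha, h1⟩ := (hT.tok c hc).class (fun i => B G x (v c i))
            exact ⟨a, fun _ => ⟨ha, fun h => absurd h hsc, h1⟩⟩
        choose a ha using this
        refine ⟨tab T.length a, (hF.shift hT x _ (tab_length _ _) ?_ ?_).1, ?_⟩
        · intro c hc; rw [wt_tab hc]; exact (ha c hc).1
        · intro c hc; rw [wt_tab hc]; exact (ha c hc).2.2
        · intro c hc; rw [wt_tab hc]; exact (ha c hc).2.1)
    apply hnot
    have hu : ∀ c i, i < (ty T c).1 → (B G u (v c i) : ℚ) =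
        if s c = true then ∑ k ∈ Finset.range (ty T c).1, z ⟨c, k⟩ * (cart (ty T c).2 k i : ℚ) else 0 := by
      intro c i hi
      have hc := ty_lt hi
      rw [h.comm, hz, sum_sigma_q (n := fun c => (ty T c).1) T.length s (fun c' k => z ⟨c', k⟩ * (B G (v c i) (v c' k) : ℚ))]
      rw [Finset.sum_eq_single c]
      · by_cases hsc : s c = true
        · rw [if_pos hsc, if_pos hsc]
          refine Finset.sum_congr rfl fun k hk => ?_
          rw [h.comm, hF.gram c k c i (Finset.mem_range.mp hk) hi, if_pos rfl]
        · rw [if_neg hsc, if_neg hsc]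
      · intro c' _ hne
        split_ifs
        · refine Finset.sum_eq_zero fun k hk => ?_
          rw [hF.gram c i c' k hi (Finset.mem_range.mp hk), if_neg (Ne.symm hne)]; simp
        · rfl
      · intro hn; exact absurd (Finset.mem_range.mpr hc) hn
    have : ∀ c, ∃ a, c < T.length → a < ncl (ty T c) ∧ (s c = false → a = 0) ∧ ∀ j < (ty T c).1, (den (ty T c) : ℤ) ∣
        ∑ i ∈ Finset.range (ty T c).1, (adj (ty T c) j i : ℤ) * B G u (v c i) - col (ty T c) a j := by
      intro c
      by_cases hc : c < T.length
      swap
      · exact ⟨0, fun h => absurd h hc⟩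
      by_cases hsc : s c = false
      · refine ⟨0, fun _ => ⟨(hT.tok c hc).ncl1, fun _ => rfl, fun j hj => ?_⟩⟩
        rw [Finset.sum_eq_zero]
        · simp [col]
        intro i hi
        have := hu c i (Finset.mem_range.mp hi)
        rw [hsc] at this
        simp at this
        rw [this]; simp
      · obtain ⟨a, ha, h1⟩ := (hT.tok c hc).class (fun i => B G u (v c i))
        exact ⟨a, fun _ => ⟨ha, fun h => absurd h hsc, h1⟩⟩
    choose a ha using this
    obtain ⟨hmem, ζ, hζ⟩ := hF.shift hT u (tab T.length a) (tab_length _ _)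
      (fun c hc => by rw [wt_tab hc]; exact (ha c hc).1) (fun c hc => by rw [wt_tab hc]; exact (ha c hc).2.2)
    obtain ⟨k, hk⟩ := hperp _ hmem (fun c hc hsc => by rw [wt_tab hc]; exact (ha c hc).2.1 hsc)
    have hDq : (D : ℚ) ≠ 0 := by exact_mod_cast hT.pos.ne'
    rw [sum_sigma_q (n := fun c => (ty T c).1) T.length s (fun c' k => z ⟨c', k⟩ * ((ev (ty T c') (wt p c') k : ℤ) : ℚ))]
    refine ⟨k + ∑ c ∈ Finset.range T.length, ∑ i ∈ Finset.range (ty T c).1, ζ c i * ev (ty T c) (wt p c) i, ?_⟩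
    apply mul_left_cancel₀ hDq
    push_cast
    rw [mul_add, ← Nat.cast_mul, ← hk, pairN, sumN_eq, Finset.mul_sum, Finset.mul_sum, Nat.cast_sum, ← Finset.sum_add_distrib]
    refine Finset.sum_congr rfl fun c hc => ?_
    have hc := Finset.mem_range.mp hc
    have ht := hT.tok c hc
    by_cases hsc : s c = true
    swap
    · have h0 := hps c hc (by simpa using hsc)
      rw [if_neg hsc, h0]; simp [ip, ev]
    rw [if_pos hsc]
    have e1 := ht.ip_eq (D := D) (a := wt (tab T.length a) c) (b := wt p c) (by rw [wt_tab hc]; exact (ha c hc).1) (hp c hc)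
    have e1' : ((ip (ty T c) D (wt (tab T.length a) c) (wt p c) : ℕ) : ℚ) = ((ip (ty T c) D (wt (tab T.length a) c) (wt p c) : ℕ) : ℤ) := by simp
    have e4 : ((D / den (ty T c) : ℕ) : ℚ) * (den (ty T c) : ℚ) = D := by exact_mod_cast hT.div hc
    rw [e1', ← e1]
    generalize D / den (ty T c) = q at e4
    push_cast
    rw [Finset.mul_sum, Finset.mul_sum, Finset.mul_sum, ← Finset.sum_add_distrib]
    refine Finset.sum_congr rfl fun j hj => ?_
    have hj := Finset.mem_range.mp hj
    have e2 := ht.conv (y := fun i => B G u (v c i)) (z := ζ c) (a := wt (tab T.length a) c)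
      (by rw [wt_tab hc]; exact (ha c hc).1) (fun i hi => hζ c i hi) hj
    have e3 : ((∑ i ∈ Finset.range (ty T c).1, (adj (ty T c) j i : ℤ) * B G u (v c i) : ℤ) : ℚ) = den (ty T c) * z ⟨c, j⟩ := by
      push_cast
      have : ∀ i ∈ Finset.range (ty T c).1, (adj (ty T c) j i : ℚ) * B G u (v c i) =
          ∑ k ∈ Finset.range (ty T c).1, z ⟨c, k⟩ * ((adj (ty T c) j i : ℚ) * cart (ty T c).2 i k) := by
        intro i hi
        rw [hu c i (Finset.mem_range.mp hi), if_pos hsc, Finset.mul_sum]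
        refine Finset.sum_congr rfl fun k _ => ?_
        rw [cart_comm]; ring
      rw [Finset.sum_congr rfl this, Finset.sum_comm]
      simp_rw [← Finset.mul_sum]
      have h3 : ∀ k ∈ Finset.range (ty T c).1, z ⟨c, k⟩ * ∑ i ∈ Finset.range (ty T c).1, (adj (ty T c) j i : ℚ) * cart (ty T c).2 i k =
          if k = j then z ⟨c, k⟩ * den (ty T c) else 0 := by
        intro k hk
        have := ht.inv' (Finset.mem_range.mp hk) hj
        have : (∑ i ∈ Finset.range (ty T c).1, (adj (ty T c) j i : ℚ) * cart (ty T c).2 i k) = if k = j then (den (ty T c) : ℚ) else 0 := by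
          exact_mod_cast this
        rw [this]; split_ifs <;> simp
      rw [Finset.sum_congr rfl h3, Finset.sum_ite_eq', if_pos (Finset.mem_range.mpr hj)]
      ring
    rw [e2] at e3
    push_cast at e3
    linear_combination (-(ev (ty T c) (wt p c) j : ℚ) * (q : ℚ)) * e3 - ev (ty T c) (wt p c) j * (z ⟨c, j⟩ - ζ c j) * e4
  · rintro _ ⟨v, hF, rfl⟩ π ρ e hs
    refine ⟨_, ⟨_, hF.sym hT hs, rfl⟩, ?_⟩
    rintro w ⟨hl, hw, x, hx⟩
    refine ⟨tab_length _ _, fun c hc => ?_, x, fun c i hi => ?_⟩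
    · rw [sapp, wt_tab hc]
      apply (hT.tok c hc).phi_lt _ (hs.aut c hc)
      rw [← hs.ty c hc]; exact hw _ (hs.lt c hc)
    · have hc := ty_lt hi
      rw [sapp, wt_tab hc]
      have ht := hT.tok c hc
      have hw' := hw _ (hs.lt c hc)
      rw [hs.ty c hc] at hw'
      rw [← ht.alp_ev _ (hs.aut c hc) i hi _ hw', hx]
      · rw [hs.ty c hc]
      · rw [hs.ty c hc]; exact ht.alp_lt _ (hs.aut c hc) i hi

end Nie

end ModFrameFam

section ModChecker
open scoped BigOperators

namespace Nie

/-! ### linear-time versions -/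

def hd (l : List ℕ) : ℕ := List.rec 0 (fun a _ _ => a) l
def tl (l : List ℕ) : List ℕ := List.rec [] (fun _ t _ => t) l

theorem wt_zero (l : List ℕ) : wt l 0 = hd l := by cases l <;> rfl
theorem wt_succ (l : List ℕ) (c) : wt l (c + 1) = wt (tl l) c := by cases l <;> simp [wt, tl]

def s3 (D : ℕ) (T : List (ℕ × ℕ)) : List ℕ → List ℕ → ℕ :=
  List.rec (fun _ _ => 0) (fun t _ ih a b => ip t D (hd a) (hd b) + ih (tl a) (tl b)) T

def z3 (f : ℕ × ℕ → ℕ → ℕ → ℕ) (T : List (ℕ × ℕ)) : List ℕ → List ℕ → List ℕ :=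
  List.rec (fun _ _ => []) (fun t _ ih a b => f t (hd a) (hd b) :: ih (tl a) (tl b)) T

def a3 (f : ℕ × ℕ → ℕ → ℕ → Bool) (T : List (ℕ × ℕ)) : List ℕ → List ℕ → Bool :=
  List.rec (fun _ _ => true) (fun t _ ih a b => f t (hd a) (hd b) && ih (tl a) (tl b)) T

theorem s3_eq (D) (T : List (ℕ × ℕ)) (a b) : s3 D T a b = pairN T D a b := by
  induction T generalizing a b with
  | nil => rfl
  | cons t T ih =>
    change ip t D (hd a) (hd b) + s3 D T (tl a) (tl b) = _
    rw [ih, pairN, pairN, sumN_eq, sumN_eq, List.length_cons, Finset.sum_range_succ', add_comm]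
    simp only [wt_zero, wt_succ]; rfl

theorem tab_succ (n) (f : ℕ → ℕ) : tab (n + 1) f = f 0 :: tab n fun c => f (c + 1) := by
  simp only [tab, List.range_succ_eq_map, List.map_cons, List.map_map]; rfl

theorem z3_eq (f) (T : List (ℕ × ℕ)) (a b) : z3 f T a b = tab T.length fun c => f (ty T c) (wt a c) (wt b c) := by
  induction T generalizing a b with
  | nil => rfl
  | cons t T ih =>
    change f t (hd a) (hd b) :: z3 f T (tl a) (tl b) = _
    rw [ih, List.length_cons, tab_succ]
    simp only [wt_zero, wt_succ]; rfl

theorem a3_iff (f) (T : List (ℕ × ℕ)) (a b) (h : a3 f T a b = true) :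
    ∀ c < T.length, f (ty T c) (wt a c) (wt b c) = true := by
  induction T generalizing a b with
  | nil => intro c hc; simp at hc
  | cons t T ih =>
    change (f t (hd a) (hd b) && a3 f T (tl a) (tl b)) = true at h
    rw [Bool.and_eq_true] at h
    intro c hc
    cases c with
    | zero => simpa [wt_zero, ty] using h.1
    | succ c =>
      rw [wt_succ, wt_succ]
      exact ih _ _ h.2 c (by simpa using hc)

def leq (a : List ℕ) : List ℕ → Bool :=
  List.rec (fun b => List.rec true (fun _ _ _ => false) b)
    (fun x _ ih b => List.rec false (fun y b' _ => Nat.beq x y && ih b') b) a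

theorem leq_eq {a b : List ℕ} (h : leq a b = true) : a = b := by
  induction a generalizing b with
  | nil => cases b with
    | nil => rfl
    | cons y b => exact absurd h (by simp [leq])
  | cons x a ih => cases b with
    | nil => exact absurd h (by simp [leq])
    | cons y b =>
      change (Nat.beq x y && leq a b) = true at h
      rw [Bool.and_eq_true] at h
      rw [Nat.eq_of_beq_eq_true h.1, ih h.2]

theorem wt_ext {a b : List ℕ} (hl : a.length = b.length) (h : ∀ c < a.length, wt a c = wt b c) : a = b := by
  apply List.ext_getElem hl
  intro c h1 h2
  have := h c h1
  simpa [wt, h1, h2] using this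

theorem wt_drop (l : List ℕ) (n c) : wt (l.drop n) c = wt l (n + c) := by
  simp [wt, List.getD_eq_getElem?_getD]

theorem s3_drop (D) (n : ℕ) (T : List (ℕ × ℕ)) (k w : List ℕ) (h : ∀ c < n, wt k c = 0) :
    s3 D (T.drop n) (k.drop n) (w.drop n) = s3 D T k w := by
  induction n generalizing T k w with
  | zero => rfl
  | succ n ih =>
    cases T with
    | nil => rfl
    | cons t T =>
      have e : ∀ l : List ℕ, l.drop (n + 1) = (tl l).drop n := by intro l; cases l <;> simp [tl]
      rw [List.drop_succ_cons, e, e, ih _ _ _ (fun c hc => by rw [← wt_succ]; exact h _ (by omega))]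
      change _ = ip t D (hd k) (hd w) + s3 D T (tl k) (tl w)
      rw [← wt_zero k, h 0 (by omega)]; simp [ip]

/-! ### generic search -/

/-- suffix search -/
def srch (ch : ℕ → List ℕ) (ok : ℕ → List ℕ → Bool) (n : ℕ) : List ℕ → List (List ℕ) :=
  Nat.rec (fun s => [s]) (fun n ih s => List.rec [] (fun a _ r => bif ok n (a :: s) then ih (a :: s) ++ r else r) (ch n)) n

theorem srch_sound (ch ok) (w : List ℕ) (n : ℕ) (hn : n ≤ w.length) (h1 : ∀ c < n, wt w c ∈ ch c)
    (h2 : ∀ c < n, ok c (w.drop c) = true) : w ∈ srch ch ok n (w.drop n) := by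
  induction n with
  | zero => exact List.mem_cons_self
  | succ n ih =>
    have ih := ih (by omega) (fun c hc => h1 c (by omega)) (fun c hc => h2 c (by omega))
    have h3 := h1 n (by omega)
    have h4 := h2 n (by omega)
    have e : w.drop n = wt w n :: w.drop (n + 1) := by
      rw [List.drop_eq_getElem_cons (by omega)]
      simp [wt, show n < w.length by omega]
    rw [e] at ih h4
    change w ∈ List.rec (motive := fun _ => List (List ℕ)) [] (fun a _ r => bif ok n (a :: w.drop (n+1)) then srch ch ok n (a :: w.drop (n+1)) ++ r else r) (ch n)
    generalize ch n = l at h3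
    induction l with
    | nil => simp at h3
    | cons a l ihl =>
      change w ∈ bif ok n (a :: w.drop (n+1)) then srch ch ok n (a :: w.drop (n+1)) ++ _ else _
      rcases List.mem_cons.mp h3 with h | h
      · rw [← h, h4]; exact List.mem_append_left _ ih
      · have := ihl h
        cases ok n (a :: w.drop (n+1))
        · exact this
        · exact List.mem_append_right _ this

/-! ### certificates -/

inductive Res where
  | bad : List ℕ → Res
  | ref : ℕ → List ℕ → List ℕ → List (List ℕ) → Res

structure Node where
  K : List (List ℕ)
  S : List ℕ
  p : List ℕ
  cons : List (List (ℕ × ℕ))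
  r1 : List Res
  r2 : List Res

def smulw (T : List (ℕ × ℕ)) (g : List ℕ) (n : ℕ) (w : List ℕ) : List ℕ :=
  Nat.rec w (fun _ r => z3 cadd T r g) n

def comb (T : List (ℕ × ℕ)) (gs : List (List ℕ)) : List ℕ → List ℕ :=
  List.rec (fun _ => tab T.length fun _ => 0) (fun g _ ih cs => smulw T g (hd cs) (ih (tl cs))) gs

def adm (D n : ℕ) : Bool := Nat.beq (n % (2 * D)) 0 && !Nat.beq n (2 * D)

def nthL (l : List (List ℕ)) (n : ℕ) : Option (List ℕ) := l[n]?

def idx (π : List ℕ) (c : ℕ) : ℕ := π.idxOf c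

/-- symmetry check -/
def symb (T : List (ℕ × ℕ)) (π e : List ℕ) : Bool :=
  a3 (fun t p e => Nat.ble (p + 1) T.length && Nat.beq (ty T p).1 t.1 && Nat.beq (ty T p).2 t.2 && Nat.ble (e + 1) (nau t)) T π e
  && allb T.length fun c => Nat.beq (wt π (idx π c)) c && Nat.beq (idx π (wt π c)) c && Nat.ble (idx π c + 1) T.length

def sapl (T : List (ℕ × ℕ)) (π e w : List ℕ) : List ℕ := z3 (fun t p e => phi t e (wt w p)) T π e

def refOK (T : List (ℕ × ℕ)) (π e : List ℕ) (gs : List (List ℕ)) (Kj : List (List ℕ)) : List (List ℕ) → Bool :=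
  List.rec (fun _ => true) (fun k _ ih css => leq k (sapl T π e (comb T gs (List.rec [] (fun a _ _ => a) css))) &&
    ih (List.rec [] (fun _ t _ => t) css)) Kj

noncomputable def resOK (T : List (ℕ × ℕ)) (D : ℕ) (prev : List (List (List ℕ))) (K : List (List ℕ)) (w : List ℕ) (r : Res) : Bool :=
  Res.rec (fun cs => (fun x => !adm D (s3 D T x x)) (comb T (w :: K) cs))
    (fun j π e css => Nat.ble (j + 1) prev.length && (symb T π e && refOK T π e (w :: K) (prev.getD j []) css)) r

def zipOK (f : List ℕ → Res → Bool) (ws : List (List ℕ)) : List Res → Bool :=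
  List.rec (fun _ => true) (fun w _ ih rs => List.rec false (fun r rs' _ => f w r && ih rs') rs) ws

theorem zipOK_spec {f ws rs} (h : zipOK f ws rs = true) {w} (hw : w ∈ ws) : ∃ r, f w r = true := by
  induction ws generalizing rs with
  | nil => simp at hw
  | cons w' ws ih =>
    cases rs with
    | nil => exact absurd h (by simp [zipOK])
    | cons r rs =>
      change (f w' r && zipOK f ws rs) = true at h
      rw [Bool.and_eq_true] at h
      rcases List.mem_cons.mp hw with rfl | hw
      · exact ⟨r, h.1⟩
      · exact ih h.2 hw

/-- low coordinates vanish -/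
def lowz (n : ℕ) (k : List ℕ) : Bool := allb n fun c => Nat.beq (wt k c) 0

def consOK (T : List (ℕ × ℕ)) (S : List ℕ) (ks : List (List ℕ)) (c cp e : ℕ) : Bool :=
  Nat.ble c cp && Nat.ble (cp + 1) T.length && Nat.beq (ty T c).1 (ty T cp).1 && Nat.beq (ty T c).2 (ty T cp).2 &&
  Nat.ble (e + 1) (nau (ty T c)) && Nat.ble (einv (ty T c) e + 1) (nau (ty T c)) && Nat.beq (wt S c) (wt S cp) &&
  ks.all fun k => Nat.beq (phi (ty T c) e (wt k c)) (wt k cp)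

def okf (T : List (ℕ × ℕ)) (D : ℕ) (K : List (List ℕ)) (cons : List (List (ℕ × ℕ))) (n : ℕ) (s : List ℕ) : Bool :=
  ((cons.getD n []).all fun q => Nat.ble (wt s (q.1 - n)) (phi (ty T n) q.2 (hd s))) &&
  (K.filter fun k => lowz n k && !lowz (n + 1) k).all fun k => Nat.beq (s3 D (T.drop n) (k.drop n) s % D) 0

noncomputable def nodeOK (T : List (ℕ × ℕ)) (D : ℕ) (prev : List (List (List ℕ))) (N : Node) : Bool :=
  (allb N.cons.length fun c => (N.cons.getD c []).all fun q => consOK T N.S (N.p :: N.K) c q.1 q.2) &&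
  (a3 (fun t s p => Nat.ble (p + 1) (ncl t) && (Nat.beq s 1 || (Nat.beq s 0 && Nat.beq p 0))) T N.S N.p) &&
  zipOK (resOK T D prev N.K)
    ((srch (fun c => bif Nat.beq (wt N.S c) 1 then List.range (ncl (ty T c)) else [0]) (okf T D N.K N.cons) T.length []).filter
      fun w => adm D (s3 D T w w) && !Nat.beq (s3 D T w N.p % D) 0) N.r1 &&
  zipOK (resOK T D prev N.K)
    ((srch (fun c => bif Nat.beq (wt N.S c) 1 then [wt N.p c] else List.range (ncl (ty T c))) (okf T D N.K N.cons) T.length []).filter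
      fun w => adm D (s3 D T w w)) N.r2

noncomputable def certOK (T : List (ℕ × ℕ)) (D : ℕ) (nodes : List Node) : List (List (List ℕ)) → Bool :=
  List.rec (fun _ => true) (fun N _ ih prev => nodeOK T D prev N && ih (prev ++ [N.K])) nodes

/-! ### soundness -/

section
variable {T : List (ℕ × ℕ)} {D : ℕ} {F : Set (Set (List ℕ))}

def Sub (C : Set (List ℕ)) (K : List (List ℕ)) : Prop := ∀ k ∈ K, k ∈ C

theorem Fam.comb_mem (hF : Fam T D F) {C} (hC : C ∈ F) (gs : List (List ℕ)) (h : Sub C gs) (cs) : comb T gs cs ∈ C := by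
  induction gs generalizing cs with
  | nil => exact hF.zero C hC
  | cons g gs ih =>
    change smulw T g (hd cs) (comb T gs (tl cs)) ∈ C
    generalize hd cs = n
    induction n with
    | zero => exact ih (fun k hk => h k (List.mem_cons_of_mem _ hk)) _
    | succ n ihn =>
      change z3 cadd T (smulw T g n _) g ∈ C
      rw [z3_eq]; exact hF.add C hC _ ihn _ (h g List.mem_cons_self)

theorem adm_iff (hF : Fam T D F) {C} (hC : C ∈ F) {w} (hw : w ∈ C) : adm D (s3 D T w w) = true := by
  have := hF.nrm C hC w hw
  rw [s3_eq, adm]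
  simp only [beq_dec, Bool.and_eq_true, decide_eq_true_eq, Bool.not_eq_true', decide_eq_false_iff_not]
  exact ⟨Nat.mod_eq_zero_of_dvd this.1, this.2⟩

theorem symb_spec {π e : List ℕ} (h : symb T π e = true) : SymOK T (wt π) (idx π) (wt e) := by
  unfold symb at h
  rw [Bool.and_eq_true] at h
  have h1 := a3_iff _ _ _ _ h.1
  have h2 := fun c (hc : c < T.length) => allb_iff h.2 hc
  simp only [beq_dec, ble_dec, Bool.and_eq_true, decide_eq_true_eq] at h1 h2
  exact ⟨fun c hc => by have := h1 c hc; omega, fun c hc => by have := h2 c hc; omega, fun c hc => (h2 c hc).1.1,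
    fun c hc => (h2 c hc).1.2, fun c hc => Prod.ext (h1 c hc).1.1.2 (h1 c hc).1.2, fun c hc => by have := (h1 c hc).2; omega⟩

theorem refOK_spec {π e gs Kj css} (h : refOK T π e gs Kj css = true) {k} (hk : k ∈ Kj) :
    ∃ cs, k = sapl T π e (comb T gs cs) := by
  induction Kj generalizing css with
  | nil => simp at hk
  | cons k' Kj ih =>
    change (leq k' (sapl T π e (comb T gs _)) && refOK T π e gs Kj _) = true at h
    rw [Bool.and_eq_true] at h
    rcases List.mem_cons.mp hk with rfl | hk
    · exact ⟨_, leq_eq h.1⟩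
    · exact ih h.2 hk

theorem resOK_spec (hF : Fam T D F) {prev K w r} (h : resOK T D prev K w r = true) {C} (hC : C ∈ F) (hK : Sub C K) (hw : w ∈ C) :
    ∃ Kj ∈ prev, ∃ C' ∈ F, Sub C' Kj := by
  have hsub : Sub C (w :: K) := by
    intro k hk
    rcases List.mem_cons.mp hk with rfl | hk
    · exact hw
    · exact hK k hk
  cases r with
  | bad cs =>
    change (!adm D (s3 D T (comb T (w :: K) cs) (comb T (w :: K) cs))) = true at h
    rw [adm_iff hF hC (hF.comb_mem hC _ hsub cs)] at h
    simp at h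
  | ref j π e css =>
    change (Nat.ble (j + 1) prev.length && (symb T π e && refOK T π e (w :: K) (prev.getD j []) css)) = true at h
    simp only [Bool.and_eq_true, ble_dec, decide_eq_true_eq] at h
    obtain ⟨hj, hs, hr⟩ := h
    obtain ⟨C', hC', h'⟩ := hF.sym C hC _ _ _ (symb_spec hs)
    refine ⟨prev.getD j [], ?_, C', hC', ?_⟩
    · rw [List.getD_eq_getElem _ _ (by omega)]; exact List.getElem_mem _
    · intro k hk
      obtain ⟨cs, rfl⟩ := refOK_spec hr hk
      have := h' _ (hF.comb_mem hC _ hsub cs)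
      unfold sapl; rw [z3_eq]; exact this

theorem pair_sapp (hT : FOK T D) {π ρ e} (hs : SymOK T π ρ e) {w w' : List ℕ}
    (hw : ∀ c < T.length, wt w c < ncl (ty T c)) (hw' : ∀ c < T.length, wt w' c < ncl (ty T c)) :
    pairN T D (sapp T π e w) (sapp T π e w') = pairN T D w w' := by
  rw [pairN, pairN, sumN_eq, sumN_eq]
  refine Finset.sum_nbij' π ρ ?_ ?_ ?_ ?_ ?_
  · intro c hc; simpa using hs.lt c (by simpa using hc)
  · intro c hc; simpa using hs.lt' c (by simpa using hc)
  · intro c hc; simpa using hs.inv' c (by simpa using hc)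
  · intro c hc; simpa using hs.inv c (by simpa using hc)
  · intro c hc
    have hc : c < T.length := by simpa using hc
    unfold sapp
    rw [wt_tab hc, wt_tab hc, hs.ty c hc]
    have h1 := hw _ (hs.lt c hc)
    have h2 := hw' _ (hs.lt c hc)
    rw [hs.ty c hc] at h1 h2
    have ht := hT.tok c hc
    have he := hs.aut c hc
    unfold ip
    simp only [beq_dec, Bool.cond_eq_ite, Bool.or_eq_true, decide_eq_true_eq]
    simp only [← ht.phi_zero _ he _ h1, ← ht.phi_zero _ he _ h2]
    split_ifs with h
    · rfl
    · push Not at h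
      rw [ht.phi_adj _ he _ h1 _ h2 h.1 h.2]

theorem phi_id (t : ℕ × ℕ) {a} (ha : a < ncl t) : phi t 0 a = a := by
  unfold phi
  simp only [beq_dec, Bool.cond_eq_ite, decide_eq_true_eq]
  split_ifs with h1 h2 h3 <;> try rfl
  have : a < 4 := by simpa [ncl, beq_dec, h1, h2] using ha
  interval_cases a <;> rfl

theorem sum_pow_lt (g : ℕ → ℕ) (n) (hg : ∀ x < n, g x < 32) : ∑ x ∈ Finset.range n, g x * 32 ^ x < 32 ^ n := by
  induction n with
  | zero => simp
  | succ n ih =>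
    rw [Finset.sum_range_succ, pow_succ]
    have := ih (fun x hx => hg x (by omega))
    have := Nat.mul_le_mul_right (32 ^ n) (show g n ≤ 31 by have := hg n (by omega); omega)
    omega

theorem code_lt (f g : ℕ → ℕ) (cp m) (hcp : cp < m) (hg : ∀ x < m, g x < 32) (h : g cp < f cp)
    (he : ∀ x, cp < x → x < m → g x = f x) :
    ∑ x ∈ Finset.range m, g x * 32 ^ x < ∑ x ∈ Finset.range m, f x * 32 ^ x := by
  induction m with
  | zero => omega
  | succ m ih =>
    rw [Finset.sum_range_succ, Finset.sum_range_succ]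
    by_cases hm : cp = m
    · subst hm
      have := sum_pow_lt g cp (fun x hx => hg x (by omega))
      have := Nat.mul_le_mul_right (32 ^ cp) (show g cp + 1 ≤ f cp by omega)
      have := Nat.zero_le (∑ x ∈ Finset.range cp, f x * 32 ^ x)
      linarith
    · have := ih (by omega) (fun x hx => hg x (by omega)) (fun x h1 h2 => he x h1 (by omega))
      rw [he m (by omega) (by omega)]; omega

structure COK (T : List (ℕ × ℕ)) (S : List ℕ) (ks : List (List ℕ)) (c cp e : ℕ) : Prop where
  le : c ≤ cp
  lt : cp < T.length
  ty : ty T c = ty T cp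
  he : e < nau (Nie.ty T c)
  he' : einv (Nie.ty T c) e < nau (Nie.ty T c)
  hS : wt S c = wt S cp
  hk : ∀ k ∈ ks, phi (Nie.ty T c) e (wt k c) = wt k cp

theorem consOK_spec {S ks c cp e} (h : consOK T S ks c cp e = true) : COK T S ks c cp e := by
  unfold consOK at h
  simp only [beq_dec, ble_dec, Bool.and_eq_true, decide_eq_true_eq, List.all_eq_true] at h
  obtain ⟨⟨⟨⟨⟨⟨⟨h1, h2⟩, h3⟩, h3'⟩, h4⟩, h5⟩, h6⟩, h7⟩ := h
  exact ⟨h1, by omega, Prod.ext h3 h3', by omega, by omega, h6, h7⟩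

def sw (c cp x : ℕ) : ℕ := if x = cp then c else if x = c then cp else x
def swe (t : ℕ × ℕ) (c cp e x : ℕ) : ℕ := if x = cp then e else if x = c then einv t e else 0

theorem COK.sym {S ks c cp e} (h : COK T S ks c cp e) : SymOK T (sw c cp) (sw c cp) (swe (Nie.ty T c) c cp e) := by
  have h1 := h.le
  have h2 := h.lt
  refine ⟨?_, ?_, ?_, ?_, ?_, ?_⟩
  · intro x hx; unfold sw; split_ifs <;> omega
  · intro x hx; unfold sw; split_ifs <;> omega
  · intro x hx; unfold sw; split_ifs <;> omega
  · intro x hx; unfold sw; split_ifs <;> omega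
  · intro x hx; unfold sw; split_ifs with h3 h4
    · rw [h3, h.ty]
    · rw [h4, h.ty]
    · rfl
  · intro x hx; unfold swe; split_ifs with h3 h4
    · rw [h3, ← h.ty]; exact h.he
    · rw [h4]; exact h.he'
    · unfold nau; cases (Nat.beq (Nie.ty T x).2 2 && Nat.beq (Nie.ty T x).1 4) <;> decide

theorem COK.fix (hT : FOK T D) {S ks c cp e} (h : COK T S ks c cp e) {k} (hk : k ∈ ks)
    (hlt : ∀ c < T.length, wt k c < ncl (Nie.ty T c)) {x} (hx : x < T.length) :
    phi (Nie.ty T x) (swe (Nie.ty T c) c cp e x) (wt k (sw c cp x)) = wt k x := by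
  unfold sw swe
  have hc : c < T.length := lt_of_le_of_lt h.le h.lt
  split_ifs with h3 h4
  · rw [h3, ← h.ty, h.hk k hk]
  · rw [h4, ← h.hk k hk, (hT.tok c hc).phi_inv _ h.he _ (hlt c hc)]
  · exact phi_id _ (hlt x hx)

def wcode (T : List (ℕ × ℕ)) (w : List ℕ) : ℕ := ∑ x ∈ Finset.range T.length, wt w x * 32 ^ x

theorem exists_min (Q : List ℕ → Prop) (f : List ℕ → ℕ) (h : ∃ w, Q w) : ∃ w, Q w ∧ ∀ w', Q w' → f w ≤ f w' := by
  obtain ⟨w, hw, hm⟩ := WellFounded.has_min (measure f).wf {w | Q w} h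
  exact ⟨w, hw, fun w' hw' => not_lt.mp (hm w' hw')⟩

/-- minimal words pass the search -/
theorem node_min (hF : Fam T D F) (hT : FOK T D) (h32 : ∀ c < T.length, ncl (ty T c) < 32) {K : List (List ℕ)} {S p : List ℕ}
    {cons : List (List (ℕ × ℕ))} (hcons : ∀ c, ∀ q ∈ cons.getD c [], COK T S (p :: K) c q.1 q.2)
    (cond : List ℕ → Prop)
    (hcond : ∀ w c cp e, (∀ c < T.length, wt w c < ncl (ty T c)) → COK T S (p :: K) c cp e → cond w → cond (sapp T (sw c cp) (swe (ty T c) c cp e) w))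
    (hex : ∃ w, ∃ C ∈ F, Sub C K ∧ w ∈ C ∧ cond w) :
    ∃ w, (∃ C ∈ F, Sub C K ∧ w ∈ C ∧ cond w) ∧ ∀ ch : ℕ → List ℕ, (∀ c < T.length, wt w c ∈ ch c) →
      w ∈ srch ch (okf T D K cons) T.length [] := by
  obtain ⟨w, ⟨C, hC, hK, hw, hcw⟩, hmin⟩ := exists_min _ (wcode T) hex
  refine ⟨w, ⟨C, hC, hK, hw, hcw⟩, fun ch hch => ?_⟩
  have hl := hF.len C hC w hw
  have hlt := hF.lt C hC w hw
  have := srch_sound ch (okf T D K cons) w T.length hl.ge hch ?_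
  · rwa [List.drop_eq_nil_of_le hl.le] at this
  intro n hn
  unfold okf
  rw [Bool.and_eq_true, List.all_eq_true, List.all_eq_true]
  constructor
  · intro q hq
    have hq := hcons n q hq
    rw [ble_dec, decide_eq_true_eq, wt_drop, ← wt_zero, wt_drop, Nat.add_zero, Nat.add_sub_cancel' hq.le]
    by_contra hcon
    push Not at hcon
    obtain ⟨C', hC', hs'⟩ := hF.sym C hC _ _ _ hq.sym
    have hmin := hmin (sapp T (sw n q.1) (swe (ty T n) n q.1 q.2) w) ⟨C', hC', ?_, hs' w hw, hcond _ _ _ _ hlt hq hcw⟩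
    · refine absurd hmin (not_le.mpr ?_)
      unfold wcode
      refine code_lt _ _ q.1 T.length hq.lt ?_ ?_ ?_
      · intro x hx
        exact lt_trans (hF.lt C' hC' _ (hs' w hw) x hx) (h32 x hx)
      · unfold sapp; rw [wt_tab hq.lt]
        simp only [sw, swe, if_true]
        rw [← hq.ty]; exact hcon
      · intro x h1 h2
        unfold sapp; rw [wt_tab h2]
        have : x ≠ q.1 := by omega
        have : x ≠ n := by have := hq.le; omega
        simp only [sw, swe, *, if_false]
        exact phi_id _ (hlt x h2)
    · intro k hk
      have hkC := hK k hk
      have : k = sapp T (sw n q.1) (swe (ty T n) n q.1 q.2) k := by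
        refine wt_ext (by rw [hF.len C hC k hkC]; exact (tab_length _ _).symm) ?_
        intro x hx
        rw [hF.len C hC k hkC] at hx
        unfold sapp; rw [wt_tab hx]
        exact (hq.fix hT (List.mem_cons_of_mem _ hk) (hF.lt C hC k hkC) hx).symm
      rw [this]; exact hs' k hkC
  · intro k hk
    rw [List.mem_filter, Bool.and_eq_true] at hk
    have hz : ∀ c < n, wt k c = 0 := by
      intro c hc
      have := allb_iff hk.2.1 hc
      simpa [beq_dec] using this
    rw [s3_drop D n T k w hz, s3_eq, beq_dec, decide_eq_true_eq]
    exact Nat.mod_eq_zero_of_dvd (hF.pair C hC k (hK k hk.1) w hw)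

theorem nodeOK_spec (hF : Fam T D F) (hT : FOK T D) (h32 : ∀ c < T.length, ncl (ty T c) < 32) {prev N} (h : nodeOK T D prev N = true)
    (hex : ∃ C ∈ F, Sub C N.K) : ∃ Kj ∈ prev, ∃ C' ∈ F, Sub C' Kj := by
  unfold nodeOK at h
  simp only [Bool.and_eq_true] at h
  obtain ⟨⟨⟨h1, h2⟩, h3⟩, h4⟩ := h
  have hcons : ∀ c, ∀ q ∈ N.cons.getD c [], COK T N.S (N.p :: N.K) c q.1 q.2 := by
    intro c q hq
    by_cases hc : c < N.cons.length
    · exact consOK_spec (List.all_eq_true.mp (allb_iff h1 hc) q hq)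
    · rw [List.getD_eq_default _ _ (by omega)] at hq; simp at hq
  have h2 := a3_iff _ _ _ _ h2
  simp only [beq_dec, ble_dec, Bool.and_eq_true, Bool.or_eq_true, decide_eq_true_eq] at h2
  have hplt : ∀ c < T.length, wt N.p c < ncl (ty T c) := fun c hc => (h2 c hc).1
  by_cases hu : ∃ w, ∃ C ∈ F, Sub C N.K ∧ w ∈ C ∧ ((∀ c < T.length, wt N.S c ≠ 1 → wt w c = 0) ∧ ¬ D ∣ pairN T D w N.p)
  · obtain ⟨w, ⟨C, hC, hK, hw, hc1, hc2⟩, hs⟩ := node_min hF hT h32 hcons _ (by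
      rintro w c cp e hlt hq ⟨hc1, hc2⟩
      constructor
      · intro x hx hSx
        unfold sapp; rw [wt_tab hx]
        have hty := hq.sym.ty x hx
        rw [hc1 _ (hq.sym.lt x hx)]
        · exact ((hT.tok x hx).phi_zero _ (hq.sym.aut x hx) 0 (hT.tok x hx).ncl1).mp rfl
        · unfold sw; split_ifs with e1 e2
          · rw [hq.hS, ← e1]; exact hSx
          · rw [← hq.hS, ← e2]; exact hSx
          · exact hSx
      · have e : pairN T D (sapp T (sw c cp) (swe (ty T c) c cp e) w) N.p =
            pairN T D (sapp T (sw c cp) (swe (ty T c) c cp e) w) (sapp T (sw c cp) (swe (ty T c) c cp e) N.p) := by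
          rw [pairN, pairN, sumN_eq, sumN_eq]
          refine Finset.sum_congr rfl fun x hx => ?_
          have hx := Finset.mem_range.mp hx
          have e2 : wt (sapp T (sw c cp) (swe (ty T c) c cp e) N.p) x = wt N.p x := by
            unfold sapp; rw [wt_tab hx]; exact hq.fix hT List.mem_cons_self hplt hx
          rw [e2]
        rw [e, pair_sapp hT hq.sym hlt hplt]; exact hc2) hu
    have hlt := hF.lt C hC w hw
    have hmem := hs (fun c => bif Nat.beq (wt N.S c) 1 then List.range (ncl (ty T c)) else [0]) (by
      intro c hc
      simp only [beq_dec, Bool.cond_eq_ite, decide_eq_true_eq]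
      split_ifs with hS
      · exact List.mem_range.mpr (hlt c hc)
      · simp [hc1 c hc hS])
    obtain ⟨r, hr⟩ := zipOK_spec h3 (w := w) (by
      rw [List.mem_filter]
      refine ⟨hmem, ?_⟩
      rw [adm_iff hF hC hw, s3_eq, beq_dec]
      simp only [Bool.true_and, Bool.not_eq_true', decide_eq_false_iff_not]
      intro h; exact hc2 (Nat.dvd_of_mod_eq_zero h))
    exact resOK_spec hF hr hC hK hw
  · have hex' : ∃ w, ∃ C ∈ F, Sub C N.K ∧ w ∈ C ∧ (∀ c < T.length, wt N.S c = 1 → wt w c = wt N.p c) := by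
      obtain ⟨C, hC, hK⟩ := hex
      obtain ⟨w, hw, hwp⟩ := hF.surj C hC (fun c => Nat.beq (wt N.S c) 1) N.p hplt (by
        intro c hc hS
        rw [beq_dec, decide_eq_false_iff_not] at hS
        have := h2 c hc
        omega) (by
        intro w hw hS
        by_contra hcon
        exact hu ⟨w, C, hC, hK, hw, fun c hc hS' => hS c hc (by rw [beq_dec, decide_eq_false_iff_not]; exact hS'), hcon⟩)
      exact ⟨w, C, hC, hK, hw, fun c hc hS => hwp c hc (by rw [beq_dec, decide_eq_true_eq]; exact hS)⟩
    obtain ⟨w, ⟨C, hC, hK, hw, hc1⟩, hs⟩ := node_min hF hT h32 hcons (fun w => ∀ c < T.length, wt N.S c = 1 → wt w c = wt N.p c) (by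
      rintro w c cp e hlt hq hc1 x hx hSx
      have e2 := hq.fix hT List.mem_cons_self hplt hx
      have e4 : wt N.S (sw c cp x) = 1 := by
        unfold sw; split_ifs with e1 e3
        · rw [hq.hS, ← e1]; exact hSx
        · rw [← hq.hS, ← e3]; exact hSx
        · exact hSx
      unfold sapp; rw [wt_tab hx, ← e2]
      rw [hc1 _ (hq.sym.lt x hx) e4]) hex'
    have hlt := hF.lt C hC w hw
    have hmem := hs (fun c => bif Nat.beq (wt N.S c) 1 then [wt N.p c] else List.range (ncl (ty T c))) (by
      intro c hc
      simp only [beq_dec, Bool.cond_eq_ite, decide_eq_true_eq]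
      split_ifs with hS
      · simp [hc1 c hc hS]
      · exact List.mem_range.mpr (hlt c hc))
    obtain ⟨r, hr⟩ := zipOK_spec h4 (w := w) (by
      rw [List.mem_filter]
      exact ⟨hmem, adm_iff hF hC hw⟩)
    exact resOK_spec hF hr hC hK hw

theorem certOK_spec (hF : Fam T D F) (hT : FOK T D) (h32 : ∀ c < T.length, ncl (ty T c) < 32) {gens : List (List ℕ)} (nodes : List Node) :
    ∀ prev, certOK T D nodes prev = true → (∀ K ∈ prev, (∃ C ∈ F, Sub C K) → ∃ C ∈ F, Sub C gens) →
    ∀ N ∈ nodes, (∃ C ∈ F, Sub C N.K) → ∃ C ∈ F, Sub C gens := by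
  induction nodes with
  | nil => intro _ _ _ N hN; simp at hN
  | cons N nodes ih =>
    intro prev h hp
    change (nodeOK T D prev N && certOK T D nodes (prev ++ [N.K])) = true at h
    rw [Bool.and_eq_true] at h
    have hN : (∃ C ∈ F, Sub C N.K) → ∃ C ∈ F, Sub C gens := by
      intro hex
      obtain ⟨Kj, hKj, hex'⟩ := nodeOK_spec hF hT h32 h.1 hex
      exact hp Kj hKj hex'
    intro N' hN'
    rcases List.mem_cons.mp hN' with rfl | hN'
    · exact hN
    · refine ih _ h.2 ?_ N' hN'
      intro K hK
      rcases List.mem_append.mp hK with hK | hK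
      · exact hp K hK
      · rw [List.mem_singleton.mp hK]; exact hN

end

end Nie

end ModChecker

section ModCerts
open scoped BigOperators

namespace Nie

/-- digits, lowest first -/
def dg (b m n : ℕ) : List ℕ := Nat.rec (fun _ => []) (fun _ ih n => (n % b) :: ih (n / b)) m n

def D0 : ℕ := 2
def w0 (n : ℕ) : List ℕ := dg 10 24 n
def gens0 : List (List ℕ) := [(w0 100110101100010000000001), (w0 110010100011010000000010), (w0 110101001010010000000100), (w0 10111000101010000001000), (w0 11100101001010000010000), (w0 101011000110010000100000), (w0 1101111010001000000), (w0 1110100111000010000000), (w0 101101001101000100000000), (w0 11011001011001000000000), (w0 111000101110100000000000), (w0 111111110000000000000000)]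
def cert0 : List Node :=
  [⟨[(w0 100110101100010000000001), (w0 101001101000011000000010), (w0 110101001010010000000100), (w0 10111000101010000001000), (w0 11100101001010000010000), (w0 101011000110010000100000), (w0 11010100100011001000000), (w0 1110100111000010000000), (w0 110110000110001100000000), (w0 111000101110100000000000), (w0 111111110000000000000000)], (w0 1100111001001111011010), (w0 100001000), [],
   [],
   [.ref 0 (dg 100 24 190723130316201012111508220105210004170218061409) [] [dg 10 12 10000010100, dg 10 12 1100010100, dg 10 12 100110000100, dg 10 12 111100010100, dg 10 12 1100001100, dg 10 12 101000001111, dg 10 12 111000100100, dg 10 12 1001, dg 10 12 100000011011, dg 10 12 110101001011, dg 10 12 10100000000, dg 10 12 100100010000]]⟩,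
   ⟨[(w0 100110101100010000000001), (w0 11111101110010100000010), (w0 110101001010010000000100), (w0 10111000101010000001000), (w0 101010101111011100010000), (w0 101011000110010000100000), (w0 11010100100011001000000), (w0 111000100001001110000000), (w0 111000101110100000000000), (w0 111111110000000000000000)], (w0 111100101001111011010), (w0 1000000010), [],
   [],
   [.ref 1 (dg 100 24 232221201918171615141312111009080706050403020100) [] [dg 10 11 10, dg 10 11 11000000011, dg 10 11 1000, dg 10 11 10000, dg 10 11 11000100111, dg 10 11 1000000, dg 10 11 10000000, dg 10 11 11100000111, dg 10 11 11000000111, dg 10 11 1000000000, dg 10 11 10000000000],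
    .ref 1 (dg 100 24 90804171100071605192110140618132315032202012012) [] [dg 10 11 10111001111, dg 10 11 111100010, dg 10 11 11000110, dg 10 11 10010000101, dg 10 11 11111101111, dg 10 11 10010111101, dg 10 11 10110101111, dg 10 11 1100100000, dg 10 11 10000001111, dg 10 11 11101101111, dg 10 11 100101101]]⟩,
   ⟨[(w0 100110101100010000000001), (w0 10111000100010100000010), (w0 110101001010010000000100), (w0 11111101111010000001000), (w0 100010000101011100010000), (w0 101011000110010000100000), (w0 10010001110011001000000), (w0 111000100001001110000000), (w0 111000101110100000000000), (w0 111111110000000000000000)], (w0 111010000101001111011010), (w0 111010000), [],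
   [],
   [.ref 1 (dg 100 24 60104171905071100142122160918151013030223082012) [] [dg 10 11 11000100011, dg 10 11 111100010, dg 10 11 11000110, dg 10 11 11111100101, dg 10 11 11010001111, dg 10 11 11101010001, dg 10 11 11010000101, dg 10 11 100100000, dg 10 11 11100100101, dg 10 11 1000000111, dg 10 11 10001000101],
    .ref 1 (dg 100 24 2120012206180209100819230504121403151116170713) [] [dg 10 11 11111100111, dg 10 11 111100010, dg 10 11 11000110, dg 10 11 1101100101, dg 10 11 10111100101, dg 10 11 11101100011, dg 10 11 11111010001, dg 10 11 100, dg 10 11 11110000111, dg 10 11 11110100011, dg 10 11 11100101111]]⟩,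
   ⟨[(w0 100110101100010000000001), (w0 101001010001101000010), (w0 110101001010010000000100), (w0 1101100001001001001000), (w0 110000001011000101010000), (w0 101011000110010000100000), (w0 111000100001001110000000), (w0 111000101110100000000000), (w0 111111110000000000000000)], (w0 110100100101001111011010), (w0 1000111000000), [],
   [],
   [.ref 2 (dg 100 24 232221201918171615141312111009080706050403020100) [] [dg 10 10 10, dg 10 10 11000101, dg 10 10 1000, dg 10 10 11010001, dg 10 10 11100001, dg 10 10 1000000, dg 10 10 11000001, dg 10 10 10000000, dg 10 10 100000000, dg 10 10 1000000000],
    .ref 2 (dg 100 24 40723190816220114091118061221001317101520030502) [] [dg 10 10 10101011, dg 10 10 1111000010, dg 10 10 1110110000, dg 10 10 1010000000, dg 10 10 110100001, dg 10 10 1110100011, dg 10 10 10000000, dg 10 10 100001, dg 10 10 110100000, dg 10 10 1010100100],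
    .ref 3 (dg 100 24 232221201918171615141312111009080706050403020100) [] [dg 10 10 10, dg 10 10 1011001101, dg 10 10 1000, dg 10 10 1011011001, dg 10 10 1011101001, dg 10 10 1000000, dg 10 10 1011001001, dg 10 10 10000000, dg 10 10 100000000, dg 10 10 1000000000],
    .ref 2 (dg 100 24 70421001205170318082016010614231011150219092213) [] [dg 10 10 1000001001, dg 10 10 1100010, dg 10 10 11100010, dg 10 10 1001100010, dg 10 10 11, dg 10 10 1001001011, dg 10 10 100100000, dg 10 10 101011, dg 10 10 10100100, dg 10 10 11110010]]⟩,
   ⟨[(w0 100110101100010000000001), (w0 110101000001001000010010), (w0 110101001010010000000100), (w0 1101100001001001001000), (w0 101011000110010000100000), (w0 111000100001001110000000), (w0 111000101110100000000000), (w0 111111110000000000000000)], (w0 11000100101101111011011), (w0 110000000), [[],[(4,0)],[],[(6,0)],[],[],[],[(8,0)],[],[(12,0)]],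
   [.ref 4 (dg 100 24 232221201918171615141312111009080706050403020100) [] [dg 10 9 10, dg 10 9 11010001, dg 10 9 1000, dg 10 9 10000, dg 10 9 11010101, dg 10 9 100000, dg 10 9 1000000, dg 10 9 10000000, dg 10 9 100000000]],
   []⟩,
   ⟨[(w0 100110101100010000000001), (w0 111000100000000001011010), (w0 110101001010010000000100), (w0 101011000110010000100000), (w0 111000100001001110000000), (w0 111000101110100000000000), (w0 111111110000000000000000)], (w0 11111100001001111011011), (w0 1010), [[],[(3,0)],[],[],[(6,0)],[],[],[(8,0)],[(9,0)],[(12,0)]],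
   [.ref 5 (dg 100 24 141115000205131019181612201709080706230403210122) [] [dg 10 8 1010, dg 10 8 1110011, dg 10 8 11010010, dg 10 8 110111, dg 10 8 10011000, dg 10 8 1100000, dg 10 8 11000000, dg 10 8 1011010],
    .ref 5 (dg 100 24 162019212223181705021012001109080704140601150313) [] [dg 10 8 11011000, dg 10 8 10100101, dg 10 8 11010000, dg 10 8 100001, dg 10 8 11001000, dg 10 8 10100000, dg 10 8 10011010, dg 10 8 10000000],
    .ref 5 (dg 100 24 20510141315001118191612201709080704210601230322) [] [dg 10 8 1010, dg 10 8 111101, dg 10 8 10011000, dg 10 8 100011, dg 10 8 10001000, dg 10 8 111010, dg 10 8 10011010, dg 10 8 1011010]],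
   []⟩,
   ⟨[(w0 100110101100010000000001), (w0 111000100000000001011010), (w0 11110001100000000100100), (w0 111000100001001110000000), (w0 111000101110100000000000), (w0 111111110000000000000000)], (w0 1110101011111011011), (w0 1000000000000000001), [[],[(3,0)],[(5,0)],[(4,0)],[(6,0)],[],[],[(8,0)],[(9,0)],[(12,0)],[],[(13,0)],[],[],[],[],[],[],[],[(20,0)],[],[(22,0)]],
   [.bad (dg 10 7 1111),
    .bad (dg 10 7 11011),
    .bad (dg 10 7 1000101),
    .bad (dg 10 7 10101)],
   [.bad (dg 10 7 1101001),
    .ref 6 (dg 100 24 20510181916002013141112152209080706230403210117) [] [dg 10 7 100001, dg 10 7 1110, dg 10 7 1101000, dg 10 7 1000011, dg 10 7 11010, dg 10 7 101010, dg 10 7 1001010]]⟩,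
   ⟨[(w0 111000100000010000100101), (w0 111000100000000001011010), (w0 111000100001001110000000), (w0 111000101110100000000000), (w0 111111110000000000000000)], (w0 100111001111011011), (w0 10000000000000), [[],[(3,0)],[(5,0)],[(4,0)],[(6,0)],[(10,0)],[],[(8,0)],[(9,0)],[(12,0)],[],[(15,0)],[],[],[],[],[(18,0)],[],[(19,0)],[(20,0)],[],[(22,0)],[(23,0)]],
   [.bad (dg 10 6 10101),
    .bad (dg 10 6 1101)],
   [.bad (dg 10 6 100011),
    .ref 7 (dg 100 24 100502222123001713111506142004030112180908160719) [] [dg 10 6 100011, dg 10 6 1010, dg 10 6 1, dg 10 6 110, dg 10 6 10010, dg 10 6 10],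
    .bad (dg 10 6 110001)]⟩,
   ⟨[(w0 111000100000010000100101), (w0 1001111011010), (w0 111000101110100000000000), (w0 111111110000000000000000)], (w0 1111010001001111011010), (w0 1000000000000000000), [[(2,0)],[(3,0)],[(5,0)],[(4,0)],[(6,0)],[(10,0)],[(7,0)],[(8,0)],[(9,0)],[(12,0)],[],[(13,0)],[],[(14,0)],[(15,0)],[],[(19,0)],[(22,0)],[],[(20,0)],[],[],[(23,0)]],
   [.bad (dg 10 5 101),
    .ref 8 (dg 100 24 100502060403000123222120171219181615091413081107) [] [dg 10 5 10111, dg 10 5 1010, dg 10 5 10010, dg 10 5 10, dg 10 5 10011],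
    .bad (dg 10 5 11101)],
   [.bad (dg 10 5 1011),
    .bad (dg 10 5 11),
    .bad (dg 10 5 1001)]⟩,
   ⟨[(w0 1110110000100101), (w0 1001111011010), (w0 111111110000000000000000)], (w0 110001001111011010), (w0 10000000000000000), [[(2,0)],[(3,0)],[(5,0)],[(4,0)],[(6,0)],[(10,0)],[(7,0)],[(8,0)],[(9,0)],[(12,0)],[(11,0)],[(13,0)],[],[(14,0)],[(15,0)],[],[],[],[(19,0)],[(20,0)],[(21,0)],[(22,0)],[(23,0)]],
   [.bad (dg 10 4 101)],
   [.bad (dg 10 4 11),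
    .ref 9 (dg 100 24 151413201918111623222112171009080706050403020100) [] [dg 10 4 10, dg 10 4 100, dg 10 4 1011, dg 10 4 11],
    .bad (dg 10 4 11),
    .bad (dg 10 4 1001),
    .bad (dg 10 4 1011)]⟩,
   ⟨[(w0 111111111110110000100101), (w0 1001111011010)], (w0 10000000001001111111010), (w0 100000), [[(2,0)],[(3,0)],[(10,0)],[(4,0)],[(6,0)],[],[(7,0)],[(8,0)],[(9,0)],[(12,0)],[(11,0)],[(13,0)],[],[(14,0)],[(15,0)],[(16,0)],[(17,0)],[(18,0)],[(19,0)],[(20,0)],[(21,0)],[(23,0)]],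
   [.bad (dg 10 3 101)],
   [.ref 10 (dg 100 24 232221201918171615141312111009080706050403020100) [] [dg 10 3 1, dg 10 3 100, dg 10 3 11],
    .bad (dg 10 3 11)]⟩,
   ⟨[(w0 111111100000110000100101), (w0 111100000000111111010010), (w0 111100011111110000001000)], (w0 100011100010010000100010), (w0 10000000000), [[(2,0)],[],[],[(12,0)],[(6,0)],[(17,0)],[(7,0)],[(8,0)],[(9,0)],[],[],[(20,0)],[(14,0)],[],[(15,0)],[(16,0)],[],[(18,0)],[(19,0)],[],[(21,0)],[(22,0)]],
   [],
   [.ref 11 (dg 100 24 232221201615141312110919080718171005060302040100) [] [dg 10 4 1001, dg 10 4 111],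
    .ref 11 (dg 100 24 191817161514131211100823070622212009050201040003) [] [dg 10 4 1011, dg 10 4 101],
    .ref 11 (dg 100 24 232221201918171615141312090811100604070302050001) [] [dg 10 4 1111, dg 10 4 1],
    .ref 11 (dg 100 24 191817161514131110080723060522212012040903020100) [] [dg 10 4 1011, dg 10 4 101],
    .ref 11 (dg 100 24 232221201918171615131114090812100706050403020001) [] [dg 10 4 1111, dg 10 4 1],
    .ref 11 (dg 100 24 232221201918171613090815070614121110050302040001) [] [dg 10 4 1111, dg 10 4 1],
    .ref 11 (dg 100 24 191817151412111009080723050322212016021306010400) [] [dg 10 4 111, dg 10 4 1001],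
    .ref 11 (dg 100 24 232221201918171514120816070613111009050201040003) [] [dg 10 4 11, dg 10 4 1101],
    .ref 11 (dg 100 24 232221201615141211090819070618171310030504010200) [] [dg 10 4 101, dg 10 4 1011],
    .bad (dg 10 4 1101),
    .ref 11 (dg 100 24 232221191817161514131220090811100706050403020001) [] [dg 10 4 1111, dg 10 4 1],
    .ref 11 (dg 100 24 201918171412111009080723060522211615031304020001) [] [dg 10 4 111, dg 10 4 1001],
    .ref 11 (dg 100 24 201918171615131110090823070622211412050301040002) [] [dg 10 4 1011, dg 10 4 101],
    .ref 11 (dg 100 24 201918171615141211100923080522211307030604020001) [] [dg 10 4 111, dg 10 4 1001],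
    .ref 11 (dg 100 24 212016151413121110090823070322191817020605010400) [] [dg 10 4 1101, dg 10 4 11],
    .bad (dg 10 4 101),
    .ref 11 (dg 100 24 212016151413111009080723060422191817021205010300) [] [dg 10 4 1101, dg 10 4 11],
    .ref 11 (dg 100 24 212019181716151413111023060522120908040703020100) [] [dg 10 4 1011, dg 10 4 101],
    .ref 11 (dg 100 24 212019181716151413111023080722120903060201050004) [] [dg 10 4 1011, dg 10 4 101],
    .bad (dg 10 4 1001),
    .ref 11 (dg 100 24 212019181715141211100923080722161306050402030001) [] [dg 10 4 111, dg 10 4 1001],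
    .ref 11 (dg 100 24 212019181715141211100923050322161308020706010400) [] [dg 10 4 111, dg 10 4 1001],
    .ref 11 (dg 100 24 222120191817161514131223111009080706050301040002) [] [dg 10 4 1011, dg 10 4 101],
    .bad (dg 10 4 101),
    .ref 11 (dg 100 24 222120191817141211100923080516151307030604020001) [] [dg 10 4 111, dg 10 4 1001],
    .bad (dg 10 4 1001),
    .ref 11 (dg 100 24 222120191817131110090823070616151412050301040002) [] [dg 10 4 1011, dg 10 4 101]]⟩,
   ⟨[(w0 111111100000110000100101), (w0 11111001111011010)], (w0 11100001000110100001000), (w0 100000000), [[(2,0)],[(4,0)],[(5,0)],[(15,0)],[(6,0)],[(17,0)],[(7,0)],[(9,0)],[],[(12,0)],[(11,0)],[(20,0)],[(13,0)],[(14,0)],[(16,0)],[],[],[(18,0)],[(19,0)],[(23,0)],[(21,0)],[(22,0)]],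
   [],
   [.ref 11 (dg 100 24 232221201918171110090816070615141312050302040001) [] [dg 10 3 11, dg 10 3 101],
    .bad (dg 10 3 101),
    .bad (dg 10 3 101),
    .ref 11 (dg 100 24 232221201918161514131217111008060504090201070003) [] [dg 10 3 111, dg 10 3 1],
    .ref 11 (dg 100 24 232221201918131211100917080716151405060302040001) [] [dg 10 3 11, dg 10 3 101],
    .ref 11 (dg 100 24 191817161514131209070623050422212011031008020100) [] [dg 10 3 101, dg 10 3 11],
    .ref 12 (dg 100 24 232221201918170908070604111016151413051201020300) [] [dg 10 3 10, dg 10 3 111, dg 10 3 11],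
    .ref 11 (dg 100 24 232221201614131211100919080718171505060302040001) [] [dg 10 3 11, dg 10 3 101]]⟩,
   ⟨[(w0 111111111111111111111111)], (w0 100000000000110000100111), (w0 10), [[(2,0)],[],[(5,0)],[(4,0)],[(6,0)],[(10,0)],[(7,0)],[(8,0)],[(9,0)],[(12,0)],[(11,0)],[(23,0)],[(13,0)],[(14,0)],[(15,0)],[(16,0)],[(17,0)],[(18,0)],[(19,0)],[(20,0)],[(21,0)],[(22,0)]],
   [],
   [.ref 11 (dg 100 24 232221201918171615141312111009080706050403020100) [] [dg 10 2 11, dg 10 2 1],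
    .ref 13 (dg 100 24 232221201918171615141312111009080706050403020100) [] [dg 10 2 11, dg 10 2 1],
    .ref 11 (dg 100 24 201918171615141312090823070622211110040502030001) [] [dg 10 2 1, dg 10 2 11]]⟩,
   ⟨[], (w0 111111111111111111111111), (w0 111111111111111111111111), [[(1,0)],[(2,0)],[(3,0)],[(4,0)],[(5,0)],[(6,0)],[(7,0)],[(8,0)],[(9,0)],[(10,0)],[(11,0)],[(12,0)],[(13,0)],[(14,0)],[(15,0)],[(16,0)],[(17,0)],[(18,0)],[(19,0)],[(20,0)],[(21,0)],[(22,0)],[(23,0)]],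
   [],
   [.ref 14 (dg 100 24 232221201918171615141312111009080706050403020100) [] [dg 10 1 1]]⟩]

def D1 : ℕ := 3
def w1 (n : ℕ) : List ℕ := dg 10 12 n
def gens1 : List (List ℕ) := [(w1 111010100001), (w1 22210100010), (w1 120120100100), (w1 121200201000), (w1 201220110000), (w1 112221000000)]
def cert1 : List Node :=
  [⟨[(w1 111010100001), (w1 210022100010), (w1 120120100100), (w1 12012201000), (w1 122002110000)], (w1 101001100101), (w1 100), [],
   [],
   [.ref 0 (dg 100 12 100408070201110500060309) (dg 10 12 111101111011) [dg 10 6 100201, dg 10 6 121000, dg 10 6 1201, dg 10 6 201122, dg 10 6 2000, dg 10 6 2],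
    .ref 0 (dg 100 12 100811060102050703040009) (dg 10 12 111011011100) [dg 10 6 201102, dg 10 6 102011, dg 10 6 2201, dg 10 6 122101, dg 10 6 100, dg 10 6 2100]]⟩,
   ⟨[(w1 22011020001), (w1 210022100010), (w1 120120100100), (w1 101011011000)], (w1 101110011100), (w1 201000010000), [[],[],[(8,0)],[],[(9,0)]],
   [.ref 1 (dg 100 12 31105080706040100020910) (dg 10 12 101011011000) [dg 10 5 2002, dg 10 5 10000, dg 10 5 2, dg 10 5 21021, dg 10 5 2202],
    .bad (dg 10 5 10002),
    .ref 1 (dg 100 12 31105080706040100020910) (dg 10 12 101011011000) [dg 10 5 2001, dg 10 5 10000, dg 10 5 1, dg 10 5 21022, dg 10 5 2201],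
    .bad (dg 10 5 10001)],
   []⟩,
   ⟨[(w1 102201100001), (w1 201110001010), (w1 102002202100), (w1 110220110000)], (w1 1110011101), (w1 2020021000), [],
   [.bad (dg 10 5 1212),
    .bad (dg 10 5 1211),
    .ref 2 (dg 100 12 30105040708110210000906) (dg 10 12 10000010111) [dg 10 5 1100, dg 10 5 200, dg 10 5 1111, dg 10 5 11012],
    .bad (dg 10 5 2022),
    .ref 2 (dg 100 12 40708100506030111000902) (dg 10 12 111011110110) [dg 10 5 1100, dg 10 5 1022, dg 10 5 11012, dg 10 5 2211],
    .ref 2 (dg 100 12 30105040708110210000906) (dg 10 12 10000010111) [dg 10 5 1100, dg 10 5 200, dg 10 5 1112, dg 10 5 11011],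
    .bad (dg 10 5 2021),
    .ref 2 (dg 100 12 40708100506030111000902) (dg 10 12 111011110110) [dg 10 5 1100, dg 10 5 1021, dg 10 5 11011, dg 10 5 2212]],
   []⟩,
   ⟨[(w1 22011020001), (w1 11000111010), (w1 22112122100)], (w1 1011100011), (w1 1021000012), [[],[],[(8,0)],[],[(10,0)],[],[],[],[],[],[],[(11,1)]],
   [],
   [.bad (dg 10 4 2102),
    .ref 2 (dg 100 12 309080607050410020111) (dg 10 12 11100111110) [dg 10 4 1211, dg 10 4 220, dg 10 4 2010, dg 10 4 10],
    .ref 3 (dg 100 12 71001081106050403000902) (dg 10 12 11101111010) [dg 10 4 1100, dg 10 4 2111, dg 10 4 110, dg 10 4 1122]]⟩,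
   ⟨[(w1 202201201), (w1 112200110)], (w1 11100111), (w1 2000211), [[],[],[],[],[(4,1),(9,0),(9,1)],[],[],[],[],[(9,1),(10,0),(10,1)],[(10,1),(11,0),(11,1)],[(11,1)]],
   [.bad (dg 10 3 102),
    .bad (dg 10 3 222),
    .bad (dg 10 3 221),
    .bad (dg 10 3 101)],
   [.bad (dg 10 3 211),
    .ref 4 (dg 100 12 111009080105060400020703) (dg 10 12 111101111) [dg 10 3 12, dg 10 3 211, dg 10 3 22]]⟩,
   ⟨[(w1 200200101201), (w1 100111000110)], (w1 11101110), (w1 1000), [[],[(6,0)],[],[],[(4,1),(9,0),(9,1)],[],[(7,0)],[],[(11,0)],[(9,1),(10,0),(10,1)],[(10,1)]],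
   [.bad (dg 10 3 221),
    .bad (dg 10 3 222)],
   [.ref 4 (dg 100 12 100706091102050103040008) (dg 10 12 11100111110) [dg 10 3 100, dg 10 3 220, dg 10 3 122]]⟩,
   ⟨[(w1 11101011)], (w1 11000011010), (w1 2000), [[(5,0)],[],[(2,1),(8,0),(8,1)],[],[(4,1),(9,0),(9,1)],[(6,0)],[(7,0)],[],[(8,1),(11,0),(11,1)],[(9,1),(10,0),(10,1)],[(10,1)],[(11,1)]],
   [],
   [.bad (dg 10 2 21),
    .bad (dg 10 2 11),
    .ref 5 (dg 100 12 111009080307010406020005) (dg 10 12 111101111) [dg 10 2 11, dg 10 2 12],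
    .ref 6 (dg 100 12 71009060503110408010002) (dg 10 12 100111000110) [dg 10 2 11, dg 10 2 20]]⟩,
   ⟨[], (w1 101010010100), (w1 10000000), [[(0,1),(1,0),(1,1)],[(1,1),(3,0),(3,1)],[(2,1),(4,0),(4,1)],[(3,1),(5,0),(5,1)],[(4,1),(9,0),(9,1)],[(5,1),(6,0),(6,1)],[(6,1),(8,0),(8,1)],[],[(8,1),(10,0),(10,1)],[(9,1),(11,0),(11,1)],[(10,1)],[(11,1)]],
   [],
   [.ref 7 (dg 100 12 111009080706050403020100) [] [dg 10 1 1]]⟩]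

def D2 : ℕ := 4
def w2 (n : ℕ) : List ℕ := dg 10 8 n
def gens2 : List (List ℕ) := [(w2 1302330), (w2 113230), (w2 12101122), (w2 21232031)]
def cert2 : List Node :=
  [⟨[(w2 1011120), (w2 10012310), (w2 13020301)], (w2 1000111), (w2 100), [[],[],[],[],[],[(5,1)]],
   [],
   [.ref 0 (dg 100 8 201000307060405) (dg 10 8 10101111) [dg 10 4 1120, dg 10 4 3210, dg 10 4 3222, dg 10 4 2123]]⟩,
   ⟨[(w2 1011120), (w2 10012310)], (w2 1010110), (w2 3020300), [[(0,1),(5,0),(5,1)],[],[],[],[],[(5,1)]],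
   [],
   [.ref 1 (dg 100 8 1050703060204) (dg 10 8 1000100) [dg 10 3 130, dg 10 3 21, dg 10 3 121]]⟩,
   ⟨[(w2 1011120)], (w2 10100001), (w2 10000000), [[(0,1),(5,0),(5,1)],[(1,1)],[(3,0)],[(4,0)],[(6,0)],[(5,1)]],
   [],
   [.ref 2 (dg 100 8 407050301060200) (dg 10 8 1100) [dg 10 2 31, dg 10 2 10]]⟩,
   ⟨[], (w2 100101), (w2 100), [[(0,1),(5,0),(5,1)],[(1,1),(3,0),(3,1)],[],[(3,1),(4,0),(4,1)],[(4,1),(6,0),(6,1)],[(5,1)],[(6,1),(7,0),(7,1)],[(7,1)]],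
   [],
   [.ref 3 (dg 100 8 706050403020100) [] [dg 10 1 1]]⟩]

def D3 : ℕ := 5
def w3 (n : ℕ) : List ℕ := dg 10 6 n
def gens3 : List (List ℕ) := [(w3 211422), (w3 14023), (w3 112313)]
def cert3 : List Node :=
  [⟨[(w3 213010), (w3 122100)], (w3 11010), (w3 20), [[(0,1)]],
   [],
   [.ref 0 (dg 100 6 50004010302) (dg 10 6 111111) [dg 10 3 122, dg 10 3 12, dg 10 3 32]]⟩,
   ⟨[(w3 330110)], (w3 110001), (w3 200000), [[(0,1)],[(2,0)],[],[(3,1)]],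
   [],
   [.ref 1 (dg 100 6 30401050200) (dg 10 6 110) [dg 10 2 22, dg 10 2 41]]⟩,
   ⟨[], (w3 11001), (w3 10000), [[(0,1),(3,0),(3,1)],[(1,1),(2,0),(2,1)],[(2,1),(5,0),(5,1)],[(3,1)],[],[(5,1)]],
   [],
   [.ref 2 (dg 100 6 50403020100) (dg 10 6 110110) [dg 10 1 2]]⟩]

def D4 : ℕ := 12
def w4 (n : ℕ) : List ℕ := dg 10 5 n
def gens4 : List (List ℕ) := [(w4 14123), (w4 11014), (w4 32134)]
def cert4 : List Node :=
  [⟨[(w4 10303), (w4 10303), (w4 20033), (w4 2022), (w4 20033)], (w4 10011), (w4 30021), [[],[],[(2,1)]],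
   [],
   [.ref 0 (dg 100 5 401030002) (dg 10 5 21101) [dg 10 6 10103, dg 10 6 100004, dg 10 6 10001]]⟩,
   ⟨[(w4 10303), (w4 10303), (w4 20033), (w4 2022)], (w4 10011), (w4 10000), [[],[],[(2,1)]],
   [.ref 1 (dg 100 5 403020001) (dg 10 5 51011) [dg 10 5 1100, dg 10 5 1100, dg 10 5 1000, dg 10 5 20000, dg 10 5 1000]],
   []⟩,
   ⟨[(w4 10303), (w4 10303), (w4 20033)], (w4 10101), (w4 2), [[],[(1,1)],[(2,1)],[(3,1)]],
   [],
   [.ref 1 (dg 100 5 403020001) (dg 10 5 51011) [dg 10 4 1100, dg 10 4 1100, dg 10 4 1000, dg 10 4 2, dg 10 4 1000]]⟩,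
   ⟨[(w4 10303), (w4 10303)], (w4 1010), (w4 30), [[(0,1),(2,0),(2,1)],[(1,1)],[(2,1)],[(3,1)],[(4,1)]],
   [],
   [.ref 3 (dg 100 5 403000201) (dg 10 5 40000) [dg 10 3 1, dg 10 3 1, dg 10 3 101]]⟩,
   ⟨[(w4 10303)], (w4 10101), (w4 20000), [[(0,1),(2,0),(2,1)],[(1,1),(3,0),(3,1)],[(2,1)],[(3,1)]],
   [.ref 4 (dg 100 5 403020100) [] [dg 10 2 10, dg 10 2 10]],
   []⟩,
   ⟨[], (w4 10101), (w4 1), [[],[(1,1),(3,0),(3,1)],[(2,1)],[(3,1)],[(4,1),(4,2),(4,3),(4,4),(4,5)]],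
   [.ref 4 (dg 100 5 403020100) [] [dg 10 1 1, dg 10 1 1]],
   []⟩]

def D5 : ℕ := 7
def w5 (n : ℕ) : List ℕ := dg 10 4 n
def gens5 : List (List ℕ) := [(w5 1450), (w5 6561)]
def cert5 : List Node :=
  [⟨[(w5 124)], (w5 101), (w5 100), [[],[],[],[(3,1)]],
   [],
   [.ref 0 (dg 100 4 1030200) (dg 10 4 1010) [dg 10 2 2, dg 10 2 26]]⟩,
   ⟨[], (w5 1001), (w5 4), [[],[(1,1),(2,0),(2,1)],[(2,1)],[(3,1)]],
   [],
   [.ref 1 (dg 100 4 3020100) (dg 10 4 111) [dg 10 1 6]]⟩]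

def D6 : ℕ := 8
def w6 (n : ℕ) : List ℕ := dg 10 4 n
def gens6 : List (List ℕ) := [(w6 1317), (w6 1224)]
def cert6 : List Node :=
  [⟨[(w6 2120), (w6 1102)], (w6 1010), (w6 1010), [],
   [],
   [.ref 0 (dg 100 4 2030001) (dg 10 4 1001) [dg 10 3 101, dg 10 3 120]]⟩,
   ⟨[(w6 2120)], (w6 110), (w6 100), [[(0,1)]],
   [],
   [.ref 1 (dg 100 4 2030100) (dg 10 4 10) [dg 10 2 30, dg 10 2 1]]⟩,
   ⟨[], (w6 1001), (w6 2000), [[(0,1)],[(1,1)],[(2,1)]],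
   [],
   [.ref 2 (dg 100 4 3020100) (dg 10 4 1110) [dg 10 1 3]]⟩]

def D7 : ℕ := 9
def w7 (n : ℕ) : List ℕ := dg 10 3 n
def gens7 : List (List ℕ) := [(w7 63), (w7 782)]
def cert7 : List Node :=
  [⟨[(w7 122)], (w7 110), (w7 600), [],
   [],
   [.ref 0 (dg 100 3 20001) (dg 10 3 111) [dg 10 2 31, dg 10 2 82]]⟩,
   ⟨[], (w7 10), (w7 20), [[(0,1),(2,0),(2,1)],[],[(2,1)]],
   [],
   [.ref 1 (dg 100 3 20100) (dg 10 3 111) [dg 10 1 8],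
    .ref 1 (dg 100 3 10200) (dg 10 3 111) [dg 10 1 4]]⟩]

def D8 : ℕ := 20
def w8 (n : ℕ) : List ℕ := dg 10 3 n
def gens8 : List (List ℕ) := [(w8 105), (w8 339)]
def cert8 : List Node :=
  [⟨[(w8 42), (w8 105), (w8 105), (w8 105), (w8 105), (w8 105), (w8 105), (w8 105)], (w8 101), (w8 206), [],
   [],
   [.ref 0 (dg 100 3 20100) (dg 10 3 11) [dg 10 9 100000000, dg 10 9 100000001]]⟩,
   ⟨[(w8 42), (w8 105), (w8 105), (w8 105), (w8 105), (w8 105), (w8 105)], (w8 101), (w8 100), [],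
   [.ref 1 (dg 100 3 20100) (dg 10 3 11) [dg 10 8 40, dg 10 8 10000000, dg 10 8 10000000, dg 10 8 10000000, dg 10 8 10000000, dg 10 8 10000000, dg 10 8 10000000, dg 10 8 10000000]],
   []⟩,
   ⟨[(w8 42), (w8 105), (w8 105), (w8 105), (w8 105), (w8 105)], (w8 101), (w8 104), [],
   [.ref 1 (dg 100 3 20100) (dg 10 3 11) [dg 10 7 40, dg 10 7 1000000, dg 10 7 1000000, dg 10 7 1000000, dg 10 7 1000000, dg 10 7 1000000, dg 10 7 1000000, dg 10 7 1000000]],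
   []⟩,
   ⟨[(w8 42), (w8 105), (w8 105), (w8 105), (w8 105)], (w8 101), (w8 100), [],
   [.ref 1 (dg 100 3 20100) (dg 10 3 11) [dg 10 6 40, dg 10 6 100000, dg 10 6 100000, dg 10 6 100000, dg 10 6 100000, dg 10 6 100000, dg 10 6 100000, dg 10 6 100000]],
   []⟩,
   ⟨[(w8 42), (w8 105), (w8 105), (w8 105)], (w8 101), (w8 7), [],
   [.ref 1 (dg 100 3 20100) (dg 10 3 11) [dg 10 5 40, dg 10 5 10000, dg 10 5 10000, dg 10 5 10000, dg 10 5 10000, dg 10 5 10000, dg 10 5 10000, dg 10 5 10000]],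
   []⟩,
   ⟨[(w8 42), (w8 105), (w8 105)], (w8 101), (w8 3), [],
   [.ref 1 (dg 100 3 20100) (dg 10 3 11) [dg 10 4 40, dg 10 4 1000, dg 10 4 1000, dg 10 4 1000, dg 10 4 1000, dg 10 4 1000, dg 10 4 1000, dg 10 4 1000]],
   []⟩,
   ⟨[(w8 42), (w8 105)], (w8 101), (w8 7), [],
   [.ref 1 (dg 100 3 20100) (dg 10 3 11) [dg 10 3 40, dg 10 3 100, dg 10 3 100, dg 10 3 100, dg 10 3 100, dg 10 3 100, dg 10 3 100, dg 10 3 100]],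
   []⟩,
   ⟨[(w8 42)], (w8 101), (w8 5), [[],[],[(2,1)]],
   [.ref 1 (dg 100 3 20100) (dg 10 3 11) [dg 10 2 40, dg 10 2 1, dg 10 2 1, dg 10 2 1, dg 10 2 1, dg 10 2 1, dg 10 2 1, dg 10 2 1]],
   []⟩,
   ⟨[], (w8 101), (w8 2), [[],[(1,1)],[(2,1)]],
   [],
   [.ref 8 (dg 100 3 20100) (dg 10 3 11) [dg 10 1 4]]⟩]

def D9 : ℕ := 12
def w9 (n : ℕ) : List ℕ := dg 100 3 n
def gens9 : List (List ℕ) := [(w9 20211)]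
def cert9 : List Node :=
  [⟨[(w9 306), (w9 203)], (w9 1), (w9 7), [[],[],[(2,1)]],
   [],
   [.ref 0 (dg 100 3 20100) (dg 10 3 111) [dg 100 3 101]]⟩,
   ⟨[(w9 306)], (w9 10100), (w9 200), [[(0,1)],[],[(2,1)]],
   [],
   [.ref 1 (dg 100 3 20100) (dg 10 3 11) [dg 100 2 100, dg 100 2 101]]⟩,
   ⟨[], (w9 1), (w9 6), [[(0,1)],[(1,1)],[(2,1)]],
   [],
   [.ref 2 (dg 100 3 20100) [] [dg 100 1 1]]⟩]

def D10 : ℕ := 13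
def w10 (n : ℕ) : List ℕ := dg 100 2 n
def gens10 : List (List ℕ) := [(w10 812)]
def cert10 : List Node :=
  [⟨[], (w10 1), (w10 1), [[],[(1,1)]],
   [],
   [.ref 0 (dg 100 2 1) (dg 10 2 1) [dg 100 1 8]]⟩]

def D11 : ℕ := 16
def w11 (n : ℕ) : List ℕ := dg 100 2 n
def gens11 : List (List ℕ) := [(w11 114)]
def cert11 : List Node :=
  [⟨[(w11 8), (w11 304)], (w11 1), (w11 6), [[],[(1,1)]],
   [],
   [.ref 0 (dg 100 2 100) [] [dg 100 3 101]]⟩,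
   ⟨[(w11 8)], (w11 100), (w11 300), [[(0,1)],[(1,1)]],
   [],
   [.ref 1 (dg 100 2 100) (dg 10 2 1) [dg 100 2 100, dg 100 2 101]]⟩,
   ⟨[], (w11 1), (w11 8), [[(0,1)],[(1,1)]],
   [],
   [.ref 2 (dg 100 2 100) [] [dg 100 1 1]]⟩]

def D12 : ℕ := 18
def w12 (n : ℕ) : List ℕ := dg 100 2 n
def gens12 : List (List ℕ) := [(w12 103)]
def cert12 : List Node :=
  [⟨[(w12 109)], (w12 1), (w12 12), [],
   [],
   [.ref 0 (dg 100 2 100) [] [dg 100 2 101]]⟩,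
   ⟨[], (w12 1), (w12 9), [[(0,1)]],
   [],
   [.ref 1 (dg 100 2 100) [] [dg 100 1 1]]⟩]

def D13 : ℕ := 25
def w13 (n : ℕ) : List ℕ := dg 100 1 n
def gens13 : List (List ℕ) := [(w13 20)]
def cert13 : List Node :=
  [⟨[], (w13 1), (w13 5), [],
   [],
   [.ref 0 (dg 100 1 0) [] [dg 100 1 4]]⟩]

def D14 : ℕ := 4
def w14 (n : ℕ) : List ℕ := dg 10 6 n
def gens14 : List (List ℕ) := [(w14 33210), (w14 230203), (w14 20113), (w14 133123), (w14 32033), (w14 200122)]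
def cert14 : List Node :=
  [⟨[(w14 11011), (w14 102021), (w14 220031), (w14 200122), (w14 33210)], (w14 11010), (w14 23030), [],
   [],
   [.ref 0 (dg 100 6 20501000403) (dg 10 6 203413) [dg 10 6 100001, dg 10 6 10100, dg 10 6 100101, dg 10 6 11, dg 10 6 1100, dg 10 6 11010]]⟩,
   ⟨[(w14 11011), (w14 102021), (w14 220031), (w14 200122)], (w14 110001), (w14 30000), [[],[],[(2,1)]],
   [],
   [.ref 1 (dg 100 6 50304020100) (dg 10 6 200511) [dg 10 5 10, dg 10 5 1000, dg 10 5 100, dg 10 5 11111, dg 10 5 1]]⟩,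
   ⟨[(w14 11011), (w14 102021), (w14 220031)], (w14 11010), (w14 20), [[(0,1)],[],[(2,1),(2,2),(2,3),(2,4),(2,5)]],
   [],
   [.ref 2 (dg 100 6 40503020100) (dg 10 6 2021) [dg 10 4 100, dg 10 4 10, dg 10 4 1000, dg 10 4 1001]]⟩,
   ⟨[(w14 11011), (w14 102021)], (w14 1011), (w14 31), [[(0,1)],[],[(2,1),(2,2),(2,3),(2,4),(2,5)],[],[(4,1)],[(5,1)]],
   [],
   [.ref 3 (dg 100 6 40305020100) (dg 10 6 220040) [dg 10 3 100, dg 10 3 1, dg 10 3 10]]⟩,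
   ⟨[(w14 11011)], (w14 10101), (w14 1), [[(0,1)],[(1,1),(3,0),(3,1)],[(2,1),(2,2),(2,3),(2,4),(2,5)],[(3,1)],[(4,1)],[(5,1),(5,2),(5,3),(5,4),(5,5)]],
   [],
   [.bad (dg 10 2 11),
    .ref 4 (dg 100 6 403020105) (dg 10 6 5050) [dg 10 2 11, dg 10 2 1]]⟩,
   ⟨[], (w14 101), (w14 1), [[(0,1)],[(1,1),(1,2),(1,3),(1,4),(1,5),(3,0),(3,1),(3,2),(3,3),(3,4),(3,5)],[(2,1),(2,2),(2,3),(2,4),(2,5)],[(3,1),(3,2),(3,3),(3,4),(3,5),(4,0),(4,1),(4,2),(4,3),(4,4),(4,5)],[(4,1),(4,2),(4,3),(4,4),(4,5),(5,0),(5,1),(5,2),(5,3),(5,4),(5,5)],[(5,1),(5,2),(5,3),(5,4),(5,5)]],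
   [],
   [.ref 5 (dg 100 6 50403020100) [] [dg 10 1 1]]⟩]

def D15 : ℕ := 4
def w15 (n : ℕ) : List ℕ := dg 10 4 n
def gens15 : List (List ℕ) := [(w15 132), (w15 1103), (w15 3110), (w15 2230)]
def cert15 : List Node :=
  [⟨[(w15 3333), (w15 1103), (w15 3110)], (w15 1010), (w15 3000), [[(0,1)]],
   [],
   [.ref 0 (dg 100 4 2030100) (dg 10 4 11) [dg 10 4 111, dg 10 4 100, dg 10 4 1110, dg 10 4 110]]⟩,
   ⟨[(w15 3333), (w15 1103)], (w15 1001), (w15 3000), [[(0,1)],[(1,1)]],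
   [],
   [.ref 1 (dg 100 4 2030100) (dg 10 4 10) [dg 10 3 10, dg 10 3 100, dg 10 3 111]]⟩,
   ⟨[(w15 3333)], (w15 11), (w15 3), [[(0,1)],[(1,1)],[(2,1),(3,0),(3,1)],[(3,1)]],
   [],
   [.ref 2 (dg 100 4 3020100) [] [dg 10 2 10, dg 10 2 1]]⟩,
   ⟨[], (w15 1001), (w15 3003), [[(0,1),(3,0),(3,1)],[(1,1),(2,0),(2,1)],[(2,1)],[(3,1)]],
   [],
   [.ref 3 (dg 100 4 3020100) [] [dg 10 1 1]]⟩]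

def D16 : ℕ := 4
def w16 (n : ℕ) : List ℕ := dg 10 3 n
def gens16 : List (List ℕ) := [(w16 133), (w16 313), (w16 201)]
def cert16 : List Node :=
  [⟨[(w16 313), (w16 133)], (w16 11), (w16 3), [[(0,1)]],
   [.ref 0 (dg 100 3 201) (dg 10 3 101) [dg 10 3 11, dg 10 3 100, dg 10 3 1]],
   []⟩,
   ⟨[(w16 313)], (w16 10), (w16 30), [[(0,1),(2,0),(2,1)],[],[(2,1)]],
   [],
   [.ref 1 (dg 100 3 20100) [] [dg 10 2 10, dg 10 2 1]]⟩,
   ⟨[], (w16 100), (w16 300), [[(0,1),(1,0),(1,1)],[(1,1)],[(2,1)]],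
   [],
   [.ref 2 (dg 100 3 20100) [] [dg 10 1 1]]⟩]

def D17 : ℕ := 4
def w17 (n : ℕ) : List ℕ := dg 10 2 n
def gens17 : List (List ℕ) := [(w17 31), (w17 13)]
def cert17 : List Node :=
  [⟨[(w17 13)], (w17 10), (w17 30), [[(0,1)]],
   [],
   [.ref 0 (dg 100 2 100) [] [dg 10 2 1, dg 10 2 10]]⟩,
   ⟨[], (w17 1), (w17 3), [[(0,1)],[(1,1)]],
   [],
   [.ref 1 (dg 100 2 100) [] [dg 10 1 1]]⟩]

def D18 : ℕ := 4
def w18 (n : ℕ) : List ℕ := dg 10 2 n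
def gens18 : List (List ℕ) := [(w18 1)]
def cert18 : List Node :=
  [⟨[], (w18 11), (w18 3), [[(0,1)]],
   [.ref 0 (dg 100 2 100) [] [dg 10 1 1]],
   []⟩]

def D19 : ℕ := 4
def w19 (n : ℕ) : List ℕ := dg 10 1 n
def gens19 : List (List ℕ) := [(w19 1)]
def cert19 : List Node :=
  [⟨[], (w19 1), (w19 3), [[(0,1)]],
   [.ref 0 (dg 100 1 0) [] [dg 10 1 1]],
   []⟩]

def D20 : ℕ := 3
def w20 (n : ℕ) : List ℕ := dg 10 4 n
def gens20 : List (List ℕ) := [(w20 111), (w20 2102), (w20 222)]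
def cert20 : List Node :=
  [⟨[(w20 111)], (w20 1000), (w20 1000), [[(1,0)],[(2,0)]],
   [],
   [.ref 0 (dg 100 4 30201) (dg 10 4 1110) [dg 10 2 22, dg 10 2 2, dg 10 2 11]]⟩,
   ⟨[], (w20 1), (w20 1), [[],[(1,1),(2,0),(2,1)],[(2,1),(3,0),(3,1)],[(3,1)]],
   [],
   [.ref 1 (dg 100 4 3020100) [] [dg 10 1 1]]⟩]

def D21 : ℕ := 4
def w21 (n : ℕ) : List ℕ := dg 10 3 n
def gens21 : List (List ℕ) := [(w21 101), (w21 113)]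
def cert21 : List Node :=
  [⟨[(w21 113)], (w21 1), (w21 2), [[],[(2,0)]],
   [],
   [.ref 0 (dg 100 3 20100) [] [dg 10 2 11, dg 10 2 10]]⟩,
   ⟨[], (w21 1), (w21 3), [[(0,1)],[(2,0)]],
   [],
   [.ref 1 (dg 100 3 20100) [] [dg 10 1 1]]⟩]

def D22 : ℕ := 1
def w22 (n : ℕ) : List ℕ := dg 10 3 n
def gens22 : List (List ℕ) := []
def cert22 : List Node :=
  []


def tD : List ℕ := [D0, D1, D2, D3, D4, D5, D6, D7, D8, D9, D10, D11, D12, D13, D14, D15, D16, D17, D18, D19, D20, D21, D22]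
def tG : List (List (List ℕ)) := [gens0, gens1, gens2, gens3, gens4, gens5, gens6, gens7, gens8, gens9, gens10, gens11, gens12, gens13, gens14, gens15, gens16, gens17, gens18, gens19, gens20, gens21, gens22]
def tC : List (List Node) := [cert0, cert1, cert2, cert3, cert4, cert5, cert6, cert7, cert8, cert9, cert10, cert11, cert12, cert13, cert14, cert15, cert16, cert17, cert18, cert19, cert20, cert21, cert22]
set_option maxRecDepth 100000
theorem ck0 : certOK (types.getD 0 []) D0 cert0 [gens0] = true := by decide +kernel
theorem ck1 : certOK (types.getD 1 []) D1 cert1 [gens1] = true := by decide +kernel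
theorem ck2 : certOK (types.getD 2 []) D2 cert2 [gens2] = true := by decide +kernel
theorem ck3 : certOK (types.getD 3 []) D3 cert3 [gens3] = true := by decide +kernel
theorem ck4 : certOK (types.getD 4 []) D4 cert4 [gens4] = true := by decide +kernel
theorem ck5 : certOK (types.getD 5 []) D5 cert5 [gens5] = true := by decide +kernel
theorem ck6 : certOK (types.getD 6 []) D6 cert6 [gens6] = true := by decide +kernel
theorem ck7 : certOK (types.getD 7 []) D7 cert7 [gens7] = true := by decide +kernel
theorem ck8 : certOK (types.getD 8 []) D8 cert8 [gens8] = true := by decide +kernel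
theorem ck9 : certOK (types.getD 9 []) D9 cert9 [gens9] = true := by decide +kernel
theorem ck10 : certOK (types.getD 10 []) D10 cert10 [gens10] = true := by decide +kernel
theorem ck11 : certOK (types.getD 11 []) D11 cert11 [gens11] = true := by decide +kernel
theorem ck12 : certOK (types.getD 12 []) D12 cert12 [gens12] = true := by decide +kernel
theorem ck13 : certOK (types.getD 13 []) D13 cert13 [gens13] = true := by decide +kernel
theorem ck14 : certOK (types.getD 14 []) D14 cert14 [gens14] = true := by decide +kernel
theorem ck15 : certOK (types.getD 15 []) D15 cert15 [gens15] = true := by decide +kernel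
theorem ck16 : certOK (types.getD 16 []) D16 cert16 [gens16] = true := by decide +kernel
theorem ck17 : certOK (types.getD 17 []) D17 cert17 [gens17] = true := by decide +kernel
theorem ck18 : certOK (types.getD 18 []) D18 cert18 [gens18] = true := by decide +kernel
theorem ck19 : certOK (types.getD 19 []) D19 cert19 [gens19] = true := by decide +kernel
theorem ck20 : certOK (types.getD 20 []) D20 cert20 [gens20] = true := by decide +kernel
theorem ck21 : certOK (types.getD 21 []) D21 cert21 [gens21] = true := by decide +kernel
theorem ck22 : certOK (types.getD 22 []) D22 cert22 [gens22] = true := by decide +kernel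
end Nie

end ModCerts

section ModCerts2
open scoped BigOperators

namespace Nie

set_option maxRecDepth 100000

def TT (i : ℕ) : List (ℕ × ℕ) := types.getD i []
def DD (i : ℕ) : ℕ := tD.getD i 0
def GG (i : ℕ) : List (List ℕ) := tG.getD i []

theorem ck_all : ∀ i < 23, certOK (TT i) (DD i) (tC.getD i []) [GG i] = true := by
  intro i hi
  interval_cases i
  exacts [ck0, ck1, ck2, ck3, ck4, ck5, ck6, ck7, ck8, ck9, ck10, ck11, ck12, ck13, ck14, ck15, ck16, ck17, ck18, ck19,
    ck20, ck21, ck22]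

def miscCheck (i : ℕ) : Bool :=
  ((GG i).isEmpty || (tC.getD i []).any fun N => N.K.isEmpty) && Nat.blt 0 (DD i) &&
  (TT i).all fun t => Nat.blt (ncl t) 32 && Nat.beq (DD i % den t) 0

theorem misc_all : allb 23 miscCheck = true := by decide +kernel

theorem TT_mem {i} (hi : i < 23) : TT i ∈ types := by
  interval_cases i <;> decide

theorem ty_mem {T : List (ℕ × ℕ)} {c} (hc : c < T.length) : ty T c ∈ T := by
  unfold ty; rw [List.getD_eq_getElem _ _ hc]; exact List.getElem_mem hc

theorem misc {i} (hi : i < 23) : FOK (TT i) (DD i) ∧ (∀ c < (TT i).length, ncl (ty (TT i) c) < 32) ∧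
    (GG i = [] ∨ ∃ N ∈ tC.getD i [], N.K = []) := by
  have h := allb_iff misc_all hi
  unfold miscCheck at h
  simp only [Bool.and_eq_true, Bool.or_eq_true, List.isEmpty_iff, List.any_eq_true, List.all_eq_true, Nat.blt_eq, Nat.beq_eq] at h
  obtain ⟨⟨h1, h2⟩, h3⟩ := h
  exact ⟨⟨fun c hc => tyOK (TT_mem hi) hc, h2, fun c hc => Nat.dvd_of_mod_eq_zero (h3 _ (ty_mem hc)).2⟩,
    fun c hc => (h3 _ (ty_mem hc)).1, h1⟩

theorem gens_in {G} (h : EUL G) {i} (hi : i < 23) (hv : ∃ v, Frame G (TT i) v) :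
    ∃ v, Frame G (TT i) v ∧ ∀ g ∈ GG i, g ∈ cod G (TT i) v := by
  obtain ⟨h1, h2, h3⟩ := misc hi
  obtain ⟨v, hv⟩ := hv
  rcases h3 with h3 | ⟨N, hN, hK⟩
  · exact ⟨v, hv, by rw [h3]; simp⟩
  · obtain ⟨C, ⟨v', hv', rfl⟩, hC⟩ := certOK_spec (gens := GG i) (fam_of_EUL h h1) h1 h2 _ _ (ck_all i hi)
      (by intro K hK; rw [List.mem_singleton] at hK; subst hK; exact id) N hN ⟨_, ⟨v, hv, rfl⟩, by rw [hK]; intro k hk; simp at hk⟩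
    exact ⟨v', hv', hC⟩

end Nie

end ModCerts2

section ModStdA
open scoped BigOperators

namespace Nie

/-- unit vector -/
def u (k : ℕ) : List ℤ := (List.range 24).map fun l => bif Nat.beq l k then 1 else 0

def kp0 : List (ℕ × ℕ) := [(10,0), (12,0), (13,0), (14,0), (15,0), (17,0), (18,0), (19,0), (20,0), (21,0), (22,0), (23,0)]
def vt0 : List (List (List ℤ)) :=
  [[[-1,0,0,-1,-1,-1,0,-1,-1,0,0,-1,2,0,0,0,0,0,0,0,0,0,0,0]], [[-1,-1,-1,0,0,-1,0,-1,0,0,-1,-1,0,2,0,0,0,0,0,0,0,0,0,0]], [[-1,0,-1,0,-1,0,-1,0,-1,0,-1,-1,0,0,2,0,0,0,0,0,0,0,0,0]], [[-1,-1,0,-1,0,0,-1,-1,-1,0,-1,0,0,0,0,2,0,0,0,0,0,0,0,0]], [[-1,-1,0,0,-1,-1,0,0,-1,-1,-1,0,0,0,0,0,2,0,0,0,0,0,0,0]], [[-1,0,-1,-1,0,0,-1,-1,0,-1,0,-1,0,0,0,0,0,2,0,0,0,0,0,0]], [[-1,-1,-1,-1,-1,-1,-1,0,0,0,0,0,0,0,0,0,0,0,2,0,0,0,0,0]],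 [[0,-1,-1,-1,0,-1,0,-1,-1,-1,0,0,0,0,0,0,0,0,0,2,0,0,0,0]], [[0,-1,0,-1,-1,0,-1,0,-1,-1,0,-1,0,0,0,0,0,0,0,0,2,0,0,0]], [[0,-1,-1,0,-1,0,-1,-1,0,-1,-1,0,0,0,0,0,0,0,0,0,0,2,0,0]], [u 0], [[0,0,-1,-1,-1,-1,0,0,0,-1,-1,-1,0,0,0,0,0,0,0,0,0,0,2,0]], [u 1], [u 2], [u 3], [u 4], [[0,0,0,0,0,-1,-1,-1,-1,-1,-1,-1,0,0,0,0,0,0,0,0,0,0,0,2]], [u 5], [u 6], [u 7], [u 8], [u 9], [u 10], [u 11]]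
def kp1 : List (ℕ × ℕ) := [(0,0), (1,0), (2,0), (3,0), (4,0), (5,0), (5,1), (6,0), (7,0), (7,1), (8,0), (8,1), (9,0), (9,1), (10,0), (10,1), (11,0), (11,1)]
def vt1 : List (List (List ℤ)) :=
  [[u 0, [-2,0,0,0,0,-2,-1,0,-2,-1,0,0,-2,-1,-2,-1,-2,-1,3,0,0,0,0,0]], [u 1, [0,-2,0,0,0,-2,-1,0,-2,-1,-1,-2,-1,-2,-1,-2,0,0,0,3,0,0,0,0]], [u 2, [0,0,-2,0,0,-2,-1,0,-1,-2,-2,-1,0,0,-1,-2,-2,-1,0,0,3,0,0,0]], [u 3, [0,0,0,-2,0,-1,-2,0,0,0,-1,-2,-2,-1,-1,-2,-2,-1,0,0,0,3,0,0]], [u 4, [0,0,0,0,-2,-2,-1,0,-1,-2,-1,-2,-2,-1,0,0,-1,-2,0,0,0,0,3,0]], [u 5, u 6], [u 7, [0,0,0,0,0,0,0,-2,-1,-2,-1,-2,-1,-2,-2,-1,-2,-1,0,0,0,0,0,3]], [u 8, u 9], [u 10, u 11], [u 12, u 13], [u 14, u 15], [u 16, u 17]]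
def kp2 : List (ℕ × ℕ) := [(0,0), (0,1), (0,2), (1,1), (1,2), (2,0), (2,1), (2,2), (3,0), (3,1), (3,2), (4,1), (4,2), (5,1), (5,2), (6,0), (6,1), (7,0), (7,1), (7,2)]
def vt2 : List (List (List ℤ)) :=
  [[u 0, u 1, u 2], [[9,6,3,-2,-3,-5,-10,-11,-1,-2,-3,4,8,4,-4,0,0,6,12,6,12,4,0,-12], u 3, u 4], [u 5, u 6, u 7], [u 8, u 9, u 10], [[-1,2,1,0,-4,2,0,-2,-1,-6,-3,-2,-3,-4,-4,-4,0,1,-2,-1,4,0,-4,4], u 11, u 12], [[-2,-4,-2,0,4,-1,2,5,1,6,3,0,0,2,5,4,0,-3,-2,-1,-8,0,4,0], u 13, u 14], [u 15, u 16, [-7,-2,-1,0,-4,5,6,3,-2,-8,-2,-4,-8,-8,-4,-7,-2,-3,-10,-5,0,-4,-4,12]], [u 17, u 18, u 19]]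
def kp3 : List (ℕ × ℕ) := [(0,0), (0,1), (0,2), (1,1), (1,2), (1,3), (2,0), (2,1), (2,2), (2,3), (3,0), (3,1), (3,2), (3,3), (4,0), (4,1), (4,2), (5,0), (5,1), (5,2), (5,3)]
def vt3 : List (List (List ℤ)) :=
  [[u 0, u 1, u 2, [1,2,-2,0,0,0,1,2,3,4,3,1,-1,-3,0,0,0,3,6,4,2,-5,5,0]], [[0,0,0,3,2,1,-2,-4,-6,-3,-2,-4,-1,2,0,0,0,-4,-3,-2,-1,0,-5,5], u 3, u 4, u 5], [u 6, u 7, u 8, u 9], [u 10, u 11, u 12, u 13], [u 14, u 15, u 16, [-5,-10,0,-15,-10,-5,3,6,9,-3,-4,7,3,-1,-4,-3,-2,3,-9,-6,-3,15,5,-15]], [u 17, u 18, u 19, u 20]]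
def kp4 : List (ℕ × ℕ) := [(0,0), (0,1), (0,2), (0,3), (0,4), (1,0), (1,1), (1,2), (1,3), (2,0), (2,1), (2,2), (2,3), (3,1), (3,2), (3,3), (3,4), (4,0), (4,1), (4,2), (4,3)]
def vt4 : List (List (List ℤ)) :=
  [[u 0, u 1, u 2, u 3, u 4], [u 5, u 6, u 7, u 8, [3,6,9,2,1,5,6,-3,-2,0,0,0,0,-4,2,8,4,9,2,4,-3,-10,-4,10]], [u 9, u 10, u 11, u 12, [-7,-14,-21,-6,-3,-10,-16,0,0,-5,-4,-3,-2,4,-8,-20,-10,-18,-5,-10,3,22,4,-16]], [[-1,-2,-3,-2,-1,-2,-2,0,0,0,0,0,0,0,-1,-2,-1,-3,-1,-2,0,2,2,-2], u 13, u 14, u 15, u 16], [u 17, u 18, u 19, u 20]]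
def kp5 : List (ℕ × ℕ) := [(0,0), (0,1), (0,2), (0,3), (0,4), (0,5), (1,0), (1,1), (1,2), (1,3), (1,4), (1,5), (2,0), (2,1), (2,2), (2,3), (2,4), (3,0), (3,1), (3,2), (3,4), (3,5)]
def vt5 : List (List (List ℤ)) :=
  [[u 0, u 1, u 2, u 3, u 4, u 5], [u 6, u 7, u 8, u 9, u 10, u 11], [u 12, u 13, u 14, u 15, u 16, [18,15,12,9,6,3,-5,-10,-15,-20,-25,-2,-6,-12,-18,-24,-2,-21,-14,-7,7,14,28,-21]], [u 17, u 18, u 19, [-24,-20,-16,-12,-8,-4,6,12,18,24,30,1,7,14,21,28,0,26,17,8,-10,-19,-35,28], u 20, u 21]]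
def kp6 : List (ℕ × ℕ) := [(0,0), (0,1), (0,2), (0,3), (0,4), (0,5), (0,6), (1,0), (1,1), (1,2), (1,3), (1,4), (1,5), (2,0), (2,2), (2,3), (2,4), (3,0), (3,1), (3,2), (3,3), (3,4)]
def vt6 : List (List (List ℤ)) :=
  [[u 0, u 1, u 2, u 3, u 4, u 5, u 6], [u 7, u 8, u 9, u 10, u 11, u 12, [3,6,9,12,-1,-14,-27,-23,-6,-5,-4,-3,-2,-8,-16,-24,-32,-30,-18,-36,-24,-12,40,-16]], [u 13, [-1,-2,-3,-4,-1,2,5,4,0,0,0,0,0,1,2,4,6,5,3,6,4,2,-8,4], u 14, u 15, u 16], [u 17, u 18, u 19, u 20, u 21]]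
def kp7 : List (ℕ × ℕ) := [(0,0), (0,1), (0,2), (0,3), (0,4), (0,5), (0,6), (1,0), (1,1), (1,2), (1,3), (1,4), (1,5), (1,7), (2,0), (2,1), (2,2), (2,3), (2,4), (2,5), (2,6), (2,7)]
def vt7 : List (List (List ℤ)) :=
  [[u 0, u 1, u 2, u 3, u 4, u 5, u 6, [-14,-28,-6,-5,-4,-3,-2,3,6,9,12,15,18,-18,-8,-16,-24,-32,-40,-48,-56,-28,-21,36]], [u 7, u 8, u 9, u 10, u 11, u 12, [3,6,0,0,0,0,0,-1,-2,-3,-4,-5,-6,4,2,4,6,8,10,12,14,7,6,-9], u 13], [u 14, u 15, u 16, u 17, u 18, u 19, u 20, u 21]]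
def kp8 : List (ℕ × ℕ) := [(0,0), (0,1), (0,2), (0,3), (0,4), (0,5), (0,7), (0,8), (1,0), (1,1), (1,2), (1,3), (1,4), (1,5), (1,6), (1,7), (1,8), (2,0), (2,2), (2,3), (2,4), (2,5)]
def vt8 : List (List (List ℤ)) :=
  [[u 0, u 1, u 2, u 3, u 4, u 5, [-3,-6,-9,-12,-15,-8,6,13,14,28,42,36,30,24,18,12,6,-5,0,5,10,15,10,-20], u 6, u 7], [u 8, u 9, u 10, u 11, u 12, u 13, u 14, u 15, u 16], [u 17, [4,8,12,16,20,10,-10,-20,-21,-42,-63,-54,-45,-36,-27,-18,-9,6,-2,-9,-16,-23,-14,30], u 18, u 19, u 20, u 21]]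
def kp9 : List (ℕ × ℕ) := [(0,1), (0,2), (0,3), (0,4), (0,5), (0,6), (0,7), (0,8), (0,9), (0,10), (1,0), (1,1), (1,2), (1,3), (1,4), (1,5), (1,6), (2,0), (2,1), (2,2), (2,3), (2,4), (2,5)]
def vt9 : List (List (List ℤ)) :=
  [[[-2,-3,-4,-5,-6,-7,-8,-9,-10,-11,-15,-21,-30,-24,-18,-12,-6,-12,-8,-16,-24,-20,-16,12], u 0, u 1, u 2, u 3, u 4, u 5, u 6, u 7, u 8, u 9], [u 10, u 11, u 12, u 13, u 14, u 15, u 16], [u 17, u 18, u 19, u 20, u 21, u 22]]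
def kp10 : List (ℕ × ℕ) := [(0,1), (0,2), (0,3), (0,4), (0,5), (0,6), (0,7), (0,8), (0,9), (0,10), (0,11), (1,0), (1,1), (1,2), (1,3), (1,4), (1,5), (1,6), (1,7), (1,8), (1,9), (1,10), (1,11)]
def vt10 : List (List (List ℤ)) :=
  [[[-2,-3,-4,-5,-6,-7,-8,-9,-10,-11,-12,-5,-10,-15,-20,-25,-30,-35,-40,-32,-24,-16,-8,13], u 0, u 1, u 2, u 3, u 4, u 5, u 6, u 7, u 8, u 9, u 10], [u 11, u 12, u 13, u 14, u 15, u 16, u 17, u 18, u 19, u 20, u 21, u 22]]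
def kp11 : List (ℕ × ℕ) := [(0,1), (0,2), (0,3), (0,4), (0,5), (0,6), (0,7), (0,8), (0,9), (0,10), (0,11), (0,12), (0,13), (0,14), (1,0), (1,1), (1,2), (1,3), (1,4), (1,5), (1,6), (1,7), (1,8)]
def vt11 : List (List (List ℤ)) :=
  [[[-2,-3,-4,-5,-6,-7,-8,-9,-10,-11,-12,-13,-14,-7,-18,-14,-28,-24,-20,-16,-12,-8,-4,8], u 0, u 1, u 2, u 3, u 4, u 5, u 6, u 7, u 8, u 9, u 10, u 11, u 12, u 13], [u 14, u 15, u 16, u 17, u 18, u 19, u 20, u 21, u 22]]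
def kp12 : List (ℕ × ℕ) := [(0,0), (0,1), (0,2), (0,3), (0,4), (0,5), (0,6), (0,7), (0,8), (0,9), (0,10), (0,11), (0,12), (0,13), (0,14), (0,15), (1,0), (1,1), (1,2), (1,3), (1,4), (1,5), (1,6)]
def vt12 : List (List (List ℤ)) :=
  [[u 0, u 1, u 2, u 3, u 4, u 5, u 6, u 7, u 8, u 9, u 10, u 11, u 12, u 13, u 14, u 15, [-5,-10,-15,-14,-13,-12,-11,-10,-9,-8,-7,-6,-5,-4,-3,-2,-9,-6,-12,-18,-15,-12,-9,6]], [u 16, u 17, u 18, u 19, u 20, u 21, u 22]]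
def kp13 : List (ℕ × ℕ) := [(0,1), (0,2), (0,3), (0,4), (0,5), (0,6), (0,7), (0,8), (0,9), (0,10), (0,11), (0,12), (0,13), (0,14), (0,15), (0,16), (0,17), (0,18), (0,19), (0,20), (0,21), (0,22), (0,23)]
def vt13 : List (List (List ℤ)) :=
  [[[-2,-3,-4,-5,-6,-7,-8,-9,-10,-11,-12,-13,-14,-15,-16,-17,-18,-19,-20,-16,-12,-8,-4,5], u 0, u 1, u 2, u 3, u 4, u 5, u 6, u 7, u 8, u 9, u 10, u 11, u 12, u 13, u 14, u 15, u 16, u 17, u 18, u 19, u 20, u 21, u 22]]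
def kp14 : List (ℕ × ℕ) := [(0,2), (0,3), (1,0), (1,1), (1,2), (1,3), (2,0), (2,1), (2,2), (2,3), (3,2), (3,3), (4,1), (4,2), (4,3), (5,1), (5,2), (5,3)]
def vt14 : List (List (List ℤ)) :=
  [[[-2,-3,-3,-3,-4,-2,-3,6,2,1,0,0,-3,0,3,6,4,2,-4,-6,6,4,0,-2], [0,1,0,0,0,0,0,-3,-2,-1,0,0,1,0,-1,-3,-2,-1,2,2,-2,-2,0,2], u 0, u 1], [u 2, u 3, u 4, u 5], [u 6, u 7, u 8, u 9], [[0,0,-7,-6,-8,-3,-6,3,-2,-1,-2,-3,-3,0,3,6,4,2,0,-8,6,4,-2,0], [0,0,4,3,4,1,4,-1,2,1,0,1,2,0,-2,-3,-2,-1,0,4,-4,-2,2,0], u 10, u 11], [[0,0,1,2,2,1,1,-4,-2,-1,0,0,0,-2,-3,-3,-2,-1,2,4,-2,-2,0,0], u 12, u 13, u 14], [[0,0,2,1,2,1,1,-1,0,0,0,0,1,0,-1,-2,-2,-1,0,2,-2,0,0,0], u 15, u 16, u 17]]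
def kp15 : List (ℕ × ℕ) := [(0,2), (0,3), (0,4), (0,5), (1,0), (1,2), (1,3), (1,4), (1,5), (2,1), (2,2), (2,3), (2,4), (2,5), (3,0), (3,1), (3,2), (3,3), (3,4), (3,5)]
def vt15 : List (List (List ℤ)) :=
  [[[-2,-3,-4,-5,-8,0,8,16,24,25,20,15,10,5,13,31,32,20,8,-4,-2,6,16,-30], [0,1,2,3,5,0,-5,-10,-15,-15,-12,-9,-6,-3,-7,-18,-18,-11,-4,3,2,-4,-10,18], u 0, u 1, u 2, u 3], [u 4, [0,0,0,0,-3,-2,0,2,4,5,4,3,2,1,4,7,8,5,2,-1,0,0,4,-6], u 5, u 6, u 7, u 8], [[0,0,0,0,1,0,-1,-2,-3,-4,-4,-3,-2,-1,-3,-5,-6,-4,-2,0,0,0,-2,4], u 9, u 10, u 11, u 12, u 13], [u 14, u 15, u 16, u 17, u 18, u 19]]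
def kp16 : List (ℕ × ℕ) := [(0,1), (0,2), (0,3), (0,4), (0,5), (0,6), (0,7), (1,0), (1,1), (1,2), (1,3), (1,4), (1,5), (1,6), (2,0), (2,1), (2,2), (2,3), (2,4), (2,6), (2,7)]
def vt16 : List (List (List ℤ)) :=
  [[[0,0,1,2,3,4,5,21,15,30,24,18,12,6,-9,-7,-12,-8,-4,4,8,6,-12,2], u 0, u 1, u 2, u 3, u 4, u 5, u 6], [u 7, u 8, u 9, u 10, u 11, u 12, u 13, [1,2,3,4,5,6,7,31,22,44,35,26,17,8,-14,-10,-18,-12,-6,6,12,10,-18,2]], [u 14, u 15, u 16, u 17, u 18, [-1,-2,-3,-4,-5,-6,-7,-28,-20,-40,-32,-24,-16,-8,11,8,14,9,4,-6,-11,-8,16,-2], u 19, u 20]]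
def kp17 : List (ℕ × ℕ) := [(0,0), (0,2), (0,4), (0,5), (0,6), (0,7), (0,8), (0,9), (0,10), (0,11), (1,0), (1,1), (1,2), (1,3), (1,4), (1,5), (1,6), (1,7), (1,8), (1,9), (1,10), (1,11)]
def vt17 : List (List (List ℤ)) :=
  [[u 0, [-3,-2,2,4,6,8,10,12,14,16,52,43,86,77,68,59,50,41,32,23,14,5,4,-18], u 1, [1,0,-2,-3,-4,-5,-6,-7,-8,-9,-29,-24,-48,-43,-38,-33,-28,-23,-18,-13,-8,-3,-2,10], u 2, u 3, u 4, u 5, u 6, u 7, u 8, u 9], [u 10, u 11, u 12, u 13, u 14, u 15, u 16, u 17, u 18, u 19, u 20, u 21]]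
def kp18 : List (ℕ × ℕ) := [(0,0), (0,1), (0,2), (0,3), (0,4), (0,5), (0,6), (0,7), (0,8), (0,9), (0,10), (0,11), (0,12), (0,13), (0,14), (1,0), (1,1), (1,2), (1,3), (1,4), (1,5), (1,6), (1,7)]
def vt18 : List (List (List ℤ)) :=
  [[u 0, u 1, u 2, u 3, u 4, u 5, u 6, u 7, u 8, u 9, u 10, u 11, u 12, u 13, u 14, [-8,-7,-14,-13,-12,-11,-10,-9,-8,-7,-6,-5,-4,-3,-2,0,0,0,0,0,0,0,0,2]], [u 15, u 16, u 17, u 18, u 19, u 20, u 21, u 22]]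
def kp19 : List (ℕ × ℕ) := [(0,0), (0,1), (0,2), (0,3), (0,4), (0,5), (0,6), (0,7), (0,8), (0,9), (0,10), (0,11), (0,12), (0,13), (0,14), (0,15), (0,16), (0,17), (0,18), (0,19), (0,20), (0,21), (0,22)]
def vt19 : List (List (List ℤ)) :=
  [[u 0, u 1, u 2, u 3, u 4, u 5, u 6, u 7, u 8, u 9, u 10, u 11, u 12, u 13, u 14, u 15, u 16, u 17, u 18, u 19, u 20, u 21, u 22, [-12,-11,-22,-21,-20,-19,-18,-17,-16,-15,-14,-13,-12,-11,-10,-9,-8,-7,-6,-5,-4,-3,-2,2]]]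
def kp20 : List (ℕ × ℕ) := [(0,0), (0,1), (0,3), (0,4), (0,5), (1,1), (1,2), (1,3), (1,4), (1,5), (2,0), (2,1), (2,3), (2,4), (2,5), (3,0), (3,1), (3,2), (3,3), (3,4), (3,5)]
def vt20 : List (List (List ℤ)) :=
  [[u 0, u 1, [3,-8,6,10,14,-10,-5,0,5,10,3,-6,6,9,12,3,2,4,6,5,4,15,-3,-15], u 2, u 3, u 4], [[-1,2,-2,-3,-4,2,0,-2,-3,-4,-1,2,-2,-3,-4,0,0,0,0,0,0,-4,0,5], u 5, u 6, u 7, u 8, u 9], [u 10, u 11, [-3,6,-6,-9,-12,8,4,0,-4,-8,-3,4,-6,-8,-10,-3,-2,-4,-6,-5,-4,-12,3,12], u 12, u 13, u 14], [u 15, u 16, u 17, u 18, u 19, u 20]]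
def kp21 : List (ℕ × ℕ) := [(0,0), (0,2), (0,4), (0,5), (0,6), (0,7), (0,8), (0,9), (1,0), (1,1), (1,2), (1,3), (1,4), (1,5), (1,6), (2,0), (2,1), (2,2), (2,3), (2,4), (2,5), (2,6)]
def vt21 : List (List (List ℤ)) :=
  [[u 0, [-3,-2,2,4,6,8,10,12,21,14,28,42,35,28,21,15,10,20,30,25,20,15,4,-14], u 1, [1,0,-2,-3,-4,-5,-6,-7,-12,-8,-16,-24,-20,-16,-12,-9,-6,-12,-18,-15,-12,-9,-2,8], u 2, u 3, u 4, u 5, u 6, u 7], [u 8, u 9, u 10, u 11, u 12, u 13, u 14], [u 15, u 16, u 17, u 18, u 19, u 20, u 21]]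
def kp22 : List (ℕ × ℕ) := [(0,0), (0,1), (0,2), (0,3), (0,4), (0,5), (0,6), (0,7), (1,0), (1,1), (1,2), (1,3), (1,4), (1,5), (1,6), (1,7), (2,0), (2,1), (2,2), (2,3), (2,4), (2,5), (2,6), (2,7)]
def vt22 : List (List (List ℤ)) :=
  [[u 0, u 1, u 2, u 3, u 4, u 5, u 6, u 7], [u 8, u 9, u 10, u 11, u 12, u 13, u 14, u 15], [u 16, u 17, u 18, u 19, u 20, u 21, u 22, u 23]]
def tK : List (List (ℕ × ℕ)) := [kp0, kp1, kp2, kp3, kp4, kp5, kp6, kp7, kp8, kp9, kp10, kp11, kp12, kp13, kp14, kp15, kp16, kp17, kp18, kp19, kp20, kp21, kp22]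
def tV : List (List (List (List ℤ))) := [vt0, vt1, vt2, vt3, vt4, vt5, vt6, vt7, vt8, vt9, vt10, vt11, vt12, vt13, vt14, vt15, vt16, vt17, vt18, vt19, vt20, vt21, vt22]

abbrev Itm := (ℕ × ℕ) ⊕ List ℕ

/-- pairing of a basis item with the simple root `(c, i)` -/
def rp (T : List (ℕ × ℕ)) (c i : ℕ) (a : Itm) : ℤ :=
  Sum.rec (fun p => bif Nat.beq p.1 c then cart (ty T c).2 p.2 i else 0) (fun w => (ev (ty T c) (wt w c) i : ℤ)) a

def hent (T : List (ℕ × ℕ)) (D : ℕ) (a b : Itm) : ℤ :=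
  Sum.rec (fun p => rp T p.1 p.2 b)
    (fun w => Sum.rec (fun p => rp T p.1 p.2 a) (fun w' => ((s3 D T w w' / D : ℕ) : ℤ)) b) a

def its (K : List (ℕ × ℕ)) (gs : List (List ℕ)) : List Itm := K.map Sum.inl ++ gs.map Sum.inr

def hm (T : List (ℕ × ℕ)) (D : ℕ) (I : List Itm) : List (List ℤ) := I.map fun a => I.map fun b => hent T D a b

noncomputable def dotl (a : List ℤ) : List ℤ → ℤ := List.rec (fun _ => 0) (fun x _ ih b =>
  Int.rec (fun n => bif Nat.beq n 0 then ih (tlZ b) else n * hdZ b + ih (tlZ b)) (fun n => Int.negSucc n * hdZ b + ih (tlZ b)) x) a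

def vg (V : List (List (List ℤ))) (c i : ℕ) : List ℤ := (V.getD c []).getD i []

def chkE (T : List (ℕ × ℕ)) (D : ℕ) (I : List Itm) : Bool :=
  Nat.beq I.length 24 && I.all (fun a => decide (hent T D a a % 2 = 0)) &&
  (fun H => decide ((I.map fun a => I.map fun b => hent T D b a) = H) && bar 23 1 H) (hm T D I)

def chkW (T : List (ℕ × ℕ)) (K : List (ℕ × ℕ)) (gs : List (List ℕ)) : Bool :=
  K.all (fun p => Nat.blt p.2 (ty T p.1).1) && gs.all fun w => Nat.beq w.length T.length &&
    allb T.length (fun c => Nat.blt (wt w c) (ncl (ty T c)))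

noncomputable def chkA (T : List (ℕ × ℕ)) (D : ℕ) (I : List Itm) (V : List (List (List ℤ))) : Bool :=
  (fun H => allb T.length fun c => allb (ty T c).1 fun i => (fun v => Nat.beq v.length 24 && decide (H.map (dotl v) = I.map (rp T c i))) (vg V c i)) (hm T D I)

noncomputable def chkB (T : List (ℕ × ℕ)) (I : List Itm) (V : List (List (List ℤ))) : Bool :=
  allb T.length fun c => allb (ty T c).1 fun i => (fun b => allb T.length fun d => allb (ty T d).1 fun j =>
    decide (dotl (vg V d j) b = bif Nat.beq d c then cart (ty T c).2 j i else 0)) (I.map (rp T c i))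

/-- the glue vectors are rational combinations of the simple roots -/
def chkS (T : List (ℕ × ℕ)) (D : ℕ) (K : List (ℕ × ℕ)) (gs : List (List ℕ)) (V : List (List (List ℤ))) : Bool :=
  (allb K.length fun k => decide (vg V (K.getD k (0, 0)).1 (K.getD k (0, 0)).2 = u k)) &&
  allb gs.length fun k => (fun w => allb 24 fun l => decide ((sumb T.length fun c => ((D / den (ty T c) : ℕ) : ℤ) *
    sumb (ty T c).1 fun j => (col (ty T c) (wt w c) j : ℤ) * (vg V c j).getD l 0) = bif Nat.beq l (K.length + k) then (D : ℤ) else 0)) (gs.getD k [])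

/-- no glue word of norm two -/
def chkR (T : List (ℕ × ℕ)) (D : ℕ) (gs : List (List ℕ)) : Bool :=
  (srch (fun c => List.range (ncl (ty T c))) (fun n s => Nat.ble (s3 D (T.drop n) s s) (2 * D) && okf T D gs [] n s) T.length []).all
    fun w => !Nat.beq (s3 D T w w) (2 * D)

set_option maxRecDepth 100000

noncomputable def chkL (i : ℕ) : Bool :=
  (fun T D K gs V => (fun I => chkE T D I && chkW T K gs && chkA T D I V && chkB T I V && chkS T D K gs V && chkR T D gs) (its K gs))
    (TT i) (DD i) (tK.getD i []) (GG i) (tV.getD i [])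

theorem cl0 : chkL 0 = true := by decide +kernel
theorem cl1 : chkL 1 = true := by decide +kernel
theorem cl2 : chkL 2 = true := by decide +kernel
theorem cl3 : chkL 3 = true := by decide +kernel
theorem cl4 : chkL 4 = true := by decide +kernel
theorem cl5 : chkL 5 = true := by decide +kernel
theorem cl6 : chkL 6 = true := by decide +kernel
theorem cl7 : chkL 7 = true := by decide +kernel
theorem cl8 : chkL 8 = true := by decide +kernel
theorem cl9 : chkL 9 = true := by decide +kernel
theorem cl10 : chkL 10 = true := by decide +kernel
theorem cl11 : chkL 11 = true := by decide +kernel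
theorem cl12 : chkL 12 = true := by decide +kernel
theorem cl13 : chkL 13 = true := by decide +kernel
theorem cl14 : chkL 14 = true := by decide +kernel
theorem cl15 : chkL 15 = true := by decide +kernel
theorem cl16 : chkL 16 = true := by decide +kernel
theorem cl17 : chkL 17 = true := by decide +kernel
theorem cl18 : chkL 18 = true := by decide +kernel
theorem cl19 : chkL 19 = true := by decide +kernel
theorem cl20 : chkL 20 = true := by decide +kernel
theorem cl21 : chkL 21 = true := by decide +kernel
theorem cl22 : chkL 22 = true := by decide +kernel

theorem chkL_all : ∀ i < 23, chkL i = true := by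
  intro i hi
  interval_cases i
  exacts [cl0, cl1, cl2, cl3, cl4, cl5, cl6, cl7, cl8, cl9, cl10, cl11, cl12, cl13, cl14, cl15, cl16, cl17, cl18, cl19, cl20, cl21, cl22]

end Nie

end ModStdA

section ModStdB
open scoped BigOperators

namespace Nie

def mat (H : List (List ℤ)) : Matrix (Fin 24) (Fin 24) ℤ := Matrix.of fun i j => ent H i j
def vec (l : List ℤ) : Fin 24 → ℤ := fun k => l.getD k 0

theorem dotl_eq (a b : List ℤ) : dotl a b = ∑ k ∈ Finset.range a.length, a.getD k 0 * b.getD k 0 := by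
  induction a generalizing b with
  | nil => rfl
  | cons x a ih =>
    have e : dotl (x :: a) b = x * hdZ b + dotl a (tlZ b) := by
      cases x with
      | ofNat n =>
        change (bif Nat.beq n 0 then dotl a (tlZ b) else (n : ℤ) * hdZ b + dotl a (tlZ b)) = _
        by_cases hn : n = 0
        · subst hn; simp
        · rw [show Nat.beq n 0 = false by rw [beq_dec]; simpa using hn]; rfl
      | negSucc n => rfl
    rw [e, ih, List.length_cons, Finset.sum_range_succ', hdZ_eq, add_comm]
    simp only [List.getD_cons_succ, List.getD_cons_zero, tlZ_eq]

theorem dotl_vec {a : List ℤ} (ha : a.length = 24) (b : List ℤ) : dotl a b = ∑ k : Fin 24, vec a k * vec b k := by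
  rw [dotl_eq, ha, Finset.sum_range]; rfl

theorem getD_map {α β : Type} (f : α → β) (l : List α) (d : α) (d' : β) {k} (hk : k < l.length) : (l.map f).getD k d' = f (l.getD k d) := by
  rw [List.getD_eq_getElem _ _ (by simpa using hk), List.getD_eq_getElem _ _ hk, List.getElem_map]

def it (I : List Itm) (k : ℕ) : Itm := I.getD k (Sum.inl (0, 0))

theorem ent_hm {T D} {I : List Itm} (hI : I.length = 24) {i j} (hi : i < 24) (hj : j < 24) :
    ent (hm T D I) i j = hent T D (it I i) (it I j) := by
  unfold ent hm
  rw [getD_map _ _ (Sum.inl (0, 0)) _ (by omega), getD_map _ _ (Sum.inl (0, 0)) _ (by omega)]; rfl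

theorem even_sum {n : ℕ} (M : ℕ → ℕ → ℤ) (hs : ∀ i < n, ∀ j < n, M i j = M j i) (hd : ∀ i < n, 2 ∣ M i i) (x : ℕ → ℤ) :
    2 ∣ qf n M x := by
  induction n with
  | zero => simp [qf]
  | succ n ih =>
    have : qf (n + 1) M x = qf n M x + 2 * (∑ i ∈ Finset.range n, x i * x n * M i n) + x n * x n * M n n := by
      unfold qf
      rw [Finset.sum_range_succ]
      simp only [Finset.sum_range_succ _ n]
      rw [Finset.sum_add_distrib, two_mul]
      have : ∑ j ∈ Finset.range n, x n * x j * M n j = ∑ i ∈ Finset.range n, x i * x n * M i n := by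
        refine Finset.sum_congr rfl fun i hi => ?_
        rw [hs n (by omega) i (by have := Finset.mem_range.mp hi; omega)]; ring
      rw [this]; ring
    rw [this]
    exact dvd_add (dvd_add (ih (fun i hi j hj => hs i (by omega) j (by omega)) (fun i hi => hd i (by omega))) (dvd_mul_right _ _))
      (Dvd.dvd.mul_left (hd n (by omega)) _)

theorem B_qf (M : ℕ → ℕ → ℤ) (x : Fin 24 → ℤ) :
    B (Matrix.of fun i j : Fin 24 => M i j) x x = qf 24 M (fun k => if h : k < 24 then x ⟨k, h⟩ else 0) := by
  unfold qf B
  simp only [Finset.sum_range, Matrix.mulVec, dotProduct, Matrix.of_apply]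
  refine Finset.sum_congr rfl fun i _ => ?_
  rw [Finset.mul_sum]
  refine Finset.sum_congr rfl fun j _ => ?_
  simp only [Fin.is_lt, dif_pos]
  ring

/-- a Gram matrix given by a list passing the elimination test is even unimodular -/
theorem EUL_of_list {H : List (List ℤ)} (hs : ∀ i < 24, ∀ j < 24, ent H i j = ent H j i) (hd : ∀ i < 24, 2 ∣ ent H i i)
    (hb : bar 23 1 H = true) : EUL (mat H) := by
  obtain ⟨h1, h2⟩ := bar_spec 23 1 H one_pos hb (fun i hi j hj => hs i (by omega) j (by omega))
  refine ⟨?_, ?_, ?_, ?_⟩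
  · ext i j; exact hs j j.2 i i.2
  · intro x; unfold mat; rw [B_qf]; exact even_sum _ hs hd _
  · intro x hx
    unfold mat
    rw [B_qf]
    apply h1
    obtain ⟨k, hk⟩ := Function.ne_iff.mp hx
    exact ⟨k, by omega, by simpa using hk⟩
  · rw [one_pow] at h2; exact h2

theorem chkE_spec {T D} {I : List Itm} (h : chkE T D I = true) : I.length = 24 ∧ EUL (mat (hm T D I)) := by
  unfold chkE at h
  simp only [Bool.and_eq_true, List.all_eq_true, decide_eq_true_eq, Nat.beq_eq] at h
  obtain ⟨⟨h1, h2⟩, h3, h4⟩ := h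
  refine ⟨h1, EUL_of_list ?_ ?_ h4⟩
  · intro i hi j hj
    rw [ent_hm h1 hj hi, ← h3]
    unfold ent
    rw [getD_map _ _ (Sum.inl (0, 0)) _ (by omega), getD_map _ _ (Sum.inl (0, 0)) _ (by omega)]; rfl
  · intro i hi
    rw [ent_hm h1 hi hi]
    apply Int.dvd_of_emod_eq_zero
    apply h2
    unfold it; rw [List.getD_eq_getElem _ _ (by omega)]; exact List.getElem_mem _

section
variable {T : List (ℕ × ℕ)} {D : ℕ} {K : List (ℕ × ℕ)} {gs : List (List ℕ)} {V : List (List (List ℤ))}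

theorem chkA_spec (I : List Itm) (hI : I.length = 24) (h : chkA T D I V = true) {c i} (hi : i < (ty T c).1) :
    (vg V c i).length = 24 ∧ ∀ x, B (mat (hm T D I)) x (vec (vg V c i)) = ∑ k : Fin 24, x k * rp T c i (it I k) := by
  have h := allb_iff (allb_iff h (ty_lt hi)) hi
  simp only [Bool.and_eq_true, decide_eq_true_eq, Nat.beq_eq] at h
  refine ⟨h.1, fun x => ?_⟩
  unfold B dotProduct
  refine Finset.sum_congr rfl fun k _ => ?_
  congr 1
  have e : ((hm T D I).map (dotl (vg V c i))).getD k 0 = rp T c i (it I k) := by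
    rw [h.2, getD_map _ _ (Sum.inl (0, 0)) _ (by omega)]; rfl
  rw [← e, getD_map _ _ [] _ (by unfold hm; rw [List.length_map]; omega), dotl_vec h.1]
  unfold Matrix.mulVec dotProduct
  refine Finset.sum_congr rfl fun j _ => ?_
  rw [mul_comm]; rfl

theorem vec_u {k} (hk : k < 24) : vec (u k) = Pi.single ⟨k, hk⟩ 1 := by
  ext l
  unfold vec u
  rw [getD_map _ _ 0 _ (by simp), List.getD_eq_getElem _ _ (by simp), List.getElem_range, beq_dec, Bool.cond_eq_ite]
  by_cases hl : (l : ℕ) = k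
  · have : l = ⟨k, hk⟩ := Fin.ext hl
    subst this; simp
  · have : l ≠ ⟨k, hk⟩ := fun h => hl (by rw [h])
    simp [hl, Pi.single_eq_of_ne this]

theorem its_length : (its K gs).length = K.length + gs.length := by simp [its]
theorem it_left {k} (hk : k < K.length) : it (its K gs) k = Sum.inl (K.getD k (0, 0)) := by
  unfold it its
  rw [List.getD_append _ _ _ _ (by simpa using hk), getD_map _ _ (0,0) _ hk]
theorem it_right {k} (hk : k < gs.length) : it (its K gs) (K.length + k) = Sum.inr (gs.getD k []) := by
  unfold it its
  rw [List.getD_append_right _ _ _ _ (by simp), getD_map _ _ [] _ (by simpa using hk)]; simp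

theorem B_single_left {G} (k : Fin 24) (y) : B G (Pi.single k 1) y = G.mulVec y k := by
  unfold B; rw [single_dotProduct, one_mul]

theorem B_singles {G} (x y : Fin 24 → ℤ) : B G x y = ∑ k, y k * B G x (Pi.single k 1) := by
  conv_lhs => rw [show y = ∑ k, y k • (Pi.single k (1:ℤ) : Fin 24 → ℤ) by
    ext l; simp [Finset.sum_apply, Pi.single_apply]]
  rw [B_sum_right]
  refine Finset.sum_congr rfl fun k _ => ?_
  rw [B_smul_right]

def sv (V : List (List (List ℤ))) (c i : ℕ) : Fin 24 → ℤ := vec (vg V c i)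

theorem std_frame0 (hT : FOK T D) (hE : chkE T D (its K gs) = true) (hW : chkW T K gs = true) (hA : chkA T D (its K gs) V = true)
    (hB : chkB T (its K gs) V = true) (hS : chkS T D K gs V = true) :
    Frame0 (mat (hm T D (its K gs))) T (sv V) ∧ Sub (cod (mat (hm T D (its K gs))) T (sv V)) gs := by
  obtain ⟨hI, hU⟩ := chkE_spec hE
  have hlen := its_length (K := K) (gs := gs)
  unfold chkS at hS
  simp only [Bool.and_eq_true] at hS
  obtain ⟨hS1, hS2⟩ := hS
  unfold chkW at hW
  simp only [Bool.and_eq_true, List.all_eq_true, Nat.blt_eq, Nat.beq_eq] at hW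
  refine ⟨⟨?_, ?_⟩, ?_⟩
  · intro c i c' j hi hj
    have h := allb_iff (allb_iff (allb_iff (allb_iff hB (ty_lt hj)) hj) (ty_lt hi)) hi
    simp only [decide_eq_true_eq] at h
    rw [dotl_vec (chkA_spec _ hI hA hi).1] at h
    unfold sv
    rw [(chkA_spec _ hI hA hj).2]
    have e : ∑ k : Fin 24, vec (vg V c i) k * rp T c' j (it (its K gs) k) =
        ∑ k, vec (vg V c i) k * vec ((its K gs).map (rp T c' j)) k := by
      refine Finset.sum_congr rfl fun k _ => ?_
      congr 1
      unfold vec; rw [getD_map _ _ (Sum.inl (0, 0)) _ (by omega)]; rfl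
    rw [e, h, beq_dec, Bool.cond_eq_ite]
    by_cases hcc : c = c'
    · subst hcc; simp
    · simp [hcc]
  · intro x hx
    have key : ∀ k : Fin 24, B (mat (hm T D (its K gs))) x (Pi.single k 1) = 0 := by
      intro k
      by_cases hk : (k : ℕ) < K.length
      · have h := allb_iff hS1 hk
        simp only [decide_eq_true_eq] at h
        have := hx (K.getD k (0, 0)).1 (K.getD k (0, 0)).2 (hW.1 _ (by
          rw [List.getD_eq_getElem _ _ hk]; exact List.getElem_mem _))
        unfold sv at this
        rwa [h, vec_u k.2] at this
      · obtain ⟨k', hk'⟩ := Nat.exists_eq_add_of_le (not_lt.mp hk)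
        have hk2 : k' < gs.length := by omega
        have h := fun l (hl : l < 24) => allb_iff (allb_iff hS2 hk2) hl
        simp only [decide_eq_true_eq, sumb_eq] at h
        have e : (D : ℤ) • (Pi.single k 1 : Fin 24 → ℤ) = combo T (sv V) fun c j =>
            ((D / den (ty T c) : ℕ) : ℤ) * (col (ty T c) (wt (gs.getD k' []) c) j : ℤ) := by
          ext l
          unfold combo
          simp only [Finset.sum_apply, Pi.smul_apply, smul_eq_mul]
          have h := h l l.2
          simp only [Finset.mul_sum, ← mul_assoc] at h
          unfold sv vec
          rw [h, beq_dec, Bool.cond_eq_ite]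
          by_cases hl : l = k
          · subst hl; simp [hk']
          · rw [Pi.single_eq_of_ne hl, if_neg]
            · simp
            · simp only [decide_eq_true_eq]; intro h; exact hl (Fin.ext (by omega))
        have e2 : (D : ℤ) * B (mat (hm T D (its K gs))) x (Pi.single k 1) = 0 := by
          rw [← B_smul_right, e]
          unfold combo
          rw [B_sum_right]
          refine Finset.sum_eq_zero fun c _ => ?_
          rw [B_sum_right]
          refine Finset.sum_eq_zero fun i hi => ?_
          rw [B_smul_right, hx c i (Finset.mem_range.mp hi), mul_zero]
        rcases mul_eq_zero.mp e2 with h | h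
        · exact absurd h (by exact_mod_cast hT.pos.ne')
        · exact h
    by_contra hne
    have := hU.pos x hne
    rw [B_singles] at this
    simp [key] at this
  · intro g hg
    obtain ⟨h1, h2⟩ := hW.2 g hg
    obtain ⟨k, hk, rfl⟩ := List.getElem_of_mem hg
    refine ⟨h1, fun c hc => by simpa using allb_iff h2 hc, Pi.single ⟨K.length + k, by omega⟩ 1, ?_⟩
    intro c i hi
    unfold sv
    rw [(chkA_spec _ hI hA hi).2, Finset.sum_eq_single ⟨K.length + k, by omega⟩]
    · simp only [Pi.single_eq_same, one_mul]
      rw [it_right hk, List.getD_eq_getElem _ _ hk]; rfl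
    · intro b _ hb; rw [Pi.single_eq_of_ne hb, zero_mul]
    · simp

/-- a frame containing the glue gives a basis with the standard Gram matrix -/
theorem std_unique (hT : FOK T D) (hI : (its K gs).length = 24) (hW : chkW T K gs = true) {G} (h : EUL G) {v} (hF : Frame0 G T v)
    (hg : Sub (cod G T v) gs) : ∃ P : Matrix (Fin 24) (Fin 24) ℤ, P.transpose * G * P = mat (hm T D (its K gs)) := by
  classical
  unfold chkW at hW
  simp only [Bool.and_eq_true, List.all_eq_true, Nat.blt_eq, Nat.beq_eq] at hW
  have : ∀ w, ∃ x, w ∈ gs → ∀ c i, i < (ty T c).1 → B G x (v c i) = ev (ty T c) (wt w c) i := by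
    intro w
    by_cases hw : w ∈ gs
    · obtain ⟨_, _, x, hx⟩ := hg w hw; exact ⟨x, fun _ => hx⟩
    · exact ⟨0, fun h => absurd h hw⟩
  choose X hX using this
  let uu : Itm → Fin 24 → ℤ := fun a => Sum.rec (fun p => v p.1 p.2) (fun w => X w) a
  have hmem : ∀ a ∈ its K gs, (∃ p, p ∈ K ∧ a = Sum.inl p) ∨ ∃ w ∈ gs, a = Sum.inr w := by
    intro a ha
    unfold its at ha
    simp only [List.mem_append, List.mem_map] at ha
    rcases ha with ⟨p, hp, rfl⟩ | ⟨w, hw, rfl⟩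
    · exact Or.inl ⟨p, hp, rfl⟩
    · exact Or.inr ⟨w, hw, rfl⟩
  have key : ∀ a ∈ its K gs, ∀ b ∈ its K gs, B G (uu a) (uu b) = hent T D a b := by
    intro a ha b hb
    rcases hmem a ha with ⟨p, hp, rfl⟩ | ⟨w, hw, rfl⟩
    · rcases hmem b hb with ⟨q, hq, rfl⟩ | ⟨w', hw', rfl⟩
      · change B G (v p.1 p.2) (v q.1 q.2) = bif Nat.beq q.1 p.1 then cart (ty T p.1).2 q.2 p.2 else 0
        rw [hF.gram _ _ _ _ (hW.1 p hp) (hW.1 q hq), beq_dec, Bool.cond_eq_ite, cart_comm]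
        by_cases hpq : p.1 = q.1
        · simp [hpq]
        · simp [hpq, Ne.symm hpq]
      · change B G (v p.1 p.2) (X w') = (ev (ty T p.1) (wt w' p.1) p.2 : ℤ)
        rw [h.comm, hX w' hw' _ _ (hW.1 p hp)]
    · rcases hmem b hb with ⟨q, hq, rfl⟩ | ⟨w', hw', rfl⟩
      · change B G (X w) (v q.1 q.2) = (ev (ty T q.1) (wt w q.1) q.2 : ℤ)
        rw [hX w hw _ _ (hW.1 q hq)]
      · change B G (X w) (X w') = ((s3 D T w w' / D : ℕ) : ℤ)
        have := hF.pairing_word h hT (hg w hw).2.1 (hg w' hw').2.1 (hX w hw) (hX w' hw')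
        rw [s3_eq]
        push_cast
        rw [← this, Int.mul_ediv_cancel_left _ (by exact_mod_cast hT.pos.ne')]
  refine ⟨Matrix.of fun i k => uu (it (its K gs) k) i, ?_⟩
  ext k l
  have hm1 : ∀ k : Fin 24, it (its K gs) k ∈ its K gs := by
    intro k; unfold it; rw [List.getD_eq_getElem _ _ (by omega)]; exact List.getElem_mem _
  change _ = ent (hm T D (its K gs)) k l
  rw [ent_hm hI k.2 l.2, ← key _ (hm1 k) _ (hm1 l), Matrix.mul_assoc]
  rfl

end

end Nie

end ModStdB

section ModStdC
open scoped BigOperators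

namespace Nie
variable {G : Matrix (Fin 24) (Fin 24) ℤ} {T : List (ℕ × ℕ)} {v : ℕ → ℕ → Fin 24 → ℤ} {D : ℕ}

theorem combo_single {c i} (hi : i < (ty T c).1) (b : ℤ) : combo T v (fun c' i' => if c' = c ∧ i' = i then b else 0) = b • v c i := by
  unfold combo
  rw [Finset.sum_eq_single c, Finset.sum_eq_single i]
  · beta_reduce; rw [if_pos ⟨rfl, rfl⟩]
  · intro i' _ h; beta_reduce; rw [if_neg (by tauto), zero_smul]
  · intro h; exact absurd (Finset.mem_range.mpr hi) h
  · intro c' _ h; refine Finset.sum_eq_zero fun i' _ => ?_; beta_reduce; rw [if_neg (by tauto), zero_smul]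
  · intro h; exact absurd (Finset.mem_range.mpr (ty_lt hi)) h

theorem combo_add (z z') : combo T v z + combo T v z' = combo T v fun c i => z c i + z' c i := by
  unfold combo
  simp only [add_smul, Finset.sum_add_distrib]

theorem combo_smul (b : ℤ) (z) : b • combo T v z = combo T v fun c i => b * z c i := by
  unfold combo
  simp only [Finset.smul_sum, smul_smul]

theorem ty_le {i} (hi : i < 23) (c) : (ty (TT i) c).1 ≤ 24 := by
  by_cases hc : c < (TT i).length
  · have h : ∀ T ∈ types, ∀ t ∈ T, t.1 ≤ 24 := by decide +kernel
    exact h _ (TT_mem hi) _ (ty_mem hc)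
  · unfold ty; rw [List.getD_eq_default _ _ (by omega)]; simp

/-- highest root of a component -/
def hr (T : List (ℕ × ℕ)) (v : ℕ → ℕ → Fin 24 → ℤ) (c : ℕ) : Fin 24 → ℤ :=
  ∑ i ∈ Finset.range (ty T c).1, (mark (ty T c).1 (ty T c).2 i : ℤ) • v c i

theorem hr_spec (h : EUL G) (hF : Frame0 G T v) (hT : FOK T D) {c} (hc : c < T.length) (hle : (ty T c).1 ≤ 24) :
    (∀ i < (ty T c).1, 0 ≤ B G (v c i) (hr T v c)) ∧ B G (hr T v c) (hr T v c) = 2 ∧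
    ∀ i < (ty T c).1, 1 ≤ mark (ty T c).1 (ty T c).2 i := by
  obtain ⟨h1, h2, h3⟩ := markCheck_spec hle (hT.tok c hc).valid
  simp only [sumb_eq] at h1 h2 h3
  have e : ∀ i < (ty T c).1, B G (v c i) (hr T v c) = ∑ j ∈ Finset.range (ty T c).1, cart (ty T c).2 i j * mark (ty T c).1 (ty T c).2 j := by
    intro i hi
    unfold hr
    rw [B_sum_right]
    refine Finset.sum_congr rfl fun j hj => ?_
    rw [B_smul_right, hF.gram c i c j hi (Finset.mem_range.mp hj), if_pos rfl, mul_comm]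
  refine ⟨fun i hi => by rw [e i hi]; exact (h1 i hi).1, ?_, fun i hi => (h1 i hi).2⟩
  rw [← h2]
  conv_lhs => enter [2]; unfold hr
  rw [B_sum_left]
  refine Finset.sum_congr rfl fun i hi => ?_
  rw [B_smul_left, e i (Finset.mem_range.mp hi)]

theorem one_of_sum {n : ℕ} (m b : ℕ → ℤ) (hm : ∀ i < n, 1 ≤ m i) (hb : ∀ i < n, 0 ≤ b i)
    (hs : ∑ i ∈ Finset.range n, m i * b i ≤ 1) : (∀ i < n, b i = 0) ∨ ∃ i < n, m i = 1 ∧ ∀ j < n, b j = if j = i then 1 else 0 := by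
  by_cases h0 : ∀ i < n, b i = 0
  · exact Or.inl h0
  right
  push Not at h0
  obtain ⟨i, hi, hbi⟩ := h0
  have hb1 : 1 ≤ b i := by have := hb i hi; omega
  have hmi := hm i hi
  have hnn : ∀ j ∈ Finset.range n, 0 ≤ m j * b j := fun j hj =>
    mul_nonneg (by have := hm j (Finset.mem_range.mp hj); omega) (hb j (Finset.mem_range.mp hj))
  have h1 := Finset.single_le_sum hnn (Finset.mem_range.mpr hi)
  refine ⟨i, hi, by nlinarith, fun j hj => ?_⟩
  split_ifs with hji
  · subst hji; nlinarith
  · by_contra hbj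
    have hbj1 : 1 ≤ b j := by have := hb j hj; omega
    have hmj := hm j hj
    have h2 := Finset.add_le_sum hnn (Finset.mem_range.mpr hi) (Finset.mem_range.mpr hj) (fun h => hji h.symm)
    nlinarith

theorem noword {gs : List (List ℕ)} {w : List ℕ} (hwl : w.length = T.length) (hwn : ∀ c < T.length, wt w c < ncl (ty T c))
    (hnorm : s3 D T w w = 2 * D) (hp : ∀ k ∈ gs, D ∣ pairN T D k w) (hR : chkR T D gs = true) : False := by
  have hmem : w ∈ srch (fun c => List.range (ncl (ty T c)))
      (fun n s => Nat.ble (s3 D (T.drop n) s s) (2 * D) && okf T D gs [] n s) T.length [] := by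
    have := srch_sound (fun c => List.range (ncl (ty T c)))
      (fun n s => Nat.ble (s3 D (T.drop n) s s) (2 * D) && okf T D gs [] n s) w T.length hwl.ge
      (fun c hc => List.mem_range.mpr (hwn c hc)) ?_
    · rwa [List.drop_eq_nil_of_le hwl.le] at this
    intro c hc
    rw [Bool.and_eq_true, Nat.ble_eq]
    constructor
    · rw [← hnorm]
      have mono : ∀ (n : ℕ) (T : List (ℕ × ℕ)) (w : List ℕ), s3 D (T.drop n) (w.drop n) (w.drop n) ≤ s3 D T w w := by
        intro n
        induction n with
        | zero => intro T w; exact le_rfl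
        | succ n ih =>
          intro T w
          cases T with
          | nil => exact le_rfl
          | cons t T =>
            have e : w.drop (n + 1) = (tl w).drop n := by cases w <;> simp [tl]
            rw [List.drop_succ_cons, e]
            refine (ih T (tl w)).trans ?_
            change _ ≤ ip t D (hd w) (hd w) + s3 D T (tl w) (tl w)
            omega
      exact mono c T w
    · unfold okf
      rw [Bool.and_eq_true]
      refine ⟨by simp, ?_⟩
      rw [List.all_eq_true]
      intro k hk
      obtain ⟨hk, hk2⟩ := List.mem_filter.mp hk
      rw [Bool.and_eq_true] at hk2
      have hz : ∀ c' < c, wt k c' = 0 := by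
        intro c' hc'
        have := allb_iff hk2.1 hc'
        simpa using this
      rw [s3_drop D c T k w hz, s3_eq, Nat.beq_eq]
      exact Nat.mod_eq_zero_of_dvd (hp k hk)
  have := List.all_eq_true.mp hR w hmem
  rw [hnorm] at this
  simp at this

theorem span_of (h : EUL G) (hF : Frame0 G T v) (hT : FOK T D) (hle : ∀ c, (ty T c).1 ≤ 24) {gs : List (List ℕ)}
    (hg : Sub (cod G T v) gs) (hR : chkR T D gs = true) : ∀ r, B G r r = 2 → ∃ z : ℕ → ℕ → ℤ, r = combo T v z := by
  classical
  by_contra hcon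
  push Not at hcon
  obtain ⟨r, hr2, hrz⟩ := hcon
  let f : (Fin 24 → ℤ) → ℤ := fun x => ∑ c ∈ Finset.range T.length, ∑ i ∈ Finset.range (ty T c).1,
    (∑ j ∈ Finset.range (ty T c).1, (adj (ty T c) i j : ℤ)) * B G x (v c i)
  let S := (shell G 1).filter fun x => ∀ z, x ≠ combo T v z
  have hS : ∀ x, x ∈ S ↔ B G x x = 2 ∧ ∀ z, x ≠ combo T v z := by
    intro x; simp only [S, Finset.mem_filter, h.mem_shell]; norm_num
  obtain ⟨x, hxS, hmax⟩ := Finset.exists_max_image S f ⟨r, (hS r).mpr ⟨hr2, hrz⟩⟩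
  obtain ⟨hx2, hxz⟩ := (hS x).mp hxS
  have hdom : ∀ c i, i < (ty T c).1 → 0 ≤ B G x (v c i) := by
    intro c l hl
    by_contra hneg
    push Not at hneg
    have hc := ty_lt hl
    have ht := hT.tok c hc
    have hv2 : B G (v c l) (v c l) = 2 := by rw [hF.gram c l c l hl hl, if_pos rfl, cart_iff, if_pos rfl]
    have h1 : x - B G x (v c l) • v c l ∈ S := by
      rw [hS]
      refine ⟨by rw [refl_norm h hv2, hx2], fun z hz => ?_⟩
      refine hxz (fun c' i' => z c' i' + if c' = c ∧ i' = l then B G x (v c l) else 0) ?_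
      rw [← combo_add z (fun c' i' => if c' = c ∧ i' = l then B G x (v c l) else 0), combo_single hl, ← hz]; abel
    have h2 := hmax _ h1
    have hfv : f (v c l) = den (ty T c) := by
      simp only [f]
      rw [Finset.sum_eq_single c]
      · have : ∀ i ∈ Finset.range (ty T c).1, (∑ j ∈ Finset.range (ty T c).1, (adj (ty T c) i j : ℤ)) * B G (v c l) (v c i) =
            ∑ j ∈ Finset.range (ty T c).1, cart (ty T c).2 l i * (adj (ty T c) i j : ℤ) := by
          intro i hi
          rw [hF.gram c l c i hl (Finset.mem_range.mp hi), if_pos rfl, Finset.sum_mul]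
          exact Finset.sum_congr rfl fun j _ => mul_comm _ _
        rw [Finset.sum_congr rfl this, Finset.sum_comm, Finset.sum_congr rfl (fun j hj => ht.inv l hl j (Finset.mem_range.mp hj)),
          Finset.sum_ite_eq, if_pos (Finset.mem_range.mpr hl)]
      · intro c' _ hne
        refine Finset.sum_eq_zero fun i hi => ?_
        rw [hF.gram c l c' i hl (Finset.mem_range.mp hi), if_neg hne.symm, mul_zero]
      · intro hn; exact absurd (Finset.mem_range.mpr hc) hn
    have hfl : f (x - B G x (v c l) • v c l) = f x - B G x (v c l) * f (v c l) := by
      simp only [f, B_sub_left, B_smul_left, mul_sub, Finset.sum_sub_distrib, Finset.mul_sum]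
      congr 1
      refine Finset.sum_congr rfl fun c _ => Finset.sum_congr rfl fun i _ => ?_
      ring
    rw [hfl, hfv] at h2
    have : (0 : ℤ) < den (ty T c) := by exact_mod_cast ht.den_pos
    nlinarith
  have hword : ∀ c, ∃ a, c < T.length → a < ncl (ty T c) ∧ ∀ i < (ty T c).1, B G x (v c i) = ev (ty T c) a i := by
    intro c
    by_cases hc : c < T.length
    swap
    · exact ⟨0, fun h => absurd h hc⟩
    have ht := hT.tok c hc
    obtain ⟨h1, h2, h3⟩ := hr_spec h hF hT hc (hle c)
    have hne : x ≠ hr T v c := by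
      intro he
      refine hxz (fun c' i' => if c' = c then mark (ty T c).1 (ty T c).2 i' else 0) ?_
      rw [he]
      symm
      unfold combo hr
      rw [Finset.sum_eq_single c]
      · simp only [if_true]
      · intro c' _ hne; refine Finset.sum_eq_zero fun i _ => ?_; beta_reduce; rw [if_neg hne, zero_smul]
      · intro hn; exact absurd (Finset.mem_range.mpr hc) hn
    have h4 := h.root_le hx2 h2 hne
    unfold hr at h4
    rw [B_sum_right] at h4
    simp only [B_smul_right] at h4
    rcases one_of_sum (fun i => (mark (ty T c).1 (ty T c).2 i : ℤ)) (fun i => B G x (v c i)) (fun i hi => by exact_mod_cast h3 i hi)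
      (hdom c) h4 with h5 | ⟨i, hi, hmi, h5⟩
    · refine ⟨0, fun _ => ⟨ht.ncl1, fun i hi => ?_⟩⟩
      have : ev (ty T c) 0 i = 0 := rfl
      rw [this]; exact h5 i hi
    · obtain ⟨a, ha, ha0, hna⟩ := ht.mark i hi (by exact_mod_cast hmi)
      refine ⟨a, fun _ => ⟨ha, fun j hj => ?_⟩⟩
      rw [h5 j hj]
      unfold ev
      simp only [beq_dec, Bool.cond_eq_ite, decide_eq_true_eq, ha0, if_false, hna]
      split_ifs <;> rfl
  choose a ha using hword
  set w := tab T.length a with hw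
  have hwl : w.length = T.length := tab_length _ _
  have hwc : ∀ c < T.length, wt w c = a c := fun c hc => wt_tab hc
  have hwn : ∀ c < T.length, wt w c < ncl (ty T c) := fun c hc => by rw [hwc c hc]; exact (ha c hc).1
  have hxw : ∀ c i, i < (ty T c).1 → B G x (v c i) = ev (ty T c) (wt w c) i := by
    intro c i hi
    rw [hwc c (ty_lt hi)]; exact (ha c (ty_lt hi)).2 i hi
  have hnorm : s3 D T w w = 2 * D := by
    have := hF.pairing_word h hT hwn hwn hxw hxw
    rw [hx2, ← s3_eq] at this
    have : ((2 * D : ℕ) : ℤ) = s3 D T w w := by push_cast; linarith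
    exact_mod_cast this.symm
  refine noword hwl hwn hnorm (fun k hk => ?_) hR
  obtain ⟨_, hkn, y, hy⟩ := hg k hk
  have := hF.pairing_word h hT hkn hwn hy hxw
  have : (D : ℤ) ∣ (pairN T D k w : ℤ) := ⟨_, this.symm⟩
  exact_mod_cast this

/-- the standard lattice of a type -/
def LL (i : ℕ) : Matrix (Fin 24) (Fin 24) ℤ := mat (hm (TT i) (DD i) (its (tK.getD i []) (GG i)))

theorem LL_spec {i} (hi : i < 23) : EUL (LL i) ∧ ∃ v, Frame (LL i) (TT i) v := by
  have h := chkL_all i hi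
  unfold chkL at h
  simp only [Bool.and_eq_true] at h
  obtain ⟨⟨⟨⟨⟨h1, h2⟩, h3⟩, h4⟩, h5⟩, h6⟩ := h
  have hT := (misc hi).1
  obtain ⟨h7, h8⟩ := std_frame0 hT h1 h2 h3 h4 h5
  have hE := (chkE_spec h1).2
  exact ⟨hE, _, h7, span_of hE h7 hT (ty_le hi) h8 h6⟩

theorem LL_unique {i} (hi : i < 23) {G} (h : EUL G) {v} (hv : Frame G (TT i) v) :
    ∃ P : Matrix (Fin 24) (Fin 24) ℤ, P.transpose * G * P = LL i := by
  have hc := chkL_all i hi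
  unfold chkL at hc
  simp only [Bool.and_eq_true] at hc
  obtain ⟨v', hv', hg⟩ := gens_in h hi ⟨v, hv⟩
  exact std_unique (misc hi).1 (chkE_spec hc.1.1.1.1.1).1 hc.1.1.1.1.2 h hv'.toFrame0 hg

end Nie

end ModStdC

section ModStdD
open scoped BigOperators

namespace Nie
variable {G : Matrix (Fin 24) (Fin 24) ℤ} {T : List (ℕ × ℕ)} {v : ℕ → ℕ → Fin 24 → ℤ} {D : ℕ}

theorem sum_ty {M : Type} [AddCommMonoid M] (f : ℕ → ℕ → M) :
    ∑ p : (Σ c : Fin T.length, Fin (ty T c).1), f p.1 p.2 = ∑ c ∈ Finset.range T.length, ∑ i ∈ Finset.range (ty T c).1, f c i := by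
  rw [Fintype.sum_sigma, ← Fin.sum_univ_eq_sum_range (fun c => ∑ i ∈ Finset.range (ty T c).1, f c i)]
  refine Finset.sum_congr rfl fun c _ => ?_
  exact Fin.sum_univ_eq_sum_range (fun i => f c i) _

theorem Frame0.combo_zero (hF : Frame0 G T v) (hT : FOK T D) {z} (hz : combo T v z = 0) {c l} (hl : l < (ty T c).1) : z c l = 0 := by
  have ht := hT.tok c (ty_lt hl)
  have h1 := ht.conv (y := fun _ => 0) (z := z c) (a := 0) ht.ncl1 (fun i hi => by
    rw [← hF.B_combo z hi, hz, B_zero_left]; rfl) hl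
  have h2 : col (ty T c) 0 l = 0 := rfl
  have : (0 : ℤ) < den (ty T c) := by exact_mod_cast ht.den_pos
  simp only [mul_zero, Finset.sum_const_zero, h2, Nat.cast_zero, zero_add] at h1
  rcases mul_eq_zero.mp h1.symm with h | h
  · omega
  · exact h

theorem Frame.rb (hF : Frame G T v) (hT : FOK T D) :
    RB G (fun p : (Σ c : Fin T.length, Fin (ty T c).1) => v p.1 p.2) := by
  refine ⟨?_, ?_, ?_, ?_⟩
  · rintro ⟨c, i⟩
    rw [hF.gram c i c i i.2 i.2, if_pos rfl, cart_iff, if_pos rfl]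
  · rintro ⟨c, i⟩ ⟨c', j⟩ hne
    dsimp only
    rw [hF.gram c i c' j i.2 j.2]
    split_ifs with h
    · have := Fin.ext h
      subst this
      rw [cart_iff, if_neg (fun h => hne (by rw [Fin.ext h]))]
      split_ifs <;> norm_num
    · exact le_rfl
  · intro x hx
    let z : ℕ → ℕ → ℤ := fun c i => if h : c < T.length then if h' : i < (ty T c).1 then x ⟨⟨c, h⟩, ⟨i, h'⟩⟩ else 0 else 0
    have hz : ∀ p : (Σ c : Fin T.length, Fin (ty T c).1), x p = z p.1 p.2 := by
      rintro ⟨c, i⟩; simp [z]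
    have h0 : combo T v z = 0 := by
      unfold combo
      rw [← sum_ty (fun c i => z c i • v c i), ← hx]
      exact Finset.sum_congr rfl fun p _ => by rw [hz]
    funext p
    rw [hz]; exact hF.combo_zero hT h0 p.2.2
  · intro r hr
    obtain ⟨z, hz⟩ := hF.span r hr
    exact ⟨fun p => z p.1 p.2, by rw [hz, ← sum_ty (fun c i => z c i • v c i)]⟩

theorem hr_combo {c} (hc : c < T.length) :
    hr T v c = combo T v fun c' i' => if c' = c then (mark (ty T c).1 (ty T c).2 i' : ℤ) else 0 := by
  symm
  unfold combo hr
  rw [Finset.sum_eq_single c]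
  · simp only [if_true]
  · intro c' _ hne; refine Finset.sum_eq_zero fun i _ => ?_; beta_reduce; rw [if_neg hne, zero_smul]
  · intro hn; exact absurd (Finset.mem_range.mpr hc) hn

theorem Frame.card (h : EUL G) (hF : Frame G T v) (hT : FOK T D) (h0 : 0 < T.length) (hle : (ty T 0).1 ≤ 24) :
    (shell G 1).card = 24 * cox (ty T 0).1 (ty T 0).2 := by
  obtain ⟨h1, h2, h3⟩ := hr_spec h hF.toFrame0 hT h0 hle
  let t : ℕ → ℕ → ℤ := fun c i => if c = 0 then (mark (ty T 0).1 (ty T 0).2 i : ℤ) else 0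
  have e : ∑ p : (Σ c : Fin T.length, Fin (ty T c).1), t p.1 p.2 • v p.1 p.2 = hr T v 0 := by
    rw [sum_ty (fun c i => t c i • v c i), hr_combo h0]; rfl
  have := (hF.rb hT).coxeter h (fun p => t p.1 p.2) (fun p => by simp only [t]; split_ifs <;> positivity) ?_ ?_
  · rw [sum_ty t] at this
    rw [Finset.sum_eq_single 0] at this
    · obtain ⟨_, _, h6⟩ := markCheck_spec hle (hT.tok 0 h0).valid
      rw [sumb_eq] at h6
      simp only [t, if_true] at this
      have : (((shell G 1).card : ℕ) : ℤ) = (24 * cox (ty T 0).1 (ty T 0).2 : ℕ) := by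
        rw [this]; push_cast; rw [← h6]; ring
      exact_mod_cast this
    · intro c _ hc; exact Finset.sum_eq_zero fun i _ => by simp only [t, if_neg hc]
    · intro hn; exact absurd (Finset.mem_range.mpr h0) hn
  · rintro ⟨p1, p2⟩
    have hp2 := p2.2
    dsimp only
    rw [e]
    generalize (p2 : ℕ) = q2 at *
    by_cases hp : (p1 : ℕ) = 0
    · rw [hp] at hp2 ⊢
      exact h1 _ hp2
    · rw [hr, B_sum_right]
      refine (Finset.sum_eq_zero fun i hi => ?_).ge
      rw [B_smul_right, hF.gram _ _ 0 i hp2 (Finset.mem_range.mp hi), if_neg hp, mul_zero]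
  · rw [e, h2]

theorem Frame0.exp_combo (hF : Frame0 G T v) (hT : FOK T D) {e : ℕ}
    (he : ∀ c i j, i < (ty T c).1 → j < (ty T c).1 → den (ty T c) ∣ e * adj (ty T c) i j) (x) : ∃ z, (e : ℤ) • x = combo T v z := by
  choose! q hq using he
  refine ⟨fun c i => ∑ j ∈ Finset.range (ty T c).1, (q c i j : ℤ) * B G x (v c j), ?_⟩
  rw [← sub_eq_zero]
  apply hF.sep
  intro c l hl
  have hc := ty_lt hl
  have ht := hT.tok c hc
  have hd : (den (ty T c) : ℤ) ≠ 0 := by exact_mod_cast ht.den_pos.ne'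
  rw [B_sub_left, hF.B_combo _ hl, B_smul_left, sub_eq_zero]
  apply mul_left_cancel₀ hd
  rw [Finset.mul_sum]
  have : ∀ i ∈ Finset.range (ty T c).1, (den (ty T c) : ℤ) * ((∑ j ∈ Finset.range (ty T c).1, (q c i j : ℤ) * B G x (v c j)) * cart (ty T c).2 i l)
      = ∑ j ∈ Finset.range (ty T c).1, (e * B G x (v c j)) * (cart (ty T c).2 l i * (adj (ty T c) i j : ℤ)) := by
    intro i hi
    rw [Finset.sum_mul, Finset.mul_sum]
    refine Finset.sum_congr rfl fun j hj => ?_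
    have h1 := hq c i j (Finset.mem_range.mp hi) (Finset.mem_range.mp hj)
    have h2 : (e : ℤ) * adj (ty T c) i j = den (ty T c) * q c i j := by exact_mod_cast h1
    rw [cart_comm _ l i]
    linear_combination (-(B G x (v c j) * cart (ty T c).2 i l)) * h2
  rw [Finset.sum_congr rfl this, Finset.sum_comm]
  simp only [← Finset.mul_sum]
  rw [Finset.sum_congr rfl (fun j hj => by rw [ht.inv l hl j (Finset.mem_range.mp hj)]), Finset.sum_eq_single l]
  · rw [if_pos rfl]; ring
  · intro j _ hj; rw [if_neg hj.symm, mul_zero]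
  · intro hn; exact absurd (Finset.mem_range.mpr hl) hn

theorem Frame.combo_trans {T' v'} (hF : Frame G T v) (hF' : Frame0 G T' v') (z') : ∃ z, combo T' v' z' = combo T v z := by
  let S : AddSubgroup (Fin 24 → ℤ) :=
    { carrier := {x | ∃ z, x = combo T v z}
      add_mem' := by rintro _ _ ⟨z, rfl⟩ ⟨z', rfl⟩; exact ⟨_, combo_add z z'⟩
      zero_mem' := ⟨fun _ _ => 0, by simp [combo]⟩
      neg_mem' := by
        rintro _ ⟨z, rfl⟩
        exact ⟨fun c i => (-1) * z c i, by rw [← combo_smul, neg_one_zsmul]⟩ }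
  change combo T' v' z' ∈ S
  unfold combo
  refine S.sum_mem fun c _ => S.sum_mem fun i hi => S.zsmul_mem ?_ _
  refine hF.span _ ?_
  have hi := Finset.mem_range.mp hi
  rw [hF'.gram c i c i hi hi, if_pos rfl, cart_iff, if_pos rfl]

theorem Frame0.exp_dvd (hF : Frame0 G T v) (hT : FOK T D) {e : ℕ} (he : ∀ x, ∃ z, (e : ℤ) • x = combo T v z)
    {g} (hg : g ∈ cod G T v) {c l} (hl : l < (ty T c).1) : den (ty T c) ∣ e * col (ty T c) (wt g c) l := by
  obtain ⟨_, h1, x, hx⟩ := hg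
  obtain ⟨z, hz⟩ := he x
  have hc := ty_lt hl
  have ht := hT.tok c hc
  have h2 := ht.conv (y := fun i => e * B G x (v c i)) (z := z c) (a := 0) ht.ncl1 (fun i hi => by
    rw [← hF.B_combo z hi, ← hz, B_smul_left]; simp [ev]) hl
  have h3 : col (ty T c) 0 l = 0 := rfl
  rw [h3, Finset.sum_congr rfl (fun i hi => by rw [hx c i (Finset.mem_range.mp hi)])] at h2
  have h4 : (den (ty T c) : ℤ) ∣ ((e * col (ty T c) (wt g c) l : ℕ) : ℤ) := by
    refine ⟨z c l, ?_⟩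
    push_cast
    rw [← ht.sum_ev (h1 c hc) hl, Finset.mul_sum]
    push_cast at h2
    rw [zero_add] at h2
    rw [← h2]
    exact Finset.sum_congr rfl fun i _ => by ring
  exact_mod_cast h4

def expA (e j : ℕ) : Bool := (TT j).all fun t => allb t.1 fun a => allb t.1 fun b => Nat.beq (e * adj t a b % den t) 0
def expB (e i : ℕ) : Bool := (GG i).any fun g => !(allb (TT i).length fun c => allb (ty (TT i) c).1 fun l =>
  Nat.beq (e * col (ty (TT i) c) (wt g c) l % den (ty (TT i) c)) 0)

theorem sep_pair (h : EUL G) {i j e} (hi : i < 23) (hj : j < 23) (hA : expA e j = true) (hB : expB e i = true)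
    (h1 : ∃ v, Frame G (TT i) v) (h2 : ∃ v, Frame G (TT j) v) : False := by
  obtain ⟨v, hv, hg⟩ := gens_in h hi h1
  obtain ⟨v', hv'⟩ := h2
  have he : ∀ x, ∃ z, (e : ℤ) • x = combo (TT i) v z := by
    intro x
    have h3 : ∀ c a b, a < (ty (TT j) c).1 → b < (ty (TT j) c).1 → den (ty (TT j) c) ∣ e * adj (ty (TT j) c) a b := by
      intro c a b ha hb
      have := List.all_eq_true.mp hA _ (ty_mem (ty_lt ha))
      have := allb_iff (allb_iff this ha) hb
      rw [Nat.beq_eq] at this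
      exact Nat.dvd_of_mod_eq_zero this
    obtain ⟨z, hz⟩ := hv'.toFrame0.exp_combo (misc hj).1 h3 x
    rw [hz]; exact hv.combo_trans hv'.toFrame0 z
  obtain ⟨g, hgG, hgb⟩ := List.any_eq_true.mp hB
  rw [Bool.not_eq_true'] at hgb
  rw [← Bool.not_eq_true] at hgb
  apply hgb
  refine allb_of fun c hc => allb_of fun l hl => ?_
  rw [Nat.beq_eq]
  exact Nat.mod_eq_zero_of_dvd (hv.toFrame0.exp_dvd (misc hi).1 he (hg g hgG) hl)

theorem sepA : (expA 1 22 && expA 2 21 && expA 3 20 && expA 2 15 && expA 2 14 && expB 1 18 && expB 2 12 && expB 3 9 && expB 2 8 && expB 2 4) = true := by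
  decide +kernel

def coxT (i : ℕ) : ℕ := cox (ty (TT i) 0).1 (ty (TT i) 0).2

def coxCheck : Bool := allb 23 fun j => allb j fun i => !(Nat.beq (coxT i) (coxT j)) ||
  [(18, 22), (12, 21), (9, 20), (8, 15), (4, 14)].contains (i, j)

theorem cox_eq {i j} (hj : j < 23) (hij : i < j) (h : coxT i = coxT j) : (i, j) ∈ [(18, 22), (12, 21), (9, 20), (8, 15), (4, 14)] := by
  have hc : coxCheck = true := by decide +kernel
  have := allb_iff (allb_iff hc hj) hij
  rw [h, Bool.or_eq_true, beq_dec] at this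
  simpa using this

theorem cox_pos : ∀ i < 23, 0 < coxT i ∧ 0 < (TT i).length := by decide +kernel

theorem frame_card (h : EUL G) {i} (hi : i < 23) (hv : ∃ v, Frame G (TT i) v) : (shell G 1).card = 24 * coxT i := by
  obtain ⟨v, hv⟩ := hv
  exact hv.card h (misc hi).1 (cox_pos i hi).2 (ty_le hi 0)

theorem frame_lt (h : EUL G) {i j} (hi : i < 23) (hj : j < 23) (hij : i < j) (h1 : ∃ v, Frame G (TT i) v) (h2 : ∃ v, Frame G (TT j) v) : False := by
  have hc : coxT i = coxT j := by
    have := frame_card h hi h1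
    rw [frame_card h hj h2] at this
    omega
  have hA := sepA
  simp only [Bool.and_eq_true] at hA
  have h3 := cox_eq hj hij hc
  simp only [List.mem_cons, List.not_mem_nil, or_false] at h3
  rcases h3 with e | e | e | e | e <;> (rw [Prod.mk.injEq] at e; obtain ⟨rfl, rfl⟩ := e)
  · exact sep_pair h hi hj (e := 1) (by tauto) (by tauto) h1 h2
  · exact sep_pair h hi hj (e := 2) (by tauto) (by tauto) h1 h2
  · exact sep_pair h hi hj (e := 3) (by tauto) (by tauto) h1 h2
  · exact sep_pair h hi hj (e := 2) (by tauto) (by tauto) h1 h2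
  · exact sep_pair h hi hj (e := 2) (by tauto) (by tauto) h1 h2

theorem frame_unique (h : EUL G) {i j} (hi : i < 23) (hj : j < 23) (h1 : ∃ v, Frame G (TT i) v) (h2 : ∃ v, Frame G (TT j) v) : i = j := by
  rcases lt_trichotomy i j with h3 | h3 | h3
  · exact (frame_lt h hi hj h3 h1 h2).elim
  · exact h3
  · exact (frame_lt h hj hi h3 h2 h1).elim

end Nie

end ModStdD

section ModLeechA
open scoped BigOperators

namespace Nie
variable {G : Matrix (Fin 24) (Fin 24) ℤ}

/-- class modulo two -/
def c2 (x : Fin 24 → ℤ) : Fin 24 → ZMod 2 := fun i => (x i : ZMod 2)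

theorem c2_eq {x y} (h : c2 x = c2 y) : ∃ z : Fin 24 → ℤ, x - y = (2 : ℤ) • z := by
  have : ∀ i, ∃ z : ℤ, x i - y i = 2 * z := by
    intro i
    have := congrFun h i
    unfold c2 at this
    rw [ZMod.intCast_eq_intCast_iff_dvd_sub] at this
    obtain ⟨z, hz⟩ := this
    refine ⟨-z, ?_⟩
    push_cast at hz
    linarith
  choose z hz using this
  exact ⟨z, funext fun i => by simp only [Pi.sub_apply, Pi.smul_apply, smul_eq_mul, hz]⟩

theorem c2_neg (x) : c2 (-x) = c2 x := by
  funext i; simp [c2]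

theorem EUL.four_le (h : EUL G) (h0 : (shell G 1).card = 0) {x} (hx : x ≠ 0) : 4 ≤ B G x x := by
  have h1 := h.pos x hx
  obtain ⟨k, hk⟩ := h.even x
  have h2 : B G x x ≠ 2 := by
    intro h2
    rw [Finset.card_eq_zero] at h0
    have : x ∈ shell G 1 := by rw [h.mem_shell, h2]; norm_num
    rw [h0] at this
    simp at this
  omega

theorem EUL.near (h : EUL G) (h0 : (shell G 1).card = 0) {x y} (hc : c2 x = c2 y) (hx : B G x x ≤ 8) (hy : B G y y ≤ 8)
    (h1 : x ≠ y) (h2 : x ≠ -y) : B G x x = 8 ∧ B G y y = 8 ∧ B G x y = 0 := by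
  obtain ⟨z, hz⟩ := c2_eq hc
  obtain ⟨z', hz'⟩ := c2_eq (hc.trans (c2_neg y).symm)
  have e1 := h.norm_sub x y
  have e2 := h.norm_sub x (-y)
  rw [hz, B_smul_left, B_smul_right] at e1
  rw [hz', B_smul_left, B_smul_right] at e2
  simp only [B_neg_left, B_neg_right] at e2
  have f1 := h.four_le h0 (x := z) (by rintro rfl; rw [smul_zero, sub_eq_zero] at hz; exact h1 hz)
  have f2 := h.four_le h0 (x := z') (by rintro rfl; rw [smul_zero, sub_eq_zero] at hz'; exact h2 hz')
  refine ⟨?_, ?_, ?_⟩ <;> linarith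

theorem EUL.big_fiber (h : EUL G) (h0 : (shell G 1).card = 0) : ∃ y, 47 < ((shell G 4).filter fun x => c2 x = y).card := by
  classical
  obtain ⟨n2, n3, n4⟩ := h.leech_counts h0
  let A := shell G 2 ∪ shell G 3
  have hA : ∀ x ∈ A, B G x x = 4 ∨ B G x x = 6 := by
    intro x hx
    rcases Finset.mem_union.mp hx with hx | hx <;> (rw [h.mem_shell] at hx; norm_num at hx; omega)
  have hAc : A.card = 196560 + 16773120 := by
    rw [Finset.card_union_of_disjoint, n2, n3]
    rw [Finset.disjoint_left]
    intro x hx hx'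
    rw [h.mem_shell] at hx hx'
    norm_num at hx hx'
    omega
  have h1 : A.card ≤ 2 * (A.image c2).card := by
    refine Finset.card_le_mul_card_image _ _ fun a ha => ?_
    obtain ⟨x, hx, rfl⟩ := Finset.mem_image.mp ha
    have : (A.filter fun y => c2 y = c2 x) ⊆ {x, -x} := by
      intro y hy
      obtain ⟨hy, hyx⟩ := Finset.mem_filter.mp hy
      rw [Finset.mem_insert, Finset.mem_singleton]
      by_contra hcon
      push Not at hcon
      have e1 := hA x hx
      have e2 := hA y hy
      have := h.near h0 hyx (by omega) (by omega) hcon.1 hcon.2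
      omega
    exact (Finset.card_le_card this).trans Finset.card_le_two
  have h00 : (0 : Fin 24 → ZMod 2) ∉ A.image c2 := by
    intro hm
    obtain ⟨x, hx, hx0⟩ := Finset.mem_image.mp hm
    have e1 := hA x hx
    have hxne : x ≠ 0 := by rintro rfl; rw [B_zero_left] at e1; omega
    have := h.near h0 (x := x) (y := 0) (by rw [hx0]; funext i; simp [c2]) (by omega) (by rw [B_zero_left]; omega)
      hxne (by simpa using hxne)
    omega
  let t : Finset (Fin 24 → ZMod 2) := (insert 0 (A.image c2))ᶜ
  have ht : t.card ≤ 8292375 := by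
    have : Fintype.card (Fin 24 → ZMod 2) = 2 ^ 24 := by simp [ZMod.card]
    rw [Finset.card_compl, Finset.card_insert_of_notMem h00, this]
    omega
  obtain ⟨y, _, hy⟩ := Finset.exists_lt_card_fiber_of_mul_lt_card_of_maps_to (s := shell G 4) (t := t) (f := c2) (n := 47) (by
    intro x hx
    rw [h.mem_shell] at hx
    norm_num at hx
    rw [Finset.mem_compl, Finset.mem_insert, not_or]
    constructor
    · intro hx0
      have hxne : x ≠ 0 := by rintro rfl; rw [B_zero_left] at hx; omega
      have := h.near h0 (x := x) (y := 0) (by rw [hx0]; funext i; simp [c2]) (by omega) (by rw [B_zero_left]; omega)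
        hxne (by simpa using hxne)
      rw [B_zero_left] at this
      omega
    · intro hm
      obtain ⟨y, hy, hyx⟩ := Finset.mem_image.mp hm
      have e1 := hA y hy
      have := h.near h0 hyx (by omega) (by omega) (by rintro rfl; omega) (by
        rintro rfl; rw [B_neg_left, B_neg_right] at e1; omega)
      omega) (by rw [n4]; omega)
  exact ⟨y, hy⟩

/-- a coordinate frame of norm 8 vectors -/
structure LFr (G : Matrix (Fin 24) (Fin 24) ℤ) (f : ℕ → Fin 24 → ℤ) : Prop where
  gram : ∀ c < 24, ∀ d < 24, B G (f c) (f d) = if c = d then 8 else 0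
  cong : ∀ c < 24, ∀ d < 24, ∃ y : Fin 24 → ℤ, f c - f d = (2 : ℤ) • y

theorem EUL.exists_LFr (h : EUL G) (h0 : (shell G 1).card = 0) : ∃ f, LFr G f := by
  classical
  obtain ⟨y, hy⟩ := h.big_fiber h0
  set F := (shell G 4).filter fun x => c2 x = y with hF
  have hmF : ∀ x ∈ F, B G x x = 8 ∧ c2 x = y := by
    intro x hx
    obtain ⟨hx, hxy⟩ := Finset.mem_filter.mp hx
    rw [h.mem_shell] at hx
    norm_num at hx
    exact ⟨hx, hxy⟩
  obtain ⟨P, hP⟩ : ∃ P : Finset (Fin 24 → ℤ) → Prop, ∀ S, P S ↔ ∀ x ∈ S, ∀ z ∈ S, x ≠ z → B G x z = 0 := ⟨_, fun _ => Iff.rfl⟩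
  obtain ⟨S, hS, hmax⟩ := Finset.exists_max_image (F.powerset.filter P) Finset.card ⟨∅, by simp [hP]⟩
  obtain ⟨hSF, hSo⟩ := Finset.mem_filter.mp hS
  rw [hP] at hSo
  rw [Finset.mem_powerset] at hSF
  have hcov : F ⊆ S ∪ S.image fun x => -x := by
    intro x hx
    rw [Finset.mem_union]
    by_contra hcon
    rw [not_or] at hcon
    obtain ⟨h1, h2⟩ := hcon
    have horth : ∀ z ∈ S, B G x z = 0 := by
      intro z hz
      obtain ⟨hx8, hxc⟩ := hmF x hx
      obtain ⟨hz8, hzc⟩ := hmF z (hSF hz)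
      refine (h.near h0 (hxc.trans hzc.symm) hx8.le hz8.le ?_ ?_).2.2
      · rintro rfl; exact h1 hz
      · rintro rfl; exact h2 (Finset.mem_image.mpr ⟨z, hz, rfl⟩)
    have := hmax (insert x S) (by
      rw [Finset.mem_filter, Finset.mem_powerset, hP]
      refine ⟨Finset.insert_subset hx hSF, ?_⟩
      intro a ha b hb hab
      rcases Finset.mem_insert.mp ha with ha' | ha' <;> rcases Finset.mem_insert.mp hb with hb' | hb'
      · exact absurd (ha'.trans hb'.symm) hab
      · rw [ha']; exact horth b hb'
      · rw [hb', h.comm]; exact horth a ha'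
      · exact hSo a ha' b hb' hab)
    rw [Finset.card_insert_of_notMem h1] at this
    omega
  have hcard : 24 ≤ S.card := by
    have h1 := Finset.card_le_card hcov
    have h2 := Finset.card_union_le S (S.image fun x => -x)
    have h3 := Finset.card_image_le (s := S) (f := fun x => -x)
    omega
  obtain ⟨S', hS'S, hS'⟩ := Finset.exists_subset_card_eq hcard
  let e := (S'.equivFinOfCardEq hS').symm
  refine ⟨fun c => if hc : c < 24 then (e ⟨c, hc⟩ : Fin 24 → ℤ) else 0, ?_, ?_⟩
  · intro c hc d hd
    rw [dif_pos hc, dif_pos hd]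
    split_ifs with hcd
    · subst hcd
      exact (hmF _ (hSF (hS'S (e ⟨c, hc⟩).2))).1
    · refine hSo _ (hS'S (e ⟨c, hc⟩).2) _ (hS'S (e ⟨d, hd⟩).2) fun he => hcd ?_
      have := e.injective (Subtype.ext he)
      simpa using this
  · intro c hc d hd
    rw [dif_pos hc, dif_pos hd]
    exact c2_eq ((hmF _ (hSF (hS'S (e ⟨c, hc⟩).2))).2.trans (hmF _ (hSF (hS'S (e ⟨d, hd⟩).2))).2.symm)

end Nie

end ModLeechA

section ModLeechB
open scoped BigOperators

namespace Nie
variable {G : Matrix (Fin 24) (Fin 24) ℤ} {f : ℕ → Fin 24 → ℤ}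

theorem LFr.zero (h : EUL G) (hf : LFr G f) {x} (hx : ∀ c < 24, B G x (f c) = 0) : x = 0 := by
  let F : Matrix (Fin 24) (Fin 24) ℤ := fun i j => f i j
  have e1 : ∀ y (c : Fin 24), (F * G).mulVec y c = B G (f c) y := by
    intro y c
    rw [← Matrix.mulVec_mulVec]; rfl
  have e2 : F * G * F.transpose = (8 : ℤ) • (1 : Matrix (Fin 24) (Fin 24) ℤ) := by
    ext c d
    have := e1 (f d) c
    rw [hf.gram c c.2 d d.2] at this
    rw [Matrix.smul_apply, Matrix.one_apply, smul_eq_mul, mul_ite, mul_one, mul_zero]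
    simp only [Fin.ext_iff]
    rw [← this]; rfl
  have e3 : (F * G).det ≠ 0 := by
    intro h0
    have := congrArg Matrix.det e2
    rw [Matrix.det_mul, h0, zero_mul, Matrix.det_smul, Matrix.det_one] at this
    norm_num at this
  refine Matrix.eq_zero_of_mulVec_eq_zero e3 (funext fun c => ?_)
  rw [e1, h.comm, hx c c.2]; rfl

theorem LFr.pars (h : EUL G) (hf : LFr G f) (x y) :
    8 * B G x y = ∑ c ∈ Finset.range 24, B G x (f c) * B G y (f c) := by
  have e : (8 : ℤ) • x - ∑ c ∈ Finset.range 24, B G x (f c) • f c = 0 := by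
    refine hf.zero h fun d hd => ?_
    rw [B_sub_left, B_smul_left, B_sum_left, Finset.sum_eq_single d]
    · rw [B_smul_left, hf.gram d hd d hd, if_pos rfl]; ring
    · intro c hc hne
      rw [B_smul_left, hf.gram c (Finset.mem_range.mp hc) d hd, if_neg hne, mul_zero]
    · intro hn; exact absurd (Finset.mem_range.mpr hd) hn
  rw [← B_smul_left, sub_eq_zero.mp e, B_sum_left]
  refine Finset.sum_congr rfl fun c _ => ?_
  rw [B_smul_left, h.comm (f c) y]

theorem LFr.par (hf : LFr G f) (x) {c d} (hc : c < 24) (hd : d < 24) : (2 : ℤ) ∣ B G x (f c) - B G x (f d) := by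
  obtain ⟨y, hy⟩ := hf.cong c hc d hd
  rw [← B_sub_right, hy, B_smul_right]; exact ⟨_, rfl⟩

theorem LFr.dvec (hf : LFr G f) (z : ℕ → ℤ) (hz : 2 ∣ ∑ c ∈ Finset.range 24, z c) : ∃ u, ∀ c < 24, B G u (f c) = 4 * z c := by
  have hy : ∀ c, ∃ y : Fin 24 → ℤ, c < 24 → f c - f 0 = (2 : ℤ) • y := by
    intro c
    by_cases hc : c < 24
    · obtain ⟨y, hy⟩ := hf.cong c hc 0 (by norm_num); exact ⟨y, fun _ => hy⟩
    · exact ⟨0, fun h => absurd h hc⟩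
  choose y hy using hy
  obtain ⟨k, hk⟩ := hz
  refine ⟨∑ c ∈ Finset.range 24, z c • y c + k • f 0, fun d hd => ?_⟩
  have e : (2 : ℤ) • (∑ c ∈ Finset.range 24, z c • y c + k • f 0) = ∑ c ∈ Finset.range 24, z c • f c := by
    rw [smul_add, smul_smul, ← hk, Finset.smul_sum, Finset.sum_smul, ← Finset.sum_add_distrib]
    refine Finset.sum_congr rfl fun c hc => ?_
    rw [smul_comm, ← hy c (Finset.mem_range.mp hc), ← smul_add, sub_add_cancel]
  have e2 := congrArg (fun x => B G x (f d)) e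
  beta_reduce at e2
  rw [B_smul_left, B_sum_left] at e2
  rw [Finset.sum_eq_single (f := fun i => B G (z i • f i) (f d)) d] at e2
  · rw [B_smul_left, hf.gram d hd d hd, if_pos rfl] at e2; linarith
  · intro c hc hne
    rw [B_smul_left, hf.gram c (Finset.mem_range.mp hc) d hd, if_neg hne, mul_zero]
  · intro hn; exact absurd (Finset.mem_range.mpr hd) hn

def lcod (G : Matrix (Fin 24) (Fin 24) ℤ) (f : ℕ → Fin 24 → ℤ) : Set (List ℕ) :=
  {w | w.length = 24 ∧ (∀ c < 24, wt w c < 2) ∧ ∃ x, ∀ c < 24, (4 : ℤ) ∣ B G x (f c) - 2 * wt w c}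

theorem TT0 : (TT 0).length = 24 ∧ DD 0 = 2 ∧ ∀ c < 24, ty (TT 0) c = (1, 1) := by decide +kernel

theorem pairN0 {w w' : List ℕ} (hw : ∀ c < 24, wt w c < 2) (hw' : ∀ c < 24, wt w' c < 2) :
    pairN (TT 0) (DD 0) w w' = ∑ c ∈ Finset.range 24, wt w c * wt w' c := by
  rw [pairN, sumN_eq, TT0.1, TT0.2.1]
  refine Finset.sum_congr rfl fun c hc => ?_
  have hc := Finset.mem_range.mp hc
  rw [TT0.2.2 c hc]
  have h1 := hw c hc
  have h2 := hw' c hc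
  generalize wt w c = a at *
  generalize wt w' c = b at *
  interval_cases a <;> interval_cases b <;> rfl

theorem lcod_word {x} (hx : ∀ c < 24, (2 : ℤ) ∣ B G x (f c)) (w : ℕ → ℕ) (hw : ∀ c < 24, w c = (B G x (f c) / 2 % 2).toNat) :
    tab 24 w ∈ lcod G f := by
  refine ⟨tab_length _ _, ?_, x, ?_⟩
  · intro c hc; rw [wt_tab hc, hw c hc]; omega
  · intro c hc; rw [wt_tab hc, hw c hc]; have := hx c hc; omega

theorem LFr.nrm4 (h : EUL G) (h0 : (shell G 1).card = 0) (hf : LFr G f) {w} (hw : w ∈ lcod G f) :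
    ∑ c ∈ Finset.range 24, wt w c * wt w c ≠ 4 := by
  intro h4
  obtain ⟨_, hw2, x, hx⟩ := hw
  have : ∀ c, ∃ z : ℤ, c < 24 → B G x (f c) - 2 * wt w c = 4 * z := by
    intro c
    by_cases hc : c < 24
    · obtain ⟨z, hz⟩ := hx c hc; exact ⟨z, fun _ => hz⟩
    · exact ⟨0, fun h => absurd h hc⟩
  choose z hz using this
  obtain ⟨d, hd, hd1⟩ : ∃ d < 24, wt w d = 1 := by
    by_contra hcon
    push Not at hcon
    rw [Finset.sum_eq_zero] at h4
    · omega
    intro c hc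
    have h1 := hw2 c (Finset.mem_range.mp hc)
    have h2 := hcon c (Finset.mem_range.mp hc)
    have : wt w c = 0 := by omega
    rw [this, mul_zero]
  obtain ⟨e, he, hev⟩ : ∃ e : ℤ, (e = 0 ∨ e = 1) ∧ 2 ∣ ∑ c ∈ Finset.range 24, (z c + if c = d then e else 0) := by
    simp only [Finset.sum_add_distrib, Finset.sum_ite_eq', Finset.mem_range, hd, if_true]
    rcases Int.emod_two_eq_zero_or_one (∑ c ∈ Finset.range 24, z c) with h | h
    · exact ⟨0, Or.inl rfl, by omega⟩
    · exact ⟨1, Or.inr rfl, by omega⟩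
  obtain ⟨u, hu⟩ := hf.dvec _ hev
  have hp := hf.pars h (x - u) (x - u)
  have : ∑ c ∈ Finset.range 24, B G (x - u) (f c) * B G (x - u) (f c) = ∑ c ∈ Finset.range 24, 4 * ((wt w c * wt w c : ℕ) : ℤ) := by
    refine Finset.sum_congr rfl fun c hc => ?_
    have hc := Finset.mem_range.mp hc
    rw [B_sub_left, hu c hc]
    have h1 := hz c hc
    have h2 : B G x (f c) = 4 * z c + 2 * wt w c := by linarith
    rw [h2]
    push_cast
    split_ifs with hcd
    · rw [hcd, hd1]
      rcases he with rfl | rfl <;> (push_cast; ring)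
    · ring
  rw [this, ← Finset.mul_sum, ← Nat.cast_sum, h4] at hp
  have h2 : B G (x - u) (x - u) = 2 := by push_cast at hp; linarith
  have h3 := h.four_le h0 (x := x - u) (by intro h; rw [h, B_zero_left] at h2; omega)
  omega

theorem EUL.dual (h : EUL G) (s : Finset ℕ) (z : ℕ → ℚ) (hk : ∀ x, ∃ n : ℤ, ∑ j ∈ s, z j * (B G x (f j) : ℚ) = n) :
    ∃ u, ∀ x, (B G x u : ℚ) = ∑ j ∈ s, z j * (B G x (f j) : ℚ) := by
  choose n hn using fun k : Fin 24 => hk (Pi.single k 1)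
  refine ⟨G⁻¹.mulVec n, fun x => ?_⟩
  have h1 : B G x (G⁻¹.mulVec n) = ∑ k, x k * n k := by
    unfold B
    rw [Matrix.mulVec_mulVec, h.inv_right, Matrix.one_mulVec]; rfl
  rw [h1]
  push_cast
  simp_rw [← hn, Finset.mul_sum]
  rw [Finset.sum_comm]
  refine Finset.sum_congr rfl fun j _ => ?_
  rw [h.comm x (f j), B_singles (f j) x]
  push_cast
  rw [Finset.mul_sum]
  refine Finset.sum_congr rfl fun k _ => ?_
  rw [h.comm (f j)]; ring

theorem LFr.surj (h : EUL G) (hf : LFr G f) (s : ℕ → Bool) (p : ℕ → ℤ)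
    (hps : ∀ c < 24, s c = false → p c = 0)
    (hperp : ∀ x, (∀ c < 24, (2 : ℤ) ∣ B G x (f c)) → (∀ c < 24, s c = false → B G x (f c) = 0) →
      4 ∣ ∑ c ∈ Finset.range 24, B G x (f c) * p c) :
    ∃ x, ∀ c < 24, s c = true → (4 : ℤ) ∣ B G x (f c) - 2 * p c := by
  classical
  by_contra hno
  let M : AddSubgroup (Fin 24 → ℤ) :=
    { carrier := {y | ∃ x, ∀ c : Fin 24, s c = true → (4 : ℤ) ∣ B G x (f c) - y c}
      add_mem' := by
        rintro a b ⟨x, hx⟩ ⟨y, hy⟩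
        refine ⟨x + y, fun c hc => ?_⟩
        have := dvd_add (hx c hc) (hy c hc)
        rw [B_add_left, Pi.add_apply, add_sub_add_comm]
        exact this
      zero_mem' := ⟨0, fun c _ => by rw [B_zero_left]; simp⟩
      neg_mem' := by
        rintro a ⟨x, hx⟩
        refine ⟨-x, fun c hc => ?_⟩
        have := (dvd_neg (a := (4:ℤ))).mpr (hx c hc)
        rw [B_neg_left, Pi.neg_apply, neg_sub_neg, ← neg_sub]
        exact this }
  obtain ⟨z, hz1, hz2⟩ := char_sep M (fun c => 2 * p c) (by
    rintro ⟨x, hx⟩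
    exact hno ⟨x, fun c hc hs => hx ⟨c, hc⟩ hs⟩)
  let ζ : ℕ → ℚ := fun c => if hc : c < 24 then (if s c = true then z ⟨c, hc⟩ else 0) else 0
  have hζ : ∀ c : Fin 24, ζ c = if s c = true then z c else 0 := by intro c; simp [ζ]
  have hm : ∀ c, ∃ m : ℤ, 4 * ζ c = m := by
    intro c
    by_cases hc : c < 24
    swap
    · exact ⟨0, by simp [ζ, hc]⟩
    obtain ⟨n, hn⟩ := hz1 (Pi.single ⟨c, hc⟩ 4) ⟨0, fun d _ => by
      rw [B_zero_left, Pi.single_apply]; split_ifs <;> norm_num⟩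
    rw [Finset.sum_eq_single ⟨c, hc⟩] at hn
    · rw [hζ ⟨c, hc⟩]
      split_ifs
      · exact ⟨n, by rw [← hn, Pi.single_eq_same]; push_cast; ring⟩
      · exact ⟨0, by simp⟩
    · intro d _ hd; rw [Pi.single_eq_of_ne hd]; simp
    · intro hn; exact absurd (Finset.mem_univ _) hn
  choose m hm using hm
  obtain ⟨u, hu⟩ := h.dual (f := f) (Finset.range 24) ζ (by
    intro x
    obtain ⟨n, hn⟩ := hz1 (fun c => if s c = true then B G x (f c) else 0) ⟨x, fun c hc => by simp [hc]⟩
    refine ⟨n, ?_⟩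
    rw [← hn, ← Fin.sum_univ_eq_sum_range (fun c => ζ c * (B G x (f c) : ℚ))]
    refine Finset.sum_congr rfl fun c _ => ?_
    rw [hζ]; split_ifs <;> simp)
  have hua : ∀ c < 24, B G u (f c) = 2 * m c := by
    intro c hc
    have : (B G u (f c) : ℚ) = (2 * m c : ℤ) := by
      rw [h.comm, hu, Finset.sum_eq_single c]
      · rw [hf.gram c hc c hc, if_pos rfl]; push_cast; rw [← hm]; ring
      · intro d hd hne; rw [hf.gram c hc d (Finset.mem_range.mp hd), if_neg hne.symm]; simp
      · intro hn; exact absurd (Finset.mem_range.mpr hc) hn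
    exact_mod_cast this
  obtain ⟨k, hk⟩ := hperp u (fun c hc => ⟨_, hua c hc⟩) (by
    intro c hc hs
    have h1 := hm c
    have h2 := hζ ⟨c, hc⟩
    simp only [hs] at h2
    simp only [Bool.false_eq_true, if_false] at h2
    rw [h2] at h1
    have : m c = 0 := by
      have : (m c : ℚ) = 0 := by rw [← h1]; ring
      exact_mod_cast this
    rw [hua c hc, this]; rfl)
  apply hz2
  refine ⟨k, ?_⟩
  have e : ∑ j : Fin 24, z j * ((2 * p j : ℤ) : ℚ) = ∑ c ∈ Finset.range 24, (m c : ℚ) * p c / 2 := by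
    rw [← Fin.sum_univ_eq_sum_range (fun c => (m c : ℚ) * p c / 2)]
    refine Finset.sum_congr rfl fun c _ => ?_
    rw [← hm, hζ]
    split_ifs with hs
    · push_cast; ring
    · rw [hps c c.2 (by simpa using hs)]; simp
  rw [e]
  have e2 : (∑ c ∈ Finset.range 24, ((2 * m c * p c : ℤ) : ℚ)) = ((4 * k : ℤ) : ℚ) := by
    rw [← hk, ← Int.cast_sum]
    congr 1
    refine Finset.sum_congr rfl fun c hc => ?_
    rw [hua c (Finset.mem_range.mp hc)]
  have e3 : ∑ c ∈ Finset.range 24, (m c : ℚ) * p c / 2 = (∑ c ∈ Finset.range 24, ((2 * m c * p c : ℤ) : ℚ)) / 4 := by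
    rw [Finset.sum_div]
    refine Finset.sum_congr rfl fun c _ => ?_
    push_cast; ring
  rw [e3, e2]; push_cast; ring

end Nie

end ModLeechB

section ModLeechC
open scoped BigOperators

namespace Nie
variable {G : Matrix (Fin 24) (Fin 24) ℤ} {f : ℕ → Fin 24 → ℤ}

theorem lcod_z {w} (hw : w ∈ lcod G f) : ∃ x, ∃ z : ℕ → ℤ, ∀ c < 24, B G x (f c) = 2 * wt w c + 4 * z c := by
  obtain ⟨_, _, x, hx⟩ := hw
  have : ∀ c, ∃ z : ℤ, c < 24 → B G x (f c) = 2 * wt w c + 4 * z := by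
    intro c
    by_cases hc : c < 24
    · obtain ⟨z, hz⟩ := hx c hc; exact ⟨z, fun _ => by linarith⟩
    · exact ⟨0, fun h => absurd h hc⟩
  choose z hz using this
  exact ⟨x, z, hz⟩

theorem LFr.wpair (h : EUL G) (hf : LFr G f) {w w'} (hw : w ∈ lcod G f) (hw' : w' ∈ lcod G f) :
    2 ∣ ∑ c ∈ Finset.range 24, wt w c * wt w' c := by
  obtain ⟨x, z, hx⟩ := lcod_z hw
  obtain ⟨x', z', hx'⟩ := lcod_z hw'
  have e := hf.pars h x x'
  have e2 : ∑ c ∈ Finset.range 24, B G x (f c) * B G x' (f c) =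
      4 * ((∑ c ∈ Finset.range 24, wt w c * wt w' c : ℕ) : ℤ) +
      8 * ∑ c ∈ Finset.range 24, (wt w c * z' c + wt w' c * z c + 2 * z c * z' c) := by
    rw [Nat.cast_sum, Finset.mul_sum, Finset.mul_sum, ← Finset.sum_add_distrib]
    refine Finset.sum_congr rfl fun c hc => ?_
    rw [hx c (Finset.mem_range.mp hc), hx' c (Finset.mem_range.mp hc)]
    push_cast; ring
  rw [e2] at e
  omega

theorem LFr.wnrm (h : EUL G) (hf : LFr G f) {w} (hw : w ∈ lcod G f) :
    4 ∣ ∑ c ∈ Finset.range 24, wt w c * wt w c := by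
  obtain ⟨x, z, hx⟩ := lcod_z hw
  have e := hf.pars h x x
  have e2 : ∑ c ∈ Finset.range 24, B G x (f c) * B G x (f c) =
      4 * ((∑ c ∈ Finset.range 24, wt w c * wt w c : ℕ) : ℤ) +
      16 * ∑ c ∈ Finset.range 24, (wt w c * z c + z c * z c) := by
    rw [Nat.cast_sum, Finset.mul_sum, Finset.mul_sum, ← Finset.sum_add_distrib]
    refine Finset.sum_congr rfl fun c hc => ?_
    rw [hx c (Finset.mem_range.mp hc)]
    push_cast; ring
  rw [e2] at e
  have := h.even x
  omega

theorem t11 : ncl (1, 1) = 2 ∧ (∀ a < 2, ∀ b < 2, cadd (1, 1) a b = (a + b) % 2) ∧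
    ∀ e < nau (1, 1), ∀ a < 2, phi (1, 1) e a = a := by decide +kernel

theorem lcod_lt {w} (hw : w ∈ lcod G f) : ∀ c < 24, wt w c < 2 := hw.2.1

theorem fam_leech (h : EUL G) (h0 : (shell G 1).card = 0) :
    Fam (TT 0) (DD 0) {C | ∃ f, LFr G f ∧ C = lcod G f} := by
  obtain ⟨hT, hD, hty⟩ := TT0
  obtain ⟨hn, hca, hph⟩ := t11
  refine ⟨?_, ?_, ?_, ?_, ?_, ?_, ?_, ?_⟩
  · rintro C ⟨f, hf, rfl⟩ w hw; rw [hT]; exact hw.1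
  · rintro C ⟨f, hf, rfl⟩ w hw c hc; rw [hT] at hc; rw [hty c hc, hn]; exact hw.2.1 c hc
  · rintro C ⟨f, hf, rfl⟩
    rw [hT]
    exact ⟨tab_length _ _, fun c hc => by rw [wt_tab hc]; norm_num, 0, fun c hc => by rw [wt_tab hc, B_zero_left]; norm_num⟩
  · rintro C ⟨f, hf, rfl⟩ w hw w' hw'
    have h1 := lcod_lt hw
    have h2 := lcod_lt hw'
    obtain ⟨x, z, hx⟩ := lcod_z hw
    obtain ⟨x', z', hx'⟩ := lcod_z hw'
    unfold wadd
    rw [hT]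
    refine ⟨tab_length _ _, fun c hc => ?_, x + x', fun c hc => ?_⟩
    · rw [wt_tab hc, hty c hc, hca _ (h1 c hc) _ (h2 c hc)]; omega
    · rw [wt_tab hc, hty c hc, hca _ (h1 c hc) _ (h2 c hc), B_add_left, hx c hc, hx' c hc]; omega
  · rintro C ⟨f, hf, rfl⟩ w hw
    rw [pairN0 (lcod_lt hw) (lcod_lt hw), hD]
    exact ⟨hf.wnrm h hw, hf.nrm4 h h0 hw⟩
  · rintro C ⟨f, hf, rfl⟩ w hw w' hw'
    rw [pairN0 (lcod_lt hw) (lcod_lt hw'), hD]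
    exact hf.wpair h hw hw'
  · rintro C ⟨f, hf, rfl⟩ s p hp hps hperp
    rw [hT] at hp hps hperp ⊢
    have hp : ∀ c < 24, wt p c < 2 := fun c hc => by have := hp c hc; rwa [hty c hc, hn] at this
    obtain ⟨x, hx⟩ := hf.surj h s (fun c => wt p c) (fun c hc hs => by rw [hps c hc hs]; rfl) (by
      intro x hx2 hx0
      have hw := lcod_word hx2 (fun c => (B G x (f c) / 2 % 2).toNat) (fun c _ => rfl)
      have := hperp _ hw (fun c hc hs => by rw [wt_tab hc, hx0 c hc hs]; rfl)
      rw [pairN0 (lcod_lt hw) hp, hD] at this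
      have h2 : (4 : ℤ) ∣ ∑ c ∈ Finset.range 24, (B G x (f c) * wt p c - 2 * ((wt (tab 24 (fun c => (B G x (f c) / 2 % 2).toNat)) c * wt p c : ℕ) : ℤ)) := by
        refine Finset.dvd_sum fun c hc => ?_
        have hc := Finset.mem_range.mp hc
        rw [wt_tab hc]
        have h1 := hx2 c hc
        have h3 := hp c hc
        generalize wt p c = a at *
        interval_cases a <;> omega
      rw [Finset.sum_sub_distrib, ← Finset.mul_sum, ← Nat.cast_sum] at h2
      omega)
    by_cases hs : ∃ c < 24, s c = true
    · obtain ⟨d, hd, hsd⟩ := hs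
      have hx2 : ∀ c < 24, (2 : ℤ) ∣ B G x (f c) := by
        intro c hc
        have := hf.par x hc hd
        have := hx d hd hsd
        omega
      refine ⟨_, lcod_word hx2 (fun c => (B G x (f c) / 2 % 2).toNat) (fun c _ => rfl), fun c hc hsc => ?_⟩
      rw [wt_tab hc]
      have := hx c hc hsc
      have := hp c hc
      omega
    · refine ⟨_, lcod_word (x := 0) (fun c _ => by rw [B_zero_left]; norm_num) (fun c => (B G 0 (f c) / 2 % 2).toNat) (fun c _ => rfl), fun c hc hsc => ?_⟩
      exact absurd ⟨c, hc, hsc⟩ hs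
  · rintro C ⟨f, hf, rfl⟩ π ρ e hS
    have hlt : ∀ c < 24, π c < 24 := by have := hS.lt; rwa [hT] at this
    have hinj : ∀ c < 24, ∀ d < 24, π c = π d → c = d := by
      intro c hc d hd he
      rw [← hS.inv' c (by rwa [hT]), he, hS.inv' d (by rwa [hT])]
    refine ⟨_, ⟨fun c => f (π c), ⟨?_, ?_⟩, rfl⟩, ?_⟩
    · intro c hc d hd
      rw [hf.gram _ (hlt c hc) _ (hlt d hd)]
      by_cases hcd : c = d
      · rw [hcd]; simp
      · rw [if_neg hcd, if_neg fun he => hcd (hinj c hc d hd he)]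
    · intro c hc d hd; exact hf.cong _ (hlt c hc) _ (hlt d hd)
    · intro w hw
      obtain ⟨x, hx⟩ := hw.2.2
      unfold sapp
      rw [hT]
      have hph' : ∀ c < 24, phi (ty (TT 0) c) (e c) (wt w (π c)) = wt w (π c) := by
        intro c hc
        have := hS.aut c (by rwa [hT])
        rw [hty c hc] at this ⊢
        exact hph _ this _ (lcod_lt hw _ (hlt c hc))
      refine ⟨tab_length _ _, fun c hc => ?_, x, fun c hc => ?_⟩
      · rw [wt_tab hc, hph' c hc]; exact lcod_lt hw _ (hlt c hc)
      · rw [wt_tab hc, hph' c hc]; exact hx _ (hlt c hc)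

theorem leech_gens (h : EUL G) (h0 : (shell G 1).card = 0) : ∃ f, LFr G f ∧ ∀ g ∈ GG 0, g ∈ lcod G f := by
  obtain ⟨h1, h2, h3⟩ := misc (i := 0) (by norm_num)
  obtain ⟨f, hf⟩ := h.exists_LFr h0
  rcases h3 with h3 | ⟨N, hN, hK⟩
  · exact ⟨f, hf, by rw [h3]; simp⟩
  · obtain ⟨C, ⟨f', hf', rfl⟩, hC⟩ := certOK_spec (gens := GG 0) (fam_leech h h0) h1 h2 _ _ (ck_all 0 (by norm_num))
      (by intro K hK; rw [List.mem_singleton] at hK; subst hK; exact id) N hN ⟨_, ⟨f, hf, rfl⟩, by rw [hK]; intro k hk; simp at hk⟩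
    exact ⟨f', hf', hC⟩

end Nie

end ModLeechC

section ModLeechD
open scoped BigOperators

namespace Nie
variable {G : Matrix (Fin 24) (Fin 24) ℤ} {f : ℕ → Fin 24 → ℤ}

theorem LFr.signs (hf : LFr G f) (σ : ℕ → ℤ) (hσ : ∀ c, σ c = 1 ∨ σ c = -1) :
    LFr G (fun c => σ c • f c) ∧ ∀ w ∈ lcod G f, w ∈ lcod G (fun c => σ c • f c) := by
  refine ⟨⟨?_, ?_⟩, ?_⟩
  · intro c hc d hd
    rw [B_smul_left, B_smul_right, hf.gram c hc d hd]
    split_ifs with h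
    · subst h; rcases hσ c with h | h <;> rw [h] <;> norm_num
    · ring
  · intro c hc d hd
    obtain ⟨y, hy⟩ := hf.cong c hc d hd
    have h2 : ∀ c, ∃ n, σ c = 1 + 2 * n := fun c => (hσ c).elim (fun h => ⟨0, by rw [h]; rfl⟩) (fun h => ⟨-1, by rw [h]; rfl⟩)
    obtain ⟨n, hn⟩ := h2 c
    obtain ⟨m, hm⟩ := h2 d
    refine ⟨y + n • f c - m • f d, ?_⟩
    rw [hn, hm, smul_sub, smul_add, ← hy]
    module
  · rintro w ⟨h1, h2, x, hx⟩
    refine ⟨h1, h2, x, fun c hc => ?_⟩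
    have := hx c hc
    rw [B_smul_right]
    rcases hσ c with h | h <;> rw [h] <;> omega

def x0 (c : ℕ) : ℤ := bif Nat.beq c 0 then -3 else 1

theorem x0_eq (c : ℕ) : x0 c = 1 - 4 * if c = 0 then 1 else 0 := by
  cases c <;> rfl

theorem sum_delta (t : ℤ) : ∑ c ∈ Finset.range 24, (if c = 0 then t else 0) = t := by
  rw [Finset.sum_ite_eq', if_pos (by simp)]

theorem leech_odd (h : EUL G) (h0 : (shell G 1).card = 0) (hf : LFr G f) : ∃ x, ∀ c < 24, ¬ (2 : ℤ) ∣ B G x (f c) := by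
  by_contra hcon
  push Not at hcon
  have hev : ∀ x, (2 : ℤ) ∣ B G x (f 0) := by
    intro x
    obtain ⟨c, hc, h1⟩ := hcon x
    have := hf.par x hc (d := 0) (by norm_num)
    omega
  obtain ⟨u, hu⟩ := h.dual (f := f) {0} (fun _ => 1 / 2) (by
    intro x
    obtain ⟨n, hn⟩ := hev x
    exact ⟨n, by rw [Finset.sum_singleton, hn]; push_cast; ring⟩)
  have hu : ∀ x, 2 * B G x u = B G x (f 0) := by
    intro x
    have := hu x
    rw [Finset.sum_singleton] at this
    have : (2 * B G x u : ℚ) = B G x (f 0) := by rw [this]; ring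
    exact_mod_cast this
  have e1 := hu (f 0)
  have e2 := hu u
  rw [hf.gram 0 (by norm_num) 0 (by norm_num), if_pos rfl] at e1
  rw [h.comm u (f 0)] at e2
  have := h.four_le h0 (x := u) (by intro h; rw [h, B_zero_right] at e1; omega)
  omega

theorem leech_x0 (h : EUL G) (h0 : (shell G 1).card = 0) : ∃ f, LFr G f ∧ (∃ x, ∀ c < 24, B G x (f c) = x0 c) ∧
    ∀ g ∈ GG 0, ∃ x, ∀ c < 24, B G x (f c) = 2 * wt g c := by
  obtain ⟨f, hf, hg⟩ := leech_gens h h0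
  obtain ⟨x, hx⟩ := leech_odd h h0 hf
  obtain ⟨hf', hs⟩ := hf.signs (fun c => if B G x (f c) % 4 = 1 then 1 else -1) (fun c => by split_ifs <;> simp)
  have hx1 : ∀ c, ∃ z : ℤ, c < 24 → B G x ((if B G x (f c) % 4 = 1 then (1 : ℤ) else -1) • f c) = 1 + 4 * z := by
    intro c
    by_cases hc : c < 24
    · have := hx c hc
      rw [B_smul_right]
      split_ifs with h1
      · exact ⟨B G x (f c) / 4, fun _ => by omega⟩
      · exact ⟨(- B G x (f c)) / 4, fun _ => by omega⟩
    · exact ⟨0, fun h => absurd h hc⟩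
  have hg' : ∀ g ∈ GG 0, g ∈ lcod G fun c => (if B G x (f c) % 4 = 1 then (1 : ℤ) else -1) • f c := fun g h => hs g (hg g h)
  choose z hz using hx1
  generalize hF : (fun c => (if B G x (f c) % 4 = 1 then (1 : ℤ) else -1) • f c) = F at hf' hg'
  have hz : ∀ c < 24, B G x (F c) = 1 + 4 * z c := by intro c hc; rw [← hF]; exact hz c hc
  clear hF
  have hodd : 2 ∣ ∑ c ∈ Finset.range 24, (z c + if c = 0 then 1 else 0) := by
    have e := hf'.pars h x x
    have e2 : ∑ c ∈ Finset.range 24, B G x (F c) * B G x (F c) = 24 + 8 * ∑ c ∈ Finset.range 24, z c + 16 * ∑ c ∈ Finset.range 24, z c * z c := by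
      rw [Finset.mul_sum, Finset.mul_sum, show (24 : ℤ) = ∑ c ∈ Finset.range 24, 1 by simp, ← Finset.sum_add_distrib, ← Finset.sum_add_distrib]
      refine Finset.sum_congr rfl fun c hc => ?_
      rw [hz c (Finset.mem_range.mp hc)]; ring
    rw [e2] at e
    have := h.even x
    rw [Finset.sum_add_distrib, sum_delta]
    omega
  obtain ⟨u, hu⟩ := hf'.dvec _ hodd
  have hX : ∀ c < 24, B G (x - u) (F c) = x0 c := by
    intro c hc
    rw [B_sub_left, hz c hc, hu c hc, x0_eq]; ring
  refine ⟨F, hf', ⟨_, hX⟩, fun g hgg => ?_⟩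
  have hgm := hg' g hgg
  obtain ⟨y, t, hy⟩ := lcod_z hgm
  have e := hf'.pars h y (x - u)
  have e2 : ∑ c ∈ Finset.range 24, B G y (F c) * B G (x - u) (F c) =
      2 * ((∑ c ∈ Finset.range 24, wt g c * wt g c : ℕ) : ℤ) + 4 * ∑ c ∈ Finset.range 24, t c - 8 * (wt g 0 + 2 * t 0) := by
    rw [← sum_delta (wt g 0 + 2 * t 0), Nat.cast_sum, Finset.mul_sum, Finset.mul_sum, Finset.mul_sum, ← Finset.sum_add_distrib, ← Finset.sum_sub_distrib]
    refine Finset.sum_congr rfl fun c hc => ?_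
    have hc := Finset.mem_range.mp hc
    rw [hy c hc, hX c hc, x0_eq]
    have : (wt g c : ℤ) * wt g c = wt g c := by
      have := lcod_lt hgm c hc
      generalize wt g c = a at *
      interval_cases a <;> rfl
    push_cast
    rw [this]
    split_ifs with h
    · subst h; ring
    · ring
  rw [e2] at e
  have h4 := hf'.wnrm h hgm
  obtain ⟨u', hu'⟩ := hf'.dvec t (by omega)
  exact ⟨y - u', fun c hc => by rw [B_sub_left, hy c hc, hu' c hc]; ring⟩

/-! ### the standard Leech lattice -/

def ue (j : ℕ) (m : ℤ) : List ℤ := (List.range 24).map fun c => bif Nat.beq c j then m else bif Nat.beq c 23 then -4 else 0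

/-- basis of the Leech lattice, scaled by the square root of 8 -/
def LX : List (List ℤ) :=
  ((List.range 24).map x0) :: (((GG 0).eraseIdx 1).map fun g => (List.range 24).map fun c => 2 * (wt g c : ℤ)) ++
  ([10, 12, 13, 14, 15, 17, 18, 19, 20, 21, 22].map fun j => ue j 4) ++ [ue 23 8]

noncomputable def LH : List (List ℤ) := LX.map fun a => LX.map fun b => dotl a b / 8
def xr (k c : ℕ) : ℤ := (LX.getD k []).getD c 0

theorem LX_row : LX.length = 24 ∧ ∀ a ∈ LX, a.length = 24 := by decide +kernel

theorem LX_bar : bar 23 1 LH = true := by decide +kernel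

theorem LX_dvd : LX.all (fun a => Nat.beq ((dotl a a) % 16).toNat 0 && LX.all fun b => Nat.beq ((dotl a b) % 8).toNat 0) = true := by decide +kernel

noncomputable def sumZ (l : List ℤ) : ℤ := dotl ((List.range 24).map fun _ => 1) l
def gz (g : List ℕ) : List ℤ := (List.range 24).map fun c => (wt g c : ℤ)

theorem LX_lin : LX.all (fun a => Nat.beq ((sumZ a - 4 * a.getD 0 0) % 8).toNat 0 &&
    ((GG 0).all fun g => Nat.beq (dotl (gz g) a % 4).toNat 0) &&
    allb 24 fun c => Nat.beq ((a.getD c 0 - a.getD 0 0) % 2).toNat 0) = true := by decide +kernel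

theorem ue_ok : ∀ a ∈ ([10, 12, 13, 14, 15, 17, 18, 19, 20, 21, 22].map fun j => ue j 4) ++ [ue 23 8],
    sumZ a % 8 = 0 ∧ ∀ c < 24, a.getD c 0 % 4 = 0 := by decide +kernel

theorem GG0_len : ∀ g ∈ GG 0, g.length = 24 ∧ ∀ c < 24, wt g c < 2 := by decide +kernel

end Nie

end ModLeechD

section ModLeechE
open scoped BigOperators

namespace Nie
variable {G : Matrix (Fin 24) (Fin 24) ℤ} {f : ℕ → Fin 24 → ℤ}

theorem xr_mem {k} (hk : k < 24) : LX.getD k [] ∈ LX := by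
  rw [List.getD_eq_getElem _ _ (by rw [LX_row.1]; exact hk)]; exact List.getElem_mem _

theorem tn0 {n m : ℤ} (hm : 0 < m) (h : Nat.beq (n % m).toNat 0 = true) : m ∣ n := by
  have h := Nat.eq_of_beq_eq_true h
  have := Int.emod_nonneg n hm.ne'
  exact Int.dvd_of_emod_eq_zero (by omega)

theorem dot_range {a : List ℤ} (ha : a.length = 24) (b : List ℤ) : dotl a b = ∑ c ∈ Finset.range 24, a.getD c 0 * b.getD c 0 := by
  rw [dotl_eq, ha]

theorem getD_rm {α : Type} (F : ℕ → α) (d : α) {c} (hc : c < 24) : ((List.range 24).map F).getD c d = F c := by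
  rw [getD_map _ _ 0 _ (by simpa using hc), List.getD_eq_getElem _ _ (by simpa using hc), List.getElem_range]

theorem sumZ_eq (b : List ℤ) : sumZ b = ∑ c ∈ Finset.range 24, b.getD c 0 := by
  unfold sumZ
  rw [dot_range (by simp)]
  refine Finset.sum_congr rfl fun c hc => ?_
  rw [getD_rm _ _ (Finset.mem_range.mp hc), one_mul]

theorem LH_ent {k l} (hk : k < 24) (hl : l < 24) : 8 * ent LH k l = ∑ c ∈ Finset.range 24, xr k c * xr l c := by
  unfold ent LH
  rw [getD_map _ _ [] _ (by rw [LX_row.1]; exact hk), getD_map _ _ [] _ (by rw [LX_row.1]; exact hl)]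
  have h := List.all_eq_true.mp LX_dvd _ (xr_mem hk)
  rw [Bool.and_eq_true] at h
  have h := tn0 (by norm_num) (List.all_eq_true.mp h.2 _ (xr_mem hl))
  rw [Int.mul_ediv_cancel' h, dot_range (LX_row.2 _ (xr_mem hk))]; rfl

noncomputable def LE : Matrix (Fin 24) (Fin 24) ℤ := mat LH

theorem LE_EUL : EUL LE := by
  refine EUL_of_list ?_ ?_ LX_bar
  · intro i hi j hj
    have h1 := LH_ent hi hj
    have h2 := LH_ent hj hi
    have : ∑ c ∈ Finset.range 24, xr i c * xr j c = ∑ c ∈ Finset.range 24, xr j c * xr i c :=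
      Finset.sum_congr rfl fun c _ => mul_comm _ _
    omega
  · intro i hi
    have h1 := LH_ent hi hi
    have h := List.all_eq_true.mp LX_dvd _ (xr_mem hi)
    rw [Bool.and_eq_true] at h
    have h := tn0 (by norm_num) h.1
    rw [dot_range (LX_row.2 _ (xr_mem hi))] at h
    change 16 ∣ ∑ c ∈ Finset.range 24, xr i c * xr i c at h
    omega

theorem LE_unique (h : EUL G) (h0 : (shell G 1).card = 0) : ∃ P : Matrix (Fin 24) (Fin 24) ℤ, P.transpose * G * P = LE := by
  obtain ⟨f, hf, ⟨x, hx⟩, hg⟩ := leech_x0 h h0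
  have key : ∀ k : Fin 24, ∃ b, ∀ c < 24, B G b (f c) = xr k c := by
    intro k
    have hm := xr_mem k.2
    unfold xr
    generalize LX.getD k [] = a at *
    unfold LX at hm
    rw [List.mem_append, List.mem_append, List.mem_cons, or_assoc, or_assoc, ← List.mem_append] at hm
    rcases hm with rfl | hm | hm
    · exact ⟨x, fun c hc => by rw [getD_rm _ _ hc, hx c hc]⟩
    · obtain ⟨g, hgm, rfl⟩ := List.mem_map.mp hm
      obtain ⟨y, hy⟩ := hg g (List.mem_of_mem_eraseIdx hgm)
      exact ⟨y, fun c hc => by rw [getD_rm _ _ hc, hy c hc]⟩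
    · obtain ⟨h1, h2⟩ := ue_ok a hm
      rw [sumZ_eq] at h1
      have e : ∑ c ∈ Finset.range 24, a.getD c 0 = 4 * ∑ c ∈ Finset.range 24, a.getD c 0 / 4 := by
        rw [Finset.mul_sum]
        refine Finset.sum_congr rfl fun c hc => ?_
        have := h2 c (Finset.mem_range.mp hc); omega
      obtain ⟨u, hu⟩ := hf.dvec (fun c => a.getD c 0 / 4) (by omega)
      exact ⟨u, fun c hc => by rw [hu c hc]; have := h2 c hc; omega⟩
  choose b hb using key
  refine ⟨Matrix.of fun i k => b k i, ?_⟩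
  ext k l
  have e : B G (b k) (b l) = ent LH k l := by
    have h1 := hf.pars h (b k) (b l)
    have h2 := LH_ent k.2 l.2
    have : ∑ c ∈ Finset.range 24, B G (b k) (f c) * B G (b l) (f c) = ∑ c ∈ Finset.range 24, xr k c * xr l c :=
      Finset.sum_congr rfl fun c hc => by rw [hb k c (Finset.mem_range.mp hc), hb l c (Finset.mem_range.mp hc)]
    omega
  change _ = ent LH k l
  rw [← e, Matrix.mul_assoc]
  rfl

theorem sq_mod4 (y : ℤ) : (4 : ℤ) ∣ y * y - (y % 2) := by
  rcases Int.even_or_odd' y with ⟨k, rfl | rfl⟩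
  · exact ⟨k * k, by rw [show 2 * k % 2 = 0 by omega]; ring⟩
  · exact ⟨k * k + k, by rw [show (2 * k + 1) % 2 = 1 by omega]; ring⟩

theorem LE_noroots : (shell LE 1).card = 0 := by
  rw [Finset.card_eq_zero, Finset.eq_empty_iff_forall_notMem]
  intro r hr
  rw [LE_EUL.mem_shell] at hr
  set X : ℕ → ℤ := fun c => ∑ k : Fin 24, r k * xr k c with hXd
  -- linear relations
  have lin : ∀ (φ : ℕ → ℤ) (m : ℤ), (∀ k < 24, m ∣ ∑ c ∈ Finset.range 24, φ c * xr k c) → m ∣ ∑ c ∈ Finset.range 24, φ c * X c := by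
    intro φ m hm
    have : ∑ c ∈ Finset.range 24, φ c * X c = ∑ k : Fin 24, r k * ∑ c ∈ Finset.range 24, φ c * xr k c := by
      simp only [hXd, Finset.mul_sum]
      rw [Finset.sum_comm]
      refine Finset.sum_congr rfl fun k _ => Finset.sum_congr rfl fun c _ => ?_
      ring
    rw [this]
    exact Finset.dvd_sum fun k _ => Dvd.dvd.mul_left (hm k k.2) _
  have hnorm : ∑ c ∈ Finset.range 24, X c * X c = 16 := by
    have e : 8 * B LE r r = ∑ c ∈ Finset.range 24, X c * X c := by
      unfold B dotProduct Matrix.mulVec dotProduct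
      simp only [Finset.mul_sum]
      have : ∀ c ∈ Finset.range 24, X c * X c = ∑ k : Fin 24, ∑ l : Fin 24, r k * r l * (xr k c * xr l c) := by
        intro c _
        simp only [hXd]
        rw [Finset.sum_mul_sum]
        refine Finset.sum_congr rfl fun k _ => Finset.sum_congr rfl fun l _ => ?_
        ring
      rw [Finset.sum_congr rfl this]
      conv_rhs => rw [Finset.sum_comm]
      refine Finset.sum_congr rfl fun k _ => ?_
      conv_rhs => rw [Finset.sum_comm]
      refine Finset.sum_congr rfl fun l _ => ?_
      rw [← Finset.mul_sum, ← LH_ent k.2 l.2]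
      change 8 * (r k * (ent LH k l * r l)) = _
      ring
    rw [← e, hr]; norm_num
  have hrow : ∀ k < 24, (8 : ℤ) ∣ (∑ c ∈ Finset.range 24, xr k c) - 4 * xr k 0 ∧
      (∀ g ∈ GG 0, (4 : ℤ) ∣ ∑ c ∈ Finset.range 24, (wt g c : ℤ) * xr k c) ∧ ∀ c < 24, (2 : ℤ) ∣ xr k c - xr k 0 := by
    intro k hk
    have h := List.all_eq_true.mp LX_lin _ (xr_mem hk)
    rw [Bool.and_eq_true, Bool.and_eq_true] at h
    obtain ⟨⟨h1, h2⟩, h3⟩ := h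
    refine ⟨?_, fun g hg => ?_, fun c hc => tn0 (by norm_num) (allb_iff h3 hc)⟩
    · have := tn0 (by norm_num) h1; rw [sumZ_eq] at this; exact this
    · have := tn0 (by norm_num) (List.all_eq_true.mp h2 g hg)
      unfold gz at this
      rw [dot_range (by simp)] at this
      have e : ∑ c ∈ Finset.range 24, (wt g c : ℤ) * xr k c = ∑ c ∈ Finset.range 24, ((List.range 24).map fun c => (wt g c : ℤ)).getD c 0 * (LX.getD k []).getD c 0 :=
        Finset.sum_congr rfl fun c hc => by rw [getD_rm _ _ (Finset.mem_range.mp hc)]; rfl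
      rw [e]; exact this
  have h8 : (8 : ℤ) ∣ (∑ c ∈ Finset.range 24, X c) - 4 * X 0 := by
    have := lin (fun c => 1 - if c = 0 then 4 else 0) 8 (fun k hk => by
      have := (hrow k hk).1
      simp only [sub_mul, one_mul, ite_mul, zero_mul, Finset.sum_sub_distrib, Finset.sum_ite_eq', Finset.mem_range]
      exact this)
    simp only [sub_mul, one_mul, ite_mul, zero_mul, Finset.sum_sub_distrib, Finset.sum_ite_eq', Finset.mem_range] at this
    exact this
  have h2 : ∀ c < 24, (2 : ℤ) ∣ X c - X 0 := by
    intro c hc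
    simp only [hXd, ← Finset.sum_sub_distrib, ← mul_sub]
    exact Finset.dvd_sum fun k _ => Dvd.dvd.mul_left ((hrow k k.2).2.2 c hc) _
  have hg : ∀ g ∈ GG 0, (4 : ℤ) ∣ ∑ c ∈ Finset.range 24, (wt g c : ℤ) * X c := fun g hg =>
    lin (fun c => wt g c) 4 fun k hk => (hrow k hk).2.1 g hg
  clear_value X
  clear lin hrow hr
  by_cases hpar : (2 : ℤ) ∣ X 0
  swap
  · have : ∑ c ∈ Finset.range 24, (1 : ℤ) ≤ ∑ c ∈ Finset.range 24, X c * X c := by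
      refine Finset.sum_le_sum fun c hc => ?_
      have := h2 c (Finset.mem_range.mp hc)
      have : X c ≠ 0 := by omega
      have := mul_self_pos.mpr this
      omega
    rw [hnorm] at this
    norm_num at this
  set y : ℕ → ℤ := fun c => X c / 2 with hy
  have hXy : ∀ c < 24, X c = 2 * y c := by
    intro c hc; have := h2 c hc; simp only [hy]; omega
  have hs1 : ∑ c ∈ Finset.range 24, y c * y c = 4 := by
    have : ∑ c ∈ Finset.range 24, X c * X c = 4 * ∑ c ∈ Finset.range 24, y c * y c := by
      rw [Finset.mul_sum]
      refine Finset.sum_congr rfl fun c hc => ?_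
      rw [hXy c (Finset.mem_range.mp hc)]; ring
    omega
  have hs2 : (4 : ℤ) ∣ ∑ c ∈ Finset.range 24, y c := by
    have : ∑ c ∈ Finset.range 24, X c = 2 * ∑ c ∈ Finset.range 24, y c := by
      rw [Finset.mul_sum]
      exact Finset.sum_congr rfl fun c hc => hXy c (Finset.mem_range.mp hc)
    omega
  set w := tab 24 (fun c => (y c % 2).toNat) with hw
  have hwc : ∀ c < 24, (wt w c : ℤ) = y c % 2 := by
    intro c hc; rw [hw, wt_tab hc]; omega
  have hw2 : ∀ c < 24, wt w c < 2 := by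
    intro c hc; have := hwc c hc; omega
  have hww : ∀ c < 24, wt w c * wt w c = wt w c := by
    intro c hc
    have := hw2 c hc
    generalize wt w c = a at *
    interval_cases a <;> rfl
  have hsum : ((∑ c ∈ Finset.range 24, wt w c : ℕ) : ℤ) = ∑ c ∈ Finset.range 24, y c % 2 := by
    rw [Nat.cast_sum]
    exact Finset.sum_congr rfl fun c hc => hwc c (Finset.mem_range.mp hc)
  have hd4 : (4 : ℤ) ∣ ∑ c ∈ Finset.range 24, (y c * y c - y c % 2) := Finset.dvd_sum fun c _ => sq_mod4 _
  have hle : ∑ c ∈ Finset.range 24, y c % 2 ≤ ∑ c ∈ Finset.range 24, y c * y c := by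
    refine Finset.sum_le_sum fun c _ => ?_
    by_cases h0 : y c = 0
    · rw [h0]; norm_num
    · have := mul_self_pos.mpr h0; omega
  rw [Finset.sum_sub_distrib] at hd4
  have hcase : ∑ c ∈ Finset.range 24, wt w c = 0 ∨ ∑ c ∈ Finset.range 24, wt w c = 4 := by omega
  rcases hcase with hz | hz
  · have h0 : ∀ c < 24, y c % 2 = 0 := by
      intro c hc
      have := Finset.sum_eq_zero_iff.mp hz c (Finset.mem_range.mpr hc)
      rw [← hwc c hc, this]; rfl
    have e1 : ∑ c ∈ Finset.range 24, y c * y c = 4 * ∑ c ∈ Finset.range 24, (y c / 2) * (y c / 2) := by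
      rw [Finset.mul_sum]
      refine Finset.sum_congr rfl fun c hc => ?_
      have : y c = 2 * (y c / 2) := by have := h0 c (Finset.mem_range.mp hc); omega
      conv_lhs => rw [this]
      ring
    have e2 : ∑ c ∈ Finset.range 24, y c = 2 * ∑ c ∈ Finset.range 24, y c / 2 := by
      rw [Finset.mul_sum]
      refine Finset.sum_congr rfl fun c hc => ?_
      have := h0 c (Finset.mem_range.mp hc); omega
    have e3 : (2 : ℤ) ∣ ∑ c ∈ Finset.range 24, ((y c / 2) * (y c / 2) - y c / 2) := by
      refine Finset.dvd_sum fun c _ => ?_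
      have := sq_mod4 (y c / 2); omega
    rw [Finset.sum_sub_distrib] at e3
    omega
  · obtain ⟨hT, hD, hty⟩ := TT0
    have hR := chkL_all 0 (by norm_num)
    unfold chkL at hR
    simp only [Bool.and_eq_true] at hR
    refine noword (T := TT 0) (D := DD 0) (gs := GG 0) (w := w) (by rw [hT]; exact tab_length _ _) ?_ ?_ ?_ hR.2
    · intro c hc; rw [hT] at hc; rw [hty c hc, t11.1]; exact hw2 c hc
    · rw [s3_eq, pairN0 hw2 hw2, hD, Finset.sum_congr rfl fun c hc => hww c (Finset.mem_range.mp hc), hz]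
    · intro g hgm
      rw [pairN0 (GG0_len g hgm).2 hw2, hD]
      have h4 := hg g hgm
      have e1 : ∑ c ∈ Finset.range 24, (wt g c : ℤ) * X c = 2 * ∑ c ∈ Finset.range 24, (wt g c : ℤ) * y c := by
        rw [Finset.mul_sum]
        refine Finset.sum_congr rfl fun c hc => ?_
        rw [hXy c (Finset.mem_range.mp hc)]; ring
      have e2 : (2 : ℤ) ∣ ∑ c ∈ Finset.range 24, ((wt g c : ℤ) * y c - (wt g c * wt w c : ℕ)) := by
        refine Finset.dvd_sum fun c hc => ?_
        rw [Nat.cast_mul, hwc c (Finset.mem_range.mp hc), ← mul_sub]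
        exact Dvd.dvd.mul_left (by omega) _
      rw [Finset.sum_sub_distrib, ← Nat.cast_sum] at e2
      omega

end Nie

end ModLeechE

namespace Nie

theorem B_mulVec (G P : Matrix (Fin 24) (Fin 24) ℤ) (x y) : B (P.transpose * G * P) x y = B G (P.mulVec x) (P.mulVec y) := by
  unfold B
  rw [← Matrix.mulVec_mulVec, ← Matrix.mulVec_mulVec, Matrix.mulVec_transpose, dotProduct_comm x, ← Matrix.dotProduct_mulVec, dotProduct_comm]

/-- upper triangular part -/
def upp (a : Matrix (Fin 24) (Fin 24) ℤ) : Matrix (Fin 24) (Fin 24) ℤ := Matrix.of fun i j => if i ≤ j then a i j else 0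

theorem Qform_B (a : Matrix (Fin 24) (Fin 24) ℤ) (x) : Qform a x = B (upp a) x x := by
  unfold Qform B upp dotProduct Matrix.mulVec dotProduct
  refine Finset.sum_congr rfl fun i _ => ?_
  rw [Finset.mul_sum]
  refine Finset.sum_congr rfl fun j _ => ?_
  beta_reduce
  rw [Matrix.of_apply]
  split_ifs <;> ring

theorem Tbil_B (a : Matrix (Fin 24) (Fin 24) ℤ) (x y) : Tbil a x y = B (upp a) x y + B (upp a) y x := by
  unfold Tbil
  rw [Qform_B, Qform_B, Qform_B, B_add_left, B_add_right, B_add_right]; ring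

theorem B_ent (A : Matrix (Fin 24) (Fin 24) ℤ) (i j : Fin 24) : B A (Pi.single i 1) (Pi.single j 1) = A i j := by
  rw [B_single_left, Matrix.mulVec_single_one]; rfl

theorem gram_eq (a : Matrix (Fin 24) (Fin 24) ℤ) : gram a = upp a + (upp a).transpose := by
  ext i j
  unfold gram
  rw [Matrix.of_apply, Tbil_B, B_ent, B_ent]; rfl

theorem B_transpose (A : Matrix (Fin 24) (Fin 24) ℤ) (x y) : B A.transpose x y = B A y x := by
  unfold B
  rw [Matrix.mulVec_transpose, dotProduct_comm x, ← Matrix.dotProduct_mulVec]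

theorem Tbil_gram (a : Matrix (Fin 24) (Fin 24) ℤ) (x y) : Tbil a x y = B (gram a) x y := by
  rw [Tbil_B, gram_eq, ← B_transpose (upp a) x y]
  unfold B
  rw [Matrix.add_mulVec, dotProduct_add]

theorem two_Q (a : Matrix (Fin 24) (Fin 24) ℤ) (x) : B (gram a) x x = 2 * Qform a x := by
  rw [← Tbil_gram, Tbil_B, Qform_B]; ring

theorem eps24 : eps 24 = 0 := by unfold eps; rw [if_pos (by decide)]

theorem EUL_iff (a : Matrix (Fin 24) (Fin 24) ℤ) : EUL (gram a) ↔ PosDef a ∧ HasDisc a 1 := by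
  constructor
  · intro h
    refine ⟨fun x hx => ?_, ?_⟩
    · have := h.pos x hx; rw [two_Q] at this; omega
    · unfold HasDisc; rw [h.det, eps24]; rfl
  · rintro ⟨h1, h2⟩
    refine ⟨?_, fun x => ⟨_, two_Q a x⟩, fun x hx => ?_, ?_⟩
    · rw [gram_eq, Matrix.transpose_add, Matrix.transpose_transpose, add_comm]
    · rw [two_Q]; have := h1 x hx; omega
    · unfold HasDisc at h2; rw [h2, eps24]; rfl

/-- coefficient matrix with a given Gram matrix -/
def unG (H : Matrix (Fin 24) (Fin 24) ℤ) : Matrix (Fin 24) (Fin 24) ℤ :=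
  Matrix.of fun i j => if i = j then H i j / 2 else H i j

theorem gram_unG {H} (h : EUL H) : gram (unG H) = H := by
  rw [gram_eq]
  ext i j
  rw [Matrix.add_apply, Matrix.transpose_apply]
  unfold upp unG
  simp only [Matrix.of_apply]
  have hs : H j i = H i j := congrFun (congrFun h.symm i) j
  rcases lt_trichotomy i j with hij | rfl | hij
  · rw [if_pos hij.le, if_neg hij.ne, if_neg (not_le.mpr hij), add_zero]
  · have := h.even (Pi.single i 1)
    rw [B_ent] at this
    simp only [le_refl, if_true]
    omega
  · rw [if_neg (not_le.mpr hij), if_pos hij.le, if_neg hij.ne, hs, zero_add]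

def Iso (G H : Matrix (Fin 24) (Fin 24) ℤ) : Prop :=
  ∃ P Q : Matrix (Fin 24) (Fin 24) ℤ, P * Q = 1 ∧ Q * P = 1 ∧ ∀ x y, B H x y = B G (P.mulVec x) (P.mulVec y)

theorem Iso.symm {G H} : Iso G H → Iso H G := by
  rintro ⟨P, Q, h1, h2, h3⟩
  refine ⟨Q, P, h2, h1, fun x y => ?_⟩
  rw [h3, Matrix.mulVec_mulVec, Matrix.mulVec_mulVec, h1, Matrix.one_mulVec, Matrix.one_mulVec]

theorem Iso.refl (G) : Iso G G := ⟨1, 1, one_mul _, one_mul _, fun x y => by rw [Matrix.one_mulVec, Matrix.one_mulVec]⟩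

theorem Iso.of_equiv {a b : Matrix (Fin 24) (Fin 24) ℤ} (h : FormEquiv (Qform a) (Qform b)) : Iso (gram a) (gram b) := by
  obtain ⟨g, hg⟩ := h
  refine ⟨(↑(g⁻¹) : Matrix (Fin 24) (Fin 24) ℤ), (g : Matrix (Fin 24) (Fin 24) ℤ), ?_, ?_, fun x y => ?_⟩
  · rw [← Units.val_mul, inv_mul_cancel]; rfl
  · rw [← Units.val_mul, mul_inv_cancel]; rfl
  · rw [← Tbil_gram, ← Tbil_gram]
    unfold Tbil
    rw [hg, hg, hg, Matrix.mulVec_add]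

theorem equiv_of {c a : Matrix (Fin 24) (Fin 24) ℤ} (hc : EUL (gram c)) (ha : EUL (gram a))
    (h : ∃ P : Matrix (Fin 24) (Fin 24) ℤ, P.transpose * gram c * P = gram a) : FormEquiv (Qform c) (Qform a) := by
  obtain ⟨P, hP⟩ := h
  have hd : IsUnit P.det := by
    have := congrArg Matrix.det hP
    rw [Matrix.det_mul, Matrix.det_mul, Matrix.det_transpose, hc.det, ha.det, mul_one] at this
    exact IsUnit.of_mul_eq_one _ this
  refine ⟨(Matrix.GeneralLinearGroup.mk'' P hd)⁻¹, fun x => ?_⟩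
  rw [inv_inv]
  have h1 := two_Q a x
  rw [← hP, B_mulVec, two_Q] at h1
  have h2 : ((Matrix.GeneralLinearGroup.mk'' P hd : GL (Fin 24) ℤ) : Matrix (Fin 24) (Fin 24) ℤ) = P := rfl
  rw [h2]
  omega

theorem Iso.frame {G H T v} (h : Iso G H) (hv : Frame H T v) : ∃ v, Frame G T v := by
  obtain ⟨P, Q, h1, h2, h3⟩ := h
  have hB : ∀ x y, B G x (P.mulVec y) = B H (Q.mulVec x) y := by
    intro x y
    rw [h3, Matrix.mulVec_mulVec, h1, Matrix.one_mulVec]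
  refine ⟨fun c i => P.mulVec (v c i), ⟨⟨?_, ?_⟩, ?_⟩⟩
  · intro c i c' j hi hj
    rw [← h3]; exact hv.gram c i c' j hi hj
  · intro x hx
    have := hv.sep (Q.mulVec x) (fun c i hi => by rw [← hB]; exact hx c i hi)
    have := congrArg P.mulVec this
    rwa [Matrix.mulVec_mulVec, h1, Matrix.one_mulVec, Matrix.mulVec_zero] at this
  · intro r hr
    obtain ⟨z, hz⟩ := hv.span (Q.mulVec r) (by
      rw [h3, Matrix.mulVec_mulVec, h1, Matrix.one_mulVec]; exact hr)
    refine ⟨z, ?_⟩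
    have := congrArg P.mulVec hz
    rw [Matrix.mulVec_mulVec, h1, Matrix.one_mulVec] at this
    rw [this]
    simp only [Matrix.mulVec_sum, Matrix.mulVec_smul]

noncomputable def lat (i : ℕ) : Matrix (Fin 24) (Fin 24) ℤ := if i < 23 then LL i else LE

theorem lat_EUL (i) : EUL (lat i) := by
  unfold lat
  split_ifs with h
  · exact (LL_spec h).1
  · exact LE_EUL

theorem no_iso {i} (hi : i < 23) (h : Iso LE (LL i)) : False := by
  obtain ⟨h1, hv⟩ := LL_spec hi
  have hc := frame_card h1 hi hv
  have hp := (cox_pos i hi).1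
  have : (shell (LL i) 1).Nonempty := by rw [← Finset.card_pos]; omega
  obtain ⟨r, hr⟩ := this
  rw [h1.mem_shell] at hr
  obtain ⟨P, Q, _, _, h3⟩ := h
  rw [h3, ← LE_EUL.mem_shell, Finset.card_eq_zero.mp LE_noroots] at hr
  simp at hr

theorem lat_inj {i j} (hi : i < 24) (hj : j < 24) (h : Iso (lat i) (lat j)) : i = j := by
  unfold lat at h
  split_ifs at h with h1 h2 h2
  · obtain ⟨hE, hv⟩ := LL_spec h1
    obtain ⟨_, v, hv'⟩ := LL_spec h2
    exact frame_unique hE h1 h2 hv (h.frame hv')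
  · exact (no_iso h1 h.symm).elim
  · exact (no_iso h2 h).elim
  · omega

theorem lat_complete {G} (h : EUL G) : ∃ i < 24, ∃ P : Matrix (Fin 24) (Fin 24) ℤ, P.transpose * G * P = lat i := by
  by_cases h0 : (shell G 1).card = 0
  · exact ⟨23, by norm_num, by simpa [lat] using LE_unique h h0⟩
  · obtain ⟨T, hT, v, hv⟩ := exists_frame h h0
    obtain ⟨i, hi, he⟩ := List.getElem_of_mem hT
    have hi' : i < 23 := hi
    have e : TT i = T := by unfold TT; rw [List.getD_eq_getElem _ _ hi, he]
    rw [← e] at hv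
    refine ⟨i, by omega, ?_⟩
    unfold lat
    rw [if_pos hi']
    exact LL_unique hi' h hv

theorem final : ∃ S : Finset (Matrix (Fin 24) (Fin 24) ℤ),
      S.card = 24 ∧
      (∀ a ∈ S, PosDef a ∧ HasDisc a 1) ∧
      (∀ a ∈ S, ∀ b ∈ S, FormEquiv (Qform a) (Qform b) → a = b) ∧
      (∀ c : Matrix (Fin 24) (Fin 24) ℤ, PosDef c → HasDisc c 1 →
        ∃ a ∈ S, FormEquiv (Qform c) (Qform a)) := by
  classical
  have hg : ∀ i, gram (unG (lat i)) = lat i := fun i => gram_unG (lat_EUL i)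
  refine ⟨(Finset.range 24).image fun i => unG (lat i), ?_, ?_, ?_, ?_⟩
  · rw [Finset.card_image_of_injOn, Finset.card_range]
    intro i hi j hj hij
    have hi : i < 24 := by simpa using hi
    have hj : j < 24 := by simpa using hj
    apply lat_inj hi hj
    beta_reduce at hij
    rw [← hg i, hij, hg j]
    exact Iso.refl _
  · intro a ha
    obtain ⟨i, _, rfl⟩ := Finset.mem_image.mp ha
    rw [← EUL_iff, hg]; exact lat_EUL i
  · intro a ha b hb hab
    obtain ⟨i, hi, rfl⟩ := Finset.mem_image.mp ha
    obtain ⟨j, hj, rfl⟩ := Finset.mem_image.mp hb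
    have := Iso.of_equiv hab
    rw [hg, hg] at this
    rw [lat_inj (Finset.mem_range.mp hi) (Finset.mem_range.mp hj) this]
  · intro c h1 h2
    have hc := (EUL_iff c).mpr ⟨h1, h2⟩
    obtain ⟨i, hi, hP⟩ := lat_complete hc
    refine ⟨unG (lat i), Finset.mem_image.mpr ⟨i, Finset.mem_range.mpr hi, rfl⟩, ?_⟩
    refine equiv_of hc ?_ ?_
    · rw [hg]; exact lat_EUL i
    · rw [hg]; exact hP

end Nie

/-- Niemeier: there are exactly `24` `GL₂₄(ℤ)`-equivalence classes of
positive definite integral quadratic forms in `24` variables with discriminant `1`. -/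
theorem niemeier_twentyfour :
    ∃ S : Finset (Matrix (Fin 24) (Fin 24) ℤ),
      S.card = 24 ∧
      (∀ a ∈ S, PosDef a ∧ HasDisc a 1) ∧
      (∀ a ∈ S, ∀ b ∈ S, FormEquiv (Qform a) (Qform b) → a = b) ∧
      (∀ c : Matrix (Fin 24) (Fin 24) ℤ, PosDef c → HasDisc c 1 →
        ∃ a ∈ S, FormEquiv (Qform c) (Qform a)) := by
  exact Nie.final
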